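/- For a fixed decomposition N = N₁N₂, the lattices (I_ij, n) arising from all pairs of class representatives form a single genus of positive definite integral quaternary quadratic lattices of discriminant N² and level N, and this genus consists of a single spinor genus. Moreover, letting N₁, N₂ vary over all decompositions N = N₁N₂ with N₁ having an odd number of prime factors, the lattices (I_ij, n) run through all isometry classes of integral quaternary quadratic lattices of discriminant N² and level N. -/

import Mathlib

open scoped Quaternion BigOperators Matrix

noncomputable section

namespace Rep

/-! ### Integral binary quadratic forms, class numbers, fundamental discriminants -/

/-- `T` is the matrix of an integral binary quadratic form, i.e. an integral symmetric
matrix `T = (2a, b; b, 2c)` (even diagonal). -/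
def IsBinaryMatrix (T : Matrix (Fin 2) (Fin 2) ℤ) : Prop :=
  T 0 1 = T 1 0 ∧ (2 ∣ T 0 0) ∧ (2 ∣ T 1 1)

/-- The signed discriminant `b² - 4ac` of `T = (2a, b; b, 2c)`. -/
def disc (T : Matrix (Fin 2) (Fin 2) ℤ) : ℤ := T 0 1 ^ 2 - T 0 0 * T 1 1

/-- `T = (2a, b; b, 2c)` is positive definite. -/
def PosDefBinary (T : Matrix (Fin 2) (Fin 2) ℤ) : Prop := 0 < T 0 0 ∧ disc T < 0

/-- `ε(T)`: the number of proper automorphs `U ∈ SL₂(ℤ)`, `UᵀTU = T`, of `T`. -/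
def autCount (T : Matrix (Fin 2) (Fin 2) ℤ) : ℕ :=
  Set.ncard {U : Matrix.SpecialLinearGroup (Fin 2) ℤ |
    (U : Matrix (Fin 2) (Fin 2) ℤ)ᵀ * T * U = T}

/-- proper (`SL₂(ℤ)`-) equivalence of binary forms. -/
def SLEquiv (T T' : Matrix (Fin 2) (Fin 2) ℤ) : Prop :=
  ∃ U : Matrix.SpecialLinearGroup (Fin 2) ℤ, (U : Matrix (Fin 2) (Fin 2) ℤ)ᵀ * T * U = T'

/-- Gauss-reduced positive definite binary form `(2a, b; b, 2c)`:
`-a < b ≤ a ≤ c`, and `b ≥ 0` if `a = c`. -/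
def IsReduced (T : Matrix (Fin 2) (Fin 2) ℤ) : Prop :=
  -(T 0 0) < 2 * T 0 1 ∧ 2 * T 0 1 ≤ T 0 0 ∧ T 0 0 ≤ T 1 1 ∧ (T 0 0 = T 1 1 → 0 ≤ T 0 1)

/-- A canonical set of representatives for the `SL₂(ℤ)`-equivalence classes of positive
definite integral binary quadratic forms of discriminant `-d`: the reduced forms. -/
def reducedForms (d : ℤ) : Set (Matrix (Fin 2) (Fin 2) ℤ) :=
  {T | IsBinaryMatrix T ∧ PosDefBinary T ∧ disc T = -d ∧ IsReduced T}

/-- The class number `h(-d)`: the number of `SL₂(ℤ)`-classes of primitive positive definite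
integral binary quadratic forms of discriminant `-d`; for a fundamental discriminant `-d`
this is the class number of `ℚ(√-d)`. -/
def classNumber (d : ℤ) : ℕ :=
  Set.ncard {T | T ∈ reducedForms d ∧
    Int.gcd (Int.gcd (T 0 0 / 2) (T 0 1)) (T 1 1 / 2) = 1}

/-- `σ₀(n)`, the number of divisors of `n`. -/
def sigma0 (n : ℕ) : ℕ := n.divisors.card

/-- `D` is a fundamental discriminant (the discriminant of the ring of integers of a
quadratic field). -/
def IsFundamentalDiscriminant (D : ℤ) : Prop :=
  D ≠ 1 ∧ ((D % 4 = 1 ∧ Squarefree D) ∨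
    (D % 4 = 0 ∧ Squarefree (D / 4) ∧ (D / 4 % 4 = 2 ∨ D / 4 % 4 = 3)))

/-! ### Quadratic lattices via Gram matrices: representation numbers, genus, spinor genus -/

/-- The number of representations of the binary form with (bilinear) Gram matrix `T` by the
quadratic lattice with (bilinear) Gram matrix `A`. -/
def rMat {m : ℕ} (A : Matrix (Fin m) (Fin m) ℤ) (T : Matrix (Fin 2) (Fin 2) ℤ) : ℕ :=
  Set.ncard {X : Matrix (Fin m) (Fin 2) ℤ | Xᵀ * A * X = T}

/-- The number of representations of the integer `t` by the quadratic form `q(x) = (xᵀAx)/2`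
with bilinear Gram matrix `A`. -/
def rQuad {m : ℕ} (A : Matrix (Fin m) (Fin m) ℤ) (t : ℤ) : ℕ :=
  Set.ncard {x : Fin m → ℤ | x ⬝ᵥ A.mulVec x = 2 * t}

/-- The order of the automorphism group of the lattice with Gram matrix `A`. -/
def autMat {m : ℕ} (A : Matrix (Fin m) (Fin m) ℤ) : ℕ :=
  Set.ncard {U : Matrix (Fin m) (Fin m) ℤ | Uᵀ * A * U = A}

/-- Integral equivalence (isometry) of Gram matrices. -/
def ZEquiv {m : ℕ} (A B : Matrix (Fin m) (Fin m) ℤ) : Prop :=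
  ∃ U : Matrix (Fin m) (Fin m) ℤ, IsUnit U.det ∧ Uᵀ * A * U = B

/-- Equivalence of Gram matrices over the `p`-adic integers `ℤ_p`. -/
def ZpEquiv {m : ℕ} (p : ℕ) (hp : p.Prime) (A B : Matrix (Fin m) (Fin m) ℤ) : Prop :=
  have : Fact p.Prime := ⟨hp⟩
  ∃ U : Matrix (Fin m) (Fin m) ℤ_[p], IsUnit U.det ∧
    Uᵀ * A.map (Int.cast : ℤ → ℤ_[p]) * U = B.map (Int.cast : ℤ → ℤ_[p])

/-- `A` is positive definite (over `ℝ`). -/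
def PosDefMat {m : ℕ} (A : Matrix (Fin m) (Fin m) ℤ) : Prop :=
  (A.map (Int.cast : ℤ → ℝ)).PosDef

/-- Two positive definite integral lattices are in the same genus iff they are equivalent
over all `ℤ_p` (and over `ℝ`, which is automatic for positive definite ones). -/
def InSameGenus {m : ℕ} (A B : Matrix (Fin m) (Fin m) ℤ) : Prop :=
  PosDefMat A ∧ PosDefMat B ∧ ∀ (p : ℕ) (hp : p.Prime), ZpEquiv p hp A B

/-- The reflection in the vector `v` of the quadratic space with Gram matrix `A`. -/
def reflMat {K : Type*} [Field K] {m : ℕ} (A : Matrix (Fin m) (Fin m) K) (v : Fin m → K) :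
    Matrix (Fin m) (Fin m) K :=
  1 - (2 / (v ⬝ᵥ A.mulVec v)) • (Matrix.vecMulVec v v * A)

/-- `U` is a rotation (proper isometry) of the quadratic space with Gram matrix `A`
with spinor norm (represented by) `θ`: `U` is a product of an even number of reflections
in anisotropic vectors `v l`, and `θ = ∏ q(v l)`. -/
def IsRotationWithSpinorNorm {K : Type*} [Field K] {m : ℕ} (A U : Matrix (Fin m) (Fin m) K)
    (θ : K) : Prop :=
  ∃ (r : ℕ) (v : Fin r → (Fin m → K)), Even r ∧ (∀ l, v l ⬝ᵥ A.mulVec (v l) ≠ 0) ∧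
    U = (List.ofFn fun l => reflMat A (v l)).prod ∧
    θ = ∏ l : Fin r, (v l ⬝ᵥ A.mulVec (v l)) / 2

/-- The lattices with Gram matrices `A` and `B` lie in the same spinor genus: there is a
rational isometry `S` of `A` and a rational equivalence `C` from `A` to `B` which at every
prime `p` factors as `S` times a rotation of trivial spinor norm times a `ℤ_p`-unit. -/
def SameSpinorGenus {m : ℕ} (A B : Matrix (Fin m) (Fin m) ℤ) : Prop :=
  InSameGenus A B ∧
  ∃ C S : Matrix (Fin m) (Fin m) ℚ,
    Cᵀ * A.map (Int.cast : ℤ → ℚ) * C = B.map (Int.cast : ℤ → ℚ) ∧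
    Sᵀ * A.map (Int.cast : ℤ → ℚ) * S = A.map (Int.cast : ℤ → ℚ) ∧
    ∀ (p : ℕ) (hp : p.Prime),
      have : Fact p.Prime := ⟨hp⟩
      ∃ (Sig : Matrix (Fin m) (Fin m) ℚ_[p]) (θ c : ℚ_[p]) (U : Matrix (Fin m) (Fin m) ℤ_[p]),
        IsRotationWithSpinorNorm (A.map (Int.cast : ℤ → ℚ_[p])) Sig θ ∧ c ≠ 0 ∧ θ = c ^ 2 ∧
        IsUnit U.det ∧
        C.map (Rat.cast : ℚ → ℚ_[p]) =
          S.map (Rat.cast : ℚ → ℚ_[p]) * Sig * U.map (fun x : ℤ_[p] => (x : ℚ_[p]))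

/-- A system of representatives for the isometry classes of lattices in the genus of `A`. -/
structure GenusReps {m : ℕ} (A : Matrix (Fin m) (Fin m) ℤ) where
  reps : Finset (Matrix (Fin m) (Fin m) ℤ)
  mem_genus : ∀ B ∈ reps, InSameGenus A B
  complete : ∀ B, InSameGenus A B → ∃ C ∈ reps, ZEquiv C B
  inequiv : ∀ B ∈ reps, ∀ C ∈ reps, ZEquiv B C → B = C

/-- The mass `μ` of the genus of `A`. -/
def mass {m : ℕ} {A : Matrix (Fin m) (Fin m) ℤ} (G : GenusReps A) : ℝ :=
  ∑ B ∈ G.reps, (1 : ℝ) / autMat B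

/-- Siegel's weighted average `r(gen(A), T)` of the representation numbers of the binary
form `T` over the classes in the genus of `A`. -/
def genusAvgBinary {m : ℕ} {A : Matrix (Fin m) (Fin m) ℤ} (G : GenusReps A)
    (T : Matrix (Fin 2) (Fin 2) ℤ) : ℝ :=
  (∑ B ∈ G.reps, (rMat B T : ℝ) / autMat B) / mass G

/-- Siegel's weighted average `r(gen(A), t)` of the representation numbers of the integer
`t` over the classes in the genus of `A`. -/
def genusAvgQuad {m : ℕ} {A : Matrix (Fin m) (Fin m) ℤ} (G : GenusReps A) (t : ℤ) : ℝ :=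
  (∑ B ∈ G.reps, (rQuad B t : ℝ) / autMat B) / mass G

/-- `o_max`: the maximal order of the automorphism group of a lattice in the genus of `A`. -/
def oMax {m : ℕ} {A : Matrix (Fin m) (Fin m) ℤ} (G : GenusReps A) : ℕ :=
  G.reps.sup autMat

/-- `ℓ • A⁻¹` is again integral with even diagonal. -/
def EvenIntegralScaledInv {m : ℕ} (A : Matrix (Fin m) (Fin m) ℤ) (ℓ : ℕ) : Prop :=
  (∀ i j, ∃ c : ℤ, (ℓ : ℚ) * (A.map (Int.cast : ℤ → ℚ))⁻¹ i j = c) ∧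
    ∀ i, ∃ c : ℤ, (ℓ : ℚ) * (A.map (Int.cast : ℤ → ℚ))⁻¹ i i = 2 * c

/-- `ℓ` is the level of the (even) lattice with bilinear Gram matrix `A`. -/
def IsLevelOf {m : ℕ} (A : Matrix (Fin m) (Fin m) ℤ) (ℓ : ℕ) : Prop :=
  0 < ℓ ∧ EvenIntegralScaledInv A ℓ ∧
    ∀ ℓ' : ℕ, 0 < ℓ' → EvenIntegralScaledInv A ℓ' → ℓ ∣ ℓ'

/-- `d` is represented primitively by (the `ℤ_p`-completion of) the ternary lattice with Gram
matrix `A` over every `ℤ_p`. -/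
def LocallyPrimitivelyRepresents (A : Matrix (Fin 3) (Fin 3) ℤ) (d : ℤ) : Prop :=
  ∀ (p : ℕ) (hp : p.Prime),
    have : Fact p.Prime := ⟨hp⟩
    ∃ x : Fin 3 → ℤ_[p], (∃ i, IsUnit (x i)) ∧
      x ⬝ᵥ (A.map (Int.cast : ℤ → ℤ_[p])).mulVec x = ((2 * d : ℤ) : ℤ_[p])

/-- `d` is represented by the ternary lattice with Gram matrix `A` over every `ℤ_p`. -/
def LocallyRepresents (A : Matrix (Fin 3) (Fin 3) ℤ) (d : ℤ) : Prop :=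
  ∀ (p : ℕ) (hp : p.Prime),
    have : Fact p.Prime := ⟨hp⟩
    ∃ x : Fin 3 → ℤ_[p], x ⬝ᵥ (A.map (Int.cast : ℤ → ℤ_[p])).mulVec x = ((2 * d : ℤ) : ℤ_[p])

/-- The prime `p` is split in the imaginary quadratic field `ℚ(√-d)`. -/
def SplitIn (d : ℤ) (p : ℕ) (hp : p.Prime) : Prop :=
  if p = 2 then (-d) % 8 = 1
  else
    have : Fact p.Prime := ⟨hp⟩
    legendreSym p (-d) = 1

/-- The prime `p` is inert in the imaginary quadratic field `ℚ(√-d)`. -/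
def InertIn (d : ℤ) (p : ℕ) (hp : p.Prime) : Prop :=
  if p = 2 then (-d) % 8 = 5
  else
    have : Fact p.Prime := ⟨hp⟩
    legendreSym p (-d) = -1

end Rep
namespace Rep

/-! ### Quaternion algebras over ℚ, Eichler orders, ideal classes -/

/-- The reduced trace of a quaternion. -/
def trd {a b : ℚ} (x : ℍ[ℚ, a, b]) : ℚ := 2 * x.re

/-- The reduced norm `n` of a quaternion. -/
def nrd {a b : ℚ} (x : ℍ[ℚ, a, b]) : ℚ := (x * star x).re

/-- The bilinear form `b(x, y) = tr(x ȳ)` associated to the reduced norm form;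
note `b(x, x) = 2 n(x)`. -/
def qbil {a b : ℚ} (x y : ℍ[ℚ, a, b]) : ℚ := (x * star y + y * star x).re

/-- The quaternion algebra `(a, b / ℚ)` is ramified at infinity, i.e. `ℍ[ℝ, a, b]` is a
division algebra. -/
def RamifiedAtInfinity (a b : ℚ) : Prop :=
  ∀ x : ℍ[ℝ, (a : ℝ), (b : ℝ)], x ≠ 0 → IsUnit x

/-- The quaternion algebra `(a, b / ℚ)` is ramified at the prime `p`, i.e. `ℍ[ℚ_p, a, b]`
is a division algebra. -/
def RamifiedAt (a b : ℚ) (p : ℕ) (hp : p.Prime) : Prop :=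
  have : Fact p.Prime := ⟨hp⟩
  ∀ x : ℍ[ℚ_[p], (a : ℚ_[p]), (b : ℚ_[p])], x ≠ 0 → IsUnit x

/-- `M` is a full `ℤ`-lattice of rank `m` in the quaternion algebra. -/
def IsLattice {a b : ℚ} (m : ℕ) (M : Submodule ℤ ℍ[ℚ, a, b]) : Prop :=
  ∃ v : Fin m → ℍ[ℚ, a, b], LinearIndependent ℚ v ∧ Submodule.span ℤ (Set.range v) = M

/-- `A` is a Gram matrix (with respect to the bilinear form `b(x,y) = tr(x ȳ)`) of a
`ℤ`-basis of (the `ℤ`-span of) `M`. -/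
def IsGramOf {a b : ℚ} {m : ℕ} (M : Set ℍ[ℚ, a, b]) (A : Matrix (Fin m) (Fin m) ℤ) : Prop :=
  ∃ v : Fin m → ℍ[ℚ, a, b], LinearIndependent ℚ v ∧
    Submodule.span ℤ (Set.range v) = Submodule.span ℤ M ∧
    ∀ i j, (A i j : ℚ) = qbil (v i) (v j)

/-- `A` is a Gram matrix of `M` for the quadratic form rescaled by the factor `s`. -/
def IsGramOfScaled {a b : ℚ} {m : ℕ} (s : ℕ) (M : Set ℍ[ℚ, a, b])
    (A : Matrix (Fin m) (Fin m) ℤ) : Prop :=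
  ∃ v : Fin m → ℍ[ℚ, a, b], LinearIndependent ℚ v ∧
    Submodule.span ℤ (Set.range v) = Submodule.span ℤ M ∧
    ∀ i j, (A i j : ℚ) = s * qbil (v i) (v j)

/-- An order in the quaternion algebra: a full lattice which is a subring. -/
def IsOrder {a b : ℚ} (O : Submodule ℤ ℍ[ℚ, a, b]) : Prop :=
  IsLattice 4 O ∧ (1 : ℍ[ℚ, a, b]) ∈ O ∧ ∀ x ∈ O, ∀ y ∈ O, x * y ∈ O

/-- The left order of a lattice `I`. -/
def leftOrderSet {a b : ℚ} (I : Set ℍ[ℚ, a, b]) : Set ℍ[ℚ, a, b] :=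
  {x | ∀ y ∈ I, x * y ∈ I}

/-- The right order of a lattice `I`. -/
def rightOrderSet {a b : ℚ} (I : Set ℍ[ℚ, a, b]) : Set ℍ[ℚ, a, b] :=
  {x | ∀ y ∈ I, y * x ∈ I}

/-- The order `O` has reduced discriminant `N`, i.e. the Gram matrix of the norm form on `O`
has determinant `N²`.  For squarefree `N` this characterizes the Eichler orders of level `N`
(hereditary orders). -/
def HasReducedDiscriminant {a b : ℚ} (O : Submodule ℤ ℍ[ℚ, a, b]) (N : ℕ) : Prop :=
  ∃ A : Matrix (Fin 4) (Fin 4) ℤ, IsGramOf (O : Set ℍ[ℚ, a, b]) A ∧ A.det = (N : ℤ) ^ 2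

/-- The pairs `(x, y) ∈ M × M` representing the binary form `T = (2a, b; b, 2c)`, i.e. with
`n(x) = a`, `b(x,y) = b`, `n(y) = c` (equivalently, with bilinear Gram matrix `T`). -/
def repPairs {a b : ℚ} (M : Set ℍ[ℚ, a, b]) (T : Matrix (Fin 2) (Fin 2) ℤ) :
    Set (ℍ[ℚ, a, b] × ℍ[ℚ, a, b]) :=
  {xy | xy.1 ∈ M ∧ xy.2 ∈ M ∧ qbil xy.1 xy.1 = T 0 0 ∧ qbil xy.1 xy.2 = T 0 1 ∧
    qbil xy.2 xy.2 = T 1 1}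

/-- `r(M, T)`: the number of representations of the binary form `T` by the quaternary
lattice `M` (with the reduced norm as quadratic form). -/
def rLat {a b : ℚ} (M : Set ℍ[ℚ, a, b]) (T : Matrix (Fin 2) (Fin 2) ℤ) : ℕ :=
  Set.ncard (repPairs M T)

/-- As `rLat`, but with the quadratic form rescaled by the factor `s`. -/
def rLatScaled {a b : ℚ} (s : ℕ) (M : Set ℍ[ℚ, a, b]) (T : Matrix (Fin 2) (Fin 2) ℤ) : ℕ :=
  Set.ncard {xy : ℍ[ℚ, a, b] × ℍ[ℚ, a, b] | xy.1 ∈ M ∧ xy.2 ∈ M ∧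
    (s : ℚ) * qbil xy.1 xy.1 = T 0 0 ∧ (s : ℚ) * qbil xy.1 xy.2 = T 0 1 ∧
    (s : ℚ) * qbil xy.2 xy.2 = T 1 1}

/-- The averaged representation number `r(M, d) = Σ_T r(M, T)/ε(T)`, the sum over the
`SL₂(ℤ)`-classes of integral binary forms of discriminant `-d`. -/
def rAvg {a b : ℚ} (M : Set ℍ[ℚ, a, b]) (d : ℤ) : ℝ :=
  ∑ᶠ T ∈ reducedForms d, (rLat M T : ℝ) / autCount T

/-- The dual lattice `M^#` of `M` with respect to `b(x,y) = tr(x ȳ)`. -/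
def dualLattice {a b : ℚ} (M : Set ℍ[ℚ, a, b]) : Set ℍ[ℚ, a, b] :=
  {x | ∀ y ∈ M, ∃ m : ℤ, qbil x y = m}

/-- The partial localization `M[1/s]` of `M`. -/
def locInv {a b : ℚ} (s : ℕ) (M : Submodule ℤ ℍ[ℚ, a, b]) : Set ℍ[ℚ, a, b] :=
  {x | ∃ k : ℕ, ((s : ℚ) ^ k) • x ∈ M}

/-- The data of an Eichler order `R` of squarefree level `N = N₁N₂` in the (definite)
quaternion algebra over `ℚ` ramified exactly at `∞` and the primes dividing `N₁`, together
with the ideals `I_ij = y_i R y_j⁻¹` coming from a double coset decomposition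
`D^×_𝔸 = ∪_j D^× y_j R^×_𝔸` (equivalently: a complete system of representatives of the
left ideal classes and their linking ideals), normalized to have reduced norm `ℤ`. -/
structure EichlerSetting (N₁ N₂ : ℕ) where
  a : ℚ
  b : ℚ
  N₁_pos : 0 < N₁
  N₂_pos : 0 < N₂
  squarefree : Squarefree (N₁ * N₂)
  odd_ram : Odd N₁.primeFactors.card
  ram_inf : RamifiedAtInfinity a b
  ram_iff : ∀ (p : ℕ) (hp : p.Prime), RamifiedAt a b p hp ↔ p ∣ N₁
  /-- the class number of the Eichler order -/
  h : ℕ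
  h_pos : 0 < h
  /-- the orders `R_i = y_i R y_i⁻¹`; `R = R_0` -/
  Rord : Fin h → Submodule ℤ ℍ[ℚ, a, b]
  /-- the ideals `I_ij = y_i R y_j⁻¹` -/
  I : Fin h → Fin h → Submodule ℤ ℍ[ℚ, a, b]
  Rord_order : ∀ i, IsOrder (Rord i)
  Rord_disc : ∀ i, HasReducedDiscriminant (Rord i) (N₁ * N₂)
  I_lattice : ∀ i j, IsLattice 4 (I i j)
  I_diag : ∀ i, I i i = Rord i
  I_left : ∀ i j, leftOrderSet (I i j : Set ℍ[ℚ, a, b]) = (Rord i : Set ℍ[ℚ, a, b])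
  I_right : ∀ i j, rightOrderSet (I i j : Set ℍ[ℚ, a, b]) = (Rord j : Set ℍ[ℚ, a, b])
  I_nrd_integral : ∀ i j, ∀ x ∈ I i j, ∃ m : ℤ, nrd x = m
  I_nrd_primitive : ∀ i j, (1 : ℚ) ∈ Submodule.span ℤ (nrd '' (I i j : Set ℍ[ℚ, a, b]))
  /-- for fixed `i`, the `I i j` represent all classes of left `R_i`-ideals -/
  classes_complete : ∀ (i : Fin h) (J : Submodule ℤ ℍ[ℚ, a, b]), IsLattice 4 J →
    leftOrderSet (J : Set ℍ[ℚ, a, b]) = (Rord i : Set ℍ[ℚ, a, b]) →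
    ∃ (j : Fin h) (u : (ℍ[ℚ, a, b])ˣ),
      J = Submodule.map (LinearMap.mulRight ℤ (u : ℍ[ℚ, a, b])) (I i j)
  classes_distinct : ∀ (i j j' : Fin h) (u : (ℍ[ℚ, a, b])ˣ),
    I i j' = Submodule.map (LinearMap.mulRight ℤ (u : ℍ[ℚ, a, b])) (I i j) → j = j'

namespace EichlerSetting

variable {N₁ N₂ : ℕ} (S : EichlerSetting N₁ N₂)

/-- The Eichler order `R` itself. -/
def R : Submodule ℤ ℍ[ℚ, S.a, S.b] := S.Rord ⟨0, S.h_pos⟩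

/-- The ternary lattice `L_i = {x ∈ ℤ·1 + 2R_i | tr(x) = 0}`. -/
def L (i : Fin S.h) : Set ℍ[ℚ, S.a, S.b] :=
  {x | (∃ m : ℤ, ∃ r ∈ S.Rord i, x = m • (1 : ℍ[ℚ, S.a, S.b]) + 2 • r) ∧ x + star x = 0}

/-- `e_i`, the number of units of the order `R_i`. -/
def units (i : Fin S.h) : ℕ :=
  Set.ncard {x : ℍ[ℚ, S.a, S.b] | x ∈ S.Rord i ∧ nrd x = 1}

/-- The underlying lattice `I_ij^# ∩ I_ij[1/s]` of the rescaled partial dual `I_ij^{*,s}`. -/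
def pd (i j : Fin S.h) (s : ℕ) : Set ℍ[ℚ, S.a, S.b] :=
  dualLattice (S.I i j : Set ℍ[ℚ, S.a, S.b]) ∩ locInv s (S.I i j)

/-- `r(rpd(I_ij, N'), T) = Σ_{s ∣ N'} r(I_ij^{*,s}, T)`: the total number of representations
of `T` by the rescaled partial duals `I_ij^{*,s}`, `s ∣ N'`. -/
def rRpd (i j : Fin S.h) (N' : ℕ) (T : Matrix (Fin 2) (Fin 2) ℤ) : ℕ :=
  ∑ s ∈ N'.divisors, rLatScaled s (S.pd i j s) T

/-- `r(rpd(I_ij, N'), d) = Σ_{s ∣ N'} r(I_ij^{*,s}, d)`, averaged over the classes of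
binary forms of discriminant `-d`. -/
def rRpdAvg (i j : Fin S.h) (N' : ℕ) (d : ℤ) : ℝ :=
  ∑ᶠ T ∈ reducedForms d, (S.rRpd i j N' T : ℝ) / autCount T

end EichlerSetting

end Rep

section
open scoped BigOperators Matrix
namespace Eich
open MeasureTheory

def ballVol (n : ℕ) : ℝ := (volume {x : Fin n → ℝ | ∑ i, |x i| ^ (2:ℝ) < 1}).toReal

lemma ballVol_eq (n : ℕ) : ballVol n = Real.pi ^ ((n:ℝ)/2) / Real.Gamma (n/2+1) := by
  unfold ballVol
  rw [volume_sum_rpow_lt_one (Fin n) (by norm_num : (1:ℝ) ≤ 2)]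
  have hG : Real.Gamma (1/2+1) = Real.sqrt Real.pi / 2 := by
    rw [Real.Gamma_add_one (by norm_num), Real.Gamma_one_half_eq]; ring
  rw [hG, ENNReal.toReal_ofReal]
  · simp only [Fintype.card_fin]
    rw [show 2 * (Real.sqrt Real.pi/2) = Real.sqrt Real.pi by ring]
    rw [Real.sqrt_eq_rpow, ← Real.rpow_natCast, ← Real.rpow_mul Real.pi_pos.le]
    congr 2; ring
  · simp only [Fintype.card_fin]
    have : 0 < Real.Gamma ((n:ℝ)/2+1) := Real.Gamma_pos_of_pos (by positivity)
    positivity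

lemma ballVol_pos (n : ℕ) : 0 < ballVol n := by
  rw [ballVol_eq]
  have : 0 < Real.Gamma ((n:ℝ)/2+1) := Real.Gamma_pos_of_pos (by positivity)
  have := Real.pi_pos
  positivity

lemma ballVol_rec (n : ℕ) : ballVol (n+2) = ballVol n * (2 * Real.pi / (n+2)) := by
  rw [ballVol_eq, ballVol_eq]
  have h0 : 0 < Real.Gamma ((n:ℝ)/2+1) := Real.Gamma_pos_of_pos (by positivity)
  have : (((n+2:ℕ):ℝ)/2+1) = ((n:ℝ)/2+1)+1 := by push_cast; ring
  rw [this, Real.Gamma_add_one (by positivity)]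
  have : (((n+2:ℕ):ℝ)/2) = (n:ℝ)/2+1 := by push_cast; ring
  rw [this, Real.rpow_add Real.pi_pos, Real.rpow_one]
  field_simp

lemma ballVol_zero : ballVol 0 = 1 := by
  rw [ballVol_eq]; simp
lemma ballVol_one : ballVol 1 = 2 := by
  rw [ballVol_eq]
  have hG : Real.Gamma (1/2+1) = Real.sqrt Real.pi / 2 := by
    rw [Real.Gamma_add_one (by norm_num), Real.Gamma_one_half_eq]; ring
  simp only [Nat.cast_one]
  rw [hG, ← Real.sqrt_eq_rpow]
  have : 0 < Real.sqrt Real.pi := Real.sqrt_pos.2 Real.pi_pos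
  field_simp

lemma ball_vol_real (n : ℕ) : volume {x : Fin n → ℝ | ∑ i, |x i| ^ (2:ℝ) < 1} = ENNReal.ofReal (ballVol n) := by
  unfold ballVol
  rw [ENNReal.ofReal_toReal]
  rw [volume_sum_rpow_lt_one (Fin n) (by norm_num : (1:ℝ) ≤ 2)]
  exact ENNReal.ofReal_ne_top

lemma convex_ball {κ ι : Type*} [Fintype ι] (j : ι → κ) : Convex ℝ {x : κ → ℝ | ∑ i, |x (j i)| ^ (2:ℝ) < 1} := by
  have : ConvexOn ℝ Set.univ (fun x : κ → ℝ => ∑ i, |x (j i)| ^ (2:ℝ)) := by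
    have hi : ∀ i : ι, ConvexOn ℝ Set.univ (fun x : κ → ℝ => |x (j i)| ^ (2:ℝ)) := by
      intro i
      have h1 : ConvexOn ℝ Set.univ (fun t : ℝ => t^2) := (Even.convexOn_pow (by decide))
      have h2 := h1.comp_linearMap (LinearMap.proj (R := ℝ) (φ := fun _ : κ => ℝ) (j i))
      refine ⟨convex_univ, ?_⟩
      intro x _ y _ a b ha hb hab
      have := h2.2 (Set.mem_univ x) (Set.mem_univ y) ha hb hab
      simpa using this
    have := (Finset.univ : Finset ι).sum_induction (fun i => fun x : κ → ℝ => |x (j i)| ^ (2:ℝ)) (fun f => ConvexOn ℝ Set.univ f)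
      (fun _ _ h h' => h.add h') (convexOn_const 0 convex_univ) (fun i _ => hi i)
    convert! this using 1
    ext x; simp
  have := this.convex_lt 1
  simpa using this

lemma minkowski_body (r s : ℕ) (B : Module.Basis (Fin r ⊕ Fin s) ℝ ((Fin r ⊕ Fin s) → ℝ))
    (h : |(Matrix.of B).det| * 2 ^ (r+s) < ballVol r * ballVol s) :
    ∃ x ∈ Submodule.span ℤ (Set.range B), x ≠ 0 ∧ ∑ i : Fin r, (x (Sum.inl i))^2 < 1 ∧ ∑ i : Fin s, (x (Sum.inr i))^2 < 1 := by
  let K : Set ((Fin r ⊕ Fin s) → ℝ) := {x | ∑ i : Fin r, |x (Sum.inl i)| ^ (2:ℝ) < 1} ∩ {x | ∑ i : Fin s, |x (Sum.inr i)| ^ (2:ℝ) < 1}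
  have hKv : volume K = ENNReal.ofReal (ballVol r * ballVol s) := by
    have hmp := volume_measurePreserving_sumPiEquivProdPi (fun _ : Fin r ⊕ Fin s => ℝ)
    have : K = (MeasurableEquiv.sumPiEquivProdPi (fun _ : Fin r ⊕ Fin s => ℝ)) ⁻¹' ({x : Fin r → ℝ | ∑ i, |x i| ^ (2:ℝ) < 1} ×ˢ {x : Fin s → ℝ | ∑ i, |x i| ^ (2:ℝ) < 1}) := by
      ext x; rfl
    rw [this, hmp.measure_preimage_equiv, Measure.volume_eq_prod, Measure.prod_prod]
    rw [ball_vol_real, ball_vol_real, ENNReal.ofReal_mul (ballVol_pos r).le]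
  haveI : Countable (Submodule.span ℤ (Set.range B)).toAddSubgroup :=
    inferInstanceAs (Countable (Submodule.span ℤ (Set.range B)))
  have := exists_ne_zero_mem_lattice_of_measure_mul_two_pow_lt_measure (s := K)
    (ZSpan.isAddFundamentalDomain' B volume) ?_ ((convex_ball _).inter (convex_ball _)) ?_
  · obtain ⟨⟨x, hx⟩, hx0, hxK⟩ := this
    refine ⟨x, hx, fun h => hx0 (Subtype.ext h), ?_, ?_⟩
    · have := hxK.1
      simpa using this
    · have := hxK.2
      simpa using this
  · intro x hx
    simpa [K] using hx
  · rw [ZSpan.volume_fundamentalDomain, hKv]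
    have : (2:ENNReal) ^ Module.finrank ℝ ((Fin r ⊕ Fin s) → ℝ) = ENNReal.ofReal (2 ^ (r+s)) := by
      rw [ENNReal.ofReal_pow (by norm_num)]; simp
    rw [this, ← ENNReal.ofReal_mul (abs_nonneg _)]
    exact (ENNReal.ofReal_lt_ofReal_iff (mul_pos (ballVol_pos r) (ballVol_pos s))).2 h
end Eich
end

section
open scoped BigOperators Matrix RealInnerProductSpace
namespace Eich
open Module

lemma perfect_det {κ M : Type*} [Fintype κ] [DecidableEq κ] [AddCommGroup M] (β : Basis κ ℤ M)
    (b : M →ₗ[ℤ] M →ₗ[ℤ] ℤ) (perf : ∀ φ : M →ₗ[ℤ] ℤ, ∃ m, ∀ x, b m x = φ x) :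
    IsUnit (Matrix.of fun i j => b (β i) (β j)).det := by
  choose m hm using fun i => perf (β.coord i)
  have : (Matrix.of fun i j => β.repr (m i) j) * (Matrix.of fun i j => b (β i) (β j)) = 1 := by
    ext i j
    rw [Matrix.mul_apply]
    have h1 : b (m i) (β j) = ∑ k, β.repr (m i) k * b (β k) (β j) := by
      conv_lhs => rw [← β.sum_repr (m i)]
      simp only [map_sum, LinearMap.sum_apply, map_smul, LinearMap.smul_apply, smul_eq_mul]
    rw [hm] at h1
    simp only [Matrix.of_apply]
    rw [← h1]
    simp [Basis.coord_apply, Finsupp.single_apply, Matrix.one_apply, eq_comm]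
  have h2 := congrArg Matrix.det this
  rw [Matrix.det_mul, Matrix.det_one] at h2
  exact IsUnit.of_mul_eq_one _ (by rw [mul_comm]; exact h2)

lemma exists_isotropic {M E F : Type} [AddCommGroup M] [Module.Free ℤ M] [Module.Finite ℤ M]
    [NormedAddCommGroup E] [InnerProductSpace ℝ E] [FiniteDimensional ℝ E]
    [NormedAddCommGroup F] [InnerProductSpace ℝ F] [FiniteDimensional ℝ F]
    (b : M →ₗ[ℤ] M →ₗ[ℤ] ℤ) (f : M →+ E) (g : M →+ F)
    (hb : ∀ x y, (b x y : ℝ) = ⟪f x, f y⟫ - ⟪g x, g y⟫) (ev : ∀ x, 2 ∣ b x x)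
    (perf : ∀ φ : M →ₗ[ℤ] ℤ, ∃ m, ∀ x, b m x = φ x) (r s : ℕ)
    (hr : finrank ℝ E = r) (hs : finrank ℝ F = s) (hM : finrank ℤ M = r + s)
    (hvol : (√2) ^ (r+s) < ballVol r * ballVol s) : ∃ v, v ≠ 0 ∧ b v v = 0 := by
  let κ := Fin r ⊕ Fin s
  let β : Basis κ ℤ M := (Module.finBasis ℤ M).reindex ((finCongr hM).trans finSumFinEquiv.symm)
  let OE : OrthonormalBasis (Fin r) ℝ E := (stdOrthonormalBasis ℝ E).reindex (finCongr hr)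
  let OF : OrthonormalBasis (Fin s) ℝ F := (stdOrthonormalBasis ℝ F).reindex (finCongr hs)
  let c : M →+ (κ → ℝ) :=
    { toFun := fun x => Sum.elim (fun i => OE.repr (f x) i) (fun i => OF.repr (g x) i)
      map_zero' := by ext i; rcases i with i | i <;> simp
      map_add' := by intro x y; ext i; rcases i with i | i <;> simp }
  have hf : ∀ x y, ⟪f x, f y⟫ = ∑ i, c x (Sum.inl i) * c y (Sum.inl i) := by
    intro x y
    rw [← OE.repr.inner_map_map, PiLp.inner_apply]
    refine Finset.sum_congr rfl fun i _ => ?_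
    simp [c, mul_comm]
  have hg : ∀ x y, ⟪g x, g y⟫ = ∑ i, c x (Sum.inr i) * c y (Sum.inr i) := by
    intro x y
    rw [← OF.repr.inner_map_map, PiLp.inner_apply]
    refine Finset.sum_congr rfl fun i _ => ?_
    simp [c, mul_comm]
  let P : Matrix κ κ ℝ := Matrix.of fun i => c (β i)
  let J : Matrix κ κ ℝ := Matrix.diagonal (Sum.elim (fun _ => 1) (fun _ => -1))
  have hG : P * J * Pᵀ = (Matrix.of fun i j => b (β i) (β j)).map (Int.castRingHom ℝ) := by
    ext i j
    simp only [Matrix.map_apply, Matrix.of_apply, eq_intCast]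
    rw [hb, hf, hg, Matrix.mul_apply]
    simp only [J, P, Matrix.mul_diagonal, Matrix.transpose_apply, Matrix.of_apply]
    rw [Fintype.sum_sum_type]
    simp [sub_eq_add_neg]
  have hdet : P.det ^ 2 = 1 := by
    have h1 := congrArg Matrix.det hG
    rw [← RingHom.mapMatrix_apply, ← RingHom.map_det] at h1
    rw [Matrix.det_mul, Matrix.det_mul, Matrix.det_transpose, Matrix.det_diagonal] at h1
    have h2 := congrArg abs h1
    rcases Int.isUnit_iff.1 (perfect_det β b perf) with h | h <;> rw [h] at h2 <;>
    · rw [Fintype.prod_sum_type] at h2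
      simp [abs_mul] at h2
      rw [sq, h2]
  have habs : |P.det| = 1 := by
    rcases (mul_self_eq_one_iff (a := P.det)).1 (by rw [← sq]; exact hdet) with h | h <;> simp [h]
  let Q : Matrix κ κ ℝ := (√2)⁻¹ • P
  have hQdet : |Q.det| = (√2)⁻¹ ^ (r+s) := by
    simp only [Q]
    rw [Matrix.det_smul, abs_mul, habs]
    simp [κ, abs_of_pos (Real.sqrt_pos.2 (by norm_num : (0:ℝ) < 2))]
  have hQu : IsUnit Q := by
    rw [Matrix.isUnit_iff_isUnit_det, isUnit_iff_ne_zero, ← abs_pos, hQdet]; positivity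
  have hli : LinearIndependent ℝ Q.row := Matrix.linearIndependent_rows_iff_isUnit.2 hQu
  let B : Basis κ ℝ (κ → ℝ) := basisOfLinearIndependentOfCardEqFinrank' _ hli (by simp)
  have hB : (B : κ → κ → ℝ) = Q.row := coe_basisOfLinearIndependentOfCardEqFinrank' _ _ _
  have hs2 : (√2)^2 = 2 := Real.sq_sqrt (by norm_num)
  have hs0 : 0 < √2 := by positivity
  obtain ⟨x, hx, hx0, hx1, hx2⟩ := minkowski_body r s B (by
    rw [hB]
    have : (Matrix.of Q.row) = Q := rfl
    rw [this, hQdet]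
    refine lt_of_eq_of_lt ?_ hvol
    rw [← mul_pow]; congr 1
    field_simp; exact hs2.symm)
  have key : ∃ m, x = (√2)⁻¹ • c m := by
    rw [hB] at hx
    refine Submodule.span_induction (p := fun x _ => ∃ m, x = (√2)⁻¹ • c m) ?_ ?_ ?_ ?_ hx
    · rintro _ ⟨i, rfl⟩; exact ⟨β i, rfl⟩
    · exact ⟨0, by simp⟩
    · rintro _ _ _ _ ⟨m, rfl⟩ ⟨m', rfl⟩; exact ⟨m + m', by rw [map_add, smul_add]⟩
    · rintro a _ _ ⟨m, rfl⟩; exact ⟨a • m, by rw [map_zsmul, smul_comm]⟩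
  obtain ⟨m, rfl⟩ := key
  refine ⟨m, fun h => hx0 (by rw [h]; simp), ?_⟩
  have h1 : ⟪f m, f m⟫ < 2 := by
    rw [hf]
    simp only [Pi.smul_apply, smul_eq_mul, mul_pow, ← Finset.mul_sum, inv_pow, hs2] at hx1
    have : ∑ i, c m (Sum.inl i) * c m (Sum.inl i) = ∑ i, c m (Sum.inl i)^2 := by simp [sq]
    rw [this]; linarith
  have h2 : ⟪g m, g m⟫ < 2 := by
    rw [hg]
    simp only [Pi.smul_apply, smul_eq_mul, mul_pow, ← Finset.mul_sum, inv_pow, hs2] at hx2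
    have : ∑ i, c m (Sum.inr i) * c m (Sum.inr i) = ∑ i, c m (Sum.inr i)^2 := by simp [sq]
    rw [this]; linarith
  have h3 : 0 ≤ ⟪f m, f m⟫ := real_inner_self_nonneg
  have h4 : 0 ≤ ⟪g m, g m⟫ := real_inner_self_nonneg
  have h5 := hb m m
  have h6 : (b m m : ℝ) < (2:ℤ) := by push_cast; linarith
  have h7 : ((-2:ℤ):ℝ) < (b m m : ℝ) := by push_cast; linarith
  have h6 := Int.cast_lt.1 h6
  have h7 := Int.cast_lt.1 h7
  have := ev m
  omega

/-- one descent step -/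
lemma descent {M E F : Type} [AddCommGroup M] [Module.Free ℤ M] [Module.Finite ℤ M]
    [NormedAddCommGroup E] [InnerProductSpace ℝ E] [FiniteDimensional ℝ E]
    [NormedAddCommGroup F] [InnerProductSpace ℝ F] [FiniteDimensional ℝ F]
    (b : M →ₗ[ℤ] M →ₗ[ℤ] ℤ) (f : M →+ E) (g : M →+ F)
    (hb : ∀ x y, (b x y : ℝ) = ⟪f x, f y⟫ - ⟪g x, g y⟫) (ev : ∀ x, 2 ∣ b x x)
    (perf : ∀ φ : M →ₗ[ℤ] ℤ, ∃ m, ∀ x, b m x = φ x) (r s : ℕ)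
    (hr : finrank ℝ E = r+1) (hs : finrank ℝ F = s+1) (hM : finrank ℤ M = (r+1) + (s+1))
    (hvol : (√2) ^ ((r+1)+(s+1)) < ballVol (r+1) * ballVol (s+1)) :
    ∃ (v w : M) (M' : Submodule ℤ M) (E' : Submodule ℝ E) (F' : Submodule ℝ F) (f' : M' →+ E') (g' : M' →+ F'),
      b v v = 0 ∧ b v w = 1 ∧ (∀ x ∈ M', b v x = 0 ∧ b x v = 0 ∧ b x w = 0) ∧
      (∀ x y : M', (b x y : ℝ) = ⟪f' x, f' y⟫ - ⟪g' x, g' y⟫) ∧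
      (∀ φ : M' →ₗ[ℤ] ℤ, ∃ m : M', ∀ x : M', b m x = φ x) ∧
      finrank ℝ E' = r ∧ finrank ℝ F' = s ∧ finrank ℤ M' = r + s := by
  have symm : ∀ x y, b x y = b y x := by
    intro x y
    have h1 := hb x y
    rw [real_inner_comm, real_inner_comm (g y), ← hb y x] at h1
    exact_mod_cast h1
  obtain ⟨v0, hv00, hv0⟩ := exists_isotropic b f g hb ev perf _ _ hr hs hM hvol
  -- primitive vector
  obtain ⟨v, w0, hv, hvw0⟩ : ∃ v w, b v v = 0 ∧ b v w = 1 := by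
    let β := Module.finBasis ℤ M
    let d := Finset.univ.gcd (fun i => β.repr v0 i)
    have hd0 : d ≠ 0 := by
      intro h
      rw [Finset.gcd_eq_zero_iff] at h
      apply hv00
      apply β.repr.injective
      ext i; simpa using h i (Finset.mem_univ i)
    obtain ⟨k, hk⟩ : ∃ k : Fin (finrank ℤ M) → ℤ, ∑ i, k i * β.repr v0 i = d := by
      obtain ⟨k, hk⟩ := Finset.gcd_eq_sum_mul (Finset.univ) (fun i => β.repr v0 i)
      exact ⟨k, by simp only [d]; rw [hk]; simp [mul_comm]⟩
    have hdvd : ∀ i, d ∣ β.repr v0 i := fun i => Finset.gcd_dvd (Finset.mem_univ i)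
    choose q hq using hdvd
    let v := ∑ i, q i • β i
    have hv0v : v0 = d • v := by
      conv_lhs => rw [← β.sum_repr v0]
      simp only [v, Finset.smul_sum, smul_smul, hq]
    have hkv : ∑ i, k i * β.repr v i = 1 := by
      have : d * ∑ i, k i * β.repr v i = d * 1 := by
        have h2 := hk
        rw [hv0v] at h2
        rw [mul_one]
        refine Eq.trans ?_ h2
        rw [Finset.mul_sum]
        simp [mul_left_comm]
      exact mul_left_cancel₀ hd0 this
    obtain ⟨w, hw⟩ := perf (∑ i, k i • β.coord i)
    refine ⟨v, w, ?_, ?_⟩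
    · rw [hv0v] at hv0
      simpa [hd0] using hv0
    · rw [symm, hw]
      simpa using hkv
  obtain ⟨t, ht⟩ := ev w0
  let w := w0 - t • v
  have hvw : b v w = 1 := by simp [w, hv, hvw0]
  have hww : b w w = 0 := by
    simp only [w, map_sub, map_smul, LinearMap.sub_apply, LinearMap.smul_apply, hv, symm w0 v, hvw0, ht, smul_eq_mul]; ring
  have hwv : b w v = 1 := by rw [symm, hvw]
  let M' : Submodule ℤ M := LinearMap.ker (b v) ⊓ LinearMap.ker (b w)
  let c := ⟪f v, f v⟫
  have hcg : ⟪g v, g v⟫ = c := by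
    have := hb v v; rw [hv] at this; simp only [Int.cast_zero] at this; linarith
  have hc0 : c ≠ 0 := by
    intro h
    have h1 : f v = 0 := inner_self_eq_zero.1 h
    have h2 : g v = 0 := inner_self_eq_zero.1 (hcg.trans h)
    have := hb v w
    rw [hvw, h1, h2] at this; simp at this
  have hfv : f v ≠ 0 := fun h => hc0 (by simp [c, h])
  have hgv : g v ≠ 0 := fun h => hc0 (by rw [← hcg]; simp [h])
  let E' := (ℝ ∙ f v)ᗮ
  let F' := (ℝ ∙ g v)ᗮ
  let pE : E →ₗ[ℝ] E' := (E'.orthogonalProjection : E →L[ℝ] E').toLinearMap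
  let pF : F →ₗ[ℝ] F' := (F'.orthogonalProjection : F →L[ℝ] F').toLinearMap
  have ipE : ∀ x y : E, ⟪pE x, pE y⟫ = ⟪x, y⟫ - ⟪f v, x⟫ * ⟪f v, y⟫ / c := by
    intro x y
    have h := Submodule.starProjection_singleton ℝ (v := f v) x
    have h2 : ((pE x : E')  : E) = x - (ℝ ∙ f v).starProjection x := by
      have := Submodule.starProjection_orthogonal_val (K := ℝ ∙ f v) x
      exact this
    have h3 : ((pE y : E')  : E) = y - (ℝ ∙ f v).starProjection y := by
      exact Submodule.starProjection_orthogonal_val (K := ℝ ∙ f v) y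
    have h' := Submodule.starProjection_singleton ℝ (v := f v) y
    rw [Submodule.coe_inner, h2, h3, h, h']
    rw [← real_inner_self_eq_norm_sq]
    simp only [inner_sub_left, inner_sub_right, real_inner_smul_left, real_inner_smul_right, RCLike.ofReal_real_eq_id, id]
    rw [real_inner_comm (f v) x]
    rw [show ⟪f v, f v⟫ = c from rfl]
    have hc0 : c ≠ 0 := hc0
    generalize c = c at hc0
    field_simp
    ring
  have ipF : ∀ x y : F, ⟪pF x, pF y⟫ = ⟪x, y⟫ - ⟪g v, x⟫ * ⟪g v, y⟫ / c := by
    intro x y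
    have h := Submodule.starProjection_singleton ℝ (v := g v) x
    have h2 : ((pF x : F')  : F) = x - (ℝ ∙ g v).starProjection x := by
      have := Submodule.starProjection_orthogonal_val (K := ℝ ∙ g v) x
      exact this
    have h3 : ((pF y : F')  : F) = y - (ℝ ∙ g v).starProjection y := by
      exact Submodule.starProjection_orthogonal_val (K := ℝ ∙ g v) y
    have h' := Submodule.starProjection_singleton ℝ (v := g v) y
    rw [Submodule.coe_inner, h2, h3, h, h']
    rw [← real_inner_self_eq_norm_sq]
    simp only [inner_sub_left, inner_sub_right, real_inner_smul_left, real_inner_smul_right, RCLike.ofReal_real_eq_id, id]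
    rw [real_inner_comm (g v) x]
    rw [hcg]
    have hc0 : c ≠ 0 := hc0
    generalize c = c at hc0
    field_simp
    ring
  let pr : M →ₗ[ℤ] M := LinearMap.id - (b w).smulRight v - (b v).smulRight w
  have hpr : ∀ x, pr x = x - b w x • v - b v x • w := fun x => rfl
  have hprM : ∀ x, pr x ∈ M' := by
    intro x
    refine ⟨?_, ?_⟩
    · rw [SetLike.mem_coe, LinearMap.mem_ker, hpr]
      simp [hv, hvw]
    · rw [SetLike.mem_coe, LinearMap.mem_ker, hpr]
      simp [hww, hwv]
  have hM'v : ∀ x ∈ M', b v x = 0 := fun x hx => hx.1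
  have hM'w : ∀ x ∈ M', b w x = 0 := fun x hx => hx.2
  refine ⟨v, w, M', E', F', pE.toAddMonoidHom.comp (f.comp M'.subtype.toAddMonoidHom),
    pF.toAddMonoidHom.comp (g.comp M'.subtype.toAddMonoidHom), hv, hvw,
    fun x hx => ⟨hM'v x hx, by rw [symm]; exact hM'v x hx, by rw [symm]; exact hM'w x hx⟩, ?_, ?_, ?_, ?_, ?_⟩
  · intro x y
    change _ = ⟪pE (f x), pE (f y)⟫ - ⟪pF (g x), pF (g y)⟫
    rw [ipE, ipF, hb]
    have h1 := hb v x; rw [hM'v x x.2] at h1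
    have h2 := hb v y; rw [hM'v y y.2] at h2
    simp only [Int.cast_zero] at h1 h2
    rw [show ⟪f v, f x⟫ = ⟪g v, g x⟫ by linarith, show ⟪f v, f y⟫ = ⟪g v, g y⟫ by linarith]
    ring
  · intro φ
    obtain ⟨m, hm⟩ := perf (φ.comp (pr.codRestrict M' hprM))
    refine ⟨⟨pr m, hprM m⟩, fun x => ?_⟩
    have h1 : pr x = x := by
      rw [hpr, hM'v x x.2, hM'w x x.2]; simp
    have h2 := hm x
    have h3 : pr.codRestrict M' hprM x = x := Subtype.ext h1
    rw [LinearMap.comp_apply, h3] at h2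
    rw [← h2]
    change b (pr m) x = _
    rw [hpr]
    simp [hM'v x x.2, hM'w x x.2]
  · have := Submodule.finrank_add_finrank_orthogonal (K := ℝ ∙ f v)
    rw [finrank_span_singleton hfv, hr] at this
    change finrank ℝ E' = r
    simp only [E']; omega
  · have := Submodule.finrank_add_finrank_orthogonal (K := ℝ ∙ g v)
    rw [finrank_span_singleton hgv, hs] at this
    change finrank ℝ F' = s
    simp only [F']; omega
  · let e : M ≃ₗ[ℤ] M' × ℤ × ℤ :=
      { toFun := fun x => (⟨pr x, hprM x⟩, b w x, b v x)
        map_add' := by intro x y; ext <;> simp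
        map_smul' := by intro x y; ext <;> simp
        invFun := fun x => x.1 + x.2.1 • v + x.2.2 • w
        left_inv := by intro x; simp only [hpr]; abel
        right_inv := by
          rintro ⟨x, α, β⟩
          ext
          · simp [hpr, hM'v x x.2, hM'w x x.2, hv, hvw, hww, hwv]
            abel
          · simp [hM'w x x.2, hwv, hww]
          · simp [hM'v x x.2, hv, hvw] }
    have h1 := e.finrank_eq
    rw [Module.finrank_prod, Module.finrank_prod, Module.finrank_self, hM] at h1
    omega

lemma sqrt2_pow (n : ℕ) : (√2 : ℝ) ^ (2*n) = 2 ^ n := by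
  rw [pow_mul, Real.sq_sqrt (by norm_num)]

lemma bv2 : ballVol 2 = Real.pi := by rw [ballVol_rec 0, ballVol_zero]; simp; 
lemma bv3 : ballVol 3 = 4 / 3 * Real.pi := by
  rw [ballVol_rec 1, ballVol_one]; push_cast; ring
lemma bv4 : ballVol 4 = Real.pi ^ 2 / 2 := by
  rw [ballVol_rec 2, bv2]; push_cast; ring
lemma bv5 : ballVol 5 = 8 / 15 * Real.pi ^ 2 := by
  rw [ballVol_rec 3, bv3]; push_cast; ring
lemma bv6 : ballVol 6 = Real.pi ^ 3 / 6 := by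
  rw [ballVol_rec 4, bv4]; push_cast; ring

lemma vol_nn (n : ℕ) (hn : n < 4) : (√2) ^ ((n+1)+(n+1)) < ballVol (n+1) * ballVol (n+1) := by
  have hp := Real.pi_gt_three
  rw [← two_mul, sqrt2_pow]
  interval_cases n <;> norm_num [ballVol_one, bv2, bv3, bv4]
  · nlinarith
  · nlinarith
  · have : 9 < Real.pi ^ 2 := by nlinarith
    nlinarith

lemma vol_62 : (√2) ^ ((5+1)+(1+1)) < ballVol (5+1) * ballVol (1+1) := by
  have hp := Real.pi_gt_d2
  have h := sqrt2_pow 4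
  norm_num at h ⊢
  rw [h, bv6, bv2]
  have h2 : 9.8 < Real.pi ^ 2 := by nlinarith
  nlinarith

lemma vol_51 : (√2) ^ ((4+1)+(0+1)) < ballVol (4+1) * ballVol (0+1) := by
  have hp := Real.pi_gt_d2
  have h := sqrt2_pow 3
  norm_num at h ⊢
  rw [h, bv5, ballVol_one]
  have h2 : 9.8 < Real.pi ^ 2 := by nlinarith
  nlinarith

lemma vol_40 : (√2) ^ (4+0) < ballVol 4 * ballVol 0 := by
  have hp := Real.pi_gt_d2
  have h := sqrt2_pow 2
  norm_num at h ⊢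
  rw [h, bv4, ballVol_zero]
  have h2 : 9.8 < Real.pi ^ 2 := by nlinarith
  nlinarith

lemma restr_form {M : Type} [AddCommGroup M] (b : M →ₗ[ℤ] M →ₗ[ℤ] ℤ) (M' : Submodule ℤ M) :
    ∃ b' : M' →ₗ[ℤ] M' →ₗ[ℤ] ℤ, ∀ x y : M', b' x y = b x y :=
  ⟨(b.comp M'.subtype).compl₂ M'.subtype, fun _ _ => rfl⟩

lemma no_eu_62 {M E F : Type} [AddCommGroup M] [Module.Free ℤ M] [Module.Finite ℤ M]
    [NormedAddCommGroup E] [InnerProductSpace ℝ E] [FiniteDimensional ℝ E]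
    [NormedAddCommGroup F] [InnerProductSpace ℝ F] [FiniteDimensional ℝ F]
    (b : M →ₗ[ℤ] M →ₗ[ℤ] ℤ) (f : M →+ E) (g : M →+ F)
    (hb : ∀ x y, (b x y : ℝ) = ⟪f x, f y⟫ - ⟪g x, g y⟫) (ev : ∀ x, 2 ∣ b x x)
    (perf : ∀ φ : M →ₗ[ℤ] ℤ, ∃ m, ∀ x, b m x = φ x)
    (hr : finrank ℝ E = 6) (hs : finrank ℝ F = 2) (hM : finrank ℤ M = 8) : False := by
  obtain ⟨v, w, M', E', F', f', g', -, -, -, hb', perf', hE', hF', hM'⟩ :=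
    descent b f g hb ev perf 5 1 hr hs hM vol_62
  obtain ⟨b', hbb'⟩ := restr_form b M'
  obtain ⟨v, w, M'', E'', F'', f'', g'', -, -, -, hb'', perf'', hE'', hF'', hM''⟩ :=
    descent b' f' g' (fun x y => by rw [hbb']; exact hb' x y) (fun x => by rw [hbb']; exact ev _)
      (fun φ => (perf' φ).imp fun m hm x => by rw [hbb']; exact hm x) 4 0 hE' hF' hM' vol_51
  obtain ⟨b'', hbb''⟩ := restr_form b' M''
  obtain ⟨v, hv0, hv⟩ := exists_isotropic b'' f'' g'' (fun x y => by rw [hbb'']; exact hb'' x y) (fun x => by rw [hbb'', hbb']; exact ev _)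
      (fun φ => (perf'' φ).imp fun m hm x => by rw [hbb'']; exact hm x) 4 0 hE'' hF'' hM'' vol_40
  have : Subsingleton F'' := finrank_zero_iff.1 hF''
  have hF0 : ∀ x : F'', x = 0 := fun x => Subsingleton.elim _ _
  have hbv : ∀ x y, (b'' x y : ℝ) = ⟪f'' x, f'' y⟫ := by
    intro x y
    rw [hbb'', hb'' x y, hF0 (g'' x)]; simp
  have hfv : f'' v = 0 := by
    have := hbv v v
    rw [hv] at this
    simpa using this.symm
  obtain ⟨φ, hφ⟩ : ∃ φ : M'' →ₗ[ℤ] ℤ, φ v ≠ 0 := by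
    by_contra h
    push Not at h
    let β := Module.finBasis ℤ M''
    apply hv0
    apply β.repr.injective
    ext i
    simpa using h (β.coord i)
  obtain ⟨m, hm⟩ := perf'' φ
  apply hφ
  rw [← hm]
  have := hbv m v
  rw [hfv, hbb''] at this
  simpa using this

lemma lagrangian (n : ℕ) (hn : n ≤ 4) : ∀ {M E F : Type} [AddCommGroup M] [Module.Free ℤ M] [Module.Finite ℤ M]
    [NormedAddCommGroup E] [InnerProductSpace ℝ E] [FiniteDimensional ℝ E]
    [NormedAddCommGroup F] [InnerProductSpace ℝ F] [FiniteDimensional ℝ F]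
    (b : M →ₗ[ℤ] M →ₗ[ℤ] ℤ) (f : M →+ E) (g : M →+ F)
    (_ : ∀ x y, (b x y : ℝ) = ⟪f x, f y⟫ - ⟪g x, g y⟫) (_ : ∀ x, 2 ∣ b x x)
    (_ : ∀ φ : M →ₗ[ℤ] ℤ, ∃ m, ∀ x, b m x = φ x)
    (_ : finrank ℝ E = n) (_ : finrank ℝ F = n) (_ : finrank ℤ M = n + n),
    ∃ u : Fin n → M, (∀ c : Fin n → ℤ, ∑ i, c i • u i = 0 → c = 0) ∧ ∀ i j, b (u i) (u j) = 0 := by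
  induction n with
  | zero => intros; exact ⟨fun i => 0, fun c _ => Subsingleton.elim _ _, fun i => i.elim0⟩
  | succ n ih =>
    intro M E F _ _ _ _ _ _ _ _ _ b f g hb ev perf hE hF hM
    obtain ⟨v, w, M', E', F', f', g', hv, hvw, hM'v, hb', perf', hE', hF', hM'⟩ :=
      descent b f g hb ev perf n n hE hF hM (vol_nn n (by omega))
    obtain ⟨b', hbb'⟩ := restr_form b M'
    obtain ⟨u, hu, huu⟩ := ih (by omega) b' f' g' (fun x y => by rw [hbb']; exact hb' x y) (fun x => by rw [hbb']; exact ev _)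
      (fun φ => (perf' φ).imp fun m hm x => by rw [hbb']; exact hm x) hE' hF' hM'
    refine ⟨Fin.cons v (fun i => (u i : M)), ?_, ?_⟩
    · intro c hc
      rw [Fin.sum_univ_succ] at hc
      simp only [Fin.cons_zero, Fin.cons_succ] at hc
      have h0 : c 0 = 0 := by
        have := congrArg (fun x => b x w) hc
        simp only [map_add, map_smul, map_sum, LinearMap.add_apply, LinearMap.smul_apply, LinearMap.sum_apply, hvw, map_zero, LinearMap.zero_apply] at this
        simpa [(hM'v _ (u _).2).2.2] using this
      have h1 := hu (fun i => c i.succ) (by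
        apply Subtype.ext
        rw [h0] at hc
        simpa using hc)
      ext i
      refine Fin.cases h0 (fun i => ?_) i
      exact congrFun h1 i
    · intro i j
      refine Fin.cases ?_ (fun i => ?_) i <;> refine Fin.cases ?_ (fun j => ?_) j
      · simpa using hv
      · simpa using (hM'v _ (u j).2).1
      · simpa using (hM'v _ (u i).2).2.1
      · have := huu i j
        rw [hbb'] at this
        simpa using this
end Eich
end

section
open scoped BigOperators Matrix RealInnerProductSpace
namespace Eich
open Module

lemma kernel_lemma {ι κ : Type*} [Fintype ι] [DecidableEq ι] [Fintype κ] (p : ℕ) [Fact p.Prime] (m : ℕ)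
    (T : Matrix ι ι ℤ) (e : κ → ι → ℤ)
    (hli : LinearIndependent (ZMod p) (fun k => fun i => ((e k i : ℤ) : ZMod p)))
    (hT : ∀ k i, (p:ℤ)^m ∣ (T.mulVec (e k)) i) : (p:ℤ) ^ (m * Fintype.card κ) ∣ T.det := by
  classical
  let B := Basis.sumExtend hli
  let J := Module.Basis.sumExtendIndex hli
  haveI : Fintype (κ ⊕ J) := FiniteDimensional.fintypeBasisIndex B
  let σ : ι ≃ κ ⊕ J := Fintype.equivOfCardEq (by
    rw [← Module.finrank_eq_card_basis B]; simp)
  let lift : ZMod p → ℤ := fun x => (x.val : ℤ)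
  have hlift : ∀ x : ZMod p, ((lift x : ℤ) : ZMod p) = x := fun x => by simp [lift]
  let c : κ ⊕ J → ι → ℤ := Sum.elim e (fun j i => lift (B (Sum.inr j) i))
  have hc : ∀ s i, ((c s i : ℤ) : ZMod p) = B s i := by
    rintro (k | j) i
    · simp only [c, B, Sum.elim_inl]
      rw [Basis.sumExtend, Basis.reindex_apply]
      simp
      rfl
    · simp [c, hlift]
  let Q : Matrix ι ι ℤ := Matrix.of fun i j => c (σ j) i
  have hQ : ((Q.det : ℤ) : ZMod p) ≠ 0 := by
    have h1 : ((Q.det : ℤ) : ZMod p) = (Q.map (Int.castRingHom (ZMod p))).det := by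
      rw [← RingHom.mapMatrix_apply, ← RingHom.map_det]; simp
    rw [h1]
    have h3 : (Q.map (Int.castRingHom (ZMod p))) = (Pi.basisFun (ZMod p) ι).toMatrix (B.reindex σ.symm) := by
      ext i j
      simp [Q, Basis.toMatrix_apply, hc]
    rw [h3]
    letI := (Pi.basisFun (ZMod p) ι).invertibleToMatrix (B.reindex σ.symm)
    have := (Matrix.isUnit_iff_isUnit_det _).1 (isUnit_of_invertible ((Pi.basisFun (ZMod p) ι).toMatrix (B.reindex σ.symm)))
    exact this.ne_zero
  have hpQ : ¬ (p:ℤ) ∣ Q.det := fun h => hQ ((ZMod.intCast_zmod_eq_zero_iff_dvd _ _).2 h)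
  choose d hd using hT
  let v : ι → ℤ := fun j => Sum.elim (fun _ : κ => (p:ℤ)^m) (fun _ : J => 1) (σ j)
  let A : Matrix ι ι ℤ := Matrix.of fun i j => Sum.elim (fun k : κ => d k i) (fun j' : J => T.mulVec (c (Sum.inr j')) i) (σ j)
  have hTQ : T * Q = Matrix.of fun i j => v j * A i j := by
    ext i j
    have h1 : (T * Q) i j = T.mulVec (c (σ j)) i := by
      simp [Matrix.mul_apply, Matrix.mulVec, dotProduct, Q]
    rw [h1]
    simp only [Matrix.of_apply, v, A]
    rcases σ j with k | j'
    · simpa [c] using hd k i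
    · simp
  have hdet := congrArg Matrix.det hTQ
  rw [Matrix.det_mul_row, Matrix.det_mul] at hdet
  haveI : Fintype J := Fintype.ofInjective (Sum.inr : J → κ ⊕ J) Sum.inr_injective
  have hprod : ∏ j, v j = (p:ℤ)^(m * Fintype.card κ) := by
    rw [Fintype.prod_equiv σ v (Sum.elim (fun _ : κ => (p:ℤ)^m) (fun _ : J => 1)) (fun _ => rfl)]
    have := Fintype.prod_sum_type (Sum.elim (fun _ : κ => (p:ℤ)^m) (fun _ : J => 1))
    simp only [Sum.elim_inl, Sum.elim_inr, Finset.prod_const_one, Finset.prod_const, Finset.card_univ, mul_one, ← pow_mul] at this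
    convert! this
  rw [hprod] at hdet
  have hcop : IsCoprime ((p:ℤ) ^ (m * Fintype.card κ)) Q.det :=
    IsCoprime.pow_left (((Nat.prime_iff_prime_int.1 Fact.out).coprime_iff_not_dvd).2 hpQ)
  exact hcop.dvd_of_dvd_mul_right ⟨_, hdet⟩

lemma basis_lemma {V : Type*} [AddCommGroup V] [Module ℚ V] [FiniteDimensional ℚ V] (n : ℕ)
    (hn : finrank ℚ V = n) (M : Submodule ℤ V) (hfg : M.FG) (hspan : Submodule.span ℚ (M : Set V) = ⊤) :
    ∃ w : Basis (Fin n) ℚ V, Submodule.span ℤ (Set.range w) = M := by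
  haveI : Module.Finite ℤ M := Module.Finite.iff_fg.2 hfg
  haveI : IsAddTorsionFree V := .of_module_rat _
  haveI : Module.Free ℤ M := inferInstance
  let β := Module.finBasis ℤ M
  let w0 : Fin (finrank ℤ M) → V := fun i => (β i : V)
  have hli : LinearIndependent ℤ w0 := β.linearIndependent.map' M.subtype (by simp)
  have hliQ : LinearIndependent ℚ w0 := (LinearIndependent.iff_fractionRing ℤ ℚ).1 hli
  have hsp : Submodule.span ℤ (Set.range w0) = M := by
    have h1 : Set.range w0 = M.subtype '' (Set.range β) := by
      rw [← Set.range_comp]; rfl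
    rw [h1, ← Submodule.map_span, β.span_eq, Submodule.map_top, Submodule.range_subtype]
  have hspQ : ⊤ ≤ Submodule.span ℚ (Set.range w0) := by
    rw [← hspan]
    refine Submodule.span_le.2 ?_
    intro x hx
    have hx : x ∈ Submodule.span ℤ (Set.range w0) := by rw [hsp]; exact hx
    exact Submodule.span_subset_span ℤ ℚ _ hx
  let W := Basis.mk hliQ hspQ
  have hcard : finrank ℤ M = n := by
    rw [← hn, Module.finrank_eq_card_basis W]; simp
  refine ⟨W.reindex (finCongr hcard), ?_⟩
  rw [Basis.range_reindex, Basis.coe_mk, hsp]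

/-- coordinates in a `ℤ`-span -/
lemma mem_span_range_int {V κ : Type*} [AddCommGroup V] [Fintype κ] {w : κ → V} {x : V}
    (hx : x ∈ Submodule.span ℤ (Set.range w)) : ∃ c : κ → ℤ, x = ∑ i, c i • w i := by
  obtain ⟨c, hc⟩ := (Submodule.mem_span_range_iff_exists_fun ℤ).1 hx
  exact ⟨c, hc.symm⟩


lemma glue {ι : Type} [Fintype ι] [DecidableEq ι] (G : Matrix ι ι ℤ) (hs : G.IsSymm) (hev : ∀ i, 2 ∣ G i i)
    (P : Finset ℕ) (hP : ∀ p ∈ P, p.Prime) (k : ℕ → ℕ) (e : (p : ℕ) → Fin (k p) → ι → ℤ)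
    (h1 : ∀ p ∈ P, ∀ i s, (p:ℤ) ∣ G.mulVec (e p i) s)
    (h2 : ∀ p ∈ P, ∀ i j, (p:ℤ)^2 ∣ e p i ⬝ᵥ G.mulVec (e p j))
    (h3 : ∀ p ∈ P, ∀ i, 2 * (p:ℤ)^2 ∣ e p i ⬝ᵥ G.mulVec (e p i))
    (hli : ∀ p ∈ P, LinearIndependent (ZMod p) (fun i => fun s => ((e p i s : ℤ) : ZMod p)))
    (hdet : |G.det| = ∏ p ∈ P, (p:ℤ)^(2 * k p)) :
    ∃ T G' : Matrix ι ι ℤ, T.det ≠ 0 ∧ G'.IsSymm ∧ (∀ i, 2 ∣ G' i i) ∧ IsUnit G'.det ∧ Tᵀ * G' * T = G := by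
  let GQ : Matrix ι ι ℚ := G.map (Int.cast : ℤ → ℚ)
  let B : (ι → ℚ) →ₗ[ℚ] (ι → ℚ) →ₗ[ℚ] ℚ := Matrix.toBilin' GQ
  have hB : ∀ x y, B x y = x ⬝ᵥ GQ.mulVec y := fun x y => by
    simp only [B]; rw [Matrix.toBilin'_apply']
  let up : (ι → ℤ) → (ι → ℚ) := fun x i => (x i : ℚ)
  have hBup : ∀ x y : ι → ℤ, B (up x) (up y) = ((x ⬝ᵥ G.mulVec y : ℤ) : ℚ) := by
    intro x y
    rw [hB]
    simp [up, GQ, dotProduct, Matrix.mulVec]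
  have hsym : ∀ x y : ι → ℤ, x ⬝ᵥ G.mulVec y = y ⬝ᵥ G.mulVec x := by
    intro x y
    rw [Matrix.dotProduct_mulVec, ← Matrix.mulVec_transpose, hs.eq, dotProduct_comm]
  have hBsym : ∀ x y, B x y = B y x := by
    intro x y
    rw [hB, hB, Matrix.dotProduct_mulVec, ← Matrix.mulVec_transpose, dotProduct_comm]
    congr 2
    simp only [GQ]; rw [← Matrix.transpose_map, hs.eq]
  let gen : ι ⊕ (Σ p : P, Fin (k p)) → (ι → ℚ) := Sum.elim (fun i => up (Pi.single i 1)) (fun x => ((x.1 : ℕ) : ℚ)⁻¹ • up (e x.1 x.2))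
  let M : Submodule ℤ (ι → ℚ) := Submodule.span ℤ (Set.range gen)
  have hp0 : ∀ p ∈ P, (p:ℚ) ≠ 0 := fun p hp => by exact_mod_cast (hP p hp).ne_zero
  have hstd : ∀ i (x : ι → ℤ), (Pi.single i 1 : ι → ℤ) ⬝ᵥ G.mulVec x = G.mulVec x i := by
    intro i x; simp
  have hgen : ∀ s t, ∃ c : ℤ, B (gen s) (gen t) = c := by
    rintro (i | ⟨⟨p, hp⟩, a⟩) (j | ⟨⟨q, hq⟩, a'⟩)
    · exact ⟨_, hBup _ _⟩
    · obtain ⟨c, hc⟩ := h1 q hq a' i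
      refine ⟨c, ?_⟩
      simp only [gen, Sum.elim_inl, Sum.elim_inr, map_smul, hBup, hstd, hc]
      push_cast; have := hp0 q hq; simp [this]
    · obtain ⟨c, hc⟩ := h1 p hp a j
      refine ⟨c, ?_⟩
      simp only [gen, Sum.elim_inl, Sum.elim_inr, map_smul, LinearMap.smul_apply, hBup, hsym _ (Pi.single _ _), hstd, hc]
      push_cast; have := hp0 p hp; simp [this]
    · simp only [gen, Sum.elim_inr, map_smul, LinearMap.smul_apply, hBup]
      have hpp := hp0 p hp
      have hqq := hp0 q hq
      have hd : ((p:ℤ) * q) ∣ e p a ⬝ᵥ G.mulVec (e q a') := by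
        by_cases hpq : p = q
        · subst hpq
          rw [← sq]; exact h2 p hp a a'
        · have hc : IsCoprime (p:ℤ) (q:ℤ) := Nat.isCoprime_iff_coprime.2 ((Nat.coprime_primes (hP p hp) (hP q hq)).2 hpq)
          refine hc.mul_dvd ?_ ?_
          · rw [hsym]; exact Finset.dvd_sum fun i _ => Dvd.dvd.mul_left (h1 p hp a i) _
          · exact Finset.dvd_sum fun i _ => Dvd.dvd.mul_left (h1 q hq a' i) _
      obtain ⟨c, hc⟩ := hd
      refine ⟨c, ?_⟩
      rw [hc]; push_cast; simp only [smul_eq_mul]; field_simp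
  have hgen2 : ∀ s, ∃ c : ℤ, B (gen s) (gen s) = 2 * c := by
    rintro (i | ⟨⟨p, hp⟩, a⟩)
    · obtain ⟨c, hc⟩ := hev i
      exact ⟨c, by simp only [gen, Sum.elim_inl, hBup, hstd]; simp [hc]⟩
    · obtain ⟨c, hc⟩ := h3 p hp a
      refine ⟨c, ?_⟩
      simp only [gen, Sum.elim_inr, map_smul, LinearMap.smul_apply, hBup]
      have hpp := hp0 p hp
      rw [hc]; push_cast; simp only [smul_eq_mul]; field_simp
  have hMint : ∀ x ∈ M, ∀ y ∈ M, ∃ c : ℤ, B x y = c := by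
    intro x hx y hy
    refine Submodule.span_induction₂ (p := fun x y _ _ => ∃ c : ℤ, B x y = c) ?_ ?_ ?_ ?_ ?_ ?_ ?_ hx hy
    · rintro _ _ ⟨s, rfl⟩ ⟨t, rfl⟩; exact hgen s t
    · intro y _; exact ⟨0, by simp⟩
    · intro y _; exact ⟨0, by simp⟩
    · rintro x y z _ _ _ ⟨c, hc⟩ ⟨d, hd⟩; exact ⟨c + d, by simp [hc, hd]⟩
    · rintro x y z _ _ _ ⟨c, hc⟩ ⟨d, hd⟩; exact ⟨c + d, by simp [hc, hd]⟩
    · rintro r x y _ _ ⟨c, hc⟩; exact ⟨r * c, by rw [← Int.cast_smul_eq_zsmul ℚ]; simp [hc]⟩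
    · rintro r x y _ _ ⟨c, hc⟩; exact ⟨r * c, by rw [← Int.cast_smul_eq_zsmul ℚ]; simp [hc]⟩
  have hMeven : ∀ x ∈ M, ∃ c : ℤ, B x x = 2 * c := by
    intro x hx
    have : x ∈ M ∧ ∃ c : ℤ, B x x = 2 * c := by
      refine Submodule.span_induction (p := fun x _ => x ∈ M ∧ ∃ c : ℤ, B x x = 2 * c) ?_ ?_ ?_ ?_ hx
      · rintro _ ⟨s, rfl⟩; exact ⟨Submodule.subset_span ⟨s, rfl⟩, hgen2 s⟩
      · exact ⟨M.zero_mem, 0, by simp⟩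
      · rintro x y _ _ ⟨hx, c, hc⟩ ⟨hy, d, hd⟩
        obtain ⟨g, hg⟩ := hMint x hx y hy
        refine ⟨M.add_mem hx hy, c + d + g, ?_⟩
        simp only [map_add, LinearMap.add_apply, hc, hd, hg, hBsym y x]
        push_cast; ring
      · rintro r x _ ⟨hx, c, hc⟩
        refine ⟨M.smul_mem r hx, r * r * c, ?_⟩
        rw [← Int.cast_smul_eq_zsmul ℚ]
        simp only [map_smul, LinearMap.smul_apply, hc, smul_eq_mul]; push_cast; ring
    exact this.2
  have hspan : Submodule.span ℚ (M : Set (ι → ℚ)) = ⊤ := by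
    rw [eq_top_iff, ← (Pi.basisFun ℚ ι).span_eq]
    refine Submodule.span_mono ?_
    rintro _ ⟨i, rfl⟩
    refine Submodule.subset_span ⟨Sum.inl i, ?_⟩
    ext j
    simp [gen, up, Pi.single_apply]
  obtain ⟨w0, hw0⟩ := basis_lemma (Fintype.card ι) (by simp) M (Submodule.fg_span (Set.finite_range _)) hspan
  let w := w0.reindex (Fintype.equivFin ι).symm
  have hw : Submodule.span ℤ (Set.range w) = M := by rw [Basis.range_reindex, hw0]
  have hwM : ∀ i, w i ∈ M := fun i => by rw [← hw]; exact Submodule.subset_span ⟨i, rfl⟩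
  choose G' hG' using fun i j => hMint (w i) (hwM i) (w j) (hwM j)
  have hcoord : ∀ s, ∃ c : ι → ℤ, gen s = ∑ i, c i • w i := fun s =>
    mem_span_range_int (by rw [hw]; exact Submodule.subset_span ⟨s, rfl⟩)
  choose C hC using hcoord
  let T : Matrix ι ι ℤ := Matrix.of fun s i => C (Sum.inl i) s
  have hTG : Tᵀ * Matrix.of G' * T = G := by
    ext i j
    have h4 : B (gen (Sum.inl i)) (gen (Sum.inl j)) = G i j := by
      simp only [gen, Sum.elim_inl, hBup, hstd]; simp
    rw [hC, hC] at h4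
    simp only [← Int.cast_smul_eq_zsmul ℚ, map_sum, map_smul, LinearMap.sum_apply, LinearMap.smul_apply, hG', smul_eq_mul] at h4
    have h5 : ((Tᵀ * Matrix.of G' * T) i j : ℚ) = G i j := by
      rw [← h4]
      simp only [Matrix.mul_apply, T, Matrix.of_apply, Matrix.transpose_apply]
      push_cast
      refine Finset.sum_congr rfl fun x _ => ?_
      rw [Finset.sum_mul, Finset.mul_sum]
      refine Finset.sum_congr rfl fun y _ => ?_
      ring
    exact_mod_cast h5
  have hTe : ∀ p ∈ P, (p:ℤ) ^ (k p) ∣ T.det := by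
    intro p hp
    haveI : Fact p.Prime := ⟨hP p hp⟩
    have := kernel_lemma p 1 T (e p) (hli p hp) (by
      intro a
      have h6 := hC (Sum.inr ⟨⟨p, hp⟩, a⟩)
      have h7 : up (e p a) = ∑ i, e p a i • gen (Sum.inl i) := by
        ext j
        rw [Finset.sum_apply]
        simp only [gen, up, Sum.elim_inl, ← Int.cast_smul_eq_zsmul ℚ, Pi.smul_apply, Pi.single_apply]
        simp
      have h8 : up (e p a) = ∑ s, (T.mulVec (e p a) s) • w s := by
        rw [h7]
        simp only [hC, Finset.smul_sum, Matrix.mulVec, dotProduct, Finset.sum_smul, T, Matrix.of_apply, smul_smul]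
        rw [Finset.sum_comm]
        simp only [mul_comm]
      have h9 : up (e p a) = ∑ s, ((p:ℤ) * C (Sum.inr ⟨⟨p, hp⟩, a⟩) s) • w s := by
        have : up (e p a) = (p:ℚ) • gen (Sum.inr ⟨⟨p, hp⟩, a⟩) := by
          simp only [gen, Sum.elim_inr, smul_smul]; rw [mul_inv_cancel₀ (hp0 p hp), one_smul]
        rw [this, hC, Finset.smul_sum]
        refine Finset.sum_congr rfl fun s _ => ?_
        rw [← Int.cast_smul_eq_zsmul ℚ, ← Int.cast_smul_eq_zsmul ℚ, smul_smul]; push_cast; rfl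
      intro s
      have h10 := congrArg (fun x => w.repr x s) (h8.symm.trans h9)
      simp only [← Int.cast_smul_eq_zsmul ℚ] at h10
      rw [w.repr_sum_self, w.repr_sum_self] at h10
      rw [pow_one]
      exact ⟨_, by exact_mod_cast h10⟩)
    simpa using this
  have hD : (∏ p ∈ P, (p:ℤ) ^ k p) ∣ T.det := by
    refine Finset.prod_dvd_of_coprime ?_ hTe
    intro p hp q hq hpq
    exact IsCoprime.pow (Nat.isCoprime_iff_coprime.2 ((Nat.coprime_primes (hP p hp) (hP q hq)).2 hpq))
  have hD0 : (∏ p ∈ P, (p:ℤ) ^ k p) ≠ 0 := Finset.prod_ne_zero_iff.2 fun p hp => pow_ne_zero _ (by exact_mod_cast (hP p hp).ne_zero)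
  have hD2 : |G.det| = (∏ p ∈ P, (p:ℤ) ^ k p)^2 := by
    rw [hdet, ← Finset.prod_pow]; simp [← pow_mul, mul_comm]
  obtain ⟨m, hm⟩ := hD
  have hdetG : G.det = T.det ^ 2 * (Matrix.of G').det := by
    rw [← hTG]; simp [Matrix.det_mul]; ring
  have hfin : m ^ 2 * |(Matrix.of G').det| = 1 := by
    have h11 : (∏ p ∈ P, (p:ℤ) ^ k p)^2 * (m ^ 2 * |(Matrix.of G').det|) = (∏ p ∈ P, (p:ℤ) ^ k p)^2 * 1 := by
      rw [mul_one]
      refine Eq.trans ?_ hD2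
      rw [hdetG, hm, abs_mul, abs_pow, sq_abs]; ring
    exact mul_left_cancel₀ (pow_ne_zero 2 hD0) h11
  refine ⟨T, Matrix.of G', ?_, ?_, ?_, ?_, hTG⟩
  · intro h
    rw [hdetG, h] at hD2
    simp at hD2
    exact pow_ne_zero 2 hD0 hD2.symm
  · ext i j
    have h12 : ((G' j i : ℤ) : ℚ) = G' i j := by rw [← hG', ← hG', hBsym]
    exact_mod_cast h12
  · intro i
    obtain ⟨c, hc⟩ := hMeven _ (hwM i)
    rw [hG'] at hc
    exact ⟨c, by exact_mod_cast hc⟩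
  · have := IsUnit.of_mul_eq_one (a := |(Matrix.of G').det|) (m^2) (by rw [mul_comm]; exact hfin)
    rw [Int.isUnit_iff_abs_eq] at this ⊢
    simpa using this
end Eich
end

section
open scoped BigOperators Matrix RealInnerProductSpace
namespace Eich
open Module

def PD {α : Type*} [Fintype α] (P : Matrix α α ℤ) : Prop := (P.map (Int.cast : ℤ → ℝ)).PosDef

lemma pd_factor {α : Type*} [Fintype α] [DecidableEq α] {P : Matrix α α ℤ} (h : PD P) :
    ∃ X : Matrix α α ℝ, Xᵀ * X = P.map (Int.cast : ℤ → ℝ) := by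
  open scoped MatrixOrder Matrix.Norms.L2Operator in
  obtain ⟨X, hX⟩ := CStarAlgebra.nonneg_iff_eq_star_mul_self.mp h.posSemidef.nonneg
  exact ⟨X, by rw [hX, Matrix.star_eq_conjTranspose, Matrix.conjTranspose_eq_transpose_of_trivial]⟩

lemma bilin_cast {α : Type*} [Fintype α] (P : Matrix α α ℤ) (x y : α → ℤ) :
    ((x ⬝ᵥ P.mulVec y : ℤ) : ℝ) = (fun i => (x i : ℝ)) ⬝ᵥ (P.map (Int.cast : ℤ → ℝ)).mulVec (fun i => (y i : ℝ)) := by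
  simp [dotProduct, Matrix.mulVec]

lemma pd_zero {α : Type*} [Fintype α] {P : Matrix α α ℤ} (h : PD P) {x : α → ℤ} (hx : x ⬝ᵥ P.mulVec x = 0) : x = 0 := by
  by_contra hne
  have h0 : (fun i => (x i : ℝ)) ≠ 0 := by
    intro h; apply hne; ext i
    simpa using congrFun h i
  have := h.dotProduct_mulVec_pos h0
  rw [star_trivial, ← bilin_cast, hx] at this
  simp at this

section
variable {α β : Type} [Fintype α] [DecidableEq α] [Fintype β] [DecidableEq β]

lemma eu_bridge (P : Matrix α α ℤ) (Q : Matrix β β ℤ) (hP : PD P) (hQ : PD Q)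
    (T G' : Matrix (α ⊕ β) (α ⊕ β) ℤ) (hT : T.det ≠ 0) (hs : G'.IsSymm) (hev : ∀ i, 2 ∣ G' i i)
    (hu : IsUnit G'.det) (hG : Tᵀ * G' * T = Matrix.fromBlocks P 0 0 (-Q)) :
    ∃ (b : (α ⊕ β → ℤ) →ₗ[ℤ] (α ⊕ β → ℤ) →ₗ[ℤ] ℤ) (f : (α ⊕ β → ℤ) →+ EuclideanSpace ℝ α)
      (g : (α ⊕ β → ℤ) →+ EuclideanSpace ℝ β),
      (∀ x y, b x y = x ⬝ᵥ G'.mulVec y) ∧ (∀ x y, (b x y : ℝ) = ⟪f x, f y⟫ - ⟪g x, g y⟫) ∧ (∀ x, 2 ∣ b x x) ∧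
      (∀ φ : (α ⊕ β → ℤ) →ₗ[ℤ] ℤ, ∃ m, ∀ x, b m x = φ x) := by
  obtain ⟨X, hX⟩ := pd_factor hP
  obtain ⟨Y, hY⟩ := pd_factor hQ
  let b : (α ⊕ β → ℤ) →ₗ[ℤ] (α ⊕ β → ℤ) →ₗ[ℤ] ℤ := Matrix.toBilin' G'
  have hb : ∀ x y, b x y = x ⬝ᵥ G'.mulVec y := fun x y => by simp only [b]; rw [Matrix.toBilin'_apply']
  let TR : Matrix (α ⊕ β) (α ⊕ β) ℝ := T.map (Int.cast : ℤ → ℝ)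
  have hTR : TR.det ≠ 0 := by
    have : TR.det = (T.det : ℝ) := by
      have := (RingHom.map_det (Int.castRingHom ℝ) T).symm
      simpa using this
    rw [this]; exact_mod_cast hT
  let up : (α ⊕ β → ℤ) →+ (α ⊕ β → ℝ) :=
    { toFun := fun x i => (x i : ℝ), map_zero' := by ext; simp, map_add' := by intros; ext; simp }
  let S : (α ⊕ β → ℤ) →+ (α ⊕ β → ℝ) := (Matrix.mulVecLin TR⁻¹).toAddMonoidHom.comp up
  have hS : ∀ x, TR.mulVec (S x) = up x := by
    intro x
    change TR.mulVec (TR⁻¹.mulVec (up x)) = _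
    rw [Matrix.mulVec_mulVec, Matrix.mul_nonsing_inv _ (isUnit_iff_ne_zero.2 hTR), Matrix.one_mulVec]
  let f : (α ⊕ β → ℤ) →+ EuclideanSpace ℝ α :=
    { toFun := fun x => WithLp.toLp 2 (X.mulVec (fun i => S x (Sum.inl i)))
      map_zero' := by ext i; simp [Matrix.mulVec, dotProduct]
      map_add' := by intro x y; ext i; simp [Matrix.mulVec, dotProduct, mul_add, Finset.sum_add_distrib] }
  let g : (α ⊕ β → ℤ) →+ EuclideanSpace ℝ β :=
    { toFun := fun x => WithLp.toLp 2 (Y.mulVec (fun i => S x (Sum.inr i)))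
      map_zero' := by ext i; simp [Matrix.mulVec, dotProduct]
      map_add' := by intro x y; ext i; simp [Matrix.mulVec, dotProduct, mul_add, Finset.sum_add_distrib] }
  have hGR : TRᵀ * (G'.map (Int.cast : ℤ → ℝ)) * TR = Matrix.fromBlocks (Xᵀ * X) 0 0 (-(Yᵀ * Y)) := by
    have := congrArg (fun A => (Int.castRingHom ℝ).mapMatrix A) hG
    simp only [map_mul, RingHom.mapMatrix_apply] at this
    rw [Matrix.fromBlocks_map] at this
    rw [hX, hY]
    convert! this using 2
    · ext; simp
    · ext; simp
    · ext; simp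
  have hip : ∀ (u v : α ⊕ β → ℝ), u ⬝ᵥ (Matrix.fromBlocks (Xᵀ * X) 0 0 (-(Yᵀ * Y))).mulVec v =
      (X.mulVec (fun i => u (Sum.inl i))) ⬝ᵥ (X.mulVec (fun i => v (Sum.inl i))) -
      (Y.mulVec (fun i => u (Sum.inr i))) ⬝ᵥ (Y.mulVec (fun i => v (Sum.inr i))) := by
    intro u v
    rw [Matrix.fromBlocks_mulVec]
    have : ∀ a : α ⊕ β → ℝ, ∀ c d, a ⬝ᵥ (Sum.elim c d) = (fun i => a (Sum.inl i)) ⬝ᵥ c + (fun i => a (Sum.inr i)) ⬝ᵥ d := by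
      intro a c d; simp [dotProduct]
    rw [this, Matrix.zero_mulVec, Matrix.zero_mulVec, add_zero, zero_add, Matrix.neg_mulVec, dotProduct_neg, ← sub_eq_add_neg]
    congr 1
    · rw [← Matrix.mulVec_mulVec, Matrix.dotProduct_mulVec, Matrix.vecMul_transpose]; rfl
    · rw [← Matrix.mulVec_mulVec, Matrix.dotProduct_mulVec, Matrix.vecMul_transpose]; rfl
  refine ⟨b, f, g, hb, ?_, ?_, ?_⟩
  · intro x y
    have h1 : ⟪f x, f y⟫ = (X.mulVec (fun i => S x (Sum.inl i))) ⬝ᵥ (X.mulVec (fun i => S y (Sum.inl i))) := by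
      simp [f, PiLp.inner_apply, dotProduct, mul_comm]
    have h2 : ⟪g x, g y⟫ = (Y.mulVec (fun i => S x (Sum.inr i))) ⬝ᵥ (Y.mulVec (fun i => S y (Sum.inr i))) := by
      simp [g, PiLp.inner_apply, dotProduct, mul_comm]
    rw [h1, h2, ← hip, ← hGR, hb, bilin_cast]
    have h3 : (fun i => (x i : ℝ)) = TR.mulVec (S x) := (hS x).symm
    have h4 : (fun i => (y i : ℝ)) = TR.mulVec (S y) := (hS y).symm
    rw [h3, h4, ← Matrix.mulVec_mulVec, ← Matrix.mulVec_mulVec]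
    conv_rhs => rw [Matrix.dotProduct_mulVec, Matrix.vecMul_transpose]
  · intro x
    rw [hb]
    -- even
    have hz : ∀ i j, G' i j = G' j i := fun i j => hs.apply j i
    have : ((x ⬝ᵥ G'.mulVec x : ℤ) : ZMod 2) = 0 := by
      simp only [dotProduct, Matrix.mulVec, Finset.mul_sum]
      push_cast
      rw [← Finset.sum_product']
      refine Finset.sum_involution (fun ij _ => (ij.2, ij.1)) ?_ ?_ ?_ ?_
      · rintro ⟨i, j⟩ _
        simp only
        rw [hz j i]
        have : (2 : ZMod 2) = 0 := rfl
        linear_combination (((x i : ℤ) : ZMod 2) * ((G' i j : ℤ) : ZMod 2) * ((x j : ℤ) : ZMod 2)) * this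
      · rintro ⟨i, j⟩ _ hne heq
        simp only [Prod.mk.injEq] at heq
        obtain ⟨rfl, _⟩ := heq
        apply hne
        have := (ZMod.intCast_zmod_eq_zero_iff_dvd (G' j j) 2).2 (by exact_mod_cast hev j)
        simp [this]
      · intros; simp
      · intros; rfl
    have := (ZMod.intCast_zmod_eq_zero_iff_dvd _ 2).1 this
    exact_mod_cast this
  · intro φ
    have hu' := hu
    let c : α ⊕ β → ℤ := fun i => φ (Pi.single i 1)
    refine ⟨G'⁻¹.mulVec c, fun x => ?_⟩
    rw [hb, Matrix.dotProduct_mulVec, ← Matrix.mulVec_transpose, hs.eq, Matrix.mulVec_mulVec, Matrix.mul_nonsing_inv _ hu, Matrix.one_mulVec]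
    conv_rhs => rw [← (Pi.basisFun ℤ (α ⊕ β)).sum_repr x]
    simp only [map_sum, map_smul, Pi.basisFun_repr, Pi.basisFun_apply, smul_eq_mul, dotProduct, c]
    exact Finset.sum_congr rfl fun _ _ => mul_comm _ _

/-- glue hypotheses -/
structure GlueData (P : Matrix α α ℤ) (Q : Matrix β β ℤ) where
  Ps : Finset ℕ
  prime : ∀ p ∈ Ps, p.Prime
  k : ℕ → ℕ
  x : (p : ℕ) → Fin (k p) → α → ℤ
  y : (p : ℕ) → Fin (k p) → β → ℤ
  hx : ∀ p ∈ Ps, ∀ i s, (p:ℤ) ∣ P.mulVec (x p i) s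
  hy : ∀ p ∈ Ps, ∀ i s, (p:ℤ) ∣ Q.mulVec (y p i) s
  h2 : ∀ p ∈ Ps, ∀ i j, (p:ℤ)^2 ∣ x p i ⬝ᵥ P.mulVec (x p j) - y p i ⬝ᵥ Q.mulVec (y p j)
  h3 : ∀ p ∈ Ps, ∀ i, 2 * (p:ℤ)^2 ∣ x p i ⬝ᵥ P.mulVec (x p i) - y p i ⬝ᵥ Q.mulVec (y p i)
  hli : ∀ p ∈ Ps, ∀ c : Fin (k p) → ZMod p,
    (∀ s, ∑ i, c i * (x p i s : ZMod p) = 0) → (∀ s, ∑ i, c i * (y p i s : ZMod p) = 0) → c = 0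
  hdet : |P.det * Q.det| = ∏ p ∈ Ps, (p:ℤ)^(2 * k p)

lemma GlueData.glue {P : Matrix α α ℤ} {Q : Matrix β β ℤ} (D : GlueData P Q) (hPs : P.IsSymm) (hQs : Q.IsSymm)
    (hPe : ∀ i, 2 ∣ P i i) (hQe : ∀ i, 2 ∣ Q i i) :
    ∃ T G' : Matrix (α ⊕ β) (α ⊕ β) ℤ, T.det ≠ 0 ∧ G'.IsSymm ∧ (∀ i, 2 ∣ G' i i) ∧ IsUnit G'.det ∧
      Tᵀ * G' * T = Matrix.fromBlocks P 0 0 (-Q) := by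
  have hmv : ∀ (x : α → ℤ) (y : β → ℤ), (Matrix.fromBlocks P 0 0 (-Q)).mulVec (Sum.elim x y) = Sum.elim (P.mulVec x) (-(Q.mulVec y)) := by
    intro x y
    rw [Matrix.fromBlocks_mulVec]
    simp [Matrix.neg_mulVec]
  have hdp : ∀ (x x' : α → ℤ) (y y' : β → ℤ), (Sum.elim x y) ⬝ᵥ (Matrix.fromBlocks P 0 0 (-Q)).mulVec (Sum.elim x' y') = x ⬝ᵥ P.mulVec x' - y ⬝ᵥ Q.mulVec y' := by
    intro x x' y y'
    rw [hmv, sumElim_dotProduct_sumElim, dotProduct_neg, sub_eq_add_neg]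
  refine Eich.glue (Matrix.fromBlocks P 0 0 (-Q)) ?_ ?_ D.Ps D.prime D.k (fun p i => Sum.elim (D.x p i) (D.y p i)) ?_ ?_ ?_ ?_ ?_
  · rw [Matrix.isSymm_fromBlocks_iff]
    exact ⟨hPs, by simp, by simp, by rw [Matrix.IsSymm, Matrix.transpose_neg, hQs.eq]⟩
  · rintro (i | i)
    · simpa using hPe i
    · simpa using hQe i
  · intro p hp i s
    rw [hmv]
    rcases s with s | s
    · exact D.hx p hp i s
    · simpa using D.hy p hp i s
  · intro p hp i j
    rw [hdp]; exact D.h2 p hp i j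
  · intro p hp i
    rw [hdp]; exact D.h3 p hp i
  · intro p hp
    rw [Fintype.linearIndependent_iff]
    intro c hc
    have := D.hli p hp c (fun s => by simpa using congrFun hc (Sum.inl s)) (fun s => by simpa using congrFun hc (Sum.inr s))
    intro i; rw [this]; rfl
  · rw [Matrix.det_fromBlocks_zero₂₁, Matrix.det_neg, ← D.hdet]
    simp [abs_mul]

lemma glue62 {P : Matrix α α ℤ} {Q : Matrix β β ℤ} (D : GlueData P Q) (hPs : P.IsSymm) (hQs : Q.IsSymm)
    (hPe : ∀ i, 2 ∣ P i i) (hQe : ∀ i, 2 ∣ Q i i) (hP : PD P) (hQ : PD Q) (hα : Fintype.card α = 6) (hβ : Fintype.card β = 2) : False := by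
  obtain ⟨T, G', hT, hs, hev, hu, hG⟩ := D.glue hPs hQs hPe hQe
  obtain ⟨b, f, g, -, hb, ev, perf⟩ := eu_bridge P Q hP hQ T G' hT hs hev hu hG
  exact no_eu_62 b f g hb ev perf (by simp [hα]) (by simp [hβ]) (by simp [hα, hβ])

lemma glue44 {P : Matrix α α ℤ} {Q : Matrix β β ℤ} (D : GlueData P Q) (hPs : P.IsSymm) (hQs : Q.IsSymm)
    (hPe : ∀ i, 2 ∣ P i i) (hQe : ∀ i, 2 ∣ Q i i) (hP : PD P) (hQ : PD Q) (hα : Fintype.card α = 4) (hβ : Fintype.card β = 4) :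
    ∃ C : Matrix β α ℚ, Cᵀ * Q.map (Int.cast : ℤ → ℚ) * C = P.map (Int.cast : ℤ → ℚ) := by
  obtain ⟨T, G', hT, hs, hev, hu, hG⟩ := D.glue hPs hQs hPe hQe
  obtain ⟨b, f, g, hbG, hb, ev, perf⟩ := eu_bridge P Q hP hQ T G' hT hs hev hu hG
  obtain ⟨u0, hu0, huu0⟩ := lagrangian 4 le_rfl b f g hb ev perf (by simp [hα]) (by simp [hβ]) (by simp [hα, hβ])
  let σ : α ≃ Fin 4 := Fintype.equivFinOfCardEq hα
  let U : Matrix (α ⊕ β) α ℤ := Matrix.of fun i j => u0 (σ j) i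
  have hU : Uᵀ * G' * U = 0 := by
    ext i j
    have := huu0 (σ i) (σ j)
    rw [hbG] at this
    rw [Matrix.mul_assoc, Matrix.mul_apply]
    simpa [dotProduct, Matrix.mulVec, U, Matrix.mul_apply] using this
  have hUinj : ∀ c : α → ℤ, U.mulVec c = 0 → c = 0 := by
    intro c hc
    have h1 := hu0 (fun i => c (σ.symm i)) (by
      ext s
      have := congrFun hc s
      simp only [Matrix.mulVec, dotProduct, U, Matrix.of_apply] at this
      rw [← Equiv.sum_comp σ]
      simpa [mul_comm] using this)
    ext i
    simpa using congrFun h1 (σ i)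
  let Z : Matrix (α ⊕ β) α ℤ := T.adjugate * U
  have hTZ : T * Z = T.det • U := by
    simp only [Z]; rw [← Matrix.mul_assoc, Matrix.mul_adjugate, Matrix.smul_mul, Matrix.one_mul]
  have hZ : Zᵀ * Matrix.fromBlocks P 0 0 (-Q) * Z = 0 := by
    rw [← hG]
    have : Zᵀ * (Tᵀ * G' * T) * Z = (T * Z)ᵀ * G' * (T * Z) := by
      rw [Matrix.transpose_mul T Z]; simp only [Matrix.mul_assoc]
    rw [this, hTZ]
    simp [hU]
  have hZinj : ∀ c : α → ℤ, Z.mulVec c = 0 → c = 0 := by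
    intro c hc
    apply hUinj
    have := congrArg (T.mulVec) hc
    rw [Matrix.mulVec_mulVec, hTZ, Matrix.mulVec_zero, Matrix.smul_mulVec] at this
    exact (smul_eq_zero.1 this).resolve_left hT
  let X : Matrix α α ℤ := Matrix.of fun i j => Z (Sum.inl i) j
  let Y : Matrix β α ℤ := Matrix.of fun i j => Z (Sum.inr i) j
  have hZXY : Z = Matrix.of (fun i j => Sum.elim (fun i => X i j) (fun i => Y i j) i) := by
    ext i j; rcases i with i | i <;> rfl
  have hXY : Xᵀ * P * X = Yᵀ * Q * Y := by
    ext i j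
    have := congrFun (congrFun hZ i) j
    rw [Matrix.mul_assoc, Matrix.mul_apply, Fintype.sum_sum_type] at this
    simp only [Matrix.mul_apply, Fintype.sum_sum_type, Matrix.fromBlocks_apply₁₁, Matrix.fromBlocks_apply₁₂, Matrix.fromBlocks_apply₂₁, Matrix.fromBlocks_apply₂₂, Matrix.zero_apply, zero_mul, Finset.sum_const_zero, add_zero, zero_add, Matrix.neg_apply, neg_mul, Finset.sum_neg_distrib, mul_neg, Matrix.transpose_apply] at this
    rw [Matrix.mul_assoc, Matrix.mul_assoc, Matrix.mul_apply, Matrix.mul_apply]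
    simp only [Matrix.mul_apply, Matrix.transpose_apply, X, Y, Matrix.of_apply]
    linarith
  have hXdet : X.det ≠ 0 := by
    intro h
    obtain ⟨c, hc0, hc⟩ := Matrix.exists_mulVec_eq_zero_iff.2 h
    apply hc0
    apply hZinj
    have hYc : Y.mulVec c = 0 := by
      apply pd_zero hQ
      have h1 : Y.mulVec c ⬝ᵥ Q.mulVec (Y.mulVec c) = c ⬝ᵥ (Yᵀ * Q * Y).mulVec c := by
        rw [← Matrix.mulVec_mulVec, ← Matrix.mulVec_mulVec]
        conv_rhs => rw [Matrix.dotProduct_mulVec, Matrix.vecMul_transpose]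
      rw [h1, ← hXY, ← Matrix.mulVec_mulVec, hc]; simp
    ext i
    rcases i with i | i
    · exact congrFun hc i
    · exact congrFun hYc i
  let XQ := X.map (Int.cast : ℤ → ℚ)
  let YQ := Y.map (Int.cast : ℤ → ℚ)
  have hXQ : IsUnit XQ.det := by
    have : XQ.det = (X.det : ℚ) := by
      have := (RingHom.map_det (Int.castRingHom ℚ) X).symm
      simpa using this
    rw [this, isUnit_iff_ne_zero]; exact_mod_cast hXdet
  have hXYQ : XQᵀ * P.map (Int.cast : ℤ → ℚ) * XQ = YQᵀ * Q.map (Int.cast : ℤ → ℚ) * YQ := by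
    ext i j
    have := congrFun (congrFun hXY i) j
    simp only [Matrix.mul_apply, Matrix.transpose_apply, XQ, YQ, Matrix.map_apply] at this ⊢
    exact_mod_cast this
  refine ⟨YQ * XQ⁻¹, ?_⟩
  calc (YQ * XQ⁻¹)ᵀ * Q.map (Int.cast : ℤ → ℚ) * (YQ * XQ⁻¹) = XQ⁻¹ᵀ * (YQᵀ * Q.map (Int.cast : ℤ → ℚ) * YQ) * XQ⁻¹ := by
        rw [Matrix.transpose_mul]; simp only [Matrix.mul_assoc]
    _ = (XQ * XQ⁻¹)ᵀ * P.map (Int.cast : ℤ → ℚ) * (XQ * XQ⁻¹) := by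
        rw [← hXYQ, Matrix.transpose_mul]; simp only [Matrix.mul_assoc]
    _ = _ := by rw [Matrix.mul_nonsing_inv _ hXQ]; simp

end
end Eich
end

section
open scoped BigOperators Matrix RealInnerProductSpace
namespace Eich
open Module

lemma aniso_match2 : ∀ (α β γ α' β' γ' : ZMod 2)
    (_ : ∀ x y : ZMod 2, α*x^2+β*x*y+γ*y^2 = 0 → x = 0 ∧ y = 0)
    (_ : ∀ x y : ZMod 2, α'*x^2+β'*x*y+γ'*y^2 = 0 → x = 0 ∧ y = 0),
    ∃ a b c d : ZMod 2, α'*a^2+β'*a*c+γ'*c^2 = α ∧ α'*b^2+β'*b*d+γ'*d^2 = γ ∧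
      2*α'*a*b+β'*(a*d+b*c)+2*γ'*c*d = β := by decide

lemma aniso_match (p : ℕ) [hp : Fact p.Prime] (α β γ α' β' γ' : ZMod p)
    (h : ∀ x y : ZMod p, α*x^2+β*x*y+γ*y^2 = 0 → x = 0 ∧ y = 0)
    (h' : ∀ x y : ZMod p, α'*x^2+β'*x*y+γ'*y^2 = 0 → x = 0 ∧ y = 0) :
    ∃ a b c d : ZMod p, α'*a^2+β'*a*c+γ'*c^2 = α ∧ α'*b^2+β'*b*d+γ'*d^2 = γ ∧
      2*α'*a*b+β'*(a*d+b*c)+2*γ'*c*d = β := by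
  by_cases h2 : p = 2
  · subst h2
    exact aniso_match2 α β γ α' β' γ' h h'
  have hp2 : (2 : ZMod p) ≠ 0 := by
    intro h0
    have := (ZMod.natCast_eq_zero_iff 2 p).1 (by exact_mod_cast h0)
    exact h2 ((Nat.prime_dvd_prime_iff_eq hp.out Nat.prime_two).1 this)
  have hchar : ringChar (ZMod p) ≠ 2 := by rw [ZMod.ringChar_zmod_n]; exact h2
  have h0 : α ≠ 0 := by
    rintro rfl; exact one_ne_zero (h 1 0 (by simp)).1
  have h0' : α' ≠ 0 := by
    rintro rfl; exact one_ne_zero (h' 1 0 (by simp)).1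
  have key : ∀ α β γ : ZMod p, α ≠ 0 → (∀ x y : ZMod p, α*x^2+β*x*y+γ*y^2 = 0 → x = 0 ∧ y = 0) →
      ¬ IsSquare (β^2-4*α*γ) := by
    rintro α β γ hα h ⟨r, hr⟩
    have := (h ((r-β)/(2*α)) 1 (by field_simp; linear_combination -hr)).2
    exact one_ne_zero this
  have hD := key α β γ h0 h
  have hD' := key α' β' γ' h0' h'
  obtain ⟨s, hs⟩ : ∃ s, β^2-4*α*γ = s^2 * (β'^2-4*α'*γ') := by
    have hne : β^2-4*α*γ ≠ 0 := fun h => hD (by rw [h]; exact ⟨0, by simp⟩)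
    have hne' : β'^2-4*α'*γ' ≠ 0 := fun h => hD' (by rw [h]; exact ⟨0, by simp⟩)
    have h1 := (quadraticChar_neg_one_iff_not_isSquare (F := ZMod p)).2 hD
    have h2 := (quadraticChar_neg_one_iff_not_isSquare (F := ZMod p)).2 hD'
    have h3 : quadraticChar (ZMod p) ((β^2-4*α*γ) * (β'^2-4*α'*γ')) = 1 := by rw [map_mul, h1, h2]; rfl
    obtain ⟨r, hr⟩ := (quadraticChar_one_iff_isSquare (mul_ne_zero hne hne')).1 h3
    refine ⟨r / (β'^2-4*α'*γ'), ?_⟩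
    field_simp
    linear_combination hr
  -- universality
  obtain ⟨a, c, hac⟩ : ∃ a c, α'*a^2+β'*a*c+γ'*c^2 = α := by
    have hne' : β'^2-4*α'*γ' ≠ 0 := fun h => hD' (by rw [h]; exact ⟨0, by simp⟩)
    obtain ⟨X, Y, hXY⟩ := FiniteField.exists_root_sum_quadratic (R := ZMod p)
      (f := Polynomial.X^2) (g := Polynomial.C (-(β'^2-4*α'*γ')) * Polynomial.X^2 + Polynomial.C 0 * Polynomial.X + Polynomial.C (-(4*α'*α)))
      (by simp) (Polynomial.degree_quadratic (neg_ne_zero.2 hne')) (by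
        rw [ZMod.card]; exact Nat.odd_iff.1 (hp.out.odd_of_ne_two h2))
    simp at hXY
    refine ⟨(X - β' * Y)/(2*α'), Y, ?_⟩
    field_simp
    linear_combination hXY
  -- complement
  obtain ⟨u, v, huv⟩ : ∃ u v, a * v - c * u = 1 := by
    by_cases ha : a = 0
    · have hc : c ≠ 0 := by rintro rfl; apply h0; rw [← hac, ha]; simp
      exact ⟨-c⁻¹, 0, by field_simp; ring⟩
    · exact ⟨0, a⁻¹, by field_simp; ring⟩
  set β'' := 2*α'*a*u+β'*(a*v+u*c)+2*γ'*c*v with hβ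
  set γ'' := α'*u^2+β'*u*v+γ'*v^2 with hγ
  have hdisc : β''^2 - 4*α*γ'' = β'^2-4*α'*γ' := by
    rw [hβ, hγ, ← hac]
    linear_combination (β'^2-4*α'*γ') * (a*v-c*u+1) * huv
  set k := (β - β''*s)/(2*α) with hk
  have hk' : 2*α*k = β - β''*s := by rw [hk]; field_simp
  have e1 : 2*α*k+s*β'' = β := by rw [hk']; ring
  refine ⟨a, k*a+s*u, c, k*c+s*v, hac, ?_, ?_⟩
  · have e2 : 4*α*(α*k^2+β''*k*s+γ''*s^2) = 4*α*γ := by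
      linear_combination (2*α*k+s*β''+β) * e1 - s^2*hdisc + hs
    have e3 := mul_left_cancel₀ (mul_ne_zero (by rw [show (4:ZMod p) = 2*2 by norm_num]; exact mul_ne_zero hp2 hp2) h0) e2
    rw [← e3, hγ, hβ]
    linear_combination k^2 * hac
  · rw [← e1, hβ]
    linear_combination 2*k*hac

section
variable {α β : Type} [Fintype α] [DecidableEq α] [Fintype β] [DecidableEq β]

def IsoAt (p : ℕ) (P : Matrix α α ℤ) : Prop :=
  ∃ e : α → ℤ, (∃ s, ¬ (p:ℤ) ∣ e s) ∧ (∀ s, (p:ℤ) ∣ P.mulVec e s) ∧ 2 * (p:ℤ)^2 ∣ e ⬝ᵥ P.mulVec e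

def AnisoBy (p : ℕ) (P : Matrix α α ℤ) (e : Fin 2 → α → ℤ) : Prop :=
  (∀ i s, (p:ℤ) ∣ P.mulVec (e i) s) ∧ (∀ i, 2 * (p:ℤ) ∣ e i ⬝ᵥ P.mulVec (e i)) ∧
  ∀ x y : ℤ, 2 * (p:ℤ)^2 ∣ (x • e 0 + y • e 1) ⬝ᵥ P.mulVec (x • e 0 + y • e 1) → (p:ℤ) ∣ x ∧ (p:ℤ) ∣ y

lemma quad_expand (P : Matrix α α ℤ) (hP : P.IsSymm) (x y x' y' : ℤ) (e f : α → ℤ) :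
    (x • e + y • f) ⬝ᵥ P.mulVec (x' • e + y' • f) =
      x*x' * (e ⬝ᵥ P.mulVec e) + (x * y' + y * x') * (e ⬝ᵥ P.mulVec f) + y*y' * (f ⬝ᵥ P.mulVec f) := by
  have : f ⬝ᵥ P.mulVec e = e ⬝ᵥ P.mulVec f := by
    rw [Matrix.dotProduct_mulVec, ← Matrix.mulVec_transpose, hP.eq, dotProduct_comm]
  simp only [Matrix.mulVec_add, Matrix.mulVec_smul, add_dotProduct, dotProduct_add, smul_dotProduct, dotProduct_smul, smul_eq_mul, this]
  ring

lemma dvd_dot (p : ℤ) (e f : α → ℤ) (h : ∀ s, p ∣ f s) : p ∣ e ⬝ᵥ f :=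
  Finset.dvd_sum fun i _ => Dvd.dvd.mul_left (h i) _

lemma aniso_glue (p : ℕ) [hp : Fact p.Prime] {P : Matrix α α ℤ} {Q : Matrix β β ℤ} (hP : P.IsSymm) (hQ : Q.IsSymm)
    {e : Fin 2 → α → ℤ} {f : Fin 2 → β → ℤ} (he : AnisoBy p P e) (hf : AnisoBy p Q f) :
    ∃ y : Fin 2 → β → ℤ, (∀ i s, (p:ℤ) ∣ Q.mulVec (y i) s) ∧
      (∀ i j, (p:ℤ)^2 ∣ e i ⬝ᵥ P.mulVec (e j) - y i ⬝ᵥ Q.mulVec (y j)) ∧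
      (∀ i, 2 * (p:ℤ)^2 ∣ e i ⬝ᵥ P.mulVec (e i) - y i ⬝ᵥ Q.mulVec (y i)) := by
  have hp0 : (p:ℤ) ≠ 0 := by exact_mod_cast hp.out.ne_zero
  have hc : ∀ x : ℤ, (x : ZMod p) = 0 ↔ (p:ℤ) ∣ x := fun x => ZMod.intCast_zmod_eq_zero_iff_dvd x p
  obtain ⟨he1, he2, he3⟩ := he
  obtain ⟨hf1, hf2, hf3⟩ := hf
  obtain ⟨A, hA⟩ := he2 0
  obtain ⟨C, hC⟩ := he2 1
  obtain ⟨B, hB⟩ := dvd_dot (p:ℤ) (e 0) _ (he1 1)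
  obtain ⟨A', hA'⟩ := hf2 0
  obtain ⟨C', hC'⟩ := hf2 1
  obtain ⟨B', hB'⟩ := dvd_dot (p:ℤ) (f 0) _ (hf1 1)
  have lift : ∀ a : ZMod p, ∃ x : ℤ, (x : ZMod p) = a := fun a => ZMod.intCast_surjective a
  obtain ⟨a, b, c, d, h1, h2, h3⟩ := aniso_match p (A : ZMod p) B C A' B' C' (by
      intro x y h
      obtain ⟨x, rfl⟩ := lift x
      obtain ⟨y, rfl⟩ := lift y
      rw [hc, hc]
      apply he3
      rw [quad_expand P hP, hA, hB, hC]
      have : (p:ℤ) ∣ A*x^2+B*x*y+C*y^2 := (hc _).1 (by push_cast; exact h)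
      obtain ⟨k, hk⟩ := this
      exact ⟨k, by linear_combination 2 * p * hk⟩) (by
      intro x y h
      obtain ⟨x, rfl⟩ := lift x
      obtain ⟨y, rfl⟩ := lift y
      rw [hc, hc]
      apply hf3
      rw [quad_expand Q hQ, hA', hB', hC']
      have : (p:ℤ) ∣ A'*x^2+B'*x*y+C'*y^2 := (hc _).1 (by push_cast; exact h)
      obtain ⟨k, hk⟩ := this
      exact ⟨k, by linear_combination 2 * p * hk⟩)
  obtain ⟨a, rfl⟩ := lift a
  obtain ⟨b, rfl⟩ := lift b
  obtain ⟨c, rfl⟩ := lift c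
  obtain ⟨d, rfl⟩ := lift d
  obtain ⟨k1, hk1⟩ : (p:ℤ) ∣ A'*a^2+B'*a*c+C'*c^2 - A := (hc _).1 (by push_cast; rw [h1]; ring)
  obtain ⟨k2, hk2⟩ : (p:ℤ) ∣ A'*b^2+B'*b*d+C'*d^2 - C := (hc _).1 (by push_cast; rw [h2]; ring)
  obtain ⟨k3, hk3⟩ : (p:ℤ) ∣ 2*A'*a*b+B'*(a*d+b*c)+2*C'*c*d - B := (hc _).1 (by push_cast; rw [h3]; ring)
  have d0 : 2 * (p:ℤ)^2 ∣ e 0 ⬝ᵥ P.mulVec (e 0) - (a • f 0 + c • f 1) ⬝ᵥ Q.mulVec (a • f 0 + c • f 1) := by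
    rw [quad_expand Q hQ, hA', hB', hC', hA]
    exact ⟨-k1, by linear_combination -2 * p * hk1⟩
  have d1 : 2 * (p:ℤ)^2 ∣ e 1 ⬝ᵥ P.mulVec (e 1) - (b • f 0 + d • f 1) ⬝ᵥ Q.mulVec (b • f 0 + d • f 1) := by
    rw [quad_expand Q hQ, hA', hB', hC', hC]
    exact ⟨-k2, by linear_combination -2 * p * hk2⟩
  have d01 : (p:ℤ)^2 ∣ e 0 ⬝ᵥ P.mulVec (e 1) - (a • f 0 + c • f 1) ⬝ᵥ Q.mulVec (b • f 0 + d • f 1) := by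
    rw [quad_expand Q hQ, hA', hB', hC', hB]
    exact ⟨-k3, by linear_combination -p * hk3⟩
  have sy : ∀ {γ : Type} [Fintype γ] (G : Matrix γ γ ℤ), G.IsSymm → ∀ u v, u ⬝ᵥ G.mulVec v = v ⬝ᵥ G.mulVec u := by
    intro γ _ G hG u v
    rw [Matrix.dotProduct_mulVec, ← Matrix.mulVec_transpose, hG.eq, dotProduct_comm]
  refine ⟨![a • f 0 + c • f 1, b • f 0 + d • f 1], ?_, ?_, ?_⟩
  · intro i s
    have : ∀ a c : ℤ, (p:ℤ) ∣ Q.mulVec (a • f 0 + c • f 1) s := by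
      intro a c
      rw [Matrix.mulVec_add, Matrix.mulVec_smul, Matrix.mulVec_smul]
      exact dvd_add ((hf1 0 s).mul_left _) ((hf1 1 s).mul_left _)
    fin_cases i
    · exact this a c
    · exact this b d
  · intro i j
    fin_cases i <;> fin_cases j
    · exact (Dvd.intro_left _ rfl).trans d0
    · exact d01
    · have := d01
      rw [sy P hP, sy Q hQ] at this
      exact this
    · exact (Dvd.intro_left _ rfl).trans d1
  · intro i
    fin_cases i
    · exact d0
    · exact d1

lemma even_quad {ι : Type*} [Fintype ι] (G' : Matrix ι ι ℤ) (hs : G'.IsSymm) (hev : ∀ i, 2 ∣ G' i i) (x : ι → ℤ) :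
    2 ∣ x ⬝ᵥ G'.mulVec x := by
  have hz : ∀ i j, G' i j = G' j i := fun i j => hs.apply j i
  have : ((x ⬝ᵥ G'.mulVec x : ℤ) : ZMod 2) = 0 := by
    simp only [dotProduct, Matrix.mulVec, Finset.mul_sum]
    push_cast
    rw [← Finset.sum_product']
    refine Finset.sum_involution (fun ij _ => (ij.2, ij.1)) ?_ ?_ ?_ ?_
    · rintro ⟨i, j⟩ _
      simp only
      rw [hz j i]
      have : (2 : ZMod 2) = 0 := rfl
      linear_combination (((x i : ℤ) : ZMod 2) * ((G' i j : ℤ) : ZMod 2) * ((x j : ℤ) : ZMod 2)) * this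
    · rintro ⟨i, j⟩ _ hne heq
      simp only [Prod.mk.injEq] at heq
      obtain ⟨rfl, _⟩ := heq
      apply hne
      have := (ZMod.intCast_zmod_eq_zero_iff_dvd (G' j j) 2).2 (by exact_mod_cast hev j)
      simp [this]
    · intros; simp
    · intros; rfl
  have := (ZMod.intCast_zmod_eq_zero_iff_dvd _ 2).1 this
  exact_mod_cast this

/-- reduction at p | N of a lattice with level N -/
lemma good_kernel (N : ℕ) (hN : Squarefree N) {B Bs : Matrix (Fin 4) (Fin 4) ℤ} (hB : B.IsSymm)
    (hBBs : B * Bs = (N:ℤ) • 1) (hdet : B.det = (N:ℤ)^2) (hBs : Bs.IsSymm) (hev : ∀ i, 2 ∣ Bs i i)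
    (p : ℕ) (hp : p.Prime) (hpN : p ∣ N) (hiso : ¬ IsoAt p B) : ∃ e, AnisoBy p B e := by
  haveI : Fact p.Prime := ⟨hp⟩
  have hc : ∀ x : ℤ, (x : ZMod p) = 0 ↔ (p:ℤ) ∣ x := fun x => ZMod.intCast_zmod_eq_zero_iff_dvd x p
  have lift : ∀ a : ZMod p, ∃ x : ℤ, (x : ZMod p) = a := fun a => ZMod.intCast_surjective a
  have hN0 : (N:ℤ) ≠ 0 := by exact_mod_cast hN.ne_zero
  have hdets : Bs.det = (N:ℤ)^2 := by
    have := congrArg Matrix.det hBBs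
    rw [Matrix.det_mul, hdet, Matrix.det_smul, Matrix.det_one] at this
    simp at this
    have h2 : (N:ℤ)^2 ≠ 0 := pow_ne_zero _ hN0
    exact mul_left_cancel₀ h2 (by rw [this]; ring)
  let Bp : Matrix (Fin 4) (Fin 4) (ZMod p) := Bs.map (Int.cast : ℤ → ZMod p)
  let φ := Matrix.mulVecLin Bp
  have hmv : ∀ x : Fin 4 → ℤ, ∀ s, ((Bs.mulVec x s : ℤ) : ZMod p) = Bp.mulVec (fun i => (x i : ZMod p)) s := by
    intro x s; simp [Matrix.mulVec, dotProduct, Bp]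
  have hrank : 2 ≤ finrank (ZMod p) (LinearMap.range φ) := by
    by_contra hlt
    have h1 := LinearMap.finrank_range_add_finrank_ker φ
    rw [Module.finrank_fin_fun] at h1
    have h3 : 3 ≤ finrank (ZMod p) (LinearMap.ker φ) := by omega
    obtain ⟨g, hg⟩ := exists_linearIndependent_of_le_finrank h3
    have hg' : LinearIndependent (ZMod p) (fun i => ((g i : LinearMap.ker φ) : Fin 4 → ZMod p)) :=
      hg.map' (LinearMap.ker φ).subtype (Submodule.ker_subtype _)
    choose k hk using fun (i : Fin 3) (s : Fin 4) => lift ((g i : Fin 4 → ZMod p) s)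
    have := kernel_lemma p 1 Bs k (by convert hg' using 1; ext i s; exact hk i s) (by
      intro i s
      rw [pow_one, ← hc, hmv]
      have h5 := (g i).2
      rw [LinearMap.mem_ker] at h5
      have : (fun s => ((k i s : ℤ) : ZMod p)) = (g i : Fin 4 → ZMod p) := by ext s; exact hk i s
      rw [this]
      exact congrFun h5 s)
    rw [hdets, Fintype.card_fin] at this
    have h7 : p^3 ∣ N^2 := by exact_mod_cast this
    obtain ⟨m, rfl⟩ := hpN
    have h8 : p ∣ m^2 := by
      have : p^2 * p ∣ p^2 * m^2 := by convert h7 using 1 <;> ring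
      exact Nat.dvd_of_mul_dvd_mul_left (by have := hp.pos; positivity) this
    have h9 := hp.dvd_of_dvd_pow h8
    exact hp.one_lt.ne' (Nat.isUnit_iff.1 (hN p (mul_dvd_mul_left p h9)))
  obtain ⟨g, hg⟩ := exists_linearIndependent_of_le_finrank hrank
  have hg' : LinearIndependent (ZMod p) (fun i => ((g i : LinearMap.range φ) : Fin 4 → ZMod p)) :=
      hg.map' (LinearMap.range φ).subtype (Submodule.ker_subtype _)
  choose w hw using fun i => (g i).2
  choose k hk using fun (i : Fin 2) (s : Fin 4) => lift (w i s)
  have hBe : ∀ i, B.mulVec (Bs.mulVec (k i)) = (N:ℤ) • k i := by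
    intro i; rw [Matrix.mulVec_mulVec, hBBs, Matrix.smul_mulVec, Matrix.one_mulVec]
  have hq : ∀ i, 2 * (p:ℤ) ∣ Bs.mulVec (k i) ⬝ᵥ B.mulVec (Bs.mulVec (k i)) := by
    intro i
    rw [hBe, dotProduct_smul, smul_eq_mul, mul_comm 2 (p:ℤ)]
    refine mul_dvd_mul (by exact_mod_cast hpN) ?_
    rw [dotProduct_comm]
    exact even_quad Bs hBs hev _
  refine ⟨fun i => Bs.mulVec (k i), ?_, hq, ?_⟩
  · intro i s
    rw [hBe]
    exact Dvd.dvd.mul_right (by exact_mod_cast hpN) _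
  · intro x y hxy
    by_contra hcon
    apply hiso
    refine ⟨_, ?_, ?_, hxy⟩
    · by_contra hall
      push Not at hall
      apply hcon
      have := Fintype.linearIndependent_iff.1 hg' ![(x : ZMod p), y] (by
        ext s
        have h1 := (hc _).2 (hall s)
        have h2 : ∀ i, (g i : Fin 4 → ZMod p) s = ((Bs.mulVec (k i) s : ℤ) : ZMod p) := by
          intro i
          rw [hmv, ← hw i]
          have : (fun s => ((k i s : ℤ) : ZMod p)) = w i := by ext s; exact hk i s
          rw [this]; rfl
        simp only [Fin.sum_univ_two, Pi.add_apply, Pi.smul_apply, h2]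
        simpa using h1)
      exact ⟨(hc x).1 (this 0), (hc y).1 (this 1)⟩
    · intro s
      rw [Matrix.mulVec_add, Matrix.mulVec_smul, Matrix.mulVec_smul, hBe, hBe]
      have : (p:ℤ) ∣ N := by exact_mod_cast hpN
      exact dvd_add ((this.mul_right _).mul_left _) ((this.mul_right _).mul_left _)
end
end Eich
end

section
open scoped BigOperators Matrix RealInnerProductSpace
namespace Eich
open Module

section
variable {α β : Type} [Fintype α] [DecidableEq α] [Fintype β] [DecidableEq β]

def LocGlue (p : ℕ) (P : Matrix α α ℤ) (Q : Matrix β β ℤ) (k : ℕ) : Prop :=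
  ∃ (x : Fin k → α → ℤ) (y : Fin k → β → ℤ), (∀ i s, (p:ℤ) ∣ P.mulVec (x i) s) ∧
  (∀ i s, (p:ℤ) ∣ Q.mulVec (y i) s) ∧
  (∀ i j, (p:ℤ)^2 ∣ x i ⬝ᵥ P.mulVec (x j) - y i ⬝ᵥ Q.mulVec (y j)) ∧
  (∀ i, 2 * (p:ℤ)^2 ∣ x i ⬝ᵥ P.mulVec (x i) - y i ⬝ᵥ Q.mulVec (y i)) ∧
  (∀ c : Fin k → ZMod p,
    (∀ s, ∑ i, c i * (x i s : ZMod p) = 0) → (∀ s, ∑ i, c i * (y i s : ZMod p) = 0) → c = 0)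

lemma mkGlue (P : Matrix α α ℤ) (Q : Matrix β β ℤ) (Ps : Finset ℕ) (prime : ∀ p ∈ Ps, p.Prime) (K : ℕ → ℕ)
    (h : ∀ p ∈ Ps, LocGlue p P Q (K p)) (hdet : |P.det * Q.det| = ∏ p ∈ Ps, (p:ℤ)^(2 * K p)) :
    Nonempty (GlueData P Q) := by
  choose x y h1 h2 h3 h4 h5 using h
  refine ⟨⟨Ps, prime, K, fun p => if h : p ∈ Ps then x p h else 0, fun p => if h : p ∈ Ps then y p h else 0, ?_, ?_, ?_, ?_, ?_, hdet⟩⟩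
  all_goals intro p hp; simp only [hp, dif_pos]
  · exact h1 p hp
  · exact h2 p hp
  · exact h3 p hp
  · exact h4 p hp
  · exact h5 p hp

lemma locGlue_left (p : ℕ) [hp : Fact p.Prime] {P : Matrix α α ℤ} (Q : Matrix β β ℤ) (h : IsoAt p P) : LocGlue p P Q 1 := by
  obtain ⟨e, ⟨s, hs⟩, h1, h2⟩ := h
  refine ⟨fun _ => e, fun _ => 0, fun _ => h1, by simp, ?_, ?_, ?_⟩
  · intro i j; simpa using (Dvd.intro_left _ rfl).trans h2
  · intro i; simpa using h2
  · intro c hc _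
    have := hc s
    simp only [Fin.sum_univ_one, mul_eq_zero, ZMod.intCast_zmod_eq_zero_iff_dvd, hs, or_false] at this
    ext i; fin_cases i; exact this

lemma locGlue_both (p : ℕ) [hp : Fact p.Prime] {P : Matrix α α ℤ} {Q : Matrix β β ℤ} (h : IsoAt p P) (h' : IsoAt p Q) : LocGlue p P Q 2 := by
  obtain ⟨e, ⟨s, hs⟩, h1, h2⟩ := h
  obtain ⟨f, ⟨t, ht⟩, h1', h2'⟩ := h'
  have d2 : (p:ℤ)^2 ∣ e ⬝ᵥ P.mulVec e := (Dvd.intro_left _ rfl).trans h2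
  have d2' : (p:ℤ)^2 ∣ f ⬝ᵥ Q.mulVec f := (Dvd.intro_left _ rfl).trans h2'
  refine ⟨![e, 0], ![0, f], ?_, ?_, ?_, ?_, ?_⟩
  · intro i; fin_cases i
    · exact h1
    · simp
  · intro i; fin_cases i
    · simp
    · exact h1'
  · intro i j; fin_cases i <;> fin_cases j <;> simp [d2, d2']
  · intro i; fin_cases i <;> simp [h2, h2']
  · intro c hc hc'
    have a := hc s
    have b := hc' t
    simp only [Fin.sum_univ_two, mul_eq_zero, ZMod.intCast_zmod_eq_zero_iff_dvd, hs, or_false, Matrix.cons_val_zero, Matrix.cons_val_one, Pi.zero_apply, Int.cast_zero, mul_zero, add_zero] at a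
    simp only [Fin.sum_univ_two, mul_eq_zero, ZMod.intCast_zmod_eq_zero_iff_dvd, ht, or_false, Matrix.cons_val_zero, Matrix.cons_val_one, Pi.zero_apply, Int.cast_zero, mul_zero, zero_add] at b
    ext i; fin_cases i
    · exact a
    · exact b

lemma aniso_li (p : ℕ) [hp : Fact p.Prime] {P : Matrix α α ℤ} (hP : P.IsSymm) (hPe : ∀ i, 2 ∣ P i i) {e : Fin 2 → α → ℤ} (he : AnisoBy p P e)
    (c : Fin 2 → ZMod p) (h : ∀ s, ∑ i, c i * (e i s : ZMod p) = 0) : c = 0 := by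
  obtain ⟨x, hx⟩ := ZMod.intCast_surjective (c 0)
  obtain ⟨y, hy⟩ := ZMod.intCast_surjective (c 1)
  have : ∀ s, (p:ℤ) ∣ (x • e 0 + y • e 1) s := by
    intro s
    rw [← ZMod.intCast_zmod_eq_zero_iff_dvd]
    have := h s
    rw [Fin.sum_univ_two, ← hx, ← hy] at this
    simpa using this
  choose f hf using this
  have hf' : x • e 0 + y • e 1 = (p:ℤ) • f := by ext s; exact hf s
  have h2 := he.2.2 x y (by
    rw [hf', Matrix.mulVec_smul, dotProduct_smul, smul_dotProduct]
    obtain ⟨k, hk⟩ := even_quad P hP hPe f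
    exact ⟨k, by rw [hk]; simp only [smul_eq_mul]; ring⟩)
  ext i; fin_cases i
  · change c 0 = 0; rw [← hx, ZMod.intCast_zmod_eq_zero_iff_dvd]; exact h2.1
  · change c 1 = 0; rw [← hy, ZMod.intCast_zmod_eq_zero_iff_dvd]; exact h2.2

lemma locGlue_aniso (p : ℕ) [hp : Fact p.Prime] {P : Matrix α α ℤ} {Q : Matrix β β ℤ} (hP : P.IsSymm) (hPe : ∀ i, 2 ∣ P i i) (hQ : Q.IsSymm)
    {e : Fin 2 → α → ℤ} {f : Fin 2 → β → ℤ} (he : AnisoBy p P e) (hf : AnisoBy p Q f) : LocGlue p P Q 2 := by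
  obtain ⟨y, h1, h2, h3⟩ := aniso_glue p hP hQ he hf
  exact ⟨e, y, he.1, h1, h2, h3, fun c hc _ => aniso_li p hP hPe he c hc⟩
end

/-- good lattices -/
structure Good (N : ℕ) (B : Matrix (Fin 4) (Fin 4) ℤ) : Prop where
  symm : B.IsSymm
  even : ∀ i, 2 ∣ B i i
  pd : PD B
  det : B.det = (N:ℤ)^2
  dual : ∃ Bs : Matrix (Fin 4) (Fin 4) ℤ, B * Bs = (N:ℤ) • 1 ∧ Bs.IsSymm ∧ ∀ i, 2 ∣ Bs i i

lemma Good.aniso {N : ℕ} (hN : Squarefree N) {B : Matrix (Fin 4) (Fin 4) ℤ} (h : Good N B) {p : ℕ} (hp : p.Prime) (hpN : p ∣ N) (hi : ¬ IsoAt p B) :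
    ∃ e, AnisoBy p B e := by
  obtain ⟨Bs, h1, h2, h3⟩ := h.dual
  exact good_kernel N hN h.symm h1 h.det h2 h3 p hp hpN hi

lemma iso44 {N : ℕ} (hN : Squarefree N) {A B : Matrix (Fin 4) (Fin 4) ℤ} (hA : Good N A) (hB : Good N B)
    (h : ∀ p, p.Prime → p ∣ N → (IsoAt p A ↔ IsoAt p B)) :
    ∃ C : Matrix (Fin 4) (Fin 4) ℚ, Cᵀ * A.map (Int.cast : ℤ → ℚ) * C = B.map (Int.cast : ℤ → ℚ) := by
  obtain ⟨D⟩ := mkGlue B A N.primeFactors (fun p hp => Nat.prime_of_mem_primeFactors hp) (fun _ => 2) (by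
    intro p hp
    obtain ⟨hpp, hpN, _⟩ := Nat.mem_primeFactors.1 hp
    haveI : Fact p.Prime := ⟨hpp⟩
    by_cases hi : IsoAt p B
    · exact locGlue_both p hi ((h p hpp hpN).2 hi)
    · obtain ⟨e, he⟩ := hB.aniso hN hpp hpN hi
      obtain ⟨f, hf⟩ := hA.aniso hN hpp hpN (fun hh => hi ((h p hpp hpN).1 hh))
      exact locGlue_aniso p hB.symm hB.even hA.symm he hf) (by
    rw [hA.det, hB.det, Finset.prod_pow]
    have : ∏ p ∈ N.primeFactors, (p:ℤ) = N := by rw [← Nat.cast_prod, Nat.prod_primeFactors_of_squarefree hN]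
    rw [this, abs_of_nonneg (by positivity)]; ring)
  exact glue44 D hB.symm hA.symm hB.even hA.even hB.pd hA.pd (by simp) (by simp)

lemma exists_ell (T : Finset ℕ) (hT : ∀ p ∈ T, p.Prime) (N : ℕ) (hev : Even T.card) :
    ∃ ℓ : ℕ, ℓ.Prime ∧ N < ℓ ∧ ℓ % 8 = 3 ∧ (∀ p ∈ T, p ≠ 2 → ¬ IsSquare (-(ℓ : ZMod p))) ∧
      ∃ t : ℤ, (ℓ:ℤ) ∣ (∏ p ∈ T, (p:ℤ)) * t^2 - 1 := by
  -- nonresidues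
  have hδ : ∀ p : ℕ, ∃ d : ℕ, p ∈ T → p ≠ 2 → ¬ IsSquare (-(d : ZMod p)) ∧ ¬ p ∣ d := by
    intro p
    by_cases hpT : p ∈ T ∧ p ≠ 2
    · have hp := hT p hpT.1
      haveI : Fact p.Prime := ⟨hp⟩
      obtain ⟨a, ha⟩ := FiniteField.exists_nonsquare (F := ZMod p) (by rw [ZMod.ringChar_zmod_n]; exact hpT.2)
      refine ⟨(-a).val, fun _ _ => ⟨by simpa using ha, fun hd => ha ?_⟩⟩
      have h0 : ((-a).val : ZMod p) = 0 := (ZMod.natCast_eq_zero_iff _ _).2 hd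
      rw [ZMod.natCast_val, ZMod.cast_id', id, neg_eq_zero] at h0
      rw [h0]; exact ⟨0, by simp⟩
    · exact ⟨0, fun h1 h2 => (hpT ⟨h1, h2⟩).elim⟩
  choose d hd using hδ
  let T' := T.erase 2
  have hT' : ∀ p ∈ T', p ∈ T ∧ p ≠ 2 := fun p hp => ⟨Finset.mem_of_mem_erase hp, Finset.ne_of_mem_erase hp⟩
  obtain ⟨c, hc⟩ := Nat.chineseRemainderOfFinset d id T' (fun p hp => (hT p (hT' p hp).1).ne_zero) (by
    intro p hp q hq hpq
    exact (Nat.coprime_primes (hT p (hT' p hp).1) (hT q (hT' q hq).1)).2 hpq)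
  have hcop8 : Nat.Coprime (∏ p ∈ T', p) 8 := by
    refine Nat.Coprime.prod_left fun p hp => ?_
    rw [show 8 = 2^3 by norm_num]
    exact Nat.Coprime.pow_right _ ((Nat.coprime_primes (hT p (hT' p hp).1) Nat.prime_two).2 (hT' p hp).2)
  obtain ⟨c', hc1, hc2⟩ := Nat.chineseRemainder hcop8 c 3
  set M := (∏ p ∈ T', p) * 8
  have hMc : Nat.Coprime c' M := by
    apply Nat.Coprime.mul_right
    · refine Nat.Coprime.prod_right fun p hp => ?_
      rw [Nat.coprime_comm, (hT p (hT' p hp).1).coprime_iff_not_dvd]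
      intro hdv
      have h1 : c' ≡ c [MOD p] := hc1.of_dvd (Finset.dvd_prod_of_mem _ hp)
      have h2 := h1.trans (hc p hp)
      exact (hd p (hT' p hp).1 (hT' p hp).2).2 ((h2.dvd_iff dvd_rfl).1 hdv)
    · rw [Nat.Coprime, hc2.gcd_eq]; norm_num
  have hM0 : M ≠ 0 := by
    apply mul_ne_zero _ (by norm_num)
    exact Finset.prod_ne_zero_iff.2 fun p hp => (hT p (hT' p hp).1).ne_zero
  haveI : NeZero M := ⟨hM0⟩
  obtain ⟨ℓ, hℓN, hℓ, hℓc⟩ := Nat.forall_exists_prime_gt_and_eq_mod (q := M) (a := (c' : ZMod M)) ((ZMod.isUnit_iff_coprime _ _).2 hMc) (N + 3)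
  have hℓc' : ℓ ≡ c' [MOD M] := (ZMod.natCast_eq_natCast_iff _ _ _).1 hℓc
  have hℓ8 : ℓ % 8 = 3 := (hℓc'.of_dvd (Dvd.intro_left _ rfl)).trans hc2
  have hres : ∀ p ∈ T, p ≠ 2 → ¬ IsSquare (-(ℓ : ZMod p)) := by
    intro p hp hp2
    have hpT : p ∈ T' := Finset.mem_erase.2 ⟨hp2, hp⟩
    have h1 : ℓ ≡ d p [MOD p] := ((hℓc'.of_dvd ((Finset.dvd_prod_of_mem _ hpT).mul_right 8)).trans (hc1.of_dvd (Finset.dvd_prod_of_mem _ hpT))).trans (hc p hpT)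
    rw [(ZMod.natCast_eq_natCast_iff _ _ _).2 h1]
    exact (hd p hp hp2).1
  refine ⟨ℓ, hℓ, by omega, hℓ8, hres, ?_⟩
  haveI : Fact ℓ.Prime := ⟨hℓ⟩
  have hleg : ∀ p ∈ T, legendreSym ℓ (p:ℤ) = -1 := by
    intro p hp
    have hpp := hT p hp
    haveI : Fact p.Prime := ⟨hpp⟩
    by_cases h2 : p = 2
    · subst h2
      have := legendreSym.at_two (p := ℓ) (by omega)
      rw [Nat.cast_ofNat, this, ZMod.χ₈_nat_eq_if_mod_eight]
      rw [hℓ8]; simp; omega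
    · have h1 : legendreSym p (-(ℓ:ℤ)) = -1 := by
        rw [legendreSym.eq_neg_one_iff]; simpa using hres p hp h2
      have h3 : (-(ℓ:ℤ)) = (-1) * (ℓ:ℤ) := by ring
      rw [h3, legendreSym.mul, legendreSym.at_neg_one h2] at h1
      rcases hpp.eq_two_or_odd with h | h
      · exact (h2 h).elim
      · have : p % 4 = 1 ∨ p % 4 = 3 := by omega
        rcases this with h4 | h4
        · rw [ZMod.χ₄_nat_one_mod_four h4, one_mul] at h1
          rw [legendreSym.quadratic_reciprocity_one_mod_four h4 (by omega), h1]
        · rw [ZMod.χ₄_nat_three_mod_four h4] at h1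
          rw [legendreSym.quadratic_reciprocity_three_mod_four h4 (by omega)]
          linarith
  have hprod : legendreSym ℓ (∏ p ∈ T, (p:ℤ)) = 1 := by
    have : ∀ S : Finset ℕ, legendreSym ℓ (∏ p ∈ S, (p:ℤ)) = ∏ p ∈ S, legendreSym ℓ (p:ℤ) := by
      intro S
      exact map_prod (legendreSym.hom ℓ) _ _
    rw [this, Finset.prod_congr rfl hleg, Finset.prod_const, hev.neg_one_pow]
  have hne : ((∏ p ∈ T, (p:ℤ) : ℤ) : ZMod ℓ) ≠ 0 := by
    intro h
    rw [(legendreSym.eq_zero_iff ℓ _).2 h] at hprod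
    norm_num at hprod
  obtain ⟨r, hr⟩ := (legendreSym.eq_one_iff ℓ hne).1 hprod
  have hr0 : r ≠ 0 := by rintro rfl; apply hne; rw [hr]; simp
  obtain ⟨t, ht⟩ := ZMod.intCast_surjective (r⁻¹ : ZMod ℓ)
  refine ⟨t, ?_⟩
  rw [← ZMod.intCast_zmod_eq_zero_iff_dvd]
  rw [Int.cast_sub, Int.cast_mul, hr, Int.cast_pow, ht]
  field_simp
  simp
end Eich
end

section
open scoped BigOperators Matrix RealInnerProductSpace
namespace Eich
open Module

lemma pd_blocks {α β : Type} [Fintype α] [Fintype β] {P : Matrix α α ℤ} {Q : Matrix β β ℤ} (hP : PD P) (hQ : PD Q) :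
    PD (Matrix.fromBlocks P 0 0 Q) := by
  rw [PD, Matrix.fromBlocks_map]
  refine Matrix.PosDef.of_dotProduct_mulVec_pos ?_ ?_
  · apply Matrix.IsHermitian.fromBlocks hP.1 (by ext; simp) hQ.1
  · intro x hx
    rw [Matrix.fromBlocks_mulVec, star_trivial]
    have hx' : x = Sum.elim (x ∘ Sum.inl) (x ∘ Sum.inr) := by ext i; rcases i <;> rfl
    have e1 : x ⬝ᵥ Sum.elim (P.map (Int.cast : ℤ → ℝ) *ᵥ (x ∘ Sum.inl) + ((0 : Matrix α β ℤ).map (Int.cast : ℤ → ℝ)) *ᵥ (x ∘ Sum.inr))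
        (((0 : Matrix β α ℤ).map (Int.cast : ℤ → ℝ)) *ᵥ (x ∘ Sum.inl) + Q.map (Int.cast : ℤ → ℝ) *ᵥ (x ∘ Sum.inr)) =
        (x ∘ Sum.inl) ⬝ᵥ P.map (Int.cast : ℤ → ℝ) *ᵥ (x ∘ Sum.inl) + (x ∘ Sum.inr) ⬝ᵥ Q.map (Int.cast : ℤ → ℝ) *ᵥ (x ∘ Sum.inr) := by
      conv_lhs => rw [hx', sumElim_dotProduct_sumElim]
      simp
    rw [e1]
    have n1 := hP.posSemidef.dotProduct_mulVec_nonneg (x ∘ Sum.inl)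
    have n2 := hQ.posSemidef.dotProduct_mulVec_nonneg (x ∘ Sum.inr)
    rw [star_trivial] at n1 n2
    by_cases h1 : x ∘ Sum.inl = 0
    · have h2 : x ∘ Sum.inr ≠ 0 := by
        intro h2; apply hx; ext i; rcases i with i | i
        · exact congrFun h1 i
        · exact congrFun h2 i
      have := hQ.dotProduct_mulVec_pos h2
      rw [star_trivial] at this
      linarith
    · have := hP.dotProduct_mulVec_pos h1
      rw [star_trivial] at this
      linarith

def OK (m : ℤ) : Matrix (Fin 2) (Fin 2) ℤ := !![2, 1; 1, m]

lemma pd_OK (n m : ℤ) (hn : 0 < n) (hm : 1 ≤ m) : PD (n • OK m) := by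
  refine Matrix.PosDef.of_dotProduct_mulVec_pos ?_ ?_
  · ext i j; fin_cases i <;> fin_cases j <;> simp [OK]
  · intro x hx
    have hm' : (1:ℝ) ≤ m := by exact_mod_cast hm
    have hn' : (0:ℝ) < n := by exact_mod_cast hn
    have e : star x ⬝ᵥ ((n • OK m).map (Int.cast : ℤ → ℝ)) *ᵥ x = n * (2 * x 0^2 + 2 * x 0 * x 1 + m * x 1 ^2) := by
      simp [OK, dotProduct, Matrix.mulVec, Fin.sum_univ_two]; ring
    rw [e]
    apply mul_pos hn'
    have h3 : 2 * x 0^2 + 2 * x 0 * x 1 + m * x 1 ^2 = x 0^2 + (x 0 + x 1)^2 + (m - 1) * x 1^2 := by ring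
    rw [h3]
    have h4 : 0 ≤ (m - 1) * x 1^2 := mul_nonneg (by linarith) (sq_nonneg _)
    by_contra hle
    have h5 := sq_nonneg (x 0)
    have h6 := sq_nonneg (x 0 + x 1)
    have h7 : x 0 = 0 := pow_eq_zero_iff (two_ne_zero) |>.1 (by linarith : x 0 ^ 2 = 0)
    have h8 : x 0 + x 1 = 0 := pow_eq_zero_iff (two_ne_zero) |>.1 (by linarith : (x 0 + x 1) ^ 2 = 0)
    apply hx; ext i; fin_cases i
    · exact h7
    · simpa [h7] using h8

lemma dec2 : ∀ x y k : ZMod 2, x^2+x*y+(2*k+1)*y^2 = 0 → x = 0 ∧ y = 0 := by decide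

lemma aniso_OK (p : ℕ) [hp : Fact p.Prime] (ℓ : ℕ) (h8 : ℓ % 8 = 3) (m n : ℤ) (hm : 2 * m = ℓ + 1)
    (hpn : (p:ℤ) ∣ n) (hpn2 : ¬ (p:ℤ)^2 ∣ n) (hsq : p ≠ 2 → ¬ IsSquare (-(ℓ : ZMod p))) :
    AnisoBy p (-(n • OK m)) ![![1,0],![0,1]] := by
  obtain ⟨n', rfl⟩ := hpn
  have hm2 : ∃ k : ℤ, m = 2 * (2 * k + 1) := ⟨ℓ / 8, by omega⟩
  obtain ⟨k, rfl⟩ := hm2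
  have hp0 : (p:ℤ) ≠ 0 := by exact_mod_cast hp.out.ne_zero
  have hpp : Prime (p:ℤ) := Nat.prime_iff_prime_int.1 hp.out
  refine ⟨?_, ?_, ?_⟩
  · intro i s
    fin_cases i <;> fin_cases s <;> simp [OK, Matrix.mulVec, dotProduct, mul_assoc]
  · intro i
    fin_cases i
    · refine ⟨-n', ?_⟩
      simp [OK, Matrix.mulVec, dotProduct, Fin.sum_univ_two]; ring
    · refine ⟨-n' * (2 * k + 1), ?_⟩
      simp [OK, Matrix.mulVec, dotProduct, Fin.sum_univ_two]; ring
  · intro x y h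
    have e : (x • (![![1,0],![0,1]] : Fin 2 → Fin 2 → ℤ) 0 + y • (![![1,0],![0,1]] : Fin 2 → Fin 2 → ℤ) 1) ⬝ᵥ (-(((p:ℤ) * n') • OK (2 * (2 * k + 1)))).mulVec (x • (![![1,0],![0,1]] : Fin 2 → Fin 2 → ℤ) 0 + y • (![![1,0],![0,1]] : Fin 2 → Fin 2 → ℤ) 1)
        = (2 * p) * (-n' * (x^2 + x*y + (2*k+1) * y^2)) := by
      simp [OK, Matrix.mulVec, dotProduct, Fin.sum_univ_two]; ring
    rw [e, show 2 * (p:ℤ)^2 = 2 * p * p by ring] at h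
    have h1 := Int.dvd_of_mul_dvd_mul_left (by simpa using hp0) h
    have hn' : ¬ (p:ℤ) ∣ n' := by
      intro ⟨q, hq⟩; exact hpn2 ⟨q, by rw [hq]; ring⟩
    have h2 : (p:ℤ) ∣ x^2 + x*y + (2*k+1) * y^2 := (hpp.dvd_or_dvd h1).resolve_left (by rwa [dvd_neg])
    by_cases hp2 : p = 2
    · subst hp2
      have := dec2
      have h3 := this x y k (by
        have := (ZMod.intCast_zmod_eq_zero_iff_dvd _ 2).2 h2
        push_cast at this; exact this)
      exact ⟨(ZMod.intCast_zmod_eq_zero_iff_dvd _ 2).1 h3.1, (ZMod.intCast_zmod_eq_zero_iff_dvd _ 2).1 h3.2⟩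
    · have h3 : ((2 * x + y : ℤ) : ZMod p)^2 = -(ℓ : ZMod p) * (y : ZMod p)^2 := by
        obtain ⟨q, hq⟩ := h2
        have h5 : (2 * x + y)^2 + ℓ * y^2 = p * (4 * q) := by
          linear_combination 4 * hq - y^2 * hm
        have := congrArg (Int.cast : ℤ → ZMod p) h5
        push_cast at this
        rw [ZMod.natCast_self, zero_mul] at this
        push_cast
        linear_combination this
      have hy : (y : ZMod p) = 0 := by
        by_contra hy
        apply hsq hp2
        refine ⟨((2 * x + y : ℤ) : ZMod p) / y, ?_⟩
        field_simp
        linear_combination -h3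
      have hx : (p:ℤ) ∣ x := by
        have h6 := (ZMod.intCast_zmod_eq_zero_iff_dvd _ p).1 hy
        have : (p:ℤ) ∣ x^2 := by
          have h7 : (p:ℤ) ∣ x*y + (2*k+1) * y^2 := dvd_add (h6.mul_left _) ((h6.pow (by norm_num)).mul_left _)
          have e8 : x^2 = x^2 + x*y + (2*k+1) * y^2 - (x*y + (2*k+1) * y^2) := by ring
          rw [e8]; exact dvd_sub h2 h7
        exact hpp.dvd_of_dvd_pow this
      exact ⟨hx, (ZMod.intCast_zmod_eq_zero_iff_dvd _ p).1 hy⟩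

lemma fb_mulVec {α β : Type} [Fintype α] [Fintype β] (P : Matrix α α ℤ) (Q : Matrix β β ℤ) (x : α → ℤ) (y : β → ℤ) :
    (Matrix.fromBlocks P 0 0 Q).mulVec (Sum.elim x y) = Sum.elim (P.mulVec x) (Q.mulVec y) := by
  rw [Matrix.fromBlocks_mulVec]; simp
lemma fb_dot {α β : Type} [Fintype α] [Fintype β] (P : Matrix α α ℤ) (Q : Matrix β β ℤ) (x x' : α → ℤ) (y y' : β → ℤ) :
    (Sum.elim x y) ⬝ᵥ (Matrix.fromBlocks P 0 0 Q).mulVec (Sum.elim x' y') = x ⬝ᵥ P.mulVec x' + y ⬝ᵥ Q.mulVec y' := by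
  rw [fb_mulVec, sumElim_dotProduct_sumElim]

open Classical in
lemma parity {N : ℕ} (hN : Squarefree N) {B : Matrix (Fin 4) (Fin 4) ℤ} (hB : Good N B) :
    Odd (N.primeFactors.filter (fun p => ¬ IsoAt p B)).card := by
  by_contra hodd
  rw [Nat.not_odd_iff_even] at hodd
  set T := N.primeFactors.filter (fun p => ¬ IsoAt p B) with hTdef
  have hT : ∀ p ∈ T, p.Prime ∧ p ∣ N ∧ ¬ IsoAt p B := by
    intro p hp
    obtain ⟨h1, h2⟩ := Finset.mem_filter.1 hp
    exact ⟨Nat.prime_of_mem_primeFactors h1, Nat.dvd_of_mem_primeFactors h1, h2⟩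
  obtain ⟨ℓ, hℓ, hNℓ, h8, hsq, t, ht⟩ := exists_ell T (fun p hp => (hT p hp).1) N hodd
  haveI : Fact ℓ.Prime := ⟨hℓ⟩
  set n : ℤ := ∏ p ∈ T, (p:ℤ) with hn
  have hnpos : 0 < n := Finset.prod_pos fun p hp => by exact_mod_cast (hT p hp).1.pos
  have hnN : n ∣ (N:ℤ) := by
    have : ∏ p ∈ N.primeFactors, (p:ℤ) = N := by rw [← Nat.cast_prod, Nat.prod_primeFactors_of_squarefree hN]
    rw [← this]
    exact Finset.prod_dvd_prod_of_subset _ _ _ (Finset.filter_subset _ _)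
  obtain ⟨m, hm⟩ : ∃ m : ℤ, 2 * m = ℓ + 1 := ⟨(ℓ+1)/2, by omega⟩
  have hm1 : 1 ≤ m := by have := hℓ.two_le; omega
  have hm2 : 2 ∣ m := by omega
  have hOsymm : (OK m).IsSymm := by ext i j; fin_cases i <;> fin_cases j <;> rfl
  have hOev : ∀ i, 2 ∣ OK m i i := by intro i; fin_cases i <;> simp [OK, hm2]
  have hOdet : (OK m).det = ℓ := by simp [OK, Matrix.det_fin_two]; omega
  have hℓN : ℓ ∉ N.primeFactors := by
    intro h; exact absurd (Nat.le_of_dvd (Nat.pos_of_ne_zero hN.ne_zero) (Nat.dvd_of_mem_primeFactors h)) (by omega)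
  let K : ℕ → ℕ := fun p => if p ∈ T then 2 else 1
  have hℓT : ℓ ∉ T := fun h => hℓN (Finset.mem_filter.1 h).1
  obtain ⟨D⟩ := mkGlue (Matrix.fromBlocks B 0 0 (n • OK m)) (OK m) (insert ℓ N.primeFactors) (by
      intro p hp
      rcases Finset.mem_insert.1 hp with rfl | hp
      · exact hℓ
      · exact Nat.prime_of_mem_primeFactors hp) K (by
      intro p hp
      rcases Finset.mem_insert.1 hp with rfl | hp
      · have : K p = 1 := if_neg hℓT
        rw [this]
        obtain ⟨q, hq⟩ := ht
        have hd : (t • ![-1, 2] : Fin 2 → ℤ) ⬝ᵥ (n • OK m).mulVec (t • ![-1, 2]) - (![-1,2] : Fin 2 → ℤ) ⬝ᵥ (OK m).mulVec ![-1,2] = 2 * (p:ℤ)^2 * q := by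
          simp [OK, Matrix.mulVec, dotProduct, Fin.sum_univ_two]
          linear_combination (2 * n * t^2 - 2) * hm + 2 * p * hq
        refine ⟨fun _ => Sum.elim 0 (t • ![-1, 2]), fun _ => ![-1, 2], ?_, ?_, ?_, ?_, ?_⟩
        · intro i s
          rw [fb_mulVec]
          rcases s with s | s
          · simp
          · fin_cases s
            · simp [OK, Matrix.mulVec, dotProduct, Fin.sum_univ_two]
              exact ⟨0, by ring⟩
            · simp [OK, Matrix.mulVec, dotProduct, Fin.sum_univ_two]
              exact ⟨n * t, by linear_combination n * t * hm⟩
        · intro i s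
          fin_cases s
          · simp [OK, Matrix.mulVec, dotProduct, Fin.sum_univ_two]
          · simp [OK, Matrix.mulVec, dotProduct, Fin.sum_univ_two]
            exact ⟨1, by linear_combination hm⟩
        · intro i j
          rw [fb_dot, Matrix.mulVec_zero, dotProduct_zero, zero_add, hd]
          exact ⟨2 * q, by ring⟩
        · intro i
          rw [fb_dot, Matrix.mulVec_zero, dotProduct_zero, zero_add, hd]
          exact ⟨q, by ring⟩
        · intro c _ hc
          have := hc 0
          simp at this
          ext i; fin_cases i; exact this
      · obtain ⟨hpp, hpN, _⟩ := Nat.mem_primeFactors.1 hp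
        haveI : Fact p.Prime := ⟨hpp⟩
        by_cases hpT : p ∈ T
        · have : K p = 2 := if_pos hpT
          rw [this]
          obtain ⟨e, he⟩ := hB.aniso hN hpp hpN (hT p hpT).2.2
          have hpn : (p:ℤ) ∣ n := Finset.dvd_prod_of_mem _ hpT
          have hpn2 : ¬ (p:ℤ)^2 ∣ n := by
            intro h
            have : (p^2 : ℕ) ∣ N := by exact_mod_cast h.trans hnN
            exact hpp.one_lt.ne' (Nat.isUnit_iff.1 (hN p (by rwa [← sq])))
          have hf := aniso_OK p ℓ h8 m n hm hpn hpn2 (hsq p hpT)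
          obtain ⟨y, h1, h2, h3⟩ := aniso_glue p hB.symm (by rw [Matrix.IsSymm, Matrix.transpose_neg, Matrix.transpose_smul, hOsymm.eq]) he hf
          refine ⟨fun i => Sum.elim (e i) (y i), fun _ => 0, ?_, by simp, ?_, ?_, ?_⟩
          · intro i s
            rw [fb_mulVec]
            rcases s with s | s
            · exact he.1 i s
            · have := h1 i s
              rw [Matrix.neg_mulVec, Pi.neg_apply, dvd_neg] at this
              exact this
          · intro i j
            have := h2 i j
            rw [Matrix.neg_mulVec, dotProduct_neg, sub_neg_eq_add] at this
            rw [fb_dot]; simpa using this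
          · intro i
            have := h3 i
            rw [Matrix.neg_mulVec, dotProduct_neg, sub_neg_eq_add] at this
            rw [fb_dot]; simpa using this
          · intro c hc _
            exact aniso_li p hB.symm hB.even he c (fun s => hc (Sum.inl s))
        · have : K p = 1 := if_neg hpT
          rw [this]
          have hi : IsoAt p B := by
            by_contra hi; exact hpT (Finset.mem_filter.2 ⟨hp, hi⟩)
          apply locGlue_left
          obtain ⟨e, ⟨s, hs⟩, h1, h2⟩ := hi
          refine ⟨Sum.elim e 0, ⟨Sum.inl s, hs⟩, ?_, ?_⟩
          · intro s; rw [fb_mulVec]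
            rcases s with s | s
            · exact h1 s
            · simp
          · rw [fb_dot]; simpa using h2) (by
      rw [Matrix.det_fromBlocks_zero₂₁, Matrix.det_smul, hOdet, hB.det, Finset.prod_insert hℓN]
      have e1 : K ℓ = 1 := if_neg hℓT
      have e2 : ∏ p ∈ N.primeFactors, (p:ℤ)^(2 * K p) = (N:ℤ)^2 * n^2 := by
        have : ∏ p ∈ N.primeFactors, (p:ℤ) = N := by rw [← Nat.cast_prod, Nat.prod_primeFactors_of_squarefree hN]
        rw [← this, hn, hTdef, Finset.prod_filter, ← Finset.prod_pow, ← Finset.prod_pow, ← Finset.prod_mul_distrib]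
        refine Finset.prod_congr rfl fun p hp => ?_
        by_cases hpT : p ∈ T
        · have e3 : K p = 2 := if_pos hpT
          rw [if_pos (hT p hpT).2.2, e3]; ring
        · have e3 : K p = 1 := if_neg hpT
          have hi : IsoAt p B := by
            by_contra hi; exact hpT (Finset.mem_filter.2 ⟨hp, hi⟩)
          rw [if_neg (by simpa using hi), e3]; ring
      rw [e1, e2, abs_of_nonneg (by positivity)]
      simp; ring)
  refine glue62 D ?_ hOsymm ?_ hOev (pd_blocks hB.pd (pd_OK n m hnpos hm1)) (by simpa using pd_OK 1 m one_pos hm1) (by simp) (by simp)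
  · rw [Matrix.isSymm_fromBlocks_iff]
    exact ⟨hB.symm, by simp, by simp, by rw [Matrix.IsSymm, Matrix.transpose_smul, hOsymm.eq]⟩
  · rintro (i | i)
    · exact hB.even i
    · exact (hOev i).mul_left _
end Eich
end

section
open scoped BigOperators Matrix RealInnerProductSpace Quaternion
namespace Eich
open Module

section
variable {K : Type*} [Field K] {a b : K}

def nm (x : ℍ[K,a,b]) : K := (x * star x).re
def bl (x y : ℍ[K,a,b]) : K := (x * star y + y * star x).re
def tc (x : ℍ[K,a,b]) : K := 2 * x.re

lemma nm_coord (x : ℍ[K,a,b]) : nm x = x.re^2 - a * x.imI^2 - b * x.imJ^2 + a*b*x.imK^2 := by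
  simp [nm]; ring
lemma bl_coord (x y : ℍ[K,a,b]) : bl x y = 2 * (x.re*y.re - a * x.imI*y.imI - b * x.imJ * y.imJ + a*b*x.imK*y.imK) := by
  simp [bl]; ring
lemma bl_comm (x y : ℍ[K,a,b]) : bl x y = bl y x := by simp only [bl_coord]; ring
lemma bl_self (x : ℍ[K,a,b]) : bl x x = 2 * nm x := by simp only [bl_coord, nm_coord]; ring
lemma bl_one (x : ℍ[K,a,b]) : bl 1 x = tc x := by simp [bl_coord, tc]
lemma bl_add_left (x y z : ℍ[K,a,b]) : bl (x+y) z = bl x z + bl y z := by simp [bl_coord]; ring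
lemma bl_add_right (x y z : ℍ[K,a,b]) : bl x (y+z) = bl x y + bl x z := by simp [bl_coord]; ring
lemma bl_sub_left (x y z : ℍ[K,a,b]) : bl (x-y) z = bl x z - bl y z := by simp [bl_coord]; ring
lemma bl_sub_right (x y z : ℍ[K,a,b]) : bl x (y-z) = bl x y - bl x z := by simp [bl_coord]; ring
lemma bl_smul_left (c : K) (x z : ℍ[K,a,b]) : bl (c • x) z = c * bl x z := by simp [bl_coord]; ring
lemma bl_smul_right (c : K) (x z : ℍ[K,a,b]) : bl x (c • z) = c * bl x z := by simp [bl_coord]; ring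
lemma nm_smul (c : K) (x : ℍ[K,a,b]) : nm (c • x) = c^2 * nm x := by simp [nm_coord]; ring
lemma nm_add (x y : ℍ[K,a,b]) : nm (x + y) = nm x + nm y + bl x y := by simp [nm_coord, bl_coord]; ring
lemma nm_sub (x y : ℍ[K,a,b]) : nm (x - y) = nm x + nm y - bl x y := by simp [nm_coord, bl_coord]; ring
lemma nm_mul (x y : ℍ[K,a,b]) : nm (x * y) = nm x * nm y := by simp [nm_coord]; ring
lemma nm_one : nm (1 : ℍ[K,a,b]) = 1 := by simp [nm_coord]
lemma nm_zero : nm (0 : ℍ[K,a,b]) = 0 := by simp [nm_coord]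
lemma nm_star (x : ℍ[K,a,b]) : nm (star x) = nm x := by simp [nm_coord]
lemma tc_add (x y : ℍ[K,a,b]) : tc (x + y) = tc x + tc y := by simp [tc]; ring
lemma tc_sub (x y : ℍ[K,a,b]) : tc (x - y) = tc x - tc y := by simp [tc]; ring
lemma tc_smul (c : K) (x : ℍ[K,a,b]) : tc (c • x) = c * tc x := by simp [tc]; ring
lemma tc_one : tc (1 : ℍ[K,a,b]) = 2 := by simp [tc]
lemma tc_mul_comm (x y : ℍ[K,a,b]) : tc (x * y) = tc (y * x) := by
  simp only [tc, QuaternionAlgebra.re_mul]; ring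
lemma tc_mul_star (x y : ℍ[K,a,b]) : tc (x * star y) = bl x y := by
  rw [bl_coord, tc]; congr 1; simp; ring
lemma mul_star_self' (x : ℍ[K,a,b]) : x * star x = nm x • (1 : ℍ[K,a,b]) := by
  ext <;> simp [nm_coord] <;> ring
lemma star_mul_self' (x : ℍ[K,a,b]) : star x * x = nm x • (1 : ℍ[K,a,b]) := by
  ext <;> simp [nm_coord] <;> ring
lemma star_eq' (x : ℍ[K,a,b]) : star x = tc x • (1 : ℍ[K,a,b]) - x := by
  ext <;> simp [tc]; ring
lemma sq_eq' (x : ℍ[K,a,b]) : x * x = tc x • x - nm x • (1 : ℍ[K,a,b]) := by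
  ext <;> simp [nm_coord, tc] <;> ring
lemma bl_mul_right (x y z : ℍ[K,a,b]) : bl (x * z) (y * z) = bl x y * nm z := by
  simp [nm_coord, bl_coord]; ring
lemma bl_mul_left (x y z : ℍ[K,a,b]) : bl (z * x) (z * y) = nm z * bl x y := by
  simp [nm_coord, bl_coord]; ring
lemma bl_star (x y : ℍ[K,a,b]) : bl (star x) (star y) = bl x y := by simp [bl_coord]
lemma bl_zero_left (y : ℍ[K,a,b]) : bl 0 y = 0 := by simp [bl_coord]
lemma bl_zero_right (y : ℍ[K,a,b]) : bl y 0 = 0 := by simp [bl_coord]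

/-- inverse -/
def iv (x : ℍ[K,a,b]) : ℍ[K,a,b] := (nm x)⁻¹ • star x
lemma mul_iv {x : ℍ[K,a,b]} (h : nm x ≠ 0) : x * iv x = 1 := by
  rw [iv, mul_smul_comm, mul_star_self', smul_smul, inv_mul_cancel₀ h, one_smul]
lemma iv_mul {x : ℍ[K,a,b]} (h : nm x ≠ 0) : iv x * x = 1 := by
  rw [iv, smul_mul_assoc, star_mul_self', smul_smul, inv_mul_cancel₀ h, one_smul]
lemma nm_iv (x : ℍ[K,a,b]) : nm (iv x) = (nm x)⁻¹ := by
  rw [iv, nm_smul, nm_star]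
  by_cases h : nm x = 0
  · simp [h]
  · field_simp
lemma mul_iv_mul {x : ℍ[K,a,b]} (h : nm x ≠ 0) (z : ℍ[K,a,b]) : x * (iv x * z) = z := by
  rw [← mul_assoc, mul_iv h, one_mul]
lemma iv_mul_mul {x : ℍ[K,a,b]} (h : nm x ≠ 0) (z : ℍ[K,a,b]) : iv x * (x * z) = z := by
  rw [← mul_assoc, iv_mul h, one_mul]

lemma isUnit_iff_nm (x : ℍ[K,a,b]) : IsUnit x ↔ nm x ≠ 0 := by
  constructor
  · rintro ⟨u, rfl⟩ h
    have := congrArg nm u.mul_inv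
    rw [nm_mul, h, zero_mul, nm_one] at this
    exact zero_ne_one this
  · intro h
    exact ⟨⟨x, iv x, mul_iv h, iv_mul h⟩, rfl⟩

/-- orthogonal to 1 and x -/
def Perp (x w : ℍ[K,a,b]) : Prop := bl 1 w = 0 ∧ bl x w = 0

lemma Perp.conj {x w : ℍ[K,a,b]} (h : Perp x w) : star w = -w := by
  rw [star_eq', ← bl_one, h.1]; simp

lemma bl_eq_mul (x y : ℍ[K,a,b]) : x * star y + y * star x = bl x y • (1 : ℍ[K,a,b]) := by
  ext <;> simp [bl_coord] <;> ring

lemma Perp.mul {x w : ℍ[K,a,b]} (h : Perp x w) : w * x = star x * w := by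
  have h1 := bl_eq_mul x w
  rw [h.2, h.conj, zero_smul] at h1
  have h2 : w * star x = x * w := by
    rw [mul_neg, neg_add_eq_zero] at h1; exact h1.symm
  have h3 : w * x = tc x • w - x * w := by
    rw [← h2, star_eq', mul_sub, mul_smul_comm, mul_one]; abel
  rw [h3, star_eq', sub_mul, smul_mul_assoc, one_mul]

lemma Perp.mul' {x w : ℍ[K,a,b]} (h : Perp x w) : w * star x = x * w := by
  have h1 := bl_eq_mul x w
  rw [h.2, h.conj, zero_smul] at h1
  rw [mul_neg, neg_add_eq_zero] at h1; exact h1.symm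

lemma Perp.add {x w w' : ℍ[K,a,b]} (h : Perp x w) (h' : Perp x w') : Perp x (w + w') :=
  ⟨by rw [bl_add_right, h.1, h'.1, add_zero], by rw [bl_add_right, h.2, h'.2, add_zero]⟩
lemma Perp.smul {x w : ℍ[K,a,b]} (h : Perp x w) (c : K) : Perp x (c • w) :=
  ⟨by rw [bl_smul_right, h.1, mul_zero], by rw [bl_smul_right, h.2, mul_zero]⟩

lemma Perp.xmul {x w : ℍ[K,a,b]} (h : Perp x w) : Perp x (x * w) := by
  constructor
  · have : bl 1 (x * w) = - bl x w := by
      rw [bl_one, ← tc_mul_star, h.conj, mul_neg, tc, tc, QuaternionAlgebra.re_neg]; ring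
    rw [this, h.2, neg_zero]
  · have := bl_mul_left 1 w x
    rw [mul_one] at this
    rw [this, h.1, mul_zero]

def dsc (x : ℍ[K,a,b]) : K := tc x ^ 2 - 4 * nm x

/-- projection coefficients -/
def pα (x z : ℍ[K,a,b]) : K := (2 * nm x * bl 1 z - tc x * bl x z) / (-dsc x)
def pβ (x z : ℍ[K,a,b]) : K := (2 * bl x z - tc x * bl 1 z) / (-dsc x)

lemma perp_proj {x : ℍ[K,a,b]} (hx : dsc x ≠ 0) (z : ℍ[K,a,b]) : Perp x (z - pα x z • 1 - pβ x z • x) := by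
  have hx' : -dsc x ≠ 0 := neg_ne_zero.2 hx
  have e1 : pα x z * (-dsc x) = 2 * nm x * bl 1 z - tc x * bl x z := div_mul_cancel₀ _ hx'
  have e2 : pβ x z * (-dsc x) = 2 * bl x z - tc x * bl 1 z := div_mul_cancel₀ _ hx'
  rw [dsc] at e1 e2
  constructor
  · rw [bl_sub_right, bl_sub_right, bl_smul_right, bl_smul_right, bl_self, nm_one, bl_one x]
    apply mul_right_cancel₀ hx'
    rw [dsc]
    linear_combination -2 * e1 - tc x * e2
  · rw [bl_sub_right, bl_sub_right, bl_smul_right, bl_smul_right, bl_self, bl_comm x 1, bl_one x]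
    apply mul_right_cancel₀ hx'
    rw [dsc]
    linear_combination -tc x * e1 - 2 * nm x * e2

lemma nm_two_sub (x : ℍ[K,a,b]) : nm (x - star x) = - dsc x := by
  simp [dsc, nm_coord, tc]; ring

lemma centralizer {x : ℍ[K,a,b]} (hx : dsc x ≠ 0) {z : ℍ[K,a,b]} (h : z * x = x * z) :
    z = pα x z • 1 + pβ x z • x := by
  have hP := perp_proj hx z
  set w := z - pα x z • 1 - pβ x z • x with hw
  have hz : z = pα x z • 1 + pβ x z • x + w := by rw [hw]; abel
  have h1 : w * x = x * w := by
    rw [hw]; simp only [sub_mul, mul_sub, h, smul_mul_assoc, mul_smul_comm, one_mul, mul_one]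
  rw [hP.mul] at h1
  have h2 : (x - star x) * w = 0 := by rw [sub_mul, h1, sub_self]
  have h3 : w = 0 := by
    have hn : nm (x - star x) ≠ 0 := by rw [nm_two_sub]; exact neg_ne_zero.2 hx
    have := iv_mul_mul hn w
    rw [h2, mul_zero] at this
    exact this.symm
  rw [h3, add_zero] at hz
  exact hz

/-- Perp space is K(x) y. -/
lemma perp_line {x y w : ℍ[K,a,b]} (hx : dsc x ≠ 0) (hy : Perp x y) (hny : nm y ≠ 0) (hw : Perp x w) :
    ∃ α β : K, w = α • y + β • (x * y) ∧ 2 * α + tc x * β = bl w y / nm y ∧ α^2 + tc x * α * β + nm x * β^2 = nm w / nm y := by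
  have hc : (w * iv y) * x = x * (w * iv y) := by
    have h1 : star y * x = star x * star y := by
      rw [hy.conj, neg_mul, mul_neg, hy.mul]
    rw [iv, mul_smul_comm, smul_mul_assoc, mul_smul_comm, mul_assoc, h1, ← mul_assoc, hw.mul', mul_assoc]
  have h2 := centralizer hx hc
  set α := pα x (w * iv y)
  set β := pβ x (w * iv y)
  refine ⟨α, β, ?_, ?_, ?_⟩
  · have : w = (w * iv y) * y := by rw [mul_assoc, iv_mul hny, mul_one]
    conv_lhs => rw [this, h2]
    rw [add_mul, smul_mul_assoc, one_mul, smul_mul_assoc]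
  · have h3 : tc (w * iv y) = bl w y / nm y := by
      rw [iv, mul_smul_comm, tc_smul, tc_mul_star]; field_simp
    rw [← h3, h2, tc_add, tc_smul, tc_smul, tc_one]; ring
  · have h3 : nm (w * iv y) = nm w / nm y := by
      rw [nm_mul, nm_iv]; field_simp
    rw [← h3, h2, nm_add, nm_smul, nm_smul, nm_one, bl_smul_left, bl_smul_right, bl_one]; ring

def Gm {n : ℕ} (v : Fin n → ℍ[K,a,b]) : Matrix (Fin n) (Fin n) K := Matrix.of fun i j => bl (v i) (v j)

def stdv (x y : ℍ[K,a,b]) : Fin 4 → ℍ[K,a,b] := ![1, x, y, x * y]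

lemma Gm_std {x y : ℍ[K,a,b]} (hy : Perp x y) : Gm (stdv x y) =
    !![2, tc x, 0, 0; tc x, 2 * nm x, 0, 0; 0, 0, 2 * nm y, tc x * nm y; 0, 0, tc x * nm y, 2 * nm x * nm y] := by
  have h1 := hy.1
  have h2 := hy.2
  have h3 := hy.xmul.1
  have h4 := hy.xmul.2
  have h5 : bl y (x * y) = tc x * nm y := by
    have := bl_mul_right 1 x y
    rwa [one_mul, bl_one] at this
  ext i j
  fin_cases i <;> fin_cases j <;> simp [Gm, stdv, h1, h2, h3, h4, h5, bl_self, nm_one, nm_mul, bl_one x, bl_comm x 1, bl_comm y, bl_comm (x*y), mul_assoc]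

lemma det_std {x y : ℍ[K,a,b]} (hy : Perp x y) : (Gm (stdv x y)).det = (dsc x * nm y)^2 := by
  rw [Gm_std hy, dsc]
  simp [Matrix.det_succ_row_zero, Fin.sum_univ_succ, Fin.succAbove]
  ring
end
end Eich
end

section
open scoped BigOperators Matrix RealInnerProductSpace Quaternion
namespace Eich
open Module

section
variable {K : Type*} [Field K] {a b : K}
/-- bilinear form as a linear map -/
def blL (x : ℍ[K,a,b]) : ℍ[K,a,b] →ₗ[K] K where
  toFun := bl x
  map_add' := bl_add_right x
  map_smul' c z := by simp [bl_smul_right]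
lemma bl_sum_right {ι : Type*} (s : Finset ι) (x : ℍ[K,a,b]) (f : ι → ℍ[K,a,b]) : bl x (∑ i ∈ s, f i) = ∑ i ∈ s, bl x (f i) :=
  map_sum (blL x) f s
lemma bl_sum_left {ι : Type*} (s : Finset ι) (x : ℍ[K,a,b]) (f : ι → ℍ[K,a,b]) : bl (∑ i ∈ s, f i) x = ∑ i ∈ s, bl (f i) x := by
  rw [bl_comm, bl_sum_right]; simp only [bl_comm x]

lemma Gm_change {n m : ℕ} {v : Fin n → ℍ[K,a,b]} {w : Fin m → ℍ[K,a,b]} {U : Matrix (Fin n) (Fin m) K}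
    (h : ∀ i, w i = ∑ j, U j i • v j) : Gm w = Uᵀ * Gm v * U := by
  ext i j
  simp only [Gm, Matrix.of_apply, Matrix.mul_apply, Matrix.transpose_apply, h, bl_sum_left, bl_sum_right, bl_smul_left, bl_smul_right]
  simp only [Finset.sum_mul, Finset.mul_sum]
  refine Finset.sum_congr rfl fun k _ => Finset.sum_congr rfl fun l _ => by ring

lemma Gm_mulVec {n : ℕ} (v : Fin n → ℍ[K,a,b]) (c : Fin n → K) (i) : (Gm v).mulVec c i = bl (v i) (∑ j, c j • v j) := by
  simp only [Gm, Matrix.mulVec, dotProduct, Matrix.of_apply, bl_sum_right, bl_smul_right, mul_comm]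

lemma li_of_det {n : ℕ} {v : Fin n → ℍ[K,a,b]} (h : (Gm v).det ≠ 0) : LinearIndependent K v := by
  rw [Fintype.linearIndependent_iff]
  intro c hc
  by_contra hne
  push Not at hne
  obtain ⟨i, hi⟩ := hne
  apply h
  apply Matrix.exists_mulVec_eq_zero_iff.1
  refine ⟨c, fun h0 => hi (congrFun h0 i), ?_⟩
  ext k
  rw [Gm_mulVec, hc]
  simp [bl_coord]
end

section
variable {p : ℕ} [hp : Fact p.Prime] {a b : ℚ_[p]}

def sp {n : ℕ} (v : Fin n → ℍ[ℚ_[p],a,b]) : Submodule ℤ_[p] ℍ[ℚ_[p],a,b] := Submodule.span ℤ_[p] (Set.range v)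

lemma zsmul_def (c : ℤ_[p]) (z : ℍ[ℚ_[p],a,b]) : c • z = (c : ℚ_[p]) • z := rfl

lemma mem_sp {n : ℕ} {v : Fin n → ℍ[ℚ_[p],a,b]} {z} : z ∈ sp v ↔ ∃ c : Fin n → ℤ_[p], ∑ i, (c i : ℚ_[p]) • v i = z :=
  Submodule.mem_span_range_iff_exists_fun ℤ_[p]

lemma vmem_sp {n : ℕ} (v : Fin n → ℍ[ℚ_[p],a,b]) (i) : v i ∈ sp v := Submodule.subset_span ⟨i, rfl⟩

lemma smul_mem' {Λ : Submodule ℤ_[p] ℍ[ℚ_[p],a,b]} {c : ℚ_[p]} (hc : ‖c‖ ≤ 1) {z} (hz : z ∈ Λ) : c • z ∈ Λ :=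
  Λ.smul_mem (⟨c, hc⟩ : ℤ_[p]) hz

lemma it {x : ℚ_[p]} : ‖x‖ ≤ 1 ↔ x ∈ PadicInt.subring p := Iff.rfl

lemma sp_le {n m : ℕ} {v : Fin n → ℍ[ℚ_[p],a,b]} {w : Fin m → ℍ[ℚ_[p],a,b]} (h : ∀ i, w i ∈ sp v) : sp w ≤ sp v := by
  rw [sp, Submodule.span_le]; rintro _ ⟨i, rfl⟩; exact h i

lemma exists_change {n m : ℕ} {v : Fin n → ℍ[ℚ_[p],a,b]} {w : Fin m → ℍ[ℚ_[p],a,b]} (h : ∀ i, w i ∈ sp v) :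
    ∃ U : Matrix (Fin n) (Fin m) ℤ_[p], ∀ i, w i = ∑ j, (U j i : ℚ_[p]) • v j := by
  choose c hc using fun i => mem_sp.1 (h i)
  exact ⟨fun j i => c i j, fun i => (hc i).symm⟩

lemma det_change {n : ℕ} {v w : Fin n → ℍ[ℚ_[p],a,b]} {U : Matrix (Fin n) (Fin n) ℤ_[p]}
    (h : ∀ i, w i = ∑ j, (U j i : ℚ_[p]) • v j) : (Gm w).det = (U.det : ℚ_[p])^2 * (Gm v).det := by
  have := Gm_change (U := U.map (fun x : ℤ_[p] => (x : ℚ_[p]))) (v := v) (w := w) h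
  rw [this, Matrix.det_mul, Matrix.det_mul, Matrix.det_transpose]
  have h2 : (U.map (fun x : ℤ_[p] => (x : ℚ_[p]))).det = (U.det : ℚ_[p]) := by
    exact (RingHom.map_det (PadicInt.Coe.ringHom) U).symm
  rw [h2]; ring

lemma sp_eq_of_unit {n : ℕ} {v w : Fin n → ℍ[ℚ_[p],a,b]} {U : Matrix (Fin n) (Fin n) ℤ_[p]}
    (h : ∀ i, w i = ∑ j, (U j i : ℚ_[p]) • v j) (hU : IsUnit U.det) : sp w = sp v := by
  apply le_antisymm
  · apply sp_le; intro i; exact mem_sp.2 ⟨fun j => U j i, (h i).symm⟩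
  · apply sp_le; intro i
    refine mem_sp.2 ⟨fun j => U⁻¹ j i, ?_⟩
    simp only [h, Finset.smul_sum, smul_smul]
    rw [Finset.sum_comm]
    have h1 : U * U⁻¹ = 1 := Matrix.mul_nonsing_inv U hU
    have h2 : ∀ k, ∑ j, ((U⁻¹ j i : ℚ_[p]) * (U k j : ℚ_[p])) • v k = ((1 : Matrix (Fin n) (Fin n) ℤ_[p]) k i : ℚ_[p]) • v k := by
      intro k
      rw [← Finset.sum_smul]
      congr 1
      rw [← h1, Matrix.mul_apply]
      rw [PadicInt.coe_sum]
      exact Finset.sum_congr rfl fun j _ => by rw [PadicInt.coe_mul, mul_comm]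
    simp only [h2]
    rw [Finset.sum_eq_single i]
    · simp
    · intro k _ hk; simp [hk]
    · simp

lemma det_le {n : ℕ} {v w : Fin n → ℍ[ℚ_[p],a,b]} (h : ∀ i, w i ∈ sp v) : ‖(Gm w).det‖ ≤ ‖(Gm v).det‖ := by
  obtain ⟨U, hU⟩ := exists_change h
  rw [det_change hU, norm_mul, norm_pow]
  have : ‖(U.det : ℚ_[p])‖ ≤ 1 := PadicInt.norm_le_one _
  exact mul_le_of_le_one_left (norm_nonneg _) (pow_le_one₀ (norm_nonneg _) this)

lemma unit_of_det {n : ℕ} {v w : Fin n → ℍ[ℚ_[p],a,b]} {U : Matrix (Fin n) (Fin n) ℤ_[p]}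
    (hU : ∀ i, w i = ∑ j, (U j i : ℚ_[p]) • v j) (hd : ‖(Gm w).det‖ = ‖(Gm v).det‖)
    (h0 : (Gm w).det ≠ 0) : IsUnit U.det := by
  have h1 := det_change hU
  rw [PadicInt.isUnit_iff]
  have h2 : ‖(Gm v).det‖ ≠ 0 := by rw [← hd]; exact norm_ne_zero_iff.2 h0
  rw [h1, norm_mul, norm_pow] at hd
  have h3 : ‖(U.det : ℚ_[p])‖^2 = 1 := by
    apply mul_right_cancel₀ h2; rw [hd, one_mul]
  have := (pow_eq_one_iff_of_nonneg (norm_nonneg _) two_ne_zero).1 h3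
  exact this

lemma sp_eq_of_det {n : ℕ} {v w : Fin n → ℍ[ℚ_[p],a,b]} (h : ∀ i, w i ∈ sp v) (hd : ‖(Gm w).det‖ = ‖(Gm v).det‖)
    (h0 : (Gm w).det ≠ 0) : sp w = sp v := by
  obtain ⟨U, hU⟩ := exists_change h
  exact sp_eq_of_unit hU (unit_of_det hU hd h0)

lemma norm_sub3 {x y z : ℚ_[p]} {r : ℝ} (hx : ‖x‖ ≤ r) (hy : ‖y‖ ≤ r) (hz : ‖z‖ ≤ r) : ‖x - y - z‖ ≤ r := by
  rw [sub_sub, sub_eq_add_neg]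
  refine (Padic.nonarchimedean _ _).trans (max_le hx ?_)
  rw [norm_neg]
  exact (Padic.nonarchimedean _ _).trans (max_le hy hz)

lemma bl_eq_nm (x y : ℍ[ℚ_[p],a,b]) : bl x y = nm (x + y) - nm x - nm y := by rw [nm_add]; ring

lemma bl_int {Λ : Submodule ℤ_[p] ℍ[ℚ_[p],a,b]} (hintg : ∀ z ∈ Λ, ‖nm z‖ ≤ 1) {x y} (hx : x ∈ Λ) (hy : y ∈ Λ) : ‖bl x y‖ ≤ 1 := by
  rw [bl_eq_nm]; exact norm_sub3 (hintg _ (Λ.add_mem hx hy)) (hintg _ hx) (hintg _ hy)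

/-- integrality of coefficients -/
lemma coef_int {t n α β T M : ℚ_[p]} (ht : ‖t‖ ≤ 1) (hn : ‖n‖ ≤ 1) (hd : ‖t^2-4*n‖ = 1) (hT : ‖T‖ ≤ 1) (hM : ‖M‖ ≤ 1)
    (h1 : 2 * α + t * β = T) (h2 : α^2+t*α*β+n*β^2 = M) : ‖α‖ ≤ 1 ∧ ‖β‖ ≤ 1 := by
  have e1 : (t^2-4*n) * β^2 = T^2 - 4 * M := by rw [← h1, ← h2]; ring
  rw [it] at ht hn hT hM
  have e2 : ‖T^2-4*M‖ ≤ 1 := it.2 (sub_mem (pow_mem hT 2) (mul_mem (ofNat_mem _ 4) hM))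
  have hβ : ‖β‖ ≤ 1 := by
    rw [← e1, norm_mul, hd, one_mul, norm_pow] at e2
    exact (pow_le_one_iff_of_nonneg (norm_nonneg _) two_ne_zero).1 e2
  refine ⟨?_, hβ⟩
  by_contra hα
  push Not at hα
  have e3 : α * (α + t * β) = M - n * β^2 := by rw [← h2]; ring
  have e4 : ‖M - n * β^2‖ ≤ 1 := it.2 (sub_mem hM (mul_mem hn (pow_mem (it.1 hβ) 2)))
  have e5 : ‖t * β‖ ≤ 1 := it.2 (mul_mem ht (it.1 hβ))
  have e6 : ‖α + t * β‖ = ‖α‖ := by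
    rw [Padic.add_eq_max_of_ne (by linarith [e5.trans_lt hα |>.ne'] : ‖α‖ ≠ ‖t*β‖)]
    exact max_eq_left (e5.trans hα.le)
  rw [← e3, norm_mul, e6] at e4
  nlinarith

lemma pαβ_int {Λ : Submodule ℤ_[p] ℍ[ℚ_[p],a,b]} (h1 : 1 ∈ Λ) (hintg : ∀ z ∈ Λ, ‖nm z‖ ≤ 1) {x z} (hx : x ∈ Λ) (hd : ‖dsc x‖ = 1)
    (hz : z ∈ Λ) : ‖pα x z‖ ≤ 1 ∧ ‖pβ x z‖ ≤ 1 := by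
  have a1 : ‖bl 1 z‖ ≤ 1 := bl_int hintg h1 hz
  have a2 : ‖bl x z‖ ≤ 1 := bl_int hintg hx hz
  have a3 : ‖tc x‖ ≤ 1 := by rw [← bl_one]; exact bl_int hintg h1 hx
  have a4 := hintg x hx
  rw [it] at a1 a2 a3 a4
  constructor
  · rw [pα, norm_div, norm_neg, hd, div_one]
    exact it.2 (sub_mem (mul_mem (mul_mem (ofNat_mem _ 2) a4) a1) (mul_mem a3 a2))
  · rw [pβ, norm_div, norm_neg, hd, div_one]
    exact it.2 (sub_mem (mul_mem (ofNat_mem _ 2) a2) (mul_mem a3 a1))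

lemma stdv_mem {x y : ℍ[ℚ_[p],a,b]} {α β γ δ : ℚ_[p]} (h1 : ‖α‖ ≤ 1) (h2 : ‖β‖ ≤ 1) (h3 : ‖γ‖ ≤ 1) (h4 : ‖δ‖ ≤ 1) :
    α • 1 + β • x + γ • y + δ • (x * y) ∈ sp (stdv x y) :=
  add_mem (add_mem (add_mem (smul_mem' h1 (vmem_sp (stdv x y) 0)) (smul_mem' h2 (vmem_sp (stdv x y) 1))) (smul_mem' h3 (vmem_sp (stdv x y) 2)))
    (smul_mem' h4 (vmem_sp (stdv x y) 3))

lemma mem_stdv {x y z : ℍ[ℚ_[p],a,b]} (h : z ∈ sp (stdv x y)) : ∃ α β γ δ : ℚ_[p], ‖α‖ ≤ 1 ∧ ‖β‖ ≤ 1 ∧ ‖γ‖ ≤ 1 ∧ ‖δ‖ ≤ 1 ∧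
    z = α • 1 + β • x + γ • y + δ • (x * y) := by
  obtain ⟨c, rfl⟩ := mem_sp.1 h
  refine ⟨c 0, c 1, c 2, c 3, PadicInt.norm_le_one _, PadicInt.norm_le_one _, PadicInt.norm_le_one _, PadicInt.norm_le_one _, ?_⟩
  rw [Fin.sum_univ_four]; rfl

lemma LST {v : Fin 4 → ℍ[ℚ_[p],a,b]} {x} (h1 : 1 ∈ sp v) (hintg : ∀ z ∈ sp v, ‖nm z‖ ≤ 1) (hdet : (Gm v).det ≠ 0) (hx : x ∈ sp v)
    (hd : ‖dsc x‖ = 1) : ∃ y ∈ sp v, Perp x y ∧ nm y ≠ 0 ∧ sp v ≤ sp (stdv x y) := by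
  have hd0 : dsc x ≠ 0 := by intro h; rw [h] at hd; simp at hd
  have hpr : ∀ z ∈ sp v, z - pα x z • 1 - pβ x z • x ∈ sp v := fun z hz =>
    sub_mem (sub_mem hz (smul_mem' (pαβ_int h1 hintg hx hd hz).1 h1)) (smul_mem' (pαβ_int h1 hintg hx hd hz).2 hx)
  have hex : ∃ y ∈ sp v, Perp x y ∧ nm y ≠ 0 := by
    by_contra hno
    push Not at hno
    apply hdet
    let w : Fin 4 → ℍ[ℚ_[p],a,b] := fun i => v i - pα x (v i) • 1 - pβ x (v i) • x
    have hwP : ∀ i, Perp x (w i) := fun i => perp_proj hd0 _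
    have hwm : ∀ i, w i ∈ sp v := fun i => hpr _ (vmem_sp v i)
    have hv : ∀ i, v i = pα x (v i) • 1 + pβ x (v i) • x + w i := fun i => by simp only [w]; abel
    have hww : ∀ i j, bl (w i) (w j) = 0 := fun i j => by
      rw [bl_eq_nm, hno _ (add_mem (hwm i) (hwm j)) ((hwP i).add (hwP j)), hno _ (hwm i) (hwP i), hno _ (hwm j) (hwP j)]; ring
    have hvw : ∀ i j, bl (v i) (w j) = 0 := fun i j => by
      rw [hv i, bl_add_left, bl_add_left, bl_smul_left, bl_smul_left, (hwP j).1, (hwP j).2, hww]; ring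
    let P : Matrix (Fin 4) (Fin 4) ℚ_[p] := ![fun i => pα x (v i), fun i => pβ x (v i), 0, 0]
    have hP : P.det = 0 := Matrix.det_eq_zero_of_row_eq_zero 2 (fun j => rfl)
    obtain ⟨c, hc0, hc⟩ := Matrix.exists_mulVec_eq_zero_iff.2 hP
    have c1 : ∑ i, c i * pα x (v i) = 0 := by
      have := congrFun hc 0
      simpa [P, Matrix.mulVec, dotProduct, mul_comm] using this
    have c2 : ∑ i, c i * pβ x (v i) = 0 := by
      have := congrFun hc 1
      simpa [P, Matrix.mulVec, dotProduct, mul_comm] using this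
    apply Matrix.exists_mulVec_eq_zero_iff.1
    refine ⟨c, hc0, ?_⟩
    ext i
    rw [Gm_mulVec]
    have : ∑ j, c j • v j = ∑ j, c j • w j := by
      have : ∀ j, c j • v j = (c j * pα x (v j)) • (1 : ℍ[ℚ_[p],a,b]) + (c j * pβ x (v j)) • x + c j • w j := fun j => by
        conv_lhs => rw [hv j]
        rw [smul_add, smul_add, smul_smul, smul_smul]
      simp only [this]
      rw [Finset.sum_add_distrib, Finset.sum_add_distrib, ← Finset.sum_smul, ← Finset.sum_smul, c1, c2]
      simp
    rw [this, bl_sum_right]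
    simp [bl_smul_right, hvw]
  let Y : Set ℍ[ℚ_[p],a,b] := {y | y ∈ sp v ∧ Perp x y ∧ nm y ≠ 0}
  have hY : Y.Nonempty := by obtain ⟨y, h⟩ := hex; exact ⟨y, h⟩
  let f : ℍ[ℚ_[p],a,b] → ℤ := fun z => (nm z).valuation
  obtain ⟨y, ⟨hy, hyP, hny⟩, hmax⟩ : ∃ y ∈ Y, ∀ w ∈ Y, ‖nm w‖ ≤ ‖nm y‖ := by
    let g : ℍ[ℚ_[p],a,b] → ℕ := fun z => ((nm z).valuation).toNat
    refine ⟨Function.argminOn g Y hY, Function.argminOn_mem g Y hY, fun w hw => ?_⟩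
    have h1 : g (Function.argminOn g Y hY) ≤ g w := Function.argminOn_le g Y hw
    have h2 := Function.argminOn_mem g Y hY
    have v0 : ∀ z ∈ Y, 0 ≤ (nm z).valuation := fun z hz => by
      exact (Padic.norm_le_one_iff_val_nonneg _).1 (hintg z hz.1)
    rw [Padic.norm_eq_zpow_neg_valuation hw.2.2, Padic.norm_eq_zpow_neg_valuation h2.2.2]
    apply zpow_le_zpow_right₀
    · exact_mod_cast hp.out.one_lt.le
    · have := v0 _ hw
      have := v0 _ h2
      have h1' : (nm (Function.argminOn g Y hY)).valuation.toNat ≤ (nm w).valuation.toNat := h1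
      omega
  refine ⟨y, hy, hyP, hny, fun z hz => ?_⟩
  have hw := hpr z hz
  have hwP := perp_proj hd0 z
  set w := z - pα x z • 1 - pβ x z • x with hwd
  have hmax' : ∀ w ∈ sp v, Perp x w → ‖nm w‖ ≤ ‖nm y‖ := fun w hw hwP => by
    by_cases h : nm w = 0
    · rw [h, norm_zero]; exact norm_nonneg _
    · exact hmax w ⟨hw, hwP, h⟩
  obtain ⟨α, β, e1, e2, e3⟩ := perp_line hd0 hyP hny hwP
  have hpos : 0 < ‖nm y‖ := norm_pos_iff.2 hny
  have hT : ‖bl w y / nm y‖ ≤ 1 := by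
    rw [norm_div, div_le_one hpos, bl_eq_nm]
    exact norm_sub3 (hmax' _ (add_mem hw hy) (hwP.add hyP)) (hmax' _ hw hwP) le_rfl
  have hM : ‖nm w / nm y‖ ≤ 1 := by
    rw [norm_div, div_le_one hpos]; exact hmax' _ hw hwP
  have a3 : ‖tc x‖ ≤ 1 := by rw [← bl_one]; exact bl_int hintg h1 hx
  obtain ⟨hα, hβ⟩ := coef_int a3 (hintg x hx) hd hT hM e2 e3
  have : z = pα x z • 1 + pβ x z • x + α • y + β • (x * y) := by
    rw [add_assoc (_ + _), ← e1, hwd]; abel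
  rw [this]
  exact stdv_mem (pαβ_int h1 hintg hx hd hz).1 (pαβ_int h1 hintg hx hd hz).2 hα hβ
end
end Eich
end

section
open scoped BigOperators Matrix RealInnerProductSpace Quaternion
namespace Eich
open Module

lemma z2key : ∀ c' : ZMod 2, c' ≠ 0 → c' = 1 := by decide

section
variable {p : ℕ} [hp : Fact p.Prime]

lemma quad_hensel {A B C z0 : ℤ_[p]} (h : ‖A*z0^2+B*z0+C‖ < 1) (h' : ‖2*A*z0+B‖ = 1) :
    ∃ z, A*z^2+B*z+C = 0 ∧ ‖z - z0‖ < 1 := by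
  let F : Polynomial ℤ_[p] := Polynomial.C A * Polynomial.X^2 + Polynomial.C B * Polynomial.X + Polynomial.C C
  have e1 : ∀ z, Polynomial.aeval z F = A*z^2+B*z+C := fun z => by simp [F]
  have e2 : ∀ z, Polynomial.aeval z (Polynomial.derivative F) = 2*A*z+B := fun z => by simp [F]; ring
  obtain ⟨z, hz, hz', -⟩ := hensels_lemma (F := F) (a := z0) (by rw [e1, e2, h']; simpa using h)
  rw [e1] at hz
  rw [e2, h'] at hz'
  exact ⟨z, hz, hz'⟩

lemma toZ_iff {x : ℤ_[p]} : PadicInt.toZMod x = 0 ↔ ‖x‖ < 1 := by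
  rw [← RingHom.mem_ker, PadicInt.ker_toZMod, IsLocalRing.mem_maximalIdeal, PadicInt.mem_nonunits]

lemma unit_iff {x : ℤ_[p]} : ‖x‖ = 1 ↔ PadicInt.toZMod x ≠ 0 := by
  rw [Ne, toZ_iff, not_lt]
  exact ⟨fun h => h.ge, fun h => le_antisymm (PadicInt.norm_le_one x) h⟩

lemma hens {t n c α₀ β₀ : ℤ_[p]} (hd : ‖t^2-4*n‖ = 1) (h0 : ‖α₀‖ = 1 ∨ ‖β₀‖ = 1) (h : ‖α₀^2+t*α₀*β₀+n*β₀^2-c‖ < 1) :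
    ∃ α β : ℤ_[p], α^2+t*α*β+n*β^2 = c ∧ ‖α-α₀‖ < 1 ∧ ‖β-β₀‖ < 1 := by
  by_cases h1 : ‖2*α₀+t*β₀‖ = 1
  · obtain ⟨z, hz, hz'⟩ := quad_hensel (A := 1) (B := t*β₀) (C := n*β₀^2-c) (z0 := α₀) (by convert h using 2; ring) (by convert h1 using 2; ring)
    exact ⟨z, β₀, by linear_combination hz, hz', by simp⟩
  · have h2 : ‖2*n*β₀+t*α₀‖ = 1 := by
      rw [unit_iff] at hd h0 h1 ⊢
      rw [unit_iff] at h0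
      rw [not_not] at h1
      intro h2
      simp only [map_sub, map_mul, map_add, map_pow, map_ofNat] at *
      set T := PadicInt.toZMod t
      set M := PadicInt.toZMod n
      have k1 : (T^2-4*M) * PadicInt.toZMod α₀ = 0 := by linear_combination T*h2 - 2*M*h1
      have k2 : (T^2-4*M) * PadicInt.toZMod β₀ = 0 := by linear_combination T*h1 - 2*h2
      rcases mul_eq_zero.1 k1 with k | k
      · exact hd k
      rcases mul_eq_zero.1 k2 with k' | k'
      · exact hd k'
      · tauto
    obtain ⟨z, hz, hz'⟩ := quad_hensel (A := n) (B := t*α₀) (C := α₀^2-c) (z0 := β₀) (by convert h using 2; ring) (by convert h2 using 2)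
    exact ⟨α₀, z, by linear_combination hz, by simp, hz'⟩

lemma unit_norm {t n c : ℤ_[p]} (hd : ‖t^2-4*n‖ = 1) (hc : ‖c‖ = 1) :
    ∃ α β : ℤ_[p], α^2+t*α*β+n*β^2 = c := by
  suffices h : ∃ α₀ β₀ : ℤ_[p], ‖α₀^2+t*α₀*β₀+n*β₀^2-c‖ < 1 by
    obtain ⟨α₀, β₀, h⟩ := h
    have hh : ‖α₀‖ = 1 ∨ ‖β₀‖ = 1 := by
      by_contra hno
      rw [unit_iff, unit_iff] at hno
      push Not at hno
      rw [unit_iff] at hc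
      rw [← toZ_iff] at h
      simp only [map_sub, map_mul, map_add, map_pow, hno.1, hno.2] at h
      apply hc
      linear_combination -h
    obtain ⟨α, β, h, -⟩ := hens hd hh h
    exact ⟨α, β, h⟩
  by_cases h2 : p = 2
  · subst h2
    refine ⟨1, 0, ?_⟩
    rw [unit_iff] at hc
    rw [← toZ_iff]
    simp only [map_sub, map_mul, map_add, map_pow, map_one, map_zero]
    generalize PadicInt.toZMod c = c' at *
    clear hd
    rw [z2key _ hc]; ring
  · have hodd : Fact (Nat.Prime p) := hp
    have hs : Function.Surjective (PadicInt.toZMod : ℤ_[p] →+* ZMod p) := ZMod.ringHom_surjective _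
    have h20 : (2 : ZMod p) ≠ 0 := by
      intro h
      have : (p : ℕ) ∣ 2 := (ZMod.natCast_eq_zero_iff 2 p).1 (by exact_mod_cast h)
      exact h2 ((Nat.prime_dvd_prime_iff_eq hp.out Nat.prime_two).1 this)
    have hd' : PadicInt.toZMod t ^ 2 - 4 * PadicInt.toZMod n ≠ 0 := by
      rw [unit_iff] at hd; simpa only [map_sub, map_mul, map_pow, map_ofNat] using hd
    set T := PadicInt.toZMod t
    set M := PadicInt.toZMod n
    set c' := PadicInt.toZMod c
    obtain ⟨u, w, huw⟩ := FiniteField.exists_root_sum_quadratic (R := ZMod p)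
      (f := Polynomial.X^2 - Polynomial.C (4*c')) (g := Polynomial.C (-(T^2-4*M)) * Polynomial.X^2)
      (by compute_degree!) (by rw [Polynomial.degree_C_mul (neg_ne_zero.2 hd'), Polynomial.degree_X_pow]; rfl) (by rw [ZMod.card]; exact Nat.odd_iff.1 (hp.out.odd_of_ne_two h2))
    simp at huw
    obtain ⟨β₀, hβ⟩ := hs w
    obtain ⟨α₀, hα⟩ := hs ((u - T*w)/2)
    refine ⟨α₀, β₀, ?_⟩
    rw [← toZ_iff]
    simp only [map_sub, map_mul, map_add, map_pow, hα, hβ]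
    have : (4 : ZMod p) ≠ 0 := by
      have : (4 : ZMod p) = 2 * 2 := by norm_num
      rw [this]; exact mul_ne_zero h20 h20
    apply mul_left_cancel₀ this
    have e : (u - T*w)/2*2 = u - T*w := div_mul_cancel₀ _ h20
    generalize (u - T*w)/2 = q at *
    have e' : u = q * 2 + T * w := by rw [e]; ring
    rw [e'] at huw
    simp only [T, M, c'] at *
    linear_combination huw
end
end Eich
end

section
open scoped BigOperators Matrix RealInnerProductSpace Quaternion
namespace Eich
open Module

section
variable {p : ℕ} [hp : Fact p.Prime] {a b : ℚ_[p]}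

lemma star_smul' (c : ℚ_[p]) (x : ℍ[ℚ_[p],a,b]) : star (c • x) = c • star x := by ext <;> simp

lemma lt_one_le_p {x : ℚ_[p]} (h : ‖x‖ < 1) : ‖x‖ ≤ ‖(p : ℚ_[p])‖ := by
  obtain ⟨x', rfl⟩ : ∃ x' : ℤ_[p], (x' : ℚ_[p]) = x := ⟨⟨x, h.le⟩, rfl⟩
  have h2 : ‖x'‖ < 1 := h
  rw [PadicInt.norm_lt_one_iff_dvd] at h2
  obtain ⟨c, rfl⟩ := h2
  rw [PadicInt.coe_mul, norm_mul, PadicInt.coe_natCast]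
  exact mul_le_of_le_one_right (norm_nonneg _) (PadicInt.norm_le_one c)

/-- the quadratic order generated by x -/
def Sx (x : ℍ[ℚ_[p],a,b]) : Submodule ℤ_[p] ℍ[ℚ_[p],a,b] := sp ![1, x]

lemma mem_Sx {x s : ℍ[ℚ_[p],a,b]} : s ∈ Sx x ↔ ∃ α β : ℚ_[p], ‖α‖ ≤ 1 ∧ ‖β‖ ≤ 1 ∧ s = α • 1 + β • x := by
  constructor
  · intro h
    obtain ⟨c, rfl⟩ := mem_sp.1 h
    exact ⟨c 0, c 1, PadicInt.norm_le_one _, PadicInt.norm_le_one _, by simp⟩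
  · rintro ⟨α, β, h1, h2, rfl⟩
    exact add_mem (smul_mem' h1 (vmem_sp ![1, x] 0)) (smul_mem' h2 (vmem_sp ![1, x] 1))

lemma one_mem_Sx (x : ℍ[ℚ_[p],a,b]) : 1 ∈ Sx x := vmem_sp ![1, x] 0
lemma x_mem_Sx (x : ℍ[ℚ_[p],a,b]) : x ∈ Sx x := vmem_sp ![1, x] 1

structure Std (Λ : Submodule ℤ_[p] ℍ[ℚ_[p],a,b]) (x y : ℍ[ℚ_[p],a,b]) : Prop where
  eq : Λ = sp (stdv x y)
  perp : Perp x y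
  tcx : ‖tc x‖ ≤ 1
  nmx : ‖nm x‖ ≤ 1
  d : ‖dsc x‖ = 1
  ny : nm y ≠ 0
  nyi : ‖nm y‖ ≤ 1

variable {Λ : Submodule ℤ_[p] ℍ[ℚ_[p],a,b]} {x y : ℍ[ℚ_[p],a,b]}

lemma Sx_mul (ht : ‖tc x‖ ≤ 1) (hn : ‖nm x‖ ≤ 1) {s t} (hs : s ∈ Sx x) (ht' : t ∈ Sx x) : s * t ∈ Sx x := by
  obtain ⟨α, β, h1, h2, rfl⟩ := mem_Sx.1 hs
  obtain ⟨γ, δ, h3, h4, rfl⟩ := mem_Sx.1 ht'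
  rw [it] at *
  refine mem_Sx.2 ⟨α*γ - β*δ*nm x, α*δ+β*γ+β*δ*tc x, it.2 ?_, it.2 ?_, ?_⟩
  · exact sub_mem (mul_mem h1 h3) (mul_mem (mul_mem h2 h4) hn)
  · exact add_mem (add_mem (mul_mem h1 h4) (mul_mem h2 h3)) (mul_mem (mul_mem h2 h4) ht)
  · simp only [add_mul, mul_add, smul_mul_assoc, mul_smul_comm, one_mul, mul_one, sq_eq', smul_sub, smul_smul, add_smul, sub_smul]
    module

lemma Sx_star (ht : ‖tc x‖ ≤ 1) {s} (hs : s ∈ Sx x) : star s ∈ Sx x := by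
  obtain ⟨α, β, h1, h2, rfl⟩ := mem_Sx.1 hs
  rw [it] at *
  refine mem_Sx.2 ⟨α + β * tc x, -β, it.2 (add_mem h1 (mul_mem h2 ht)), it.2 (neg_mem h2), ?_⟩
  rw [star_add, star_smul', star_smul', star_one, star_eq' x]
  module

lemma Perp.mulS (h : Perp x y) {s} (hs : s ∈ Sx x) : y * s = star s * y := by
  obtain ⟨α, β, h1, h2, rfl⟩ := mem_Sx.1 hs
  rw [star_add, star_smul', star_smul', star_one, mul_add, add_mul, mul_smul_comm, mul_smul_comm, h.mul, smul_mul_assoc, smul_mul_assoc]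
  simp

lemma mem_std : ∀ {x y z : ℍ[ℚ_[p],a,b]}, z ∈ sp (stdv x y) ↔ ∃ s ∈ Sx x, ∃ t ∈ Sx x, z = s + t * y := by
  intro x y z
  constructor
  · intro h
    obtain ⟨α, β, γ, δ, h1, h2, h3, h4, rfl⟩ := mem_stdv h
    refine ⟨_, mem_Sx.2 ⟨α, β, h1, h2, rfl⟩, _, mem_Sx.2 ⟨γ, δ, h3, h4, rfl⟩, ?_⟩
    rw [add_mul, smul_mul_assoc, smul_mul_assoc, one_mul]; abel
  · rintro ⟨s, hs, t, ht, rfl⟩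
    obtain ⟨α, β, h1, h2, rfl⟩ := mem_Sx.1 hs
    obtain ⟨γ, δ, h3, h4, rfl⟩ := mem_Sx.1 ht
    rw [add_mul, smul_mul_assoc, smul_mul_assoc, one_mul, ← add_assoc]
    exact stdv_mem h1 h2 h3 h4

lemma Std.mem (h : Std Λ x y) {z} : z ∈ Λ ↔ ∃ s ∈ Sx x, ∃ t ∈ Sx x, z = s + t * y := by rw [h.eq, mem_std]

lemma Std.S_le (h : Std Λ x y) {s} (hs : s ∈ Sx x) : s ∈ Λ := h.mem.2 ⟨s, hs, 0, zero_mem _, by simp⟩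
lemma Std.one_mem (h : Std Λ x y) : 1 ∈ Λ := h.S_le (one_mem_Sx x)
lemma Std.x_mem (h : Std Λ x y) : x ∈ Λ := h.S_le (x_mem_Sx x)
lemma Std.y_mem (h : Std Λ x y) : y ∈ Λ := h.mem.2 ⟨0, zero_mem _, 1, one_mem_Sx x, by simp⟩

lemma Perp.sq (h : Perp x y) : y * y = - (nm y • (1 : ℍ[ℚ_[p],a,b])) := by
  rw [sq_eq', ← bl_one, h.1]; simp

lemma Std.mul (h : Std Λ x y) {z w} (hz : z ∈ Λ) (hw : w ∈ Λ) : z * w ∈ Λ := by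
  obtain ⟨s, hs, t, ht, rfl⟩ := h.mem.1 hz
  obtain ⟨s', hs', t', ht', rfl⟩ := h.mem.1 hw
  have M := fun {s t} => Sx_mul (s := s) (t := t) h.tcx h.nmx
  refine h.mem.2 ⟨s * s' - nm y • (t * star t'), sub_mem (M hs hs') (smul_mem' h.nyi (M ht (Sx_star h.tcx ht'))),
    s * t' + t * star s', add_mem (M hs ht') (M ht (Sx_star h.tcx hs')), ?_⟩
  have e1 : t * y * s' = t * star s' * y := by rw [mul_assoc, h.perp.mulS hs', mul_assoc]
  have e2 : t * y * (t' * y) = - (nm y • (t * star t')) := by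
    rw [mul_assoc, ← mul_assoc y, h.perp.mulS ht', mul_assoc, h.perp.sq, mul_neg, mul_neg, mul_smul_comm, mul_one, mul_smul_comm]
  rw [add_mul, mul_add, mul_add, e1, e2, add_mul, mul_assoc s]
  abel

lemma blS (h : Perp x y) {s t} (hs : s ∈ Sx x) (ht : t ∈ Sx x) : bl s (t * y) = 0 := by
  obtain ⟨α, β, h1, h2, rfl⟩ := mem_Sx.1 hs
  obtain ⟨γ, δ, h3, h4, rfl⟩ := mem_Sx.1 ht
  simp [add_mul, bl_add_left, bl_add_right, bl_smul_left, bl_smul_right, h.1, h.2, h.xmul.1, h.xmul.2]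

lemma nm_Sx (α β : ℚ_[p]) : nm (α • 1 + β • x) = α^2 + tc x * α * β + nm x * β^2 := by
  rw [nm_add, nm_smul, nm_smul, nm_one, bl_smul_left, bl_smul_right, bl_one]; ring

lemma nm_std (h : Perp x y) {s t} (hs : s ∈ Sx x) (ht : t ∈ Sx x) : nm (s + t * y) = nm s + nm t * nm y := by
  rw [nm_add, blS h hs ht, nm_mul, add_zero]

lemma Sx_int (ht : ‖tc x‖ ≤ 1) (hn : ‖nm x‖ ≤ 1) {s} (hs : s ∈ Sx x) : ‖nm s‖ ≤ 1 := by
  obtain ⟨α, β, h1, h2, rfl⟩ := mem_Sx.1 hs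
  rw [nm_Sx]
  rw [it] at *
  exact add_mem (add_mem (pow_mem h1 2) (mul_mem (mul_mem ht h1) h2)) (mul_mem hn (pow_mem h2 2))

lemma Std.int (h : Std Λ x y) {z} (hz : z ∈ Λ) : ‖nm z‖ ≤ 1 := by
  obtain ⟨s, hs, t, ht, rfl⟩ := h.mem.1 hz
  rw [nm_std h.perp hs ht]
  exact it.2 (add_mem (it.1 (Sx_int h.tcx h.nmx hs)) (mul_mem (it.1 (Sx_int h.tcx h.nmx ht)) (it.1 h.nyi)))

lemma Std.blint (h : Std Λ x y) {z w} (hz : z ∈ Λ) (hw : w ∈ Λ) : ‖bl z w‖ ≤ 1 := bl_int (fun _ h' => h.int h') hz hw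
lemma Std.tcint (h : Std Λ x y) {z} (hz : z ∈ Λ) : ‖tc z‖ ≤ 1 := by rw [← bl_one]; exact h.blint h.one_mem hz
lemma Std.star (h : Std Λ x y) {z} (hz : z ∈ Λ) : star z ∈ Λ := by
  rw [star_eq']; exact sub_mem (smul_mem' (h.tcint hz) h.one_mem) hz
lemma Std.iv (h : Std Λ x y) {z} (hz : z ∈ Λ) (hn : ‖nm z‖ = 1) : iv z ∈ Λ := by
  rw [Eich.iv]; exact smul_mem' (by rw [norm_inv, hn, inv_one]) (h.star hz)

lemma Std.unit (h : Std Λ x y) {c : ℚ_[p]} (hc : ‖c‖ = 1) : ∃ s ∈ Sx x, nm s = c := by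
  obtain ⟨α, β, e⟩ := unit_norm (t := ⟨tc x, h.tcx⟩) (n := ⟨nm x, h.nmx⟩) (c := ⟨c, hc.le⟩) h.d hc
  refine ⟨_, mem_Sx.2 ⟨α, β, PadicInt.norm_le_one _, PadicInt.norm_le_one _, rfl⟩, ?_⟩
  rw [nm_Sx]
  have := congrArg (fun x : ℤ_[p] => (x : ℚ_[p])) e
  simp only [PadicInt.coe_add, PadicInt.coe_mul, PadicInt.coe_pow] at this
  exact this

lemma Std.det (h : Std Λ x y) : ‖(Gm (stdv x y)).det‖ = ‖nm y‖^2 := by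
  rw [det_std h.perp, norm_pow, norm_mul, h.d, one_mul]
lemma Std.det_ne (h : Std Λ x y) : (Gm (stdv x y)).det ≠ 0 := by
  rw [← norm_ne_zero_iff, h.det]; exact pow_ne_zero _ (norm_ne_zero_iff.2 h.ny)

/-- if xy lies in it, the lattice of LST is standard -/
lemma std_of {v : Fin 4 → ℍ[ℚ_[p],a,b]} {x} (h1 : 1 ∈ sp v) (hintg : ∀ z ∈ sp v, ‖nm z‖ ≤ 1) (hdet : (Gm v).det ≠ 0) (hx : x ∈ sp v)
    (hd : ‖dsc x‖ = 1) (hxy : ∀ y ∈ sp v, Perp x y → x * y ∈ sp v) : ∃ y, Std (sp v) x y := by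
  obtain ⟨y, hy, hP, hny, hle⟩ := LST h1 hintg hdet hx hd
  refine ⟨y, le_antisymm hle ?_, hP, ?_, hintg x hx, hd, hny, hintg y hy⟩
  · apply sp_le
    intro i
    fin_cases i
    · exact h1
    · exact hx
    · exact hy
    · exact hxy y hy hP
  · rw [← bl_one]; exact bl_int hintg h1 hx

lemma Std.det_eq {v : Fin 4 → ℍ[ℚ_[p],a,b]} (h : Std (sp v) x y) : ‖(Gm v).det‖ = ‖nm y‖^2 := by
  rw [← h.det]
  apply le_antisymm
  · apply det_le; intro i; rw [← h.eq]; exact vmem_sp v i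
  · apply det_le; intro i; rw [h.eq]; exact vmem_sp _ i

/-- order case -/
lemma std_order {v : Fin 4 → ℍ[ℚ_[p],a,b]} {x} (h1 : 1 ∈ sp v) (hintg : ∀ z ∈ sp v, ‖nm z‖ ≤ 1) (hdet : (Gm v).det ≠ 0) (hx : x ∈ sp v)
    (hd : ‖dsc x‖ = 1) (hm : ∀ z ∈ sp v, z * star x ∈ sp v) : ∃ y, Std (sp v) x y := by
  refine std_of h1 hintg hdet hx hd fun y hy hP => ?_
  rw [← hP.mul']; exact hm y hy

/-- level case -/
lemma std_level {v : Fin 4 → ℍ[ℚ_[p],a,b]} {x} (h1 : 1 ∈ sp v) (hintg : ∀ z ∈ sp v, ‖nm z‖ ≤ 1) (hx : x ∈ sp v)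
    (hd : ‖dsc x‖ = 1) (ε : ℝ) (hdet : ‖(Gm v).det‖ = ε^2) (hε : ε = 1 ∨ (ε = ‖(p : ℚ_[p])‖ ∧
      ∀ w, (∀ m ∈ sp v, ‖bl w m‖ ≤ ε) → ‖nm w‖ ≤ ε)) : ∃ y, Std (sp v) x y := by
  have hp1 : ‖(p : ℚ_[p])‖ < 1 := Padic.norm_p_lt_one
  have hp0 : 0 < ‖(p : ℚ_[p])‖ := norm_pos_iff.2 (by exact_mod_cast hp.out.ne_zero)
  have hε0 : 0 < ε := by rcases hε with h | h
                         · rw [h]; exact one_pos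
                         · rw [h.1]; exact hp0
  have hdet0 : (Gm v).det ≠ 0 := by
    rw [← norm_ne_zero_iff, hdet]; positivity
  obtain ⟨y, hy, hP, hny, hle⟩ := LST h1 hintg hdet0 hx hd
  have ht : ‖tc x‖ ≤ 1 := by rw [← bl_one]; exact bl_int hintg h1 hx
  have hS : Std (sp (stdv x y)) x y := ⟨rfl, hP, ht, hintg x hx, hd, hny, hintg y hy⟩
  have hdl : ε^2 ≤ ‖nm y‖^2 := by
    rw [← hdet, ← hS.det]; apply det_le; intro i; exact hle (vmem_sp v i)
  have hεy : ε ≤ ‖nm y‖ := by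
    exact (pow_le_pow_iff_left₀ hε0.le (norm_nonneg _) two_ne_zero).1 hdl
  suffices h : ‖nm y‖ = ε by
    have : sp v = sp (stdv x y) := sp_eq_of_det (fun i => hle (vmem_sp v i)) (by rw [hdet, hS.det, h]) hdet0
    rw [this]; exact ⟨y, hS⟩
  apply le_antisymm _ hεy
  rcases hε with h | ⟨h, hlev⟩
  · rw [h]; exact hintg y hy
  · by_contra hlt
    push Not at hlt
    have hny1 : ‖nm y‖ = 1 := by
      by_contra hne
      have h2 : ‖nm y‖ < 1 := lt_of_le_of_ne (hintg y hy) hne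
      have h3 := lt_one_le_p h2
      linarith
    by_cases hxy : ∀ y ∈ sp v, Perp x y → x * y ∈ sp v
    · have hall : sp v = sp (stdv x y) := by
        refine le_antisymm hle (sp_le fun i => ?_)
        fin_cases i
        · exact h1
        · exact hx
        · exact hy
        · exact hxy y hy hP
      have hS' : Std (sp v) x y := by rw [hall]; exact hS
      have := hS'.det_eq
      rw [hdet, hny1] at this
      nlinarith
    · have hxy' : x * y ∉ sp v := by
        intro hmem
        apply hxy
        intro w hw hwP
        obtain ⟨s, hs, t, ht', e⟩ := mem_std.1 (hle hw)
        have hall : sp v = sp (stdv x y) := by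
          refine le_antisymm hle (sp_le fun i => ?_)
          fin_cases i
          · exact h1
          · exact hx
          · exact hy
          · exact hmem
        rw [hall] at hw ⊢
        exact hS.mul hS.x_mem hw
      have hdl' : ∀ m ∈ sp v, ∃ s ∈ Sx x, ∃ γ δ : ℚ_[p], ‖γ‖ ≤ 1 ∧ ‖δ‖ ≤ ‖(p : ℚ_[p])‖ ∧ m = s + γ • y + δ • (x * y) := by
        intro m hm
        obtain ⟨α, β, γ, δ, h1', h2', h3', h4', e⟩ := mem_stdv (hle hm)
        refine ⟨_, mem_Sx.2 ⟨α, β, h1', h2', rfl⟩, γ, δ, h3', ?_, e⟩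
        by_contra hδ
        push Not at hδ
        have hδ1 : ‖δ‖ = 1 := by
          by_contra hne
          have h2 : ‖δ‖ < 1 := lt_of_le_of_ne h4' hne
          have h3 := lt_one_le_p h2
          linarith
        apply hxy'
        have hδ0 : δ ≠ 0 := by rw [← norm_ne_zero_iff, hδ1]; exact one_ne_zero
        have : x * y = δ⁻¹ • (m - α • 1 - β • x - γ • y) := by
          rw [e]
          have : α • (1 : ℍ[ℚ_[p],a,b]) + β • x + γ • y + δ • (x * y) - α • 1 - β • x - γ • y = δ • (x * y) := by abel
          rw [this, smul_smul, inv_mul_cancel₀ hδ0, one_smul]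
        rw [this]
        exact smul_mem' (by rw [norm_inv, hδ1, inv_one]) (sub_mem (sub_mem (sub_mem hm (smul_mem' h1' h1)) (smul_mem' h2' hx)) (smul_mem' h3' hy))
      have hw := hlev ((2 : ℚ_[p]) • (x * y) - tc x • y) ?_
      · have hn : nm ((2 : ℚ_[p]) • (x * y) - tc x • y) = - dsc x * nm y := by
          have h5 : bl (x * y) y = tc x * nm y := by
            have := bl_mul_right x 1 y
            rwa [one_mul, bl_comm x 1, bl_one] at this
          rw [nm_sub, nm_smul, nm_smul, nm_mul, bl_smul_left, bl_smul_right, h5, dsc]; ring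
        rw [hn, norm_mul, norm_neg, hd, hny1, h] at hw
        linarith
      · intro m hm
        obtain ⟨s, hs, γ, δ, h3', h4', e⟩ := hdl' m hm
        have h5 : bl (x * y) y = tc x * nm y := by
          have := bl_mul_right x 1 y
          rwa [one_mul, bl_comm x 1, bl_one] at this
        have e1 : bl (x * y) s = 0 := by rw [bl_comm]; exact blS hP hs (x_mem_Sx x)
        have e2 : bl y s = 0 := by
          have := blS hP hs (one_mem_Sx x)
          rwa [one_mul, bl_comm] at this
        have : bl ((2 : ℚ_[p]) • (x * y) - tc x • y) m = δ * (- dsc x * nm y) := by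
          rw [e]
          simp only [bl_sub_left, bl_add_right, bl_smul_left, bl_smul_right, h5, e1, e2, bl_self, nm_mul, bl_comm y (x * y), dsc]
          ring
        rw [this, norm_mul, norm_mul, norm_neg, hd, hny1, h]; simpa using h4'
end
end Eich
end

section
open scoped BigOperators Matrix RealInnerProductSpace Quaternion
namespace Eich
open Module

section
variable {p : ℕ} [hp : Fact p.Prime] {a b : ℚ_[p]}
variable {Λ Λ' : Submodule ℤ_[p] ℍ[ℚ_[p],a,b]} {x y x' y' e e' : ℍ[ℚ_[p],a,b]}

def SIso (x : ℍ[ℚ_[p],a,b]) : Prop := ∃ α β : ℚ_[p], ‖α‖ ≤ 1 ∧ ‖β‖ ≤ 1 ∧ (‖α‖ = 1 ∨ ‖β‖ = 1) ∧ ‖nm (α • 1 + β • x)‖ < 1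

lemma exists_Z {x : ℚ_[p]} (h : ‖x‖ ≤ 1) : ∃ x' : ℤ_[p], (x' : ℚ_[p]) = x := ⟨⟨x, h⟩, rfl⟩

lemma Sx_le (h : Std Λ x y) {α β : ℚ_[p]} (h1 : ‖α‖ ≤ 1) (h2 : ‖β‖ ≤ 1) : α • 1 + β • x ∈ Λ := h.S_le (mem_Sx.2 ⟨α, β, h1, h2, rfl⟩)

lemma iso_idem (h : Std Λ x y) (hs : SIso x) : ∃ e ∈ Λ, nm e = 0 ∧ tc e = 1 := by
  obtain ⟨α₀, β₀, h1, h2, h3, h4⟩ := hs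
  obtain ⟨α₀, rfl⟩ := exists_Z h1
  obtain ⟨β₀, rfl⟩ := exists_Z h2
  obtain ⟨t, ht⟩ := exists_Z h.tcx
  obtain ⟨n, hn⟩ := exists_Z h.nmx
  have hd : ‖t^2-4*n‖ = 1 := by
    have := h.d
    rw [dsc, ← ht, ← hn] at this
    exact_mod_cast this
  rw [nm_Sx, ← ht, ← hn] at h4
  have h4' : ‖α₀^2+t*α₀*β₀+n*β₀^2-0‖ < 1 := by rw [sub_zero]; exact_mod_cast h4
  obtain ⟨α, β, e1, e2, e3⟩ := hens hd (by exact_mod_cast h3) h4'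
  have hprim : ‖α‖ = 1 ∨ ‖β‖ = 1 := by
    simp only [unit_iff] at *
    have q1 : PadicInt.toZMod α = PadicInt.toZMod α₀ := by
      rw [← sub_eq_zero, ← map_sub, toZ_iff]; exact e2
    have q2 : PadicInt.toZMod β = PadicInt.toZMod β₀ := by
      rw [← sub_eq_zero, ← map_sub, toZ_iff]; exact e3
    rw [q1, q2]
    rcases h3 with h3 | h3
    · left; exact unit_iff.1 (by exact_mod_cast h3)
    · right; exact unit_iff.1 (by exact_mod_cast h3)
  have hβ : ‖β‖ = 1 := by
    rcases hprim with h5 | h5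
    · rw [unit_iff] at *
      intro h6
      have := congrArg PadicInt.toZMod e1
      simp [h6] at this
      exact h5 this
    · exact h5
  have htc : ‖2*α+t*β‖ = 1 := by
    have e4 : (2*α+t*β)^2 = (t^2-4*n)*β^2 := by linear_combination 4 * e1
    have : ‖2*α+t*β‖^2 = 1 := by rw [← norm_pow, e4, norm_mul, hd, norm_pow, hβ]; norm_num
    exact (pow_eq_one_iff_of_nonneg (norm_nonneg _) two_ne_zero).1 this
  set s : ℍ[ℚ_[p],a,b] := (α : ℚ_[p]) • 1 + (β : ℚ_[p]) • x with hs
  have hsΛ : s ∈ Λ := Sx_le h (PadicInt.norm_le_one _) (PadicInt.norm_le_one _)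
  have htcs : tc s = ((2*α+t*β : ℤ_[p]) : ℚ_[p]) := by
    rw [hs, tc_add, tc_smul, tc_smul, tc_one, ← ht, PadicInt.coe_add, PadicInt.coe_mul, PadicInt.coe_mul]
    have : ((2 : ℤ_[p]) : ℚ_[p]) = 2 := map_ofNat PadicInt.Coe.ringHom 2
    rw [this]; ring
  have hn1 : ‖tc s‖ = 1 := by rw [htcs]; exact htc
  have hne : tc s ≠ 0 := by rw [← norm_ne_zero_iff, hn1]; exact one_ne_zero
  refine ⟨(tc s)⁻¹ • s, smul_mem' (by rw [norm_inv, hn1, inv_one]) hsΛ, ?_, ?_⟩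
  · rw [nm_smul, hs, nm_Sx, ← ht, ← hn]
    have : (α:ℚ_[p])^2 + t * α * β + n * β^2 = 0 := by exact_mod_cast congrArg (fun x : ℤ_[p] => (x : ℚ_[p])) e1
    rw [this, mul_zero]
  · rw [tc_smul, inv_mul_cancel₀ hne]

lemma unit_idem (h : Std Λ x y) (hy : ‖nm y‖ = 1) : ∃ e ∈ Λ, nm e = 0 ∧ tc e = 1 := by
  obtain ⟨s, hs, hns⟩ := h.unit (c := -(nm y)⁻¹) (by rw [norm_neg, norm_inv, hy, inv_one])
  have key : ∀ x'' ∈ Sx x, ‖tc x''‖ = 1 → ∃ e ∈ Λ, nm e = 0 ∧ tc e = 1 := by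
    intro x'' hx'' htc
    have hne : tc x'' ≠ 0 := by rw [← norm_ne_zero_iff, htc]; exact one_ne_zero
    refine ⟨(tc x'')⁻¹ • (x'' * (1 + s * y)), smul_mem' (by rw [norm_inv, htc, inv_one])
      (h.mul (h.S_le hx'') (add_mem h.one_mem (h.mul (h.S_le hs) h.y_mem))), ?_, ?_⟩
    · rw [nm_smul, nm_mul, nm_std h.perp (one_mem_Sx x) hs, nm_one, hns, neg_mul, inv_mul_cancel₀ h.ny]; ring
    · rw [tc_smul, mul_add, mul_one, tc_add, ← mul_assoc, ← bl_one (x'' * s * y), blS h.perp (one_mem_Sx x) (Sx_mul h.tcx h.nmx hx'' hs),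
        add_zero, inv_mul_cancel₀ hne]
  by_cases h1 : ‖tc x‖ = 1
  · exact key x (x_mem_Sx x) h1
  · refine key (1 + x) (add_mem (one_mem_Sx x) (x_mem_Sx x)) ?_
    rw [tc_add, tc_one]
    obtain ⟨t, ht⟩ := exists_Z h.tcx
    obtain ⟨n, hn⟩ := exists_Z h.nmx
    have hd : ‖t^2-4*n‖ = 1 := by
      have := h.d
      rw [dsc, ← ht, ← hn] at this
      exact_mod_cast this
    rw [← ht] at h1 ⊢
    have h1' : ¬ ‖t‖ = 1 := h1
    have : ‖2 + t‖ = 1 := by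
      rw [unit_iff] at *
      rw [not_not] at h1'
      intro h2
      apply hd
      rw [map_add, h1', add_zero] at h2
      have h4 : (4 : ℤ_[p]) = 2 * 2 := by norm_num
      rw [map_sub, map_pow, map_mul, h1', h4, map_mul, h2]; simp
    exact_mod_cast this

lemma aniso_norm (h : Std Λ x y) (hs : ¬ SIso x) (α β : ℚ_[p]) : ‖nm (α • 1 + β • x)‖ = (max ‖α‖ ‖β‖)^2 := by
  have key : ∀ c : ℚ_[p], c ≠ 0 → ‖α‖ ≤ ‖c‖ → ‖β‖ ≤ ‖c‖ → (‖α‖ = ‖c‖ ∨ ‖β‖ = ‖c‖) → ‖nm (α • 1 + β • x)‖ = ‖c‖^2 := by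
    intro c hc h1 h2 h3
    have hc' : 0 < ‖c‖ := norm_pos_iff.2 hc
    have e1 : α • 1 + β • x = c • ((α / c) • 1 + (β / c) • x) := by
      rw [smul_add, smul_smul, smul_smul, mul_div_cancel₀ _ hc, mul_div_cancel₀ _ hc]
    have hα : ‖α / c‖ ≤ 1 := by rw [norm_div]; exact div_le_one_of_le₀ h1 hc'.le
    have hβ : ‖β / c‖ ≤ 1 := by rw [norm_div]; exact div_le_one_of_le₀ h2 hc'.le
    have h4 : ‖nm ((α / c) • 1 + (β / c) • x)‖ = 1 := by
      apply le_antisymm (h.int (Sx_le h hα hβ))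
      by_contra hlt
      push Not at hlt
      apply hs
      refine ⟨_, _, hα, hβ, ?_, hlt⟩
      rw [norm_div, norm_div, div_eq_one_iff_eq hc'.ne', div_eq_one_iff_eq hc'.ne']; exact h3
    rw [e1, nm_smul, norm_mul, h4, norm_pow, mul_one]
  rcases le_total ‖α‖ ‖β‖ with hl | hl
  · rw [max_eq_right hl]
    by_cases h0 : β = 0
    · subst h0
      have : α = 0 := by simpa using hl
      subst this; simp [nm_zero]
    · exact key β h0 hl le_rfl (Or.inr rfl)
  · rw [max_eq_left hl]
    by_cases h0 : α = 0
    · subst h0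
      have : β = 0 := by simpa using hl
      subst this; simp [nm_zero]
    · exact key α h0 le_rfl hl (Or.inl rfl)

lemma par {c d : ℚ_[p]} (hc : c ≠ 0 ∨ d ≠ 0) : ‖c‖^2 ≠ ‖d‖^2 * ‖(p : ℚ_[p])‖ := by
  intro h
  have hp1 : (1:ℝ) < p := by exact_mod_cast hp.out.one_lt
  have hpp : (p : ℝ) ≠ 0 := by positivity
  have hp0 : ‖(p : ℚ_[p])‖ ≠ 0 := by rw [Padic.norm_p]; exact inv_ne_zero hpp
  have hc0 : c ≠ 0 := by
    rintro rfl
    simp [hp0] at h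
    rcases hc with hc | hc
    · exact hc rfl
    · apply hc
      rcases h with h | h
      · exact h
      · exact absurd h (hp.out.ne_zero)
  have hd0 : d ≠ 0 := by
    rintro rfl
    simp at h; exact hc0 h
  rw [Padic.norm_eq_zpow_neg_valuation hc0, Padic.norm_eq_zpow_neg_valuation hd0, Padic.norm_p, ← zpow_natCast, ← zpow_natCast, ← zpow_mul, ← zpow_mul,
    ← zpow_neg_one, ← zpow_add₀ hpp] at h
  have := zpow_right_injective₀ (by positivity) hp1.ne' h
  push_cast at this
  omega

lemma max_norm (α β : ℚ_[p]) : ∃ c : ℚ_[p], max ‖α‖ ‖β‖ = ‖c‖ ∧ (c = 0 → α = 0 ∧ β = 0) := by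
  rcases le_total ‖α‖ ‖β‖ with hl | hl
  · refine ⟨β, max_eq_right hl, ?_⟩
    rintro rfl
    simpa using hl
  · refine ⟨α, max_eq_left hl, ?_⟩
    rintro rfl
    simpa using hl

lemma Std.d0 (h : Std Λ x y) : dsc x ≠ 0 := by rw [← norm_ne_zero_iff, h.d]; exact one_ne_zero

lemma le_one_of_sq {d : ℚ_[p]} (h : ‖d‖^2 * ‖(p : ℚ_[p])‖ ≤ 1) : ‖d‖ ≤ 1 := by
  by_contra hlt
  push Not at hlt
  have hd0 : d ≠ 0 := by rintro rfl; simp at hlt; linarith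
  have h1 : ‖d⁻¹‖ < 1 := by rw [norm_inv]; exact inv_lt_one_of_one_lt₀ hlt
  have h2 := lt_one_le_p h1
  rw [norm_inv] at h2
  have h3 : 0 < ‖d‖ := by linarith
  have : ‖d‖^2 * ‖d‖⁻¹ ≤ 1 := le_trans (mul_le_mul_of_nonneg_left h2 (by positivity)) h
  rw [pow_two, mul_assoc, mul_inv_cancel₀ h3.ne'] at this
  linarith

lemma decomp (h : Std Λ x y) (z : ℍ[ℚ_[p],a,b]) : ∃ α β γ δ : ℚ_[p], z = α • 1 + β • x + γ • y + δ • (x * y) := by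
  obtain ⟨γ, δ, e, -, -⟩ := perp_line h.d0 h.perp h.ny (perp_proj h.d0 z)
  refine ⟨pα x z, pβ x z, γ, δ, ?_⟩
  rw [add_assoc, ← e]; abel

lemma nm_decomp (h : Perp x y) (α β γ δ : ℚ_[p]) : nm (α • 1 + β • x + γ • y + δ • (x * y)) = nm (α • 1 + β • x) + nm (γ • 1 + δ • x) * nm y := by
  have : γ • y + δ • (x * y) = (γ • 1 + δ • x) * y := by simp [add_mul]
  rw [add_assoc, nm_add, this, nm_mul]
  have : bl (α • 1 + β • x) ((γ • 1 + δ • x) * y) = 0 := by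
    simp [add_mul, bl_add_left, bl_add_right, bl_smul_left, bl_smul_right, h.1, h.2, h.xmul.1, h.xmul.2]
  rw [this, add_zero]

lemma aniso_mem (h : Std Λ x y) (hs : ¬ SIso x) (hy : ‖nm y‖ = ‖(p : ℚ_[p])‖) (z : ℍ[ℚ_[p],a,b]) :
    (nm z = 0 → z = 0) ∧ (‖nm z‖ ≤ 1 → z ∈ Λ) := by
  obtain ⟨α, β, γ, δ, rfl⟩ := decomp h z
  obtain ⟨c, hc, hc0⟩ := max_norm α β
  obtain ⟨d, hd, hd0⟩ := max_norm γ δ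
  rw [nm_decomp h.perp]
  have n1 := aniso_norm h hs α β
  have n2 := aniso_norm h hs γ δ
  rw [hc] at n1
  rw [hd] at n2
  have n3 : ‖nm (γ • 1 + δ • x) * nm y‖ = ‖d‖^2 * ‖(p : ℚ_[p])‖ := by rw [norm_mul, n2, hy]
  by_cases h0 : c = 0 ∧ d = 0
  · obtain ⟨rfl, rfl⟩ := hc0 h0.1
    obtain ⟨rfl, rfl⟩ := hd0 h0.2
    simp
  · have hne := par (c := c) (d := d) (by tauto)
    have n4 := Padic.add_eq_max_of_ne (q := nm (α • 1 + β • x)) (r := nm (γ • 1 + δ • x) * nm y) (by rw [n1, n3]; exact hne)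
    constructor
    · intro h1
      exfalso
      rw [h1, n1, n3, norm_zero] at n4
      have h5 : ‖c‖^2 ≤ 0 := by rw [n4]; exact le_max_left _ _
      have h6 : ‖d‖^2 * ‖(p : ℚ_[p])‖ ≤ 0 := by rw [n4]; exact le_max_right _ _
      have h7 : 0 ≤ ‖d‖^2 * ‖(p : ℚ_[p])‖ := by positivity
      have h8 : 0 ≤ ‖c‖^2 := by positivity
      exact hne (by linarith)
    · intro h1
      rw [n4, n1, n3, max_le_iff] at h1
      have h2 : ‖c‖ ≤ 1 := (pow_le_one_iff_of_nonneg (norm_nonneg _) two_ne_zero).1 h1.1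
      have h3 := le_one_of_sq h1.2
      rw [← hc, max_le_iff] at h2
      rw [← hd, max_le_iff] at h3
      rw [h.eq]; exact stdv_mem h2.1 h2.2 h3.1 h3.2

def Dv (p : ℕ) [Fact p.Prime] (a b : ℚ_[p]) : Prop := ∀ z : ℍ[ℚ_[p],a,b], nm z = 0 → z = 0

lemma not_dv {e : ℍ[ℚ_[p],a,b]} (h : nm e = 0) (h' : tc e = 1) : ¬ Dv p a b := by
  intro hd
  have := hd e h
  rw [this] at h'
  simp [tc] at h'

lemma dv_iff (h : Std Λ x y) (hy : ‖nm y‖ = ‖(p : ℚ_[p])‖) : Dv p a b ↔ ¬ SIso x := by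
  constructor
  · intro hd hs
    obtain ⟨e, -, h1, h2⟩ := iso_idem h hs
    exact not_dv h1 h2 hd
  · intro hs z; exact (aniso_mem h hs hy z).1

/-- the split form -/
lemma split_form (h : Std Λ x y) (hy : ‖nm y‖ = 1 ∨ ‖nm y‖ = ‖(p : ℚ_[p])‖) (hd : ¬ Dv p a b) :
    ∃ e y', Std Λ e y' ∧ nm e = 0 ∧ tc e = 1 ∧ ‖nm y'‖ = ‖nm y‖ := by
  obtain ⟨e, he, h1, h2⟩ : ∃ e ∈ Λ, nm e = 0 ∧ tc e = 1 := by
    rcases hy with hy | hy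
    · exact unit_idem h hy
    · rw [dv_iff h hy, not_not] at hd
      exact iso_idem h hd
  have hv := h.eq
  subst hv
  obtain ⟨y', hy'⟩ := std_order h.one_mem (fun z hz => h.int hz) h.det_ne he (by rw [dsc, h1, h2]; simp) (fun z hz => h.mul hz (h.star he))
  refine ⟨e, y', hy', h1, h2, ?_⟩
  have := hy'.det_eq
  rw [h.det] at this
  exact ((pow_left_inj₀ (norm_nonneg _) (norm_nonneg _) two_ne_zero).1 this).symm

lemma conj_mem {n : ℕ} {v : Fin n → ℍ[ℚ_[p],a,b]} {g : ℍ[ℚ_[p],a,b]} (hg : nm g ≠ 0) (z : ℍ[ℚ_[p],a,b]) :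
    z ∈ sp v ↔ g * z * iv g ∈ sp (fun i => g * v i * iv g) := by
  have key : ∀ c : Fin n → ℤ_[p], ∑ i, (c i : ℚ_[p]) • (g * v i * iv g) = g * (∑ i, (c i : ℚ_[p]) • v i) * iv g := by
    intro c
    rw [Finset.mul_sum, Finset.sum_mul]
    simp [mul_smul_comm, smul_mul_assoc]
  rw [mem_sp, mem_sp]
  simp only [key]
  constructor
  · rintro ⟨c, rfl⟩; exact ⟨c, rfl⟩
  · rintro ⟨c, hc⟩
    refine ⟨c, ?_⟩
    have := congrArg (fun w => iv g * w * g) hc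
    simp only [mul_assoc] at this
    simpa [iv_mul hg, iv_mul_mul hg] using this

lemma split_conj (h : Std Λ e y) (he : nm e = 0) (ht : tc e = 1) (h' : Std Λ' e' y') (he' : nm e' = 0) (ht' : tc e' = 1)
    (hy : ‖nm y‖ = ‖nm y'‖) : ∃ g, nm g ≠ 0 ∧ ∀ z, z ∈ Λ' ↔ g * z * iv g ∈ Λ := by
  have se : star e = 1 - e := by rw [star_eq', ht, one_smul]
  have se' : star e' = 1 - e' := by rw [star_eq', ht', one_smul]
  have ee : e * e = e := by rw [sq_eq', he, ht]; simp
  have ee' : e' * e' = e' := by rw [sq_eq', he', ht']; simp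
  have key : ∀ u : ℍ[ℚ_[p],a,b], e * (e * u * e' + star e * u * star e') = (e * u * e' + star e * u * star e') * e' ∧
      nm (e * u * e' + star e * u * star e') = tc (e * u * e' * star u) := by
    intro u
    constructor
    · rw [mul_add, add_mul]
      have a1 : e * (e * u * e') = e * u * e' := by rw [← mul_assoc, ← mul_assoc, ee]
      have a2 : e * (star e * u * star e') = 0 := by rw [← mul_assoc, ← mul_assoc, mul_star_self', he]; simp
      have a3 : e * u * e' * e' = e * u * e' := by rw [mul_assoc, ee']
      have a4 : star e * u * star e' * e' = 0 := by rw [mul_assoc, star_mul_self', he']; simp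
      rw [a1, a2, a3, a4]
    · rw [nm_add]
      simp only [nm_mul, nm_star, he, ← tc_mul_star, star_mul, star_star]
      rw [zero_mul, zero_mul, zero_add, zero_add]
      have : e * u * e' * (e' * (star u * e)) = (e * u * e' * star u) * e := by
        simp only [mul_assoc]; rw [← mul_assoc e' e', ee']
      rw [this, tc_mul_comm]
      simp only [← mul_assoc]; rw [ee]
  have : ∃ g, nm g ≠ 0 ∧ e * g = g * e' := by
    by_cases h1 : tc (e * e') = 0
    · refine ⟨_, ?_, (key y).1⟩
      rw [(key y).2]
      have : e * y = y * star e := h.perp.mul'.symm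
      rw [this, tc_mul_comm, ← mul_assoc, ← mul_assoc, star_mul_self', smul_mul_assoc, smul_mul_assoc, one_mul, tc_smul, se, sub_mul, one_mul, tc_sub, h1, ht']
      simpa using h.ny
    · refine ⟨_, ?_, (key 1).1⟩
      rw [(key 1).2]
      simpa using h1
  obtain ⟨g, hg, hge⟩ := this
  set y'' := g * y' * iv g with hy''
  have hgg : g * iv g = 1 := mul_iv hg
  have hge' : g * e' * iv g = e := by rw [← hge, mul_assoc, hgg, mul_one]
  have cj : ∀ u w : ℍ[ℚ_[p],a,b], bl (g * u * iv g) (g * w * iv g) = bl u w := by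
    intro u w
    rw [bl_mul_right, bl_mul_left, nm_iv]; field_simp
  have hP : Perp e y'' := by
    constructor
    · have := cj 1 y'
      rw [mul_one, hgg, h'.perp.1] at this; exact this
    · have := cj e' y'
      rw [hge', h'.perp.2] at this; exact this
  have hny'' : nm y'' = nm y' := by
    rw [hy'', nm_mul, nm_mul, nm_iv]; field_simp
  obtain ⟨α, β, e1, -, e3⟩ := perp_line h.d0 h.perp h.ny hP
  rw [he, ht, hny''] at e3
  set γ := α + β with hγ
  have hκ : γ * α = nm y' / nm y := by rw [← e3]; ring
  have hκ1 : ‖γ * α‖ = 1 := by rw [hκ, norm_div, hy, div_self]; exact norm_ne_zero_iff.2 h'.ny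
  have hγ0 : γ ≠ 0 := by intro h0; rw [h0] at hκ1; simp at hκ1
  -- h = γ e + ē, h⁻¹ = γ⁻¹ e + ē
  set k : ℍ[ℚ_[p],a,b] := γ • e + (1 - e) with hk
  set k' : ℍ[ℚ_[p],a,b] := γ⁻¹ • e + (1 - e) with hk'
  have kk : k' * k = 1 := by
    rw [hk, hk']; simp only [mul_add, add_mul, mul_sub, sub_mul, smul_mul_assoc, mul_smul_comm, ee, mul_one, one_mul, smul_smul]
    have g1 := mul_inv_cancel₀ hγ0
    linear_combination (norm := module) g1 • e
  have nk : nm k' * nm k = 1 := by rw [← nm_mul, kk, nm_one]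
  have nk' : nm k' ≠ 0 := left_ne_zero_of_mul_eq_one nk
  have ivk : iv k' = k := by
    have := iv_mul_mul nk' k
    rw [kk, mul_one] at this; exact this
  have ke : k' * e = e * k' := by
    rw [hk']; simp only [mul_add, add_mul, mul_sub, sub_mul, smul_mul_assoc, mul_smul_comm, ee, mul_one, one_mul]
  have hye : y * e = (1 - e) * y := by rw [h.perp.mul, se]
  have hG : nm (k' * g) ≠ 0 := by rw [nm_mul]; exact mul_ne_zero nk' hg
  have ivG : iv (k' * g) = iv g * k := by
    have : k' * g * (iv g * k) = 1 := by rw [mul_assoc, mul_iv_mul hg, kk]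
    have h2 := iv_mul_mul hG (iv g * k)
    rw [this, mul_one] at h2; exact h2
  have cG : ∀ z, k' * g * z * iv (k' * g) = k' * (g * z * iv g) * k := by
    intro z; rw [ivG]; simp only [mul_assoc]
  have c1 : k' * g * e' * iv (k' * g) = e := by rw [cG, hge', ke, mul_assoc, kk, mul_one]
  have c2 : k' * g * y' * iv (k' * g) = (γ * α) • y + (1 - γ * α) • (e * y) := by
    rw [cG, ← hy'', e1]
    have hyk : y * k = γ • y + (1 - γ) • (e * y) := by
      rw [hk]; simp only [mul_add, mul_sub, mul_smul_comm, mul_one, hye, sub_mul, one_mul]; module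
    have : (α • y + β • (e * y)) * k = (α * γ) • y + (γ - α * γ) • (e * y) := by
      rw [add_mul, smul_mul_assoc, smul_mul_assoc, mul_assoc, hyk, mul_add, mul_smul_comm, mul_smul_comm, ← mul_assoc, ee, hγ]; module
    rw [mul_assoc, this, hk']
    simp only [mul_add, add_mul, mul_sub, sub_mul, smul_mul_assoc, mul_smul_comm, one_mul, ← mul_assoc, ee, smul_add, smul_smul]
    have g1 : γ⁻¹ * γ = 1 := inv_mul_cancel₀ hγ0
    linear_combination (norm := module) g1 • (e * y)
  set κ := γ * α with hκd
  set Y : ℍ[ℚ_[p],a,b] := κ • y + (1 - κ) • (e * y) with hY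
  have heY : e * Y = e * y := by
    rw [hY, mul_add, mul_smul_comm, mul_smul_comm, ← mul_assoc, ee]; module
  have hPY : Perp e Y := (h.perp.smul κ).add (h.perp.xmul.smul (1 - κ))
  have hnY : nm Y = κ * nm y := by
    have : Y = (κ • 1 + (1 - κ) • e) * y := by rw [hY]; simp [add_mul]
    rw [this, nm_mul, nm_Sx, he, ht]; ring
  have hk1 : ‖1 - κ‖ ≤ 1 := it.2 (sub_mem (one_mem _) (it.1 hκ1.le))
  have hS : Std (sp (stdv e Y)) e Y := ⟨rfl, hPY, h.tcx, h.nmx, h.d, by rw [hnY]; exact mul_ne_zero (by rw [← norm_ne_zero_iff, hκ1]; exact one_ne_zero) h.ny,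
    by rw [hnY, norm_mul, hκ1, one_mul]; exact h.nyi⟩
  have hΛ : Λ = sp (stdv e Y) := by
    rw [h.eq]
    symm
    apply sp_eq_of_det
    · intro i
      fin_cases i
      · exact vmem_sp (stdv e y) 0
      · exact vmem_sp (stdv e y) 1
      · exact add_mem (smul_mem' hκ1.le (vmem_sp (stdv e y) 2)) (smul_mem' hk1 (vmem_sp (stdv e y) 3))
      · change e * Y ∈ _
        rw [heY]; exact vmem_sp (stdv e y) 3
    · rw [hS.det, h.det, hnY, norm_mul, hκ1, one_mul]
    · exact hS.det_ne
  refine ⟨k' * g, hG, fun z => ?_⟩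
  rw [h'.eq, conj_mem hG, hΛ]
  have : (fun i => k' * g * stdv e' y' i * iv (k' * g)) = stdv e Y := by
    funext i
    fin_cases i
    · change k' * g * 1 * iv (k' * g) = 1
      rw [mul_one, mul_iv hG]
    · exact c1
    · exact c2
    · change k' * g * (e' * y') * iv (k' * g) = e * Y
      rw [← c1, ← c2]
      have : iv (k' * g) * (k' * g) = 1 := iv_mul hG
      simp only [mul_assoc] at *
      rw [← mul_assoc (iv (k' * g)) k', ← mul_assoc (iv (k' * g) * k') g]
      rw [mul_assoc (iv (k' * g)) k' g, this, one_mul]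
  rw [this]

lemma local_conj (h : Std Λ x y) (h' : Std Λ' x' y') (hy : ‖nm y‖ = ‖nm y'‖) (hy' : ‖nm y‖ = 1 ∨ ‖nm y‖ = ‖(p : ℚ_[p])‖) :
    ∃ g, nm g ≠ 0 ∧ ∀ z, z ∈ Λ' ↔ g * z * iv g ∈ Λ := by
  by_cases hd : Dv p a b
  · have hyp : ‖nm y‖ = ‖(p : ℚ_[p])‖ := by
      rcases hy' with h1 | h1
      · obtain ⟨e, -, h2, h3⟩ := unit_idem h h1
        exact absurd hd (not_dv h2 h3)
      · exact h1
    have hs := (dv_iff h hyp).1 hd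
    have hs' := (dv_iff h' (hy ▸ hyp)).1 hd
    refine ⟨1, by rw [nm_one]; exact one_ne_zero, fun z => ?_⟩
    have : iv (1 : ℍ[ℚ_[p],a,b]) = 1 := by rw [iv, nm_one]; simp
    rw [this, one_mul, mul_one]
    exact ⟨fun hz => (aniso_mem h hs hyp z).2 (h'.int hz), fun hz => (aniso_mem h' hs' (hy ▸ hyp) z).2 (h.int hz)⟩
  · obtain ⟨e, w, s, s1, s2, s3⟩ := split_form h hy' hd
    obtain ⟨e', w', s', s1', s2', s3'⟩ := split_form h' (hy ▸ hy') hd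
    exact split_conj s s1 s2 s' s1' s2' (by rw [s3, s3', hy])
end
end Eich
end

section
open scoped BigOperators Matrix RealInnerProductSpace Quaternion
namespace Eich
open Module

section
variable {a b : ℚ}
section
variable (K : Type*) [Field K] [CharZero K]

/-- base change of quaternions -/
def bcq (z : ℍ[ℚ,a,b]) : ℍ[K,(a:K),(b:K)] := ⟨z.re, z.imI, z.imJ, z.imK⟩

@[simp] lemma bcq_re (z : ℍ[ℚ,a,b]) : (bcq K z).re = (z.re : K) := rfl
@[simp] lemma bcq_imI (z : ℍ[ℚ,a,b]) : (bcq K z).imI = (z.imI : K) := rfl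
@[simp] lemma bcq_imJ (z : ℍ[ℚ,a,b]) : (bcq K z).imJ = (z.imJ : K) := rfl
@[simp] lemma bcq_imK (z : ℍ[ℚ,a,b]) : (bcq K z).imK = (z.imK : K) := rfl
lemma bcq_add (x y : ℍ[ℚ,a,b]) : bcq K (x + y) = bcq K x + bcq K y := by ext <;> simp
lemma bcq_sub (x y : ℍ[ℚ,a,b]) : bcq K (x - y) = bcq K x - bcq K y := by ext <;> simp
lemma bcq_mul (x y : ℍ[ℚ,a,b]) : bcq K (x * y) = bcq K x * bcq K y := by ext <;> simp
lemma bcq_one : bcq K (1 : ℍ[ℚ,a,b]) = 1 := by ext <;> simp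
lemma bcq_zero : bcq K (0 : ℍ[ℚ,a,b]) = 0 := by ext <;> simp
lemma bcq_star (x : ℍ[ℚ,a,b]) : bcq K (star x) = star (bcq K x) := by ext <;> simp
lemma bcq_smul (q : ℚ) (x : ℍ[ℚ,a,b]) : bcq K (q • x) = (q : K) • bcq K x := by ext <;> simp
lemma bcq_zsmul (q : ℤ) (x : ℍ[ℚ,a,b]) : bcq K (q • x) = (q : K) • bcq K x := by
  rw [← Int.cast_smul_eq_zsmul ℚ, bcq_smul]; simp
lemma bcq_inj {x y : ℍ[ℚ,a,b]} (h : bcq K x = bcq K y) : x = y := by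
  have := QuaternionAlgebra.ext_iff.1 h
  simp at this
  exact QuaternionAlgebra.ext this.1 this.2.1 this.2.2.1 this.2.2.2
lemma nm_bcq (x : ℍ[ℚ,a,b]) : nm (bcq K x) = ((nm x : ℚ) : K) := by simp [nm_coord]
lemma bl_bcq (x y : ℍ[ℚ,a,b]) : bl (bcq K x) (bcq K y) = ((bl x y : ℚ) : K) := by simp [bl_coord]
lemma tc_bcq (x : ℍ[ℚ,a,b]) : tc (bcq K x) = ((tc x : ℚ) : K) := by simp [tc]
lemma iv_bcq (x : ℍ[ℚ,a,b]) : iv (bcq K x) = bcq K (iv x) := by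
  rw [iv, iv, nm_bcq, ← bcq_star, bcq_smul]; simp
def ioH : ℍ[ℚ,a,b] →+ ℍ[K,(a:K),(b:K)] := { toFun := bcq K, map_zero' := bcq_zero K, map_add' := bcq_add K }
lemma bcq_sum {ι : Type*} (s : Finset ι) (f : ι → ℍ[ℚ,a,b]) : bcq K (∑ i ∈ s, f i) = ∑ i ∈ s, bcq K (f i) := map_sum (ioH K) f s
lemma Gm_bcq {n : ℕ} (v : Fin n → ℍ[ℚ,a,b]) : Gm (fun i => bcq K (v i)) = (Gm v).map (fun q : ℚ => (q : K)) := by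
  ext i j; simp [Gm, bl_bcq]
lemma det_bcq {n : ℕ} (v : Fin n → ℍ[ℚ,a,b]) : (Gm (fun i => bcq K (v i))).det = (((Gm v).det : ℚ) : K) := by
  rw [Gm_bcq]; exact ((Rat.castHom K).map_det (Gm v)).symm
lemma det_bcq_ne {n : ℕ} {v : Fin n → ℍ[ℚ,a,b]} (h : (Gm v).det ≠ 0) : (Gm (fun i => bcq K (v i))).det ≠ 0 := by
  rw [det_bcq]; exact_mod_cast h
end

lemma det_ne_of_li {n : ℕ} (hD : ∀ z : ℍ[ℚ,a,b], nm z = 0 → z = 0) {v : Fin n → ℍ[ℚ,a,b]} (h : LinearIndependent ℚ v) : (Gm v).det ≠ 0 := by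
  intro h0
  obtain ⟨c, hc, hc0⟩ := Matrix.exists_mulVec_eq_zero_iff.2 h0
  apply hc
  have hz : ∑ j, c j • v j = 0 := by
    apply hD
    have : bl (∑ j, c j • v j) (∑ j, c j • v j) = 0 := by
      rw [bl_sum_left]
      apply Finset.sum_eq_zero
      intro i _
      rw [bl_smul_left, ← Gm_mulVec, hc0]; simp
    rw [bl_self] at this
    simpa using this
  have := Fintype.linearIndependent_iff.1 h c hz
  funext i; exact this i

/-- expansions in a basis, any field -/
lemma expand {K : Type*} [Field K] {a b : K} {v : Fin 4 → ℍ[K,a,b]} (h : (Gm v).det ≠ 0) (z : ℍ[K,a,b]) : ∃ c : Fin 4 → K, z = ∑ i, c i • v i := by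
  have hli := li_of_det h
  have hsp : Submodule.span K (Set.range v) = ⊤ := hli.span_eq_top_of_card_eq_finrank' (by rw [QuaternionAlgebra.finrank_eq_four]; simp)
  have : z ∈ Submodule.span K (Set.range v) := by rw [hsp]; trivial
  obtain ⟨c, hc⟩ := (Submodule.mem_span_range_iff_exists_fun K).1 this
  exact ⟨c, hc.symm⟩

lemma expand_unique {K : Type*} [Field K] {a b : K} {v : Fin 4 → ℍ[K,a,b]} (h : (Gm v).det ≠ 0) {c d : Fin 4 → K}
    (e : ∑ i, c i • v i = ∑ i, d i • v i) : c = d := by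
  have := Fintype.linearIndependent_iff.1 (li_of_det h) (fun i => c i - d i) (by simp [sub_smul, Finset.sum_sub_distrib, e])
  funext i; exact sub_eq_zero.1 (this i)

lemma int_of_local {c : ℚ} (h : ∀ (p : ℕ) [Fact p.Prime], ‖(c : ℚ_[p])‖ ≤ 1) : ∃ m : ℤ, c = m := by
  by_contra hne
  have hden : c.den ≠ 1 := fun h1 => hne ⟨c.num, ((Rat.den_eq_one_iff c).1 h1).symm⟩
  obtain ⟨p, hp, hpd⟩ := Nat.exists_prime_and_dvd hden
  haveI : Fact p.Prime := ⟨hp⟩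
  have := (Padic.norm_rat_le_one_iff_padicValuation_le_one p).1 (h p)
  exact (Rat.padicValuation_le_one_iff.1 this) hpd

variable (p : ℕ) [hp : Fact p.Prime]

/-- localization of a lattice -/
def lc (M : Submodule ℤ ℍ[ℚ,a,b]) : Submodule ℤ_[p] ℍ[ℚ_[p],(a:ℚ_[p]),(b:ℚ_[p])] := Submodule.span ℤ_[p] (bcq ℚ_[p] '' M)

variable {p}
lemma bcq_mem {M : Submodule ℤ ℍ[ℚ,a,b]} {z} (h : z ∈ M) : bcq ℚ_[p] z ∈ lc p M := Submodule.subset_span ⟨z, h, rfl⟩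

lemma lc_mono {M M' : Submodule ℤ ℍ[ℚ,a,b]} (h : M ≤ M') : lc p M ≤ lc p M' := Submodule.span_mono (Set.image_mono h)

lemma lc_span {n : ℕ} (v : Fin n → ℍ[ℚ,a,b]) : lc p (Submodule.span ℤ (Set.range v)) = sp (fun i => bcq ℚ_[p] (v i)) := by
  apply le_antisymm
  · rw [lc, Submodule.span_le]
    rintro _ ⟨z, hz, rfl⟩
    obtain ⟨c, rfl⟩ := mem_span_range_int hz
    rw [bcq_sum]
    apply sum_mem
    intro i _
    rw [bcq_zsmul]
    exact smul_mem' (Padic.norm_int_le_one _) (vmem_sp _ i)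
  · rw [sp, Submodule.span_le]
    rintro _ ⟨i, rfl⟩
    exact bcq_mem (Submodule.subset_span ⟨i, rfl⟩)

lemma lc_mul {M M' M'' : Submodule ℤ ℍ[ℚ,a,b]} (h : ∀ x ∈ M, ∀ y ∈ M', x * y ∈ M'') {x y} (hx : x ∈ lc p M) (hy : y ∈ lc p M') : x * y ∈ lc p M'' := by
  induction hx using Submodule.span_induction with
  | mem x hx =>
    obtain ⟨x, hx, rfl⟩ := hx
    induction hy using Submodule.span_induction with
    | mem y hy =>
      obtain ⟨y, hy, rfl⟩ := hy
      rw [← bcq_mul]; exact bcq_mem (h x hx y hy)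
    | zero => rw [mul_zero]; exact zero_mem _
    | add y y' _ _ h1 h2 => rw [mul_add]; exact add_mem h1 h2
    | smul c y _ h1 => rw [zsmul_def, mul_smul_comm]; exact Submodule.smul_mem _ c h1
  | zero => rw [zero_mul]; exact zero_mem _
  | add y y' _ _ h1 h2 => rw [add_mul]; exact add_mem h1 h2
  | smul c y _ h1 => rw [zsmul_def, smul_mul_assoc]; exact Submodule.smul_mem _ c h1

lemma mem_of_local {v : Fin 4 → ℍ[ℚ,a,b]} (hdet : (Gm v).det ≠ 0) {z} (h : ∀ (p : ℕ) [Fact p.Prime], bcq ℚ_[p] z ∈ lc p (Submodule.span ℤ (Set.range v))) :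
    z ∈ Submodule.span ℤ (Set.range v) := by
  obtain ⟨c, rfl⟩ := expand hdet z
  have : ∀ i, ∃ m : ℤ, c i = m := by
    intro i
    apply int_of_local
    intro p _
    have h1 := h p
    rw [lc_span, bcq_sum] at h1
    obtain ⟨d, hd⟩ := mem_sp.1 h1
    simp only [bcq_smul] at hd
    have := expand_unique (det_bcq_ne ℚ_[p] hdet) hd
    have h2 : (c i : ℚ_[p]) = d i := (congrFun this i).symm
    rw [h2]; exact PadicInt.norm_le_one _
  choose m hm using this
  apply sum_mem
  intro i _
  rw [hm, Int.cast_smul_eq_zsmul]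
  exact Submodule.smul_mem _ _ (Submodule.subset_span ⟨i, rfl⟩)

lemma norm_q_p (q : ℕ) [hq : Fact q.Prime] (h : q ≠ p) : ‖(p : ℚ_[q])‖ = 1 := by
  rw [Padic.norm_natCast_eq_one_iff]
  exact (Nat.coprime_primes hq.out hp.out).2 h

lemma dense1 (c : ℚ_[p]) (n : ℕ) : ∃ c' : ℚ, ‖(c' : ℚ_[p]) - c‖ ≤ ‖(p : ℚ_[p])‖^n ∧ ∀ (q : ℕ) [Fact q.Prime], q ≠ p → ‖(c' : ℚ_[q])‖ ≤ 1 := by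
  have hp1 : ‖(p : ℚ_[p])‖ < 1 := Padic.norm_p_lt_one
  have hp0 : 0 < ‖(p : ℚ_[p])‖ := norm_pos_iff.2 (by exact_mod_cast hp.out.ne_zero)
  obtain ⟨k, hk⟩ : ∃ k : ℕ, ‖(p : ℚ_[p])^k * c‖ ≤ 1 := by
    by_cases hc : c = 0
    · exact ⟨0, by simp [hc]⟩
    · obtain ⟨k, hk⟩ := exists_pow_lt_of_lt_one (inv_pos.2 (norm_pos_iff.2 hc)) hp1
      refine ⟨k, ?_⟩
      rw [norm_mul, norm_pow]
      have := mul_le_mul_of_nonneg_right hk.le (norm_nonneg c)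
      rwa [inv_mul_cancel₀ (norm_ne_zero_iff.2 hc)] at this
  obtain ⟨C, hC⟩ := exists_Z hk
  have hpp : (p : ℚ_[p]) ≠ 0 := by exact_mod_cast hp.out.ne_zero
  refine ⟨(PadicInt.appr C (n + k) : ℚ) / (p : ℚ)^k, ?_, ?_⟩
  · have h1 := PadicInt.appr_spec (n + k) C
    rw [Ideal.mem_span_singleton] at h1
    obtain ⟨d, hd⟩ := h1
    have h2 : (p : ℚ_[p])^k * c - (PadicInt.appr C (n+k) : ℚ_[p]) = (p : ℚ_[p])^(n+k) * d := by
      rw [← hC]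
      have := congrArg (fun x : ℤ_[p] => (x : ℚ_[p])) hd
      simpa using this
    have h3 : ((((PadicInt.appr C (n + k) : ℚ) / (p : ℚ)^k : ℚ)) : ℚ_[p]) - c = - ((p : ℚ_[p])^n * d) := by
      push_cast
      field_simp
      rw [pow_add] at h2
      linear_combination -h2
    rw [h3, norm_neg, norm_mul, norm_pow]
    exact mul_le_of_le_one_right (by positivity) (PadicInt.norm_le_one d)
  · intro q _ hq
    push_cast
    rw [norm_div, norm_pow, norm_q_p q hq, one_pow, div_one]
    exact_mod_cast Padic.norm_int_le_one (p := q) (PadicInt.appr C (n + k) : ℤ)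

/-- density -/
lemma dense {v : Fin 4 → ℍ[ℚ,a,b]} (hdet : (Gm v).det ≠ 0) (z : ℍ[ℚ_[p],(a:ℚ_[p]),(b:ℚ_[p])]) (n : ℕ) :
    ∃ z' : ℍ[ℚ,a,b], (∃ m ∈ lc p (Submodule.span ℤ (Set.range v)), bcq ℚ_[p] z' - z = (p : ℚ_[p])^n • m) ∧
      ∀ (q : ℕ) [Fact q.Prime], q ≠ p → bcq ℚ_[q] z' ∈ lc q (Submodule.span ℤ (Set.range v)) := by
  obtain ⟨c, rfl⟩ := expand (det_bcq_ne ℚ_[p] hdet) z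
  choose c' hc' hc'' using fun i => dense1 (c i) n
  have hpp : (p : ℚ_[p]) ≠ 0 := by exact_mod_cast hp.out.ne_zero
  refine ⟨∑ i, c' i • v i, ⟨∑ i, (((c' i : ℚ_[p]) - c i) / (p : ℚ_[p])^n) • bcq ℚ_[p] (v i), ?_, ?_⟩, ?_⟩
  · apply sum_mem
    intro i _
    apply smul_mem'
    · rw [norm_div, norm_pow]
      exact div_le_one_of_le₀ (hc' i) (by positivity)
    · exact bcq_mem (Submodule.subset_span ⟨i, rfl⟩)
  · rw [bcq_sum, ← Finset.sum_sub_distrib, Finset.smul_sum]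
    apply Finset.sum_congr rfl
    intro i _
    rw [bcq_smul, smul_smul, mul_div_cancel₀ _ (pow_ne_zero _ hpp), sub_smul]
  · intro q _ hq
    rw [bcq_sum]
    apply sum_mem
    intro i _
    rw [bcq_smul]
    exact smul_mem' (hc'' i q hq) (bcq_mem (Submodule.subset_span ⟨i, rfl⟩))

end
end Eich
end

section
open scoped BigOperators Matrix RealInnerProductSpace Quaternion
namespace Eich
open Module

lemma sqf_pow {N p k : ℕ} (hN : Squarefree N) (hp : p.Prime) (hk : 3 ≤ k) : ¬ (p : ℤ)^k ∣ (N : ℤ)^2 := by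
  intro h
  have h' : p^3 ∣ N^2 := by
    have : (p:ℤ)^3 ∣ (N:ℤ)^2 := (pow_dvd_pow _ hk).trans h
    exact_mod_cast this
  have h1 : p ∣ N := hp.dvd_of_dvd_pow ((dvd_pow_self p (by norm_num)).trans h')
  obtain ⟨m, rfl⟩ := h1
  have h2 : p ∣ m^2 := by
    have : p^2 * p ∣ p^2 * m^2 := by rw [← mul_pow, ← pow_succ]; exact h'
    exact Nat.dvd_of_mul_dvd_mul_left (pow_pos hp.pos 2) this
  obtain ⟨k, rfl⟩ := hp.dvd_of_dvd_pow h2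
  have := hN p ⟨k, by ring⟩
  exact hp.one_lt.ne' (Nat.isUnit_iff.1 this)

lemma lemX {A : Matrix (Fin 4) (Fin 4) ℤ} (hs : A.IsSymm) (hev : ∀ i, 2 ∣ A i i) {N : ℕ} (hN : Squarefree N) (hdet : A.det = (N:ℤ)^2)
    {p : ℕ} [hp : Fact p.Prime] (y : Fin 4 → ℤ) (h2 : p = 2 → ∃ i, ¬ (2:ℤ) ∣ A.mulVec y i) (hy : p ≠ 2 → ¬ (p:ℤ) ∣ y ⬝ᵥ A.mulVec y) :
    ∃ x : Fin 4 → ℤ, ¬ (p:ℤ) ∣ (x ⬝ᵥ A.mulVec y)^2 - (x ⬝ᵥ A.mulVec x) * (y ⬝ᵥ A.mulVec y) := by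
  have hpp : _root_.Prime (p:ℤ) := Nat.prime_iff_prime_int.1 hp.out
  by_cases hp2 : p = 2
  · obtain ⟨i, hi⟩ := h2 hp2
    subst hp2
    refine ⟨Pi.single i 1, ?_⟩
    rw [single_one_dotProduct]
    intro h
    have h4 := even_quad A hs hev y
    have h5 : ((2:ℕ):ℤ) ∣ (A.mulVec y i)^2 := by
      have := dvd_add h (Dvd.dvd.mul_left (by exact_mod_cast h4 : ((2:ℕ):ℤ) ∣ _) (Pi.single i 1 ⬝ᵥ A.mulVec (Pi.single i 1)))
      simpa using this
    exact hi (by exact_mod_cast hpp.dvd_of_dvd_pow h5)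
  · have hy := hy hp2
    by_contra hcon
    push Not at hcon
    set t := A.mulVec y with ht
    set d := y ⬝ᵥ t with hd
    have hsym : ∀ i j, A i j = A j i := fun i j => hs.apply j i
    have e1 : ∀ i j, (p:ℤ) ∣ d * A i j - t i * t j := by
      intro i j
      have f1 := hcon (Pi.single i 1)
      have f2 := hcon (Pi.single j 1)
      have f3 := hcon (Pi.single i 1 + Pi.single j 1)
      have : (2:ℤ) * (d * A i j - t i * t j) = - (((Pi.single i 1 + Pi.single j 1) ⬝ᵥ t)^2 - ((Pi.single i 1 + Pi.single j 1) ⬝ᵥ A.mulVec (Pi.single i 1 + Pi.single j 1)) * d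
         - ((Pi.single i 1 ⬝ᵥ t)^2 - (Pi.single i 1 ⬝ᵥ A.mulVec (Pi.single i 1)) * d) - ((Pi.single j 1 ⬝ᵥ t)^2 - (Pi.single j 1 ⬝ᵥ A.mulVec (Pi.single j 1)) * d)) := by
        simp only [add_dotProduct, Matrix.mulVec_add, single_one_dotProduct, Matrix.mulVec_single_one, Pi.add_apply, Matrix.col_apply, hsym j i]
        ring
      have h6 : (p:ℤ) ∣ 2 * (d * A i j - t i * t j) := by
        rw [this]; exact (dvd_neg).2 (dvd_sub (dvd_sub f3 f1) f2)
      rcases hpp.dvd_or_dvd h6 with h7 | h7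
      · exfalso
        apply hp2
        have : p ∣ 2 := by exact_mod_cast h7
        exact (Nat.prime_dvd_prime_iff_eq hp.out Nat.prime_two).1 this
      · exact h7
    obtain ⟨i0, hi0⟩ : ∃ i, ¬ (p:ℤ) ∣ t i := by
      by_contra hall
      push Not at hall
      exact hy (Finset.dvd_sum fun i _ => Dvd.dvd.mul_left (hall i) _)
    have K := kernel_lemma p 1 A (κ := {k : Fin 4 // k ≠ i0}) (fun k => Pi.single k.1 (t i0) - Pi.single i0 (t k.1)) ?_ ?_
    · rw [hdet] at K
      refine sqf_pow hN hp.out ?_ K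
      rw [one_mul, Fintype.card_subtype_compl]
      simp
    · rw [Fintype.linearIndependent_iff]
      intro g hg k
      have := congrFun hg k.1
      rw [Finset.sum_apply] at this
      rw [Finset.sum_eq_single k] at this
      · simp [Pi.single_eq_of_ne k.2] at this
        rcases this with h | h
        · exact h
        · exact absurd ((ZMod.intCast_zmod_eq_zero_iff_dvd _ p).1 h) hi0
      · intro k' _ hk'
        have : k.1 ≠ k'.1 := fun h => hk' (Subtype.ext h.symm)
        simp [Pi.single_eq_of_ne k.2, Pi.single_eq_of_ne this]
      · simp
    · intro k i
      rw [pow_one]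
      have h8 : (p:ℤ) ∣ d * A.mulVec (Pi.single k.1 (t i0) - Pi.single i0 (t k.1)) i := by
        have : d * A.mulVec (Pi.single k.1 (t i0) - Pi.single i0 (t k.1)) i = t i0 * (d * A i k.1 - t i * t k.1) - t k.1 * (d * A i i0 - t i * t i0) := by
          rw [Matrix.mulVec_sub]; simp; ring
        rw [this]
        exact dvd_sub (Dvd.dvd.mul_left (e1 _ _) _) (Dvd.dvd.mul_left (e1 _ _) _)
      exact (hpp.dvd_or_dvd h8).resolve_left hy

section
variable {a b : ℚ} {v : Fin 4 → ℍ[ℚ,a,b]} {A : Matrix (Fin 4) (Fin 4) ℤ} {N : ℕ}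

lemma bl_comb (hA : ∀ i j, (A i j : ℚ) = bl (v i) (v j)) (x y : Fin 4 → ℤ) :
    bl (∑ i, x i • v i) (∑ i, y i • v i) = ((x ⬝ᵥ A.mulVec y : ℤ) : ℚ) := by
  rw [bl_sum_left]
  simp only [dotProduct, Matrix.mulVec]
  push_cast
  apply Finset.sum_congr rfl
  intro i _
  rw [← Int.cast_smul_eq_zsmul ℚ, bl_smul_left, bl_sum_right]
  congr 1
  apply Finset.sum_congr rfl
  intro j _
  rw [← Int.cast_smul_eq_zsmul ℚ, bl_smul_right, hA]; ring

lemma A_symm (hA : ∀ i j, (A i j : ℚ) = bl (v i) (v j)) : A.IsSymm := by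
  ext i j
  have : (A j i : ℚ) = A i j := by rw [hA, hA, bl_comm]
  exact_mod_cast this

lemma A_even (hA : ∀ i j, (A i j : ℚ) = bl (v i) (v j)) (hintg : ∀ z ∈ Submodule.span ℤ (Set.range v), ∃ m : ℤ, nm z = m) (i) : 2 ∣ A i i := by
  obtain ⟨m, hm⟩ := hintg (v i) (Submodule.subset_span ⟨i, rfl⟩)
  have : (A i i : ℚ) = 2 * m := by rw [hA, bl_self, hm]
  exact ⟨m, by exact_mod_cast this⟩

lemma dsc_div {K : Type*} [Field K] {a b : K} {x y : ℍ[K,a,b]} (hy : nm y ≠ 0) : dsc (x * iv y) = (bl x y ^2 - 4 * nm x * nm y) / (nm y)^2 := by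
  rw [dsc, nm_mul, nm_iv, iv, mul_smul_comm, tc_smul, tc_mul_star]
  field_simp

lemma norm_int_of_not_dvd {p : ℕ} [hp : Fact p.Prime] {m : ℤ} (h : ¬ (p:ℤ) ∣ m) : ‖(m : ℚ_[p])‖ = 1 := by
  by_contra hne
  exact h ((Padic.norm_intCast_lt_one_iff (k := m)).1 (lt_of_le_of_ne (Padic.norm_int_le_one m) hne))

lemma norm_two {p : ℕ} [hp : Fact p.Prime] (h : p ≠ 2) : ‖(2 : ℚ_[p])‖ = 1 := by
  have := norm_q_p (p := 2) (hp := ⟨Nat.prime_two⟩) p h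
  exact_mod_cast this

lemma order_x (hN : Squarefree N) (hA : ∀ i j, (A i j : ℚ) = bl (v i) (v j)) (hdet : A.det = (N:ℤ)^2)
    (hintg : ∀ z ∈ Submodule.span ℤ (Set.range v), ∃ m : ℤ, nm z = m) (h1 : 1 ∈ Submodule.span ℤ (Set.range v))
    (hmul : ∀ x ∈ Submodule.span ℤ (Set.range v), ∀ y ∈ Submodule.span ℤ (Set.range v), x * y ∈ Submodule.span ℤ (Set.range v))
    (p : ℕ) [hp : Fact p.Prime] : ∃ x ∈ Submodule.span ℤ (Set.range v), ‖dsc (bcq ℚ_[p] x)‖ = 1 := by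
  obtain ⟨y, hy⟩ := mem_span_range_int h1
  have hyy : y ⬝ᵥ A.mulVec y = 2 := by
    have := bl_comb hA y y
    rw [← hy, bl_self, nm_one] at this
    have : ((y ⬝ᵥ A.mulVec y : ℤ) : ℚ) = ((2:ℤ):ℚ) := by rw [← this]; norm_num
    exact_mod_cast this
  have htc : ∀ x ∈ Submodule.span ℤ (Set.range v), ∃ m : ℤ, tc x = m := by
    intro x hx
    obtain ⟨c, rfl⟩ := mem_span_range_int hx
    rw [← bl_one, hy]
    exact ⟨_, bl_comb hA y c⟩
  have hstar : ∀ x ∈ Submodule.span ℤ (Set.range v), star x ∈ Submodule.span ℤ (Set.range v) := by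
    intro x hx
    obtain ⟨m, hm⟩ := htc x hx
    rw [star_eq', hm, Int.cast_smul_eq_zsmul]
    exact sub_mem (Submodule.smul_mem _ _ h1) hx
  have HX := lemX (A_symm hA) (A_even hA hintg) hN hdet (p := p) y ?_ ?_
  · obtain ⟨x, hx⟩ := HX
    refine ⟨∑ i, x i • v i, sum_mem fun i _ => Submodule.smul_mem _ _ (Submodule.subset_span ⟨i, rfl⟩), ?_⟩
    have : dsc (bcq ℚ_[p] (∑ i, x i • v i)) = (((x ⬝ᵥ A.mulVec y)^2 - (x ⬝ᵥ A.mulVec x) * (y ⬝ᵥ A.mulVec y) : ℤ) : ℚ_[p]) := by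
      have e1 := bl_comb hA x y
      have e2 := bl_comb hA x x
      rw [← hy, bl_comm, bl_one] at e1
      rw [bl_self] at e2
      have : dsc (∑ i, x i • v i) = (((x ⬝ᵥ A.mulVec y)^2 - (x ⬝ᵥ A.mulVec x) * (y ⬝ᵥ A.mulVec y) : ℤ) : ℚ) := by
        rw [dsc, e1, hyy]; push_cast; rw [← e2]; ring
      rw [dsc, tc_bcq, nm_bcq]
      rw [dsc] at this
      exact_mod_cast congrArg (fun q : ℚ => (q : ℚ_[p])) this
    rw [this]
    exact norm_int_of_not_dvd hx
  · intro hp2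
    by_contra hall
    push Not at hall
    have hte : ∀ x ∈ Submodule.span ℤ (Set.range v), ∃ m : ℤ, tc x = 2 * m := by
      intro x hx
      obtain ⟨c, rfl⟩ := mem_span_range_int hx
      rw [← bl_one, hy, bl_comm, bl_comb hA]
      obtain ⟨m, hm⟩ : (2:ℤ) ∣ c ⬝ᵥ A.mulVec y := Finset.dvd_sum fun i _ => Dvd.dvd.mul_left (hall i) _
      exact ⟨m, by rw [hm]; push_cast; ring⟩
    have hAe : ∀ i j, (2:ℤ) ∣ A i j := by
      intro i j
      obtain ⟨m, hm⟩ := hte (v i * star (v j)) (hmul _ (Submodule.subset_span ⟨i, rfl⟩) _ (hstar _ (Submodule.subset_span ⟨j, rfl⟩)))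
      rw [tc_mul_star, ← hA] at hm
      exact ⟨m, by exact_mod_cast hm⟩
    have K := kernel_lemma 2 1 A (κ := Fin 4) (fun k => Pi.single k 1) ?_ ?_
    · rw [hdet] at K
      exact sqf_pow hN Nat.prime_two (by simp) K
    · rw [Fintype.linearIndependent_iff]
      intro g hg k
      have := congrFun hg k
      rw [Finset.sum_apply, Finset.sum_eq_single k] at this
      · simpa using this
      · intro k' _ hk'
        simp [Pi.single_eq_of_ne hk'.symm]
      · simp
    · intro k i
      simp [hAe]
  · intro hp2 h
    rw [hyy] at h
    apply hp2
    have : p ∣ 2 := by exact_mod_cast h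
    exact (Nat.prime_dvd_prime_iff_eq hp.out Nat.prime_two).1 this

/-- version for a lattice with even dual -/
lemma latt_x (hN : Squarefree N) (hA : ∀ i j, (A i j : ℚ) = bl (v i) (v j)) (hG : Good N A)
    (p : ℕ) [hp : Fact p.Prime] : ∃ x ∈ Submodule.span ℤ (Set.range v), ∃ y ∈ Submodule.span ℤ (Set.range v),
      ‖nm (bcq ℚ_[p] y)‖ = 1 ∧ ‖dsc (bcq ℚ_[p] x * iv (bcq ℚ_[p] y))‖ = 1 := by
  have hpp : _root_.Prime (p:ℤ) := Nat.prime_iff_prime_int.1 hp.out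
  have hq := fun x => even_quad A hG.symm hG.even x
  have hnm : ∀ x : Fin 4 → ℤ, ∃ m : ℤ, x ⬝ᵥ A.mulVec x = 2 * m ∧ nm (∑ i, x i • v i) = m := by
    intro x
    obtain ⟨m, hm⟩ := hq x
    refine ⟨m, hm, ?_⟩
    have := bl_comb hA x x
    rw [bl_self, hm] at this
    push_cast at this
    linarith
  obtain ⟨y, m, hm, hmn, hmp⟩ : ∃ (y : Fin 4 → ℤ) (m : ℤ), y ⬝ᵥ A.mulVec y = 2 * m ∧ nm (∑ i, y i • v i) = m ∧ ¬ (p:ℤ) ∣ m := by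
    by_contra hcon
    push Not at hcon
    have hall : ∀ i j, (p:ℤ) ∣ A i j := by
      intro i j
      obtain ⟨m1, h1, h1'⟩ := hnm (Pi.single i 1)
      obtain ⟨m2, h2, h2'⟩ := hnm (Pi.single j 1)
      obtain ⟨m3, h3, h3'⟩ := hnm (Pi.single i 1 + Pi.single j 1)
      have d1 := hcon _ _ h1 h1'
      have d2 := hcon _ _ h2 h2'
      have d3 := hcon _ _ h3 h3'
      have hsym : A i j = A j i := hG.symm.apply j i
      simp only [add_dotProduct, Matrix.mulVec_add, single_one_dotProduct, Matrix.mulVec_single_one, Pi.add_apply, Matrix.col_apply] at h1 h2 h3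
      have : A i j = m3 - m1 - m2 := by linarith
      rw [this]
      exact dvd_sub (dvd_sub d3 d1) d2
    have K := kernel_lemma p 1 A (κ := Fin 4) (fun k => Pi.single k 1) ?_ ?_
    · rw [hG.det] at K
      exact sqf_pow hN hp.out (by simp) K
    · rw [Fintype.linearIndependent_iff]
      intro g hg k
      have := congrFun hg k
      rw [Finset.sum_apply, Finset.sum_eq_single k] at this
      · simpa using this
      · intro k' _ hk'
        simp [Pi.single_eq_of_ne hk'.symm]
      · simp
    · intro k i
      simp [hall]
  have hn1 : ‖nm (bcq ℚ_[p] (∑ i, y i • v i))‖ = 1 := by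
    rw [nm_bcq, hmn]
    exact_mod_cast norm_int_of_not_dvd hmp
  have HX := lemX hG.symm hG.even hN hG.det (p := p) y ?_ ?_
  · obtain ⟨x, hx⟩ := HX
    refine ⟨∑ i, x i • v i, sum_mem fun i _ => Submodule.smul_mem _ _ (Submodule.subset_span ⟨i, rfl⟩), ∑ i, y i • v i, sum_mem fun i _ => Submodule.smul_mem _ _ (Submodule.subset_span ⟨i, rfl⟩), hn1, ?_⟩
    have h0 : nm (bcq ℚ_[p] (∑ i, y i • v i)) ≠ 0 := by rw [← norm_ne_zero_iff, hn1]; exact one_ne_zero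
    rw [dsc_div h0, norm_div, norm_pow, hn1, one_pow, div_one]
    have : bl (bcq ℚ_[p] (∑ i, x i • v i)) (bcq ℚ_[p] (∑ i, y i • v i)) ^2 - 4 * nm (bcq ℚ_[p] (∑ i, x i • v i)) * nm (bcq ℚ_[p] (∑ i, y i • v i))
        = (((x ⬝ᵥ A.mulVec y)^2 - (x ⬝ᵥ A.mulVec x) * (y ⬝ᵥ A.mulVec y) : ℤ) : ℚ_[p]) := by
      have e2 := bl_comb hA x x
      have e3 := bl_comb hA y y
      rw [bl_self] at e2 e3
      have : bl (∑ i, x i • v i) (∑ i, y i • v i) ^2 - 4 * nm (∑ i, x i • v i) * nm (∑ i, y i • v i) = (((x ⬝ᵥ A.mulVec y)^2 - (x ⬝ᵥ A.mulVec x) * (y ⬝ᵥ A.mulVec y) : ℤ) : ℚ) := by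
        rw [bl_comb hA]; push_cast; rw [← e2, ← e3]; ring
      rw [bl_bcq, nm_bcq, nm_bcq]
      exact_mod_cast congrArg (fun q : ℚ => (q : ℚ_[p])) this
    rw [this]
    exact norm_int_of_not_dvd hx
  · intro hp2
    subst hp2
    by_contra hall
    push Not at hall
    choose w hw using hall
    obtain ⟨Bs, h1, h2, h3⟩ := hG.dual
    have hw' : A.mulVec y = (2:ℤ) • w := by funext i; rw [hw]; rfl
    have e1 : Bs * A = (N:ℤ) • (1 : Matrix _ _ ℤ) := by
      have := congrArg Matrix.transpose h1
      rw [Matrix.transpose_mul, h2.eq, hG.symm.eq] at this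
      rw [this]; simp
    have e2 : (N:ℤ) • y = (2:ℤ) • Bs.mulVec w := by
      rw [← Matrix.mulVec_smul, ← hw', Matrix.mulVec_mulVec, e1, Matrix.smul_mulVec, Matrix.one_mulVec]
    obtain ⟨k, hk⟩ := even_quad Bs h2 h3 w
    have e3 : (N:ℤ) * (2 * m) = 2 * (2 * (2 * k)) := by
      rw [← hk, ← hm, hw', ← smul_eq_mul, ← smul_dotProduct, e2]
      simp only [smul_dotProduct, dotProduct_smul, smul_eq_mul]
      rw [dotProduct_comm]
    have h4 : (2:ℤ)^2 ∣ N := by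
      have : (2:ℤ)^2 ∣ N * m := ⟨k, by linarith⟩
      have hc : IsCoprime ((2:ℤ)^2) m := by
        apply IsCoprime.pow_left
        exact (Prime.coprime_iff_not_dvd hpp).2 hmp
      exact hc.dvd_of_dvd_mul_right this
    have h5 : 2 * 2 ∣ N := by exact_mod_cast h4
    have := hN 2 h5
    simp at this
  · intro hp2 h
    rw [hm] at h
    rcases hpp.dvd_or_dvd h with h | h
    · apply hp2
      have : p ∣ 2 := by exact_mod_cast h
      exact (Nat.prime_dvd_prime_iff_eq hp.out Nat.prime_two).1 this
    · exact hmp h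
end
end Eich
end

section
open scoped BigOperators Matrix RealInnerProductSpace Quaternion
namespace Eich
open Module

section
variable {a b : ℚ} {p : ℕ} [hp : Fact p.Prime]

lemma norm_le_of_int {q : ℚ} (h : ∃ m : ℤ, q = m) : ‖(q : ℚ_[p])‖ ≤ 1 := by
  obtain ⟨m, rfl⟩ := h
  exact_mod_cast Padic.norm_int_le_one (p := p) m

lemma bl_rat (x y : ℍ[ℚ,a,b]) : bl x y = nm (x + y) - nm x - nm y := by rw [nm_add]; ring

lemma lc_bl {M M' : Submodule ℤ ℍ[ℚ,a,b]} {r : ℝ} (hr : 0 ≤ r) (hintg : ∀ x ∈ M, ∀ y ∈ M', ‖((bl x y : ℚ) : ℚ_[p])‖ ≤ r) {z w} (hz : z ∈ lc p M) (hw : w ∈ lc p M') :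
    ‖bl z w‖ ≤ r := by
  induction hz using Submodule.span_induction with
  | mem x hx =>
    obtain ⟨x, hx, rfl⟩ := hx
    induction hw using Submodule.span_induction with
    | mem y hy =>
      obtain ⟨y, hy, rfl⟩ := hy
      rw [bl_bcq]; exact hintg x hx y hy
    | zero => rw [bl_zero_right, norm_zero]; exact hr
    | add y y' _ _ h1 h2 => rw [bl_add_right]; exact (Padic.nonarchimedean _ _).trans (max_le h1 h2)
    | smul c y _ h1 => rw [zsmul_def, bl_smul_right, norm_mul]; exact (mul_le_of_le_one_left (norm_nonneg _) (PadicInt.norm_le_one c)).trans h1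
  | zero => rw [bl_zero_left, norm_zero]; exact hr
  | add y y' _ _ h1 h2 => rw [bl_add_left]; exact (Padic.nonarchimedean _ _).trans (max_le h1 h2)
  | smul c y _ h1 => rw [zsmul_def, bl_smul_left, norm_mul]; exact (mul_le_of_le_one_left (norm_nonneg _) (PadicInt.norm_le_one c)).trans h1

lemma lc_int {M : Submodule ℤ ℍ[ℚ,a,b]} (hintg : ∀ x ∈ M, ∃ m : ℤ, nm x = m) {z} (hz : z ∈ lc p M) : ‖nm z‖ ≤ 1 := by
  have hb : ∀ x ∈ M, ∀ y ∈ M, ‖((bl x y : ℚ) : ℚ_[p])‖ ≤ 1 := by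
    intro x hx y hy
    rw [bl_rat]
    push_cast
    exact norm_sub3 (norm_le_of_int (hintg _ (add_mem hx hy))) (norm_le_of_int (hintg _ hx)) (norm_le_of_int (hintg _ hy))
  induction hz using Submodule.span_induction with
  | mem x hx =>
    obtain ⟨x, hx, rfl⟩ := hx
    rw [nm_bcq]; exact norm_le_of_int (hintg x hx)
  | zero => rw [nm_zero, norm_zero]; exact zero_le_one
  | add y y' h3 h4 h1 h2 =>
    rw [nm_add]
    exact (Padic.nonarchimedean _ _).trans (max_le ((Padic.nonarchimedean _ _).trans (max_le h1 h2)) (lc_bl zero_le_one hb h3 h4))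
  | smul c y _ h1 =>
    rw [zsmul_def, nm_smul, norm_mul, norm_pow]; exact mul_le_one₀ (pow_le_one₀ (norm_nonneg _) (PadicInt.norm_le_one c)) (norm_nonneg _) h1

/-- an order of reduced discriminant N -/
structure OrdN (N : ℕ) (R : Submodule ℤ ℍ[ℚ,a,b]) : Prop where
  one : 1 ∈ R
  mul : ∀ x ∈ R, ∀ y ∈ R, x * y ∈ R
  int : ∀ x ∈ R, ∃ m : ℤ, nm x = m
  gram : ∃ (v : Fin 4 → ℍ[ℚ,a,b]) (A : Matrix (Fin 4) (Fin 4) ℤ), Submodule.span ℤ (Set.range v) = R ∧ (∀ i j, (A i j : ℚ) = bl (v i) (v j)) ∧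
    A.det = (N:ℤ)^2

lemma Gm_of_A {v : Fin 4 → ℍ[ℚ,a,b]} {A : Matrix (Fin 4) (Fin 4) ℤ} (hA : ∀ i j, (A i j : ℚ) = bl (v i) (v j)) : Gm v = A.map (Int.cast : ℤ → ℚ) := by
  ext i j; simp [Gm, hA]

lemma det_of_A {v : Fin 4 → ℍ[ℚ,a,b]} {A : Matrix (Fin 4) (Fin 4) ℤ} (hA : ∀ i j, (A i j : ℚ) = bl (v i) (v j)) : (Gm v).det = (A.det : ℚ) := by
  rw [Gm_of_A hA]; exact ((Int.castRingHom ℚ).map_det A).symm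

lemma norm_N {p N : ℕ} [hp : Fact p.Prime] (hN : Squarefree N) : ‖(N : ℚ_[p])‖ = 1 ∨ ‖(N : ℚ_[p])‖ = ‖(p : ℚ_[p])‖ := by
  by_cases h : p ∣ N
  · right
    obtain ⟨m, rfl⟩ := h
    have : ¬ p ∣ m := by
      rintro ⟨k, rfl⟩
      have := hN p ⟨k, by ring⟩
      exact hp.out.one_lt.ne' (Nat.isUnit_iff.1 this)
    push_cast
    rw [norm_mul, (Padic.norm_natCast_eq_one_iff).2 ((Nat.Prime.coprime_iff_not_dvd hp.out).2 this), mul_one]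
  · left
    rw [Padic.norm_natCast_eq_one_iff]
    exact (Nat.Prime.coprime_iff_not_dvd hp.out).2 h

lemma OrdN.std {N : ℕ} (hN : Squarefree N) {R : Submodule ℤ ℍ[ℚ,a,b]} (h : OrdN N R) : ∃ x y, Std (lc p R) x y ∧ ‖nm y‖ = ‖(N : ℚ_[p])‖ := by
  obtain ⟨h1, h2, h3, v, A, rfl, hA, hdet⟩ := h
  obtain ⟨x, hx, hd⟩ := order_x hN hA hdet h3 h1 h2 p
  have e := lc_span (p := p) v
  have hN0 : (N : ℚ) ≠ 0 := by exact_mod_cast hN.ne_zero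
  have hdet' : (Gm v).det = (N:ℚ)^2 := by rw [det_of_A hA, hdet]; push_cast; ring
  have hd0 : (Gm v).det ≠ 0 := by rw [hdet']; exact pow_ne_zero _ hN0
  have hxm := bcq_mem (p := p) hx
  obtain ⟨y, hy⟩ := std_order (v := fun i => bcq ℚ_[p] (v i)) (x := bcq ℚ_[p] x) (by rw [← e, ← bcq_one]; exact bcq_mem h1)
    (by rw [← e]; exact fun z hz => lc_int h3 hz) (det_bcq_ne _ hd0) (by rw [← e]; exact hxm) hd (by
      rw [← e]
      intro z hz
      refine lc_mul h2 hz ?_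
      rw [star_eq', tc_bcq]
      refine sub_mem (smul_mem' ?_ ?_) hxm
      · rw [← bl_one, bl_rat]
        push_cast
        exact norm_sub3 (norm_le_of_int (h3 _ (add_mem h1 hx))) (norm_le_of_int (h3 _ h1)) (norm_le_of_int (h3 _ hx))
      · rw [← bcq_one]; exact bcq_mem h1)
  refine ⟨_, y, e ▸ hy, ?_⟩
  have := hy.det_eq
  rw [det_bcq, hdet'] at this
  push_cast at this
  rw [norm_pow] at this
  exact ((pow_left_inj₀ (norm_nonneg _) (norm_nonneg _) two_ne_zero).1 this).symm

lemma left_sp {a b : ℚ_[p]} {n : ℕ} {v : Fin n → ℍ[ℚ_[p],a,b]} {g : ℍ[ℚ_[p],a,b]} (hg : nm g ≠ 0) (z) : z ∈ sp (fun i => iv g * v i) ↔ g * z ∈ sp v := by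
  have key : ∀ c : Fin n → ℤ_[p], ∑ i, (c i : ℚ_[p]) • (iv g * v i) = iv g * (∑ i, (c i : ℚ_[p]) • v i) := by
    intro c; rw [Finset.mul_sum]; simp only [mul_smul_comm]
  rw [mem_sp, mem_sp]
  constructor
  · rintro ⟨c, rfl⟩
    exact ⟨c, by rw [key, mul_iv_mul hg]⟩
  · rintro ⟨c, hc⟩
    exact ⟨c, by rw [key, hc, iv_mul_mul hg]⟩

lemma Gm_left {K : Type*} [Field K] {a b : K} {n : ℕ} (v : Fin n → ℍ[K,a,b]) (g : ℍ[K,a,b]) : Gm (fun i => g * v i) = nm g • Gm v := by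
  ext i j; simp [Gm, bl_mul_left]
lemma Gm_right {K : Type*} [Field K] {a b : K} {n : ℕ} (v : Fin n → ℍ[K,a,b]) (g : ℍ[K,a,b]) : Gm (fun i => v i * g) = nm g • Gm v := by
  ext i j; simp [Gm, bl_mul_right, mul_comm]

lemma right_loc {v r : Fin 4 → ℍ[ℚ,a,b]} (hv : (Gm v).det ≠ 0) (hr : (Gm r).det ≠ 0)
    (hR : ∀ x, x ∈ Submodule.span ℤ (Set.range r) ↔ ∀ y ∈ Submodule.span ℤ (Set.range v), y * x ∈ Submodule.span ℤ (Set.range v))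
    {z} (hz : ∀ m ∈ lc p (Submodule.span ℤ (Set.range v)), m * z ∈ lc p (Submodule.span ℤ (Set.range v))) : z ∈ lc p (Submodule.span ℤ (Set.range r)) := by
  obtain ⟨z', ⟨m, hm, e⟩, hq⟩ := dense hr z 0
  rw [pow_zero, one_smul] at e
  have hmul : ∀ x ∈ Submodule.span ℤ (Set.range v), ∀ y ∈ Submodule.span ℤ (Set.range r), x * y ∈ Submodule.span ℤ (Set.range v) :=
    fun x hx y hy => (hR y).1 hy x hx
  have : z' ∈ Submodule.span ℤ (Set.range r) := by
    rw [hR]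
    intro y hy
    apply mem_of_local hv
    intro q hqf
    rw [bcq_mul]
    by_cases hqp : q = p
    · subst hqp
      have : bcq ℚ_[q] z' = z + m := by rw [← e]; abel
      rw [this, mul_add]
      exact add_mem (hz _ (bcq_mem hy)) (lc_mul hmul (bcq_mem hy) hm)
    · exact lc_mul hmul (bcq_mem hy) (hq q hqp)
  have e' : z = bcq ℚ_[p] z' - m := by rw [← e]; abel
  rw [e']
  exact sub_mem (bcq_mem this) hm

/-- a normalized lattice with right order R -/
structure Idl (R M : Submodule ℤ ℍ[ℚ,a,b]) : Prop where
  int : ∀ x ∈ M, ∃ m : ℤ, nm x = m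
  prim : (1:ℚ) ∈ Submodule.span ℤ (nm '' (M : Set ℍ[ℚ,a,b]))
  lat : ∃ v : Fin 4 → ℍ[ℚ,a,b], (Gm v).det ≠ 0 ∧ Submodule.span ℤ (Set.range v) = M
  right : ∀ x, x ∈ R ↔ ∀ y ∈ M, y * x ∈ M

lemma prim_unit {M : Submodule ℤ ℍ[ℚ,a,b]} (hintg : ∀ x ∈ M, ∃ m : ℤ, nm x = m) (h : (1:ℚ) ∈ Submodule.span ℤ (nm '' (M : Set ℍ[ℚ,a,b]))) (p : ℕ) [hp : Fact p.Prime] : ∃ w ∈ M, ‖nm (bcq ℚ_[p] w)‖ = 1 := by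
  by_contra hcon
  push Not at hcon
  have key : ∀ q ∈ Submodule.span ℤ (nm '' (M : Set ℍ[ℚ,a,b])), ‖((q : ℚ) : ℚ_[p])‖ < 1 := by
    intro q hq
    induction hq using Submodule.span_induction with
    | mem x hx =>
      obtain ⟨x, hx, rfl⟩ := hx
      rw [← nm_bcq]
      refine lt_of_le_of_ne ?_ (hcon x hx)
      rw [nm_bcq]; exact norm_le_of_int (hintg x hx)
    | zero => simp
    | add x y _ _ h1 h2 => push_cast; exact (Padic.nonarchimedean _ _).trans_lt (max_lt h1 h2)
    | smul c x _ h1 =>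
      rw [zsmul_eq_mul]; push_cast
      rw [norm_mul]
      exact (mul_le_of_le_one_left (norm_nonneg _) (Padic.norm_int_le_one c)).trans_lt h1
  have := key 1 h
  simp at this

lemma nm_ne_of_unit {a b : ℚ_[p]} {z : ℍ[ℚ_[p],a,b]} (h : ‖nm z‖ = 1) : nm z ≠ 0 := by
  rw [← norm_ne_zero_iff, h]; exact one_ne_zero

lemma Idl.loc {N : ℕ} (hN : Squarefree N) {R M : Submodule ℤ ℍ[ℚ,a,b]} (hR : OrdN N R) (h : Idl R M) (p : ℕ) [hp : Fact p.Prime] :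
    ∃ w, w ∈ lc p M ∧ ‖nm w‖ = 1 ∧ ∀ z, z ∈ lc p M ↔ iv w * z ∈ lc p R := by
  obtain ⟨w, hw, hw1⟩ := prim_unit h.int h.prim p
  have hw0 := nm_ne_of_unit hw1
  refine ⟨_, bcq_mem hw, hw1, ?_⟩
  obtain ⟨x, y, hS, -⟩ := hR.std hN (p := p)
  have hintg := fun z (hz : z ∈ lc p M) => lc_int h.int hz
  obtain ⟨v, hv, rfl⟩ := h.lat
  have hr := h.right
  obtain ⟨r, A, rfl, hA, hAd⟩ := hR.gram
  have hr0 : (Gm r).det ≠ 0 := by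
    rw [det_of_A hA, hAd]; push_cast
    have hN0 : (N : ℚ) ≠ 0 := by exact_mod_cast hN.ne_zero
    exact pow_ne_zero _ hN0
  have e := lc_span (p := p) v
  set g := bcq ℚ_[p] w with hg
  have hmulr : ∀ x ∈ Submodule.span ℤ (Set.range v), ∀ y ∈ Submodule.span ℤ (Set.range r), x * y ∈ Submodule.span ℤ (Set.range v) :=
    fun x hx y hy => (hr y).1 hy x hx
  have L := fun z => left_sp (v := fun i => bcq ℚ_[p] (v i)) hw0 z
  rw [← e] at L
  have hm' : ∀ z ∈ sp (fun i => iv g * bcq ℚ_[p] (v i)), ∀ t ∈ lc p (Submodule.span ℤ (Set.range r)), z * t ∈ sp (fun i => iv g * bcq ℚ_[p] (v i)) := by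
    intro z hz t ht
    rw [L] at hz ⊢
    rw [← mul_assoc]
    exact lc_mul hmulr hz ht
  have h1 : 1 ∈ sp (fun i => iv g * bcq ℚ_[p] (v i)) := by rw [L, mul_one]; exact bcq_mem hw
  have hle : ∀ t ∈ lc p (Submodule.span ℤ (Set.range r)), t ∈ sp (fun i => iv g * bcq ℚ_[p] (v i)) := by
    intro t ht
    have := hm' 1 h1 t ht
    rwa [one_mul] at this
  obtain ⟨y', hS'⟩ := std_order (v := fun i => iv g * bcq ℚ_[p] (v i)) (x := x) h1 (by
      intro z hz
      rw [L] at hz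
      have := hintg _ hz
      rwa [nm_mul, norm_mul, hw1, one_mul] at this) (by
      rw [Gm_left, Matrix.det_smul]
      refine mul_ne_zero (pow_ne_zero _ ?_) (det_bcq_ne _ hv)
      rw [nm_iv]; exact inv_ne_zero hw0) (hle x hS.x_mem) hS.d (fun z hz => hm' z hz _ (hS.star hS.x_mem))
  intro z
  constructor
  · intro hz
    have hz' : iv g * z ∈ sp (fun i => iv g * bcq ℚ_[p] (v i)) := by rw [L, mul_iv_mul hw0]; exact hz
    apply right_loc hv hr0 hr
    intro m hm
    have hm1 : iv g * m ∈ sp (fun i => iv g * bcq ℚ_[p] (v i)) := by rw [L, mul_iv_mul hw0]; exact hm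
    have := hS'.mul hm1 hz'
    rw [L, mul_assoc, mul_iv_mul hw0] at this
    exact this
  · intro hz
    have := hle _ hz
    rwa [L, mul_iv_mul hw0] at this

end
end Eich
end

section
open scoped BigOperators Matrix RealInnerProductSpace Quaternion
namespace Eich
open Module

section
variable {a b : ℚ} {p : ℕ} [hp : Fact p.Prime]

lemma iv_mul_rev {K : Type*} [Field K] {a b : K} (x y : ℍ[K,a,b]) : iv (x * y) = iv y * iv x := by
  simp only [iv, nm_mul, star_mul, smul_mul_assoc, mul_smul_comm, smul_smul, mul_inv]
lemma iv_iv {K : Type*} [Field K] {a b : K} {x : ℍ[K,a,b]} (h : nm x ≠ 0) : iv (iv x) = x := by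
  have h2 : nm (iv x) ≠ 0 := by rw [nm_iv]; exact inv_ne_zero h
  calc iv (iv x) = iv (iv x) * (iv x * x) := by rw [iv_mul h, mul_one]
    _ = x := by rw [iv_mul_mul h2]

lemma ord_conj {N : ℕ} (hN : Squarefree N) {R R' : Submodule ℤ ℍ[ℚ,a,b]} (h : OrdN N R) (h' : OrdN N R') {u : ℍ[ℚ_[p],(a:ℚ_[p]),(b:ℚ_[p])]} (hu : nm u ≠ 0)
    (hle : ∀ t ∈ lc p R, iv u * t * u ∈ lc p R') : ∀ z ∈ lc p R', u * z * iv u ∈ lc p R := by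
  obtain ⟨x, y, hS, hy⟩ := h.std hN (p := p)
  obtain ⟨x', y', hS', hy'⟩ := h'.std hN (p := p)
  have hm : ∀ i, iv u * stdv x y i * u ∈ sp (stdv x' y') := by
    intro i
    rw [← hS'.eq]
    apply hle
    rw [hS.eq]; exact vmem_sp _ i
  have hG : Gm (fun i => iv u * stdv x y i * u) = Gm (stdv x y) := by
    rw [Gm_right (fun i => iv u * stdv x y i), Gm_left, nm_iv, smul_smul, mul_inv_cancel₀ hu, one_smul]
  have heq := sp_eq_of_det hm (by rw [hG, hS.det, hS'.det, hy, hy']) (by rw [hG]; exact hS.det_ne)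
  intro z hz
  rw [hS'.eq, ← heq, conj_mem hu] at hz
  rw [hS.eq]
  convert hz using 2
  funext i
  rw [← mul_assoc, ← mul_assoc, mul_iv hu, one_mul, mul_assoc, mul_iv hu, mul_one]

lemma transport {N : ℕ} (hN : Squarefree N) {R R' M M' Q : Submodule ℤ ℍ[ℚ,a,b]} (hR : OrdN N R) (hR' : OrdN N R') (hM : Idl R M) (hM' : Idl R' M')
    (hQ : Idl R' Q) (hQl : ∀ x ∈ R, ∀ y ∈ Q, x * y ∈ Q) (p : ℕ) [hp : Fact p.Prime] :
    ∃ X Y : ℍ[ℚ_[p],(a:ℚ_[p]),(b:ℚ_[p])], nm X = 1 ∧ nm Y = 1 ∧ ∀ z ∈ lc p M', iv X * z * iv Y ∈ lc p M := by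
  obtain ⟨w, hw, hw1, hwm⟩ := hM.loc hN hR p
  obtain ⟨w', hw', hw1', hwm'⟩ := hM'.loc hN hR' p
  obtain ⟨u, hu, hu1, hum⟩ := hQ.loc hN hR' p
  obtain ⟨x, y, hS, hy⟩ := hR.std hN (p := p)
  have w0 := nm_ne_of_unit hw1
  have w0' := nm_ne_of_unit hw1'
  have u0 := nm_ne_of_unit hu1
  have hle : ∀ t ∈ lc p R, iv u * t * u ∈ lc p R' := by
    intro t ht
    rw [mul_assoc, ← hum]
    exact lc_mul hQl ht hu
  have hc := ord_conj hN hR hR' u0 hle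
  obtain ⟨r, hr, hrn⟩ := hS.unit (c := nm w * nm u / nm w') (by rw [norm_div, norm_mul, hw1, hu1, hw1']; norm_num)
  obtain ⟨s, hs, hsn⟩ := hS.unit (c := (nm u)⁻¹) (by rw [norm_inv, hu1]; norm_num)
  have hr := hS.S_le hr
  have hs := hS.S_le hs
  have hr1 : ‖nm r‖ = 1 := by rw [hrn, norm_div, norm_mul, hw1, hu1, hw1']; norm_num
  have hs1 : ‖nm s‖ = 1 := by rw [hsn, norm_inv, hu1]; norm_num
  have r0 := nm_ne_of_unit hr1
  have s0 := nm_ne_of_unit hs1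
  refine ⟨w' * iv u * r * iv w, s * u, ?_, ?_, ?_⟩
  · simp only [nm_mul, nm_iv, hrn]; field_simp
  · rw [nm_mul, hsn]; field_simp
  · intro z hz
    rw [hwm]
    have h1 := hc _ ((hwm' z).1 hz)
    have h2 := hS.mul (hS.mul (hS.iv hr hr1) h1) (hS.iv hs hs1)
    convert h2 using 1
    simp only [iv_mul_rev, iv_iv w0, iv_iv u0, mul_assoc, iv_mul_mul w0]
end
end Eich
end

section
open scoped BigOperators Matrix RealInnerProductSpace Quaternion
namespace Eich
open Module

section
variable {K : Type*} [Field K] [CharZero K] {a b : K}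

lemma exists_perp (ha : a ≠ 0) (hb : b ≠ 0) (X : ℍ[K,a,b]) : ∃ w, Perp X w ∧ nm w ≠ 0 := by
  by_contra hcon
  push Not at hcon
  have h1 := hcon ⟨0, 0, -2*a*X.imK, -2*X.imJ⟩ (by constructor <;> simp [bl_coord]; ring)
  have h2 := hcon ⟨0, 2*b*X.imK, 0, 2*X.imI⟩ (by constructor <;> simp [bl_coord]; ring)
  have h3 := hcon ⟨0, -2*b*X.imJ, 2*a*X.imI, 0⟩ (by constructor <;> simp [bl_coord]; ring)
  simp only [nm_coord] at h1 h2 h3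
  have e1 : X.imJ^2 = a * X.imK^2 := by
    have : (4*a*b) * (X.imJ^2 - a * X.imK^2) = 0 := by linear_combination h1
    have := (mul_eq_zero.1 this).resolve_left (by simp [ha, hb])
    linear_combination this
  have e2 : X.imI^2 = b * X.imK^2 := by
    have : (4*a*b) * (X.imI^2 - b * X.imK^2) = 0 := by linear_combination h2
    have := (mul_eq_zero.1 this).resolve_left (by simp [ha, hb])
    linear_combination this
  have e3 : X.imK = 0 := by
    have : (8*a*b*(a*b)) * X.imK^2 = 0 := by linear_combination -h3 - 4*a^2*b*e2 - 4*b^2*a*e1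
    have := (mul_eq_zero.1 this).resolve_left (by simp [ha, hb])
    exact pow_eq_zero_iff two_ne_zero |>.1 this
  rw [e3] at e1 e2
  have e1 : X.imJ = 0 := by simpa using e1
  have e2 : X.imI = 0 := by simpa using e2
  have := hcon ⟨0, 1, 0, 0⟩ (by constructor <;> simp [bl_coord, e2])
  simp [nm_coord, ha] at this

lemma sq_pure {w : ℍ[K,a,b]} (h : bl 1 w = 0) : w * w = -(nm w • (1 : ℍ[K,a,b])) := by
  rw [sq_eq', ← bl_one, h]; simp

lemma commutator (ha : a ≠ 0) (hb : b ≠ 0) {X : ℍ[K,a,b]} (hX : nm X = 1) : ∃ g w, nm g ≠ 0 ∧ nm w ≠ 0 ∧ X = g * w * iv g * iv w := by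
  obtain ⟨w, hw, hw0⟩ := exists_perp ha hb X
  have hXw := hw.xmul
  have n1 : nm (X * w) = nm w := by rw [nm_mul, hX, one_mul]
  have s1 := sq_pure hw.1
  have s2 := sq_pure hXw.1
  rw [n1] at s2
  suffices ∃ g, nm g ≠ 0 ∧ g * w = X * w * g by
    obtain ⟨g, hg, e⟩ := this
    refine ⟨g, w, hg, hw0, ?_⟩
    rw [e, mul_assoc (X * w), mul_iv hg, mul_one, mul_assoc, mul_iv hw0, mul_one]
  by_cases h : tc X = -2
  · obtain ⟨k, hk, hk0⟩ := exists_perp ha hb w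
    refine ⟨(X * w - w) * k, ?_, ?_⟩
    · have : X * w - w = (X - 1) * w := by rw [sub_mul, one_mul]
      rw [this, nm_mul, nm_mul, nm_sub, hX, nm_one, bl_comm, bl_one, h]
      norm_num; exact ⟨hw0, hk0⟩
    · have hkw : k * w = -(w * k) := by
        rw [hk.mul, hw.conj, neg_mul]
      rw [mul_assoc (X * w - w), hkw, mul_neg, ← mul_assoc (X*w-w), sub_mul, s1, ← mul_assoc (X * w), mul_sub, s2]
      noncomm_ring
  · refine ⟨X * w + w, ?_, ?_⟩
    · have : X * w + w = (X + 1) * w := by rw [add_mul, one_mul]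
      rw [this, nm_mul, nm_add, hX, nm_one, bl_comm, bl_one]
      refine mul_ne_zero (fun h' => h ?_) hw0
      linear_combination h'
    · rw [add_mul, mul_add, s1, s2, add_comm]

/-- reflection -/
def tau (v : ℍ[K,a,b]) : ℍ[K,a,b] →ₗ[K] ℍ[K,a,b] where
  toFun z := z - (bl z v / nm v) • v
  map_add' x y := by rw [bl_add_left]; module
  map_smul' c x := by rw [bl_smul_left]; simp; module

lemma tau_eq {v : ℍ[K,a,b]} (hv : nm v ≠ 0) (z) : tau v z = -((nm v)⁻¹ • (v * star z * v)) := by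
  have : (v * star z) = bl z v • 1 - z * star v := by rw [← bl_eq_mul]; abel
  rw [this, sub_mul, mul_assoc z, star_mul_self']
  simp only [tau, LinearMap.coe_mk, AddHom.coe_mk, smul_sub, smul_mul_assoc, one_mul, mul_smul_comm, mul_one, smul_smul, inv_mul_cancel₀ hv, one_smul, div_eq_inv_mul]
  abel

lemma star_smul'' (c : K) (x : ℍ[K,a,b]) : star (c • x) = c • star x := by ext <;> simp

lemma left_comm {g w : ℍ[K,a,b]} (hg : nm g ≠ 0) (hw : nm w ≠ 0) (z) :
    tau g (tau (star w) (tau 1 (tau (w * g) z))) = g * w * iv g * iv w * z := by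
  rw [tau_eq hg, tau_eq (by rwa [nm_star]), tau_eq (by rw [nm_one]; exact one_ne_zero), tau_eq (by rw [nm_mul]; exact mul_ne_zero hw hg)]
  simp only [star_neg, star_smul'', star_mul, star_star, neg_mul, mul_neg, smul_mul_assoc, mul_smul_comm, nm_star, nm_one, inv_one, one_smul, one_mul, mul_one, smul_neg, neg_neg, smul_smul, iv, star_one]
  have : g * (w * (star g * star w * z * (star g * star w)) * w) * g = (nm g * nm w) • (g * w * star g * star w * z) := by
    have : g * (w * (star g * star w * z * (star g * star w)) * w) * g = (g * w * star g * star w * z) * (star g * (star w * w) * g) := by noncomm_ring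
    rw [this, star_mul_self']
    simp only [mul_smul_comm, mul_one, smul_mul_assoc, star_mul_self', smul_smul]
    rw [mul_comm (nm w)]
  simp only [nm_mul, ← mul_assoc] at this ⊢
  rw [this]
  simp only [smul_smul]
  congr 1
  field_simp

lemma tau_star {v : ℍ[K,a,b]} (hv : nm v ≠ 0) (z) : tau (star v) (star z) = star (tau v z) := by
  rw [tau_eq hv, tau_eq (by rwa [nm_star]), nm_star]
  simp only [star_neg, star_smul'', star_mul, star_star, mul_assoc]

lemma right_comm {g w : ℍ[K,a,b]} (hg : nm g ≠ 0) (hw : nm w ≠ 0) (z) :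
    tau (star g) (tau w (tau 1 (tau (star (w * g)) z))) = z * star (g * w * iv g * iv w) := by
  have h1 : nm (1 : ℍ[K,a,b]) ≠ 0 := by rw [nm_one]; exact one_ne_zero
  have h := congrArg star (left_comm hg hw (star z))
  have e1 := fun z => (tau_star h1 z)
  rw [star_one] at e1
  have e2 := fun z => (tau_star (v := star w) (by rwa [nm_star]) z)
  rw [star_star] at e2
  rw [← tau_star hg, ← e2, ← e1, ← tau_star (by rw [nm_mul]; exact mul_ne_zero hw hg), star_star] at h
  rw [h, star_mul _ (star z), star_star]
end
end Eich
end

section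
open scoped BigOperators Matrix RealInnerProductSpace Quaternion
namespace Eich
open Module

section
variable {K : Type*} [Field K] [CharZero K] {a b : K}

/-- linear combination -/
def cmb (v : Fin 4 → ℍ[K,a,b]) (c : Fin 4 → K) : ℍ[K,a,b] := ∑ i, c i • v i

lemma cmb_bl (v : Fin 4 → ℍ[K,a,b]) (c d : Fin 4 → K) : bl (cmb v c) (cmb v d) = c ⬝ᵥ (Gm v).mulVec d := by
  simp only [dotProduct, Gm_mulVec]
  rw [cmb, bl_sum_left]
  simp only [bl_smul_left, cmb]

lemma cmb_self (v : Fin 4 → ℍ[K,a,b]) (c : Fin 4 → K) : c ⬝ᵥ (Gm v).mulVec c = 2 * nm (cmb v c) := by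
  rw [← cmb_bl, bl_self]

lemma cmb_refl (v : Fin 4 → ℍ[K,a,b]) (c x : Fin 4 → K) :
    cmb v ((Rep.reflMat (Gm v) c).mulVec x) = tau (cmb v c) (cmb v x) := by
  have h : (Rep.reflMat (Gm v) c).mulVec x = x - (bl (cmb v x) (cmb v c) / nm (cmb v c)) • c := by
    rw [Rep.reflMat, Matrix.sub_mulVec, Matrix.one_mulVec, Matrix.smul_mulVec, ← Matrix.mulVec_mulVec, Matrix.vecMulVec_mulVec, cmb_self, ← cmb_bl, bl_comm (cmb v c)]
    congr 1
    ext i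
    simp only [Pi.smul_apply, smul_eq_mul, MulOpposite.smul_eq_mul_unop, MulOpposite.unop_op]
    by_cases h0 : nm (cmb v c) = 0
    · simp [h0]
    · field_simp
  rw [h]
  simp only [tau, LinearMap.coe_mk, AddHom.coe_mk, cmb, Pi.sub_apply, Pi.smul_apply, sub_smul, Finset.sum_sub_distrib, Finset.smul_sum, smul_smul, smul_eq_mul]

lemma rotation (ha : a ≠ 0) (hb : b ≠ 0) {v : Fin 4 → ℍ[K,a,b]} (hv : (Gm v).det ≠ 0) {X Y : ℍ[K,a,b]} (hX : nm X = 1) (hY : nm Y = 1) :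
    ∃ Sig θ c, Rep.IsRotationWithSpinorNorm (Gm v) Sig θ ∧ c ≠ 0 ∧ θ = c ^ 2 ∧ ∀ x, cmb v (Sig.mulVec x) = X * cmb v x * Y := by
  obtain ⟨g, w, hg, hw, eX⟩ := commutator ha hb hX
  obtain ⟨g', w', hg', hw', eY⟩ := commutator ha hb (X := star Y) (by rw [nm_star, hY])
  have ex : ∀ z, ∃ c, cmb v c = z := fun z => by
    obtain ⟨c, hc⟩ := expand hv z
    exact ⟨c, hc.symm⟩
  choose co hco using ex
  have h1 : nm (1 : ℍ[K,a,b]) ≠ 0 := by rw [nm_one]; exact one_ne_zero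
  have hh : ∀ z : ℍ[K,a,b], nm z ≠ 0 → co z ⬝ᵥ (Gm v).mulVec (co z) ≠ 0 := fun z hz => by
    rw [cmb_self, hco]; exact mul_ne_zero two_ne_zero hz
  refine ⟨_, _, nm g * nm w * (nm g' * nm w'), ⟨8, ![co g, co (star w), co 1, co (w * g), co (star g'), co w', co 1, co (star (w' * g'))], by decide, ?_, rfl, rfl⟩, ?_, ?_, ?_⟩
  · intro l
    fin_cases l
    · exact hh _ hg
    · exact hh _ (by rwa [nm_star])
    · exact hh _ h1
    · exact hh _ (by rw [nm_mul]; exact mul_ne_zero hw hg)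
    · exact hh _ (by rwa [nm_star])
    · exact hh _ hw'
    · exact hh _ h1
    · exact hh _ (by rw [nm_star, nm_mul]; exact mul_ne_zero hw' hg')
  · exact mul_ne_zero (mul_ne_zero hg hw) (mul_ne_zero hg' hw')
  · simp only [cmb_self, Fin.prod_univ_eight]
    simp [hco, nm_mul, nm_star, nm_one]
    ring
  · intro x
    simp [List.ofFn_succ, ← Matrix.mulVec_mulVec, cmb_refl, hco]
    rw [left_comm hg hw, ← star_mul w' g', right_comm hg' hw', ← eX, ← eY, star_star, mul_assoc]
end
end Eich
end

section
open scoped BigOperators Matrix RealInnerProductSpace Quaternion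
namespace Eich
open Module

lemma neg_of_inf {a b : ℚ} (h : Rep.RamifiedAtInfinity a b) : a < 0 ∧ b < 0 := by
  constructor
  · by_contra hc
    push Not at hc
    have hc' : (0:ℝ) ≤ a := by exact_mod_cast hc
    have := (isUnit_iff_nm _).1 (h ⟨Real.sqrt a, 1, 0, 0⟩ (by intro h; have := congrArg QuaternionAlgebra.imI h; simp at this))
    apply this
    rw [nm_coord]; simp [Real.sq_sqrt hc']
  · by_contra hc
    push Not at hc
    have hc' : (0:ℝ) ≤ b := by exact_mod_cast hc
    have := (isUnit_iff_nm _).1 (h ⟨Real.sqrt b, 0, 1, 0⟩ (by intro h; have := congrArg QuaternionAlgebra.imJ h; simp at this))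
    apply this
    rw [nm_coord]; simp [Real.sq_sqrt hc']

lemma nm_pos {K : Type*} [Field K] [LinearOrder K] [IsStrictOrderedRing K] {a b : K} (ha : a < 0) (hb : b < 0) {z : ℍ[K,a,b]} (hz : z ≠ 0) : 0 < nm z := by
  rw [nm_coord]
  have h1 : 0 ≤ z.re^2 := sq_nonneg _
  have h2 : 0 ≤ -a * z.imI^2 := mul_nonneg (by linarith) (sq_nonneg _)
  have h3 : 0 ≤ -b * z.imJ^2 := mul_nonneg (by linarith) (sq_nonneg _)
  have hab := mul_pos_of_neg_of_neg ha hb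
  have h4 : 0 ≤ (a*b) * z.imK^2 := mul_nonneg hab.le (sq_nonneg _)
  by_contra hc
  push Not at hc
  apply hz
  have e1 : z.re^2 = 0 := by linarith
  have e2 : -a * z.imI^2 = 0 := by linarith
  have e3 : -b * z.imJ^2 = 0 := by linarith
  have e4 : (a*b) * z.imK^2 = 0 := by linarith
  have f2 := (mul_eq_zero.1 e2).resolve_left (by linarith)
  have f3 := (mul_eq_zero.1 e3).resolve_left (by linarith)
  have f4 := (mul_eq_zero.1 e4).resolve_left hab.ne'
  ext
  · simpa using e1
  · simpa using f2
  · simpa using f3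
  · simpa using f4

lemma aniso_of_neg {a b : ℚ} (ha : a < 0) (hb : b < 0) (z : ℍ[ℚ,a,b]) (h : nm z = 0) : z = 0 := by
  by_contra hz
  exact (nm_pos ha hb hz).ne' h

lemma pd_of_gram {a b : ℚ} (ha : a < 0) (hb : b < 0) {v : Fin 4 → ℍ[ℚ,a,b]} (hv : LinearIndependent ℚ v) {A : Matrix (Fin 4) (Fin 4) ℤ}
    (hA : ∀ i j, (A i j : ℚ) = bl (v i) (v j)) : PD A := by
  have hdet := det_ne_of_li (aniso_of_neg ha hb) hv
  have hG : A.map (Int.cast : ℤ → ℝ) = Gm (fun i => bcq ℝ (v i)) := by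
    rw [Gm_bcq, Gm_of_A hA]
    ext i j; simp
  rw [PD, hG]
  refine Matrix.PosDef.of_dotProduct_mulVec_pos ?_ ?_
  · ext i j; simp [Gm, Matrix.conjTranspose_apply, bl_comm]
  · intro c hc
    have e : star c ⬝ᵥ (Gm (fun i => bcq ℝ (v i))).mulVec c = 2 * nm (cmb (fun i => bcq ℝ (v i)) c) := by
      rw [← cmb_self]; rfl
    rw [e]
    have : cmb (fun i => bcq ℝ (v i)) c ≠ 0 := by
      intro h0
      apply hc
      exact expand_unique (det_bcq_ne (K := ℝ) hdet) (c := c) (d := 0) (by simpa [cmb] using h0)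
    have := nm_pos (by exact_mod_cast ha) (by exact_mod_cast hb) this
    linarith

section
variable {p : ℕ} [hp : Fact p.Prime] {a b : ℚ_[p]} {Λ : Submodule ℤ_[p] ℍ[ℚ_[p],a,b]} {x y : ℍ[ℚ_[p],a,b]}

lemma ab_int (ht : ‖tc x‖ ≤ 1) (hn : ‖nm x‖ ≤ 1) (hd : ‖dsc x‖ = 1) {α β : ℚ_[p]} (h1 : ‖2 * α + tc x * β‖ ≤ 1) (h2 : ‖tc x * α + 2 * nm x * β‖ ≤ 1) :
    ‖α‖ ≤ 1 ∧ ‖β‖ ≤ 1 := by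
  have e1 : ‖dsc x * α‖ ≤ 1 := by
    have : dsc x * α = tc x * (tc x * α + 2 * nm x * β) - 2 * nm x * (2 * α + tc x * β) := by rw [dsc]; ring
    rw [this]
    rw [it] at *
    exact sub_mem (mul_mem ht h2) (mul_mem (mul_mem (by simpa using natCast_mem (PadicInt.subring p) 2) hn) h1)
  have e2 : ‖dsc x * β‖ ≤ 1 := by
    have : dsc x * β = tc x * (2 * α + tc x * β) - 2 * (tc x * α + 2 * nm x * β) := by rw [dsc]; ring
    rw [this]
    rw [it] at *
    exact sub_mem (mul_mem ht h1) (mul_mem (by simpa using natCast_mem (PadicInt.subring p) 2) h2)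
  rw [norm_mul, hd, one_mul] at e1 e2
  exact ⟨e1, e2⟩

lemma Std.dual (h : Std Λ x y) {W} (hW : ∀ m ∈ Λ, ‖bl W m‖ ≤ 1) : ‖nm y * nm W‖ ≤ 1 := by
  obtain ⟨α, β, γ, δ, rfl⟩ := decomp h W
  have hxy : x * y ∈ Λ := h.mul h.x_mem h.y_mem
  have b1 := hW _ h.one_mem
  have b2 := hW _ h.x_mem
  have b3 := hW _ h.y_mem
  have b4 := hW _ hxy
  have p1 := h.perp
  have p2 := h.perp.xmul
  have c1 : bl y 1 = 0 := by rw [bl_comm]; exact p1.1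
  have c2 : bl y x = 0 := by rw [bl_comm]; exact p1.2
  have c3 : bl (x*y) 1 = 0 := by rw [bl_comm]; exact p2.1
  have c4 : bl (x*y) x = 0 := by rw [bl_comm]; exact p2.2
  have d1 : bl y (x*y) = nm y * tc x := by
    have := bl_mul_right (1 : ℍ[ℚ_[p],a,b]) x y
    rw [one_mul, bl_one] at this; rw [this]; ring
  have d2 : bl (x*y) y = nm y * tc x := by rw [bl_comm]; exact d1
  have d3 : bl (x*y) (x*y) = 2 * (nm x * nm y) := by rw [bl_self, nm_mul]
  simp only [bl_add_left, bl_smul_left, c1, c2, c3, c4, p1.1, p1.2, p2.1, p2.2, bl_self, nm_one, bl_one, d1, d2, nm_mul, bl_comm x 1] at b1 b2 b3 b4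
  have ab := ab_int (α := α) (β := β) h.tcx h.nmx h.d (by refine le_of_eq_of_le (congrArg norm ?_) b1; ring) (by refine le_of_eq_of_le (congrArg norm ?_) b2; ring)
  have cd := ab_int (α := nm y * γ) (β := nm y * δ) h.tcx h.nmx h.d (by refine le_of_eq_of_le (congrArg norm ?_) b3; ring) (by refine le_of_eq_of_le (congrArg norm ?_) b4; ring)
  rw [nm_decomp h.perp]
  have e : nm y * (nm (α • 1 + β • x) + nm (γ • 1 + δ • x) * nm y) = nm y * nm (α • 1 + β • x) + nm ((nm y * γ) • 1 + (nm y * δ) • x) := by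
    rw [nm_Sx, nm_Sx, nm_Sx]; ring
  rw [e]
  have i1 := Sx_int h.tcx h.nmx (mem_Sx.2 ⟨α, β, ab.1, ab.2, rfl⟩)
  have i2 := Sx_int h.tcx h.nmx (mem_Sx.2 ⟨nm y * γ, nm y * δ, cd.1, cd.2, rfl⟩)
  have i3 := h.nyi
  rw [it] at *
  exact add_mem (mul_mem i3 i1) i2

lemma bl_sp_le {n : ℕ} {v : Fin n → ℍ[ℚ_[p],a,b]} {W} (h : ∀ i, ‖bl W (v i)‖ ≤ 1) {m} (hm : m ∈ sp v) : ‖bl W m‖ ≤ 1 := by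
  obtain ⟨c, rfl⟩ := mem_sp.1 hm
  rw [bl_sum_right]
  simp only [bl_smul_right]
  exact it.2 (sum_mem fun i _ => mul_mem (it.1 (PadicInt.norm_le_one (c i))) (it.1 (h i)))
end

section
variable {a b : ℚ}

lemma Idl.gram {N : ℕ} (hN : Squarefree N) {R M : Submodule ℤ ℍ[ℚ,a,b]} (hR : OrdN N R) (h : Idl R M) {v : Fin 4 → ℍ[ℚ,a,b]}
    (hv : Submodule.span ℤ (Set.range v) = M) (p : ℕ) [hp : Fact p.Prime] :
    ‖(Gm (fun i => bcq ℚ_[p] (v i))).det‖ = ‖(N : ℚ_[p])‖^2 ∧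
    ∀ W, (∀ i, ‖bl W (bcq ℚ_[p] (v i))‖ ≤ 1) → ‖(N : ℚ_[p]) * nm W‖ ≤ 1 := by
  obtain ⟨w, hw, hw1, hwm⟩ := h.loc hN hR p
  have w0 := nm_ne_of_unit hw1
  obtain ⟨x, y, hS, hy⟩ := hR.std hN (p := p)
  have hsp : lc p R = sp (fun i => iv w * bcq ℚ_[p] (v i)) := by
    ext z
    rw [left_sp w0, ← lc_span, hv, hwm, iv_mul_mul w0]
  rw [hsp] at hS
  have hiv : ‖nm (iv w)‖ = 1 := by rw [nm_iv, norm_inv, hw1, inv_one]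
  constructor
  · have := hS.det_eq
    rw [Gm_left, Matrix.det_smul, norm_mul, norm_pow, hiv, one_pow, one_mul] at this
    rw [this, hy]
  · intro W hW
    have := hS.dual (W := iv w * W) (fun m hm => bl_sp_le (fun i => by rw [bl_mul_left, norm_mul, hiv, one_mul]; exact hW i) hm)
    rwa [nm_mul, norm_mul, norm_mul, hiv, one_mul, hy, ← norm_mul] at this

lemma det_eq_sq {N : ℕ} (hN0 : N ≠ 0) {d : ℤ} (hd : 0 < d) (h : ∀ (p : ℕ) [Fact p.Prime], ‖(d : ℚ_[p])‖ = ‖(N : ℚ_[p])‖^2) : d = (N:ℤ)^2 := by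
  have hNq : (N:ℚ)^2 ≠ 0 := by positivity
  have hdq : (d:ℚ) ≠ 0 := by exact_mod_cast hd.ne'
  obtain ⟨m, hm⟩ := int_of_local (c := (d:ℚ) / (N:ℚ)^2) (fun p _ => by
    push_cast; rw [norm_div, norm_pow, h p]
    exact div_self_le_one _)
  obtain ⟨m', hm'⟩ := int_of_local (c := (N:ℚ)^2 / (d:ℚ)) (fun p _ => by
    push_cast; rw [norm_div, norm_pow, h p]
    exact div_self_le_one _)
  have hmm : m * m' = 1 := by
    have : ((m * m' : ℤ) : ℚ) = 1 := by push_cast; rw [← hm, ← hm']; field_simp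
    exact_mod_cast this
  have hdp : (0:ℚ) < d := by exact_mod_cast hd
  have hpos : (0:ℚ) < m := by rw [← hm]; positivity
  have hpos' : 0 < m := by exact_mod_cast hpos
  have : m = 1 := by
    rcases Int.eq_one_or_neg_one_of_mul_eq_one hmm with h | h <;> omega
  rw [this] at hm
  have : (d:ℚ) = (N:ℚ)^2 := by field_simp at hm; simpa using hm
  exact_mod_cast this
end
end Eich
end

section
open scoped BigOperators Matrix RealInnerProductSpace Quaternion
namespace Eich
open Module

section
variable {a b : ℚ}

lemma Idl.nm_dual {N : ℕ} (hN : Squarefree N) {R M : Submodule ℤ ℍ[ℚ,a,b]} (hR : OrdN N R) (h : Idl R M) {v : Fin 4 → ℍ[ℚ,a,b]}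
    (hv : Submodule.span ℤ (Set.range v) = M) {W} (hW : ∀ i, ∃ m : ℤ, bl W (v i) = m) : ∃ m : ℤ, N * nm W = m := by
  apply int_of_local
  intro p _
  have := (h.gram hN hR hv p).2 (bcq ℚ_[p] W) (fun i => by rw [bl_bcq]; exact norm_le_of_int (hW i))
  rw [nm_bcq] at this
  push_cast; exact this

lemma level_even {N : ℕ} {v : Fin 4 → ℍ[ℚ,a,b]} (hdet : (Gm v).det ≠ 0) {A : Matrix (Fin 4) (Fin 4) ℤ} (hA : ∀ i j, (A i j : ℚ) = bl (v i) (v j))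
    (h : ∀ W : ℍ[ℚ,a,b], (∀ i, ∃ m : ℤ, bl W (v i) = m) → ∃ m : ℤ, N * nm W = m) : Rep.EvenIntegralScaledInv A N := by
  have hu : IsUnit (Gm v).det := isUnit_iff_ne_zero.2 hdet
  set w : Fin 4 → ℍ[ℚ,a,b] := fun i => cmb v (fun k => (Gm v)⁻¹ k i) with hw
  have e0 : ∀ i, (Gm v).mulVec (fun k => (Gm v)⁻¹ k i) = Pi.single i 1 := by
    intro i
    ext j
    have := congrFun (congrFun (Matrix.mul_nonsing_inv _ hu) j) i
    rw [Matrix.mul_apply] at this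
    simp only [Matrix.mulVec, dotProduct, this, Matrix.one_apply, Pi.single_apply]
  have e1 : ∀ i j, bl (w i) (v j) = if j = i then 1 else 0 := by
    intro i j
    rw [bl_comm]
    have := Gm_mulVec v (fun k => (Gm v)⁻¹ k i) j
    rw [e0, Pi.single_apply] at this
    exact this.symm
  have e2 : ∀ i j, bl (w i) (w j) = (Gm v)⁻¹ j i := by
    intro i j
    rw [hw, cmb_bl, e0]; simp
  have e3 : ∀ i k, ∃ m : ℤ, bl (w i) (v k) = m := by
    intro i k
    rw [e1]; split_ifs
    · exact ⟨1, by simp⟩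
    · exact ⟨0, by simp⟩
  have hAG : (A.map (Int.cast : ℤ → ℚ))⁻¹ = (Gm v)⁻¹ := by rw [Gm_of_A hA]
  constructor
  · intro i j
    rw [hAG, ← e2, bl_rat]
    obtain ⟨m1, h1⟩ := h (w j + w i) (fun k => by
      obtain ⟨c1, hc1⟩ := e3 i k
      obtain ⟨c2, hc2⟩ := e3 j k
      exact ⟨c2 + c1, by rw [bl_add_left, hc1, hc2]; push_cast; ring⟩)
    obtain ⟨m2, h2⟩ := h (w i) (e3 i)
    obtain ⟨m3, h3⟩ := h (w j) (e3 j)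
    exact ⟨m1 - m3 - m2, by push_cast; rw [← h1, ← h2, ← h3]; ring⟩
  · intro i
    rw [hAG, ← e2, bl_self]
    obtain ⟨m2, h2⟩ := h (w i) (e3 i)
    exact ⟨m2, by rw [← h2]; ring⟩

lemma level_of {N : ℕ} (hN : Squarefree N) {A : Matrix (Fin 4) (Fin 4) ℤ} (hd : A.det = (N:ℤ)^2) (h : Rep.EvenIntegralScaledInv A N) :
    Rep.IsLevelOf A N := by
  refine ⟨Nat.pos_of_ne_zero hN.ne_zero, h, ?_⟩
  intro l hl hl'
  choose T hT using hl'.1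
  have hN0 : (N:ℚ) ≠ 0 := by exact_mod_cast hN.ne_zero
  have h1 : (l:ℚ) • (A.map (Int.cast : ℤ → ℚ))⁻¹ = (Matrix.of T).map (Int.cast : ℤ → ℚ) := by
    ext i j; simp [hT]
  have h2 := congrArg Matrix.det h1
  have h3 : ((Matrix.of T).map (Int.cast : ℤ → ℚ)).det = ((Matrix.of T).det : ℚ) := ((Int.castRingHom ℚ).map_det (Matrix.of T)).symm
  have h3' : ((Matrix.of T).map (fun x : ℤ => (x:ℚ))).det = ((Matrix.of T).det : ℚ) := h3
  have h4 : (A.map (Int.cast : ℤ → ℚ)).det = (A.det : ℚ) := ((Int.castRingHom ℚ).map_det A).symm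
  rw [Matrix.det_smul, Matrix.det_nonsing_inv, Ring.inverse_eq_inv', h3, h4, hd] at h2
  push_cast at h2
  simp only [Fintype.card_fin] at h2
  have h5 : ((l:ℤ))^4 = (Matrix.of T).det * (N:ℤ)^2 := by
    have : (l:ℚ)^4 = ((Matrix.of T).det : ℚ) * (N:ℚ)^2 := by
      rw [h3'] at h2; rw [← h2]; field_simp
    exact_mod_cast this
  have h6 : (N:ℤ) ∣ ((l^4 : ℕ) : ℤ) := by
    push_cast; rw [h5, sq, ← mul_assoc]; exact dvd_mul_left _ _
  have h7 : N ∣ l^4 := by exact_mod_cast h6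
  exact (hN.dvd_pow_iff_dvd (by norm_num)).1 h7

lemma zp_map_inj {p : ℕ} [Fact p.Prime] {P Q : Matrix (Fin 4) (Fin 4) ℤ_[p]} (h : P.map (fun x : ℤ_[p] => (x : ℚ_[p])) = Q.map (fun x : ℤ_[p] => (x : ℚ_[p]))) : P = Q := by
  ext i j
  have := congrFun (congrFun h i) j
  simp only [Matrix.map_apply] at this
  exact Subtype.ext this

lemma zp_map_mul {p : ℕ} [Fact p.Prime] (P Q : Matrix (Fin 4) (Fin 4) ℤ_[p]) : (P * Q).map (fun x : ℤ_[p] => (x : ℚ_[p])) = P.map (fun x : ℤ_[p] => (x : ℚ_[p])) * Q.map (fun x : ℤ_[p] => (x : ℚ_[p])) :=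
  Matrix.map_mul (f := (PadicInt.Coe.ringHom : ℤ_[p] →+* ℚ_[p]))

lemma local_part (ha : a < 0) (hb : b < 0) {N : ℕ} (hN : Squarefree N) {R R' M M' Q : Submodule ℤ ℍ[ℚ,a,b]} (hR : OrdN N R) (hR' : OrdN N R') (hM : Idl R M) (hM' : Idl R' M')
    (hQ : Idl R' Q) (hQl : ∀ x ∈ R, ∀ y ∈ Q, x * y ∈ Q) {v v' : Fin 4 → ℍ[ℚ,a,b]} (hv : LinearIndependent ℚ v) (hv' : LinearIndependent ℚ v')
    (hs : Submodule.span ℤ (Set.range v) = M) (hs' : Submodule.span ℤ (Set.range v') = M') {A A' : Matrix (Fin 4) (Fin 4) ℤ}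
    (hA : ∀ i j, (A i j : ℚ) = bl (v i) (v j)) (hA' : ∀ i j, (A' i j : ℚ) = bl (v' i) (v' j)) {C : Matrix (Fin 4) (Fin 4) ℚ} (hC : ∀ j, v' j = ∑ i, C i j • v i) (p : ℕ) [hp : Fact p.Prime] :
    ∃ (Sig : Matrix (Fin 4) (Fin 4) ℚ_[p]) (θ c : ℚ_[p]) (U : Matrix (Fin 4) (Fin 4) ℤ_[p]),
        Rep.IsRotationWithSpinorNorm (A.map (Int.cast : ℤ → ℚ_[p])) Sig θ ∧ c ≠ 0 ∧ θ = c ^ 2 ∧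
        IsUnit U.det ∧
        C.map (Rat.cast : ℚ → ℚ_[p]) = Sig * U.map (fun x : ℤ_[p] => (x : ℚ_[p])) ∧
        Uᵀ * A.map (Int.cast : ℤ → ℤ_[p]) * U = A'.map (Int.cast : ℤ → ℤ_[p]) := by
  have hd := det_bcq_ne (K := ℚ_[p]) (det_ne_of_li (aniso_of_neg ha hb) hv)
  have hd' := det_bcq_ne (K := ℚ_[p]) (det_ne_of_li (aniso_of_neg ha hb) hv')
  have hG : Gm (fun i => bcq ℚ_[p] (v i)) = A.map (Int.cast : ℤ → ℚ_[p]) := by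
    rw [Gm_bcq, Gm_of_A hA]; ext i j; simp
  have hG' : Gm (fun i => bcq ℚ_[p] (v' i)) = A'.map (Int.cast : ℤ → ℚ_[p]) := by
    rw [Gm_bcq, Gm_of_A hA']; ext i j; simp
  obtain ⟨X, Y, hX, hY, ht⟩ := transport hN hR hR' hM hM' hQ hQl p
  have X0 : nm X ≠ 0 := by rw [hX]; exact one_ne_zero
  have Y0 : nm Y ≠ 0 := by rw [hY]; exact one_ne_zero
  obtain ⟨U, hU⟩ := exists_change (v := fun i => bcq ℚ_[p] (v i)) (w := fun j => iv X * bcq ℚ_[p] (v' j) * iv Y) (fun j => by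
    rw [← lc_span, hs]
    exact ht _ (by rw [← hs', lc_span]; exact vmem_sp _ j))
  have hGw : Gm (fun j => iv X * bcq ℚ_[p] (v' j) * iv Y) = Gm (fun i => bcq ℚ_[p] (v' i)) := by
    rw [Gm_right (fun j => iv X * bcq ℚ_[p] (v' j)), Gm_left, nm_iv, nm_iv, hX, hY]; simp
  have hUu : IsUnit U.det := unit_of_det hU (by
    rw [hGw, (hM.gram hN hR hs p).1, (hM'.gram hN hR' hs' p).1]) (by rw [hGw]; exact hd')
  obtain ⟨Sig, θ, c, hrot, hc, hθ, hact⟩ := rotation (by exact_mod_cast ha.ne) (by exact_mod_cast hb.ne) hd hX hY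
  refine ⟨Sig, θ, c, U, ?_, hc, hθ, hUu, ?_, ?_⟩
  · rw [← hG]; exact hrot
  · ext i j
    have h1 : cmb (fun i => bcq ℚ_[p] (v i)) (fun i => (C i j : ℚ_[p])) = cmb (fun i => bcq ℚ_[p] (v i)) (Sig.mulVec (fun i => (U i j : ℚ_[p]))) := by
      rw [hact]
      have e1 : cmb (fun i => bcq ℚ_[p] (v i)) (fun i => (C i j : ℚ_[p])) = bcq ℚ_[p] (v' j) := by
        rw [hC j, bcq_sum]; simp only [cmb, bcq_smul]
      have e2 : cmb (fun i => bcq ℚ_[p] (v i)) (fun i => (U i j : ℚ_[p])) = iv X * bcq ℚ_[p] (v' j) * iv Y := (hU j).symm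
      rw [e1, e2, ← mul_assoc, ← mul_assoc, mul_iv X0, one_mul, mul_assoc, iv_mul Y0, mul_one]
    have h2 := congrFun (expand_unique hd h1) i
    simp only [Matrix.map_apply]
    rw [h2]; rfl
  · apply zp_map_inj
    have h1 := Gm_change (U := U.map (fun x : ℤ_[p] => (x : ℚ_[p]))) (v := fun i => bcq ℚ_[p] (v i)) hU
    rw [hGw, hG, hG'] at h1
    rw [zp_map_mul, zp_map_mul, Matrix.transpose_map]
    have e : ∀ P : Matrix (Fin 4) (Fin 4) ℤ, (P.map (Int.cast : ℤ → ℤ_[p])).map (fun x : ℤ_[p] => (x : ℚ_[p])) = P.map (Int.cast : ℤ → ℚ_[p]) := by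
      intro P; ext i j; simp
    rw [e, e, h1]

lemma exists_C (ha : a < 0) (hb : b < 0) {v v' : Fin 4 → ℍ[ℚ,a,b]} (hv : LinearIndependent ℚ v) : ∃ C : Matrix (Fin 4) (Fin 4) ℚ, ∀ j, v' j = ∑ i, C i j • v i := by
  have hd := (det_ne_of_li (aniso_of_neg ha hb) hv)
  choose c hc using fun j => expand hd (v' j)
  exact ⟨fun i j => c j i, hc⟩

section
variable {N₁ N₂ : ℕ} (S : Rep.EichlerSetting N₁ N₂)

lemma S_ord (j) : OrdN (N₁ * N₂) (S.Rord j) := by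
  obtain ⟨-, h1, h2⟩ := S.Rord_order j
  obtain ⟨A, ⟨v, hv, hs, hA⟩, hd⟩ := S.Rord_disc j
  refine ⟨h1, h2, ?_, v, A, ?_, hA, hd⟩
  · intro x hx
    rw [← S.I_diag] at hx
    exact S.I_nrd_integral _ _ x hx
  · rw [hs, Submodule.span_eq]

lemma S_aniso : ∀ z : ℍ[ℚ,S.a,S.b], nm z = 0 → z = 0 := aniso_of_neg (neg_of_inf S.ram_inf).1 (neg_of_inf S.ram_inf).2

lemma S_idl (i j) : Idl (S.Rord j) (S.I i j) := by
  refine ⟨S.I_nrd_integral i j, S.I_nrd_primitive i j, ?_, ?_⟩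
  · obtain ⟨v, hv, hs⟩ := S.I_lattice i j
    exact ⟨v, det_ne_of_li (S_aniso S) hv, hs⟩
  · intro x
    have := S.I_right i j
    have h := Set.ext_iff.1 this x
    exact h.symm

lemma S_left (i j) {x y} (hx : x ∈ S.Rord i) (hy : y ∈ S.I i j) : x * y ∈ S.I i j := by
  have h := Set.ext_iff.1 (S.I_left i j) x
  exact h.2 hx y hy

lemma S_gram (i j) {A : Matrix (Fin 4) (Fin 4) ℤ} (h : Rep.IsGramOf (S.I i j : Set ℍ[ℚ,S.a,S.b]) A) :
    Rep.PosDefMat A ∧ A.det = ((N₁ * N₂ : ℕ) : ℤ)^2 ∧ Rep.IsLevelOf A (N₁ * N₂) := by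
  obtain ⟨v, hv, hs, hA⟩ := h
  rw [Submodule.span_eq] at hs
  have hN := S.squarefree
  obtain ⟨ha, hb⟩ := neg_of_inf S.ram_inf
  have hdet := det_ne_of_li (S_aniso S) hv
  have hpd := pd_of_gram ha hb hv hA
  have hd : A.det = ((N₁ * N₂ : ℕ) : ℤ)^2 := by
    apply det_eq_sq hN.ne_zero
    · have := hpd.det_pos
      have h4 : (A.map (Int.cast : ℤ → ℝ)).det = (A.det : ℝ) := ((Int.castRingHom ℝ).map_det A).symm
      rw [h4] at this
      exact_mod_cast this
    · intro p _
      have := ((S_idl S i j).gram hN (S_ord S j) hs p).1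
      rw [det_bcq, det_of_A hA] at this
      rw [← this]; simp
  refine ⟨hpd, hd, level_of hN hd ?_⟩
  exact level_even hdet hA fun W hW => (S_idl S i j).nm_dual hN (S_ord S j) hs hW

lemma S_spinor (i j i' j') {A A' : Matrix (Fin 4) (Fin 4) ℤ} (h : Rep.IsGramOf (S.I i j : Set ℍ[ℚ,S.a,S.b]) A) (h' : Rep.IsGramOf (S.I i' j' : Set ℍ[ℚ,S.a,S.b]) A') :
    Rep.SameSpinorGenus A A' := by
  have g := S_gram S i j h
  have g' := S_gram S i' j' h'
  obtain ⟨v, hv, hs, hA⟩ := h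
  obtain ⟨v', hv', hs', hA'⟩ := h'
  rw [Submodule.span_eq] at hs hs'
  have hN := S.squarefree
  obtain ⟨ha, hb⟩ := neg_of_inf S.ram_inf
  obtain ⟨C, hC⟩ := exists_C ha hb hv (v' := v')
  have L := fun (p : ℕ) (hp : Fact p.Prime) => local_part ha hb hN (S_ord S j) (S_ord S j') (S_idl S i j) (S_idl S i' j') (S_idl S j j') (fun x hx y hy => S_left S _ _ hx hy) hv hv' hs hs' hA hA' hC p
  refine ⟨⟨g.1, g'.1, ?_⟩, C, 1, ?_, by simp, ?_⟩
  · intro p hp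
    obtain ⟨Sig, θ, c, U, h1, h2, h3, h4, h5, h6⟩ := L p ⟨hp⟩
    exact ⟨U, h4, h6⟩
  · rw [← Gm_of_A hA, ← Gm_of_A hA']
    exact (Gm_change hC).symm
  · intro p hp
    obtain ⟨Sig, θ, c, U, h1, h2, h3, h4, h5, h6⟩ := L p ⟨hp⟩
    refine ⟨Sig, θ, c, U, h1, h2, h3, h4, ?_⟩
    rw [h5]; simp
end
end
end Eich
end

section
open scoped BigOperators Matrix RealInnerProductSpace Quaternion
namespace Eich
open Module

lemma good_of {N : ℕ} (hN0 : N ≠ 0) {A : Matrix (Fin 4) (Fin 4) ℤ} (hs : A.IsSymm) (hev : ∀ i, 2 ∣ A i i) (hpd : PD A) (hd : A.det = (N:ℤ)^2)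
    (h : Rep.EvenIntegralScaledInv A N) : Good N A := by
  refine ⟨hs, hev, hpd, hd, ?_⟩
  choose T hT using h.1
  have hdq : (A.map (Int.cast : ℤ → ℚ)).det = (A.det : ℚ) := ((Int.castRingHom ℚ).map_det A).symm
  have hu : IsUnit (A.map (Int.cast : ℤ → ℚ)).det := by
    rw [hdq, hd, isUnit_iff_ne_zero]; push_cast; positivity
  have hAs : (A.map (Int.cast : ℤ → ℚ)).IsSymm := by
    ext i j; simp [hs.apply i j]
  have hTm : (Matrix.of T).map (Int.cast : ℤ → ℚ) = (N:ℚ) • (A.map (Int.cast : ℤ → ℚ))⁻¹ := by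
    ext i j; simp [hT]
  refine ⟨Matrix.of T, ?_, ?_, ?_⟩
  · have e : (A * Matrix.of T).map (Int.cast : ℤ → ℚ) = ((N:ℤ) • (1 : Matrix (Fin 4) (Fin 4) ℤ)).map (Int.cast : ℤ → ℚ) := by
      have h1 : (A * Matrix.of T).map (Int.cast : ℤ → ℚ) = A.map (Int.cast : ℤ → ℚ) * (Matrix.of T).map (Int.cast : ℤ → ℚ) := Matrix.map_mul (f := Int.castRingHom ℚ)
      rw [h1, hTm, Matrix.mul_smul, Matrix.mul_nonsing_inv _ hu]
      ext i j
      rw [Matrix.smul_apply, Matrix.map_apply, Matrix.smul_apply, Matrix.one_apply, Matrix.one_apply]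
      split_ifs <;> simp
    ext i j
    have := congrFun (congrFun e i) j
    simp only [Matrix.map_apply] at this
    exact_mod_cast this
  · ext i j
    have h1 := hT i j
    have h2 := hT j i
    have h3 : (A.map (Int.cast : ℤ → ℚ))⁻¹ j i = (A.map (Int.cast : ℤ → ℚ))⁻¹ i j := by
      have := Matrix.transpose_nonsing_inv (A.map (Int.cast : ℤ → ℚ))
      rw [hAs] at this
      exact congrFun (congrFun this i) j
    rw [h3, h1] at h2
    simp only [Matrix.transpose_apply, Matrix.of_apply]
    exact_mod_cast h2.symm
  · intro i
    obtain ⟨c, hc⟩ := h.2 i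
    rw [hT] at hc
    exact ⟨c, by simp only [Matrix.of_apply]; exact_mod_cast hc⟩

section
variable {p : ℕ} [hp : Fact p.Prime] {a b : ℚ_[p]} {Λ : Submodule ℤ_[p] ℍ[ℚ_[p],a,b]} {x y : ℍ[ℚ_[p],a,b]}

lemma p_ne : (p : ℚ_[p]) ≠ 0 := by exact_mod_cast hp.out.ne_zero

lemma div_p {c : ℚ_[p]} : ‖c / p‖ ≤ 1 ↔ ‖c‖ ≤ ‖(p : ℚ_[p])‖ := by
  rw [norm_div, div_le_one (norm_pos_iff.2 p_ne)]

lemma iso_loc (h : Std Λ x y) (hy : ‖nm y‖ = ‖(p : ℚ_[p])‖) : SIso x ↔ ∃ z ∈ Λ, (¬ ∃ z' ∈ Λ, z = (p : ℚ_[p]) • z') ∧ (∀ m ∈ Λ, ‖bl z m‖ ≤ ‖(p : ℚ_[p])‖) ∧ ‖nm z‖ ≤ ‖(p : ℚ_[p])‖^2 := by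
  have hpp : 0 < ‖(p : ℚ_[p])‖ := norm_pos_iff.2 p_ne
  constructor
  · rintro ⟨α, β, hα, hβ, h1, hn⟩
    have ht : α • 1 + β • x ∈ Sx x := mem_Sx.2 ⟨α, β, hα, hβ, rfl⟩
    refine ⟨(α • 1 + β • x) * y, h.mem.2 ⟨0, zero_mem _, _, ht, by simp⟩, ?_, ?_, ?_⟩
    · rintro ⟨z', hz', e⟩
      rw [h.eq] at hz'
      obtain ⟨α', β', γ', δ', i1, i2, i3, i4, rfl⟩ := mem_stdv hz'
      have := expand_unique h.det_ne (c := ![0,0,α,β]) (d := ![p*α',p*β',p*γ',p*δ']) (by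
        simp only [Fin.sum_univ_four, stdv]
        simp only [add_mul, smul_mul_assoc, one_mul, smul_add, smul_smul] at e
        simpa using e)
      have e1 : α = p * γ' := congrFun this 2
      have e2 : β = p * δ' := congrFun this 3
      have hp1 : ‖(p : ℚ_[p])‖ < 1 := Padic.norm_p_lt_one
      have key : ∀ c : ℚ_[p], ‖c‖ ≤ 1 → ‖(p : ℚ_[p]) * c‖ < 1 := fun c hc => by
        rw [norm_mul]
        exact (mul_le_of_le_one_right hpp.le hc).trans_lt hp1
      rcases h1 with h1 | h1
      · rw [e1] at h1; exact (key _ i3).ne h1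
      · rw [e2] at h1; exact (key _ i4).ne h1
    · intro m hm
      obtain ⟨s, hs, t, ht', rfl⟩ := h.mem.1 hm
      rw [bl_add_right, bl_comm, blS h.perp hs ht, zero_add, bl_mul_right, norm_mul, hy]
      exact mul_le_of_le_one_left hpp.le (h.blint (h.S_le ht) (h.S_le ht'))
    · rw [nm_mul, norm_mul, hy, sq]
      exact mul_le_mul_of_nonneg_right (lt_one_le_p hn) hpp.le
  · rintro ⟨z, hz, hprim, hbl, hnm⟩
    rw [h.eq] at hz
    obtain ⟨α, β, γ, δ, i1, i2, i3, i4, rfl⟩ := mem_stdv hz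
    have b1 := hbl _ h.one_mem
    have b2 := hbl _ h.x_mem
    have p1 := h.perp
    have p2 := h.perp.xmul
    have c1 : bl y 1 = 0 := by rw [bl_comm]; exact p1.1
    have c2 : bl y x = 0 := by rw [bl_comm]; exact p1.2
    have c3 : bl (x*y) 1 = 0 := by rw [bl_comm]; exact p2.1
    have c4 : bl (x*y) x = 0 := by rw [bl_comm]; exact p2.2
    simp only [bl_add_left, bl_smul_left, c1, c2, c3, c4, bl_self, nm_one, bl_one, bl_comm x 1] at b1 b2
    have ab := ab_int (α := α / p) (β := β / p) h.tcx h.nmx h.d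
      (by rw [← div_p] at b1; refine le_of_eq_of_le (congrArg norm ?_) b1; ring)
      (by rw [← div_p] at b2; refine le_of_eq_of_le (congrArg norm ?_) b2; ring)
    have hs := Sx_int h.tcx h.nmx (mem_Sx.2 ⟨_, _, ab.1, ab.2, rfl⟩)
    rw [nm_decomp h.perp] at hnm
    have e1 : nm (α • 1 + β • x) = (p : ℚ_[p])^2 * nm ((α/p) • 1 + (β/p) • x) := by
      rw [nm_Sx, nm_Sx]; have := p_ne (p := p); field_simp
    have n1 : ‖nm (α • 1 + β • x)‖ ≤ ‖(p : ℚ_[p])‖^2 := by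
      rw [e1, norm_mul, norm_pow]
      exact mul_le_of_le_one_right (by positivity) hs
    have n2 : ‖nm (γ • 1 + δ • x) * nm y‖ ≤ ‖(p : ℚ_[p])‖^2 := by
      have : nm (γ • 1 + δ • x) * nm y = (nm (α • 1 + β • x) + nm (γ • 1 + δ • x) * nm y) + -nm (α • 1 + β • x) := by ring
      rw [this]
      exact (Padic.nonarchimedean _ _).trans (max_le hnm (by rwa [norm_neg]))
    rw [norm_mul, hy, sq] at n2
    have n3 := le_of_mul_le_mul_right n2 hpp
    refine ⟨γ, δ, i3, i4, ?_, n3.trans_lt Padic.norm_p_lt_one⟩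
    by_contra hcon
    push Not at hcon
    have j3 := div_p.2 (lt_one_le_p (lt_of_le_of_ne i3 hcon.1))
    have j4 := div_p.2 (lt_one_le_p (lt_of_le_of_ne i4 hcon.2))
    refine hprim ⟨((α/p) • 1 + (β/p) • x) + ((γ/p) • 1 + (δ/p) • x) * y, h.mem.2 ⟨_, mem_Sx.2 ⟨_, _, ab.1, ab.2, rfl⟩, _, mem_Sx.2 ⟨_, _, j3, j4, rfl⟩, rfl⟩, ?_⟩
    have hc : ∀ c : ℚ_[p], (p : ℚ_[p]) * (c / p) = c := fun c => by have := p_ne (p := p); field_simp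
    simp only [add_mul, smul_mul_assoc, one_mul, smul_add, smul_smul, hc, add_assoc]
end

section
variable {a b : ℚ} {p : ℕ} [hp : Fact p.Prime]

lemma int_norm_dvd {m : ℤ} {n : ℕ} (h : ‖(m : ℚ_[p])‖ ≤ ‖(p : ℚ_[p])‖^n) : (p:ℤ)^n ∣ m := by
  have := (Padic.norm_int_le_pow_iff_dvd (p := p) m n).1 (by
    refine h.trans (le_of_eq ?_)
    rw [Padic.norm_p, zpow_neg, zpow_natCast, inv_pow])
  exact_mod_cast this

lemma dvd_norm_int {m : ℤ} {n : ℕ} (h : (p:ℤ)^n ∣ m) : ‖(m : ℚ_[p])‖ ≤ ‖(p : ℚ_[p])‖^n := by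
  obtain ⟨k, rfl⟩ := h
  push_cast
  rw [norm_mul, norm_pow]
  exact mul_le_of_le_one_right (by positivity) (Padic.norm_int_le_one k)

lemma iso_glob {v : Fin 4 → ℍ[ℚ,a,b]} {A : Matrix (Fin 4) (Fin 4) ℤ} (hA : ∀ i j, (A i j : ℚ) = bl (v i) (v j)) (hdet : (Gm v).det ≠ 0)
    (hintg : ∀ z ∈ lc p (Submodule.span ℤ (Set.range v)), ‖nm z‖ ≤ 1) (hintg' : ∀ z ∈ Submodule.span ℤ (Set.range v), ∃ m : ℤ, nm z = m) :
    IsoAt p A ↔ ∃ z ∈ lc p (Submodule.span ℤ (Set.range v)), (¬ ∃ z' ∈ lc p (Submodule.span ℤ (Set.range v)), z = (p : ℚ_[p]) • z') ∧ (∀ m ∈ lc p (Submodule.span ℤ (Set.range v)), ‖bl z m‖ ≤ ‖(p : ℚ_[p])‖) ∧ ‖nm z‖ ≤ ‖(p : ℚ_[p])‖^2 := by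
  have hd := det_bcq_ne (K := ℚ_[p]) hdet
  have hpp : 0 < ‖(p : ℚ_[p])‖ := norm_pos_iff.2 p_ne
  have hp1 : ‖(p : ℚ_[p])‖ < 1 := Padic.norm_p_lt_one
  -- facts for integral vectors
  have F1 : ∀ e : Fin 4 → ℤ, bcq ℚ_[p] (∑ i, e i • v i) = ∑ i, (e i : ℚ_[p]) • bcq ℚ_[p] (v i) := by
    intro e
    rw [bcq_sum]
    refine Finset.sum_congr rfl fun i _ => ?_
    rw [bcq_zsmul]
  have F2 : ∀ (e : Fin 4 → ℤ) i, bl (bcq ℚ_[p] (∑ i, e i • v i)) (bcq ℚ_[p] (v i)) = ((A.mulVec e i : ℤ) : ℚ_[p]) := by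
    intro e i
    rw [bl_bcq, bl_comm]
    have := bl_comb hA (Pi.single i 1) e
    simp only [single_one_dotProduct] at this
    have h2 : ∑ k, (Pi.single i 1 : Fin 4 → ℤ) k • v k = v i := by
      rw [Finset.sum_eq_single i] <;> simp +contextual [Pi.single_apply]
    rw [h2] at this
    rw [this]; simp
  have F3 : ∀ (e : Fin 4 → ℤ), ((e ⬝ᵥ A.mulVec e : ℤ) : ℚ) = 2 * nm (∑ i, e i • v i) := by
    intro e
    rw [← bl_comb hA, bl_self]
  constructor
  · rintro ⟨e, ⟨s, hs⟩, h1, h2⟩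
    refine ⟨bcq ℚ_[p] (∑ i, e i • v i), bcq_mem (Submodule.sum_mem _ fun i _ => Submodule.smul_mem _ _ (Submodule.subset_span ⟨i, rfl⟩)), ?_, ?_, ?_⟩
    · rintro ⟨z', hz', e'⟩
      rw [lc_span] at hz'
      obtain ⟨c, rfl⟩ := mem_sp.1 hz'
      rw [F1, Finset.smul_sum] at e'
      simp only [smul_smul] at e'
      have := congrFun (expand_unique hd e') s
      apply hs
      rw [← pow_one (p:ℤ)]
      apply int_norm_dvd
      rw [this, norm_mul, pow_one]
      exact mul_le_of_le_one_right hpp.le (PadicInt.norm_le_one _)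
    · intro m hm
      rw [lc_span] at hm
      have := bl_sp_le (W := (p : ℚ_[p])⁻¹ • bcq ℚ_[p] (∑ i, e i • v i)) (v := fun i => bcq ℚ_[p] (v i)) (fun i => by
        rw [bl_smul_left, F2, mul_comm, ← div_eq_mul_inv, div_p]
        have := dvd_norm_int (p := p) (n := 1) (m := A.mulVec e i) (by rw [pow_one]; exact h1 i)
        rwa [pow_one] at this) hm
      rwa [bl_smul_left, mul_comm, ← div_eq_mul_inv, div_p] at this
    · rw [nm_bcq]
      obtain ⟨k, hk⟩ := h2
      have := F3 e
      rw [hk] at this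
      push_cast at this
      have h3 : nm (∑ i, e i • v i) = (((p:ℤ)^2 * k : ℤ) : ℚ) := by push_cast; linarith
      rw [h3]
      have := dvd_norm_int (p := p) (n := 2) (m := (p:ℤ)^2 * k) (dvd_mul_right _ _)
      simpa using this
  · rintro ⟨z, hz, hprim, hbl, hnm⟩
    obtain ⟨z', ⟨m, hm, em⟩, hq⟩ := dense hdet z 2
    have ez : bcq ℚ_[p] z' = z + (p : ℚ_[p])^2 • m := by rw [← em]; abel
    have hpn : ∀ n : ℕ, ‖(p : ℚ_[p])^n‖ ≤ 1 := fun n => by rw [norm_pow]; exact pow_le_one₀ hpp.le hp1.le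
    have hz' : z' ∈ Submodule.span ℤ (Set.range v) := by
      apply mem_of_local hdet
      intro q _
      by_cases hqp : q = p
      · subst hqp
        convert (ez ▸ add_mem hz (smul_mem' (hpn 2) hm) : bcq ℚ_[q] z' ∈ _)
      · exact hq q hqp
    obtain ⟨e, rfl⟩ := mem_span_range_int hz'
    have hbm : ∀ {m m'}, m ∈ lc p (Submodule.span ℤ (Set.range v)) → m' ∈ lc p (Submodule.span ℤ (Set.range v)) → ‖bl m m'‖ ≤ 1 := fun h h' => bl_int hintg h h'
    refine ⟨e, ?_, ?_, ?_⟩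
    · by_contra hcon
      push Not at hcon
      choose k hk using hcon
      have hk' : ∑ i, (k i : ℚ_[p]) • bcq ℚ_[p] (v i) ∈ lc p (Submodule.span ℤ (Set.range v)) := by
        rw [← F1]; exact bcq_mem (Submodule.sum_mem _ fun i _ => Submodule.smul_mem _ _ (Submodule.subset_span ⟨i, rfl⟩))
      refine hprim ⟨∑ i, (k i : ℚ_[p]) • bcq ℚ_[p] (v i) - (p : ℚ_[p]) • m, sub_mem hk' (smul_mem' hp1.le hm), ?_⟩
      have : bcq ℚ_[p] (∑ i, e i • v i) = (p : ℚ_[p]) • ∑ i, (k i : ℚ_[p]) • bcq ℚ_[p] (v i) := by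
        rw [F1, Finset.smul_sum]
        refine Finset.sum_congr rfl fun i _ => ?_
        rw [hk i, smul_smul]; push_cast; rfl
      rw [smul_sub, ← this, ez, smul_smul, sq]; abel
    · intro s
      rw [← pow_one (p:ℤ)]
      apply int_norm_dvd
      have hvs : bcq ℚ_[p] (v s) ∈ lc p (Submodule.span ℤ (Set.range v)) := bcq_mem (Submodule.subset_span ⟨s, rfl⟩)
      rw [← F2, ez, bl_add_left, bl_smul_left, pow_one]
      refine (Padic.nonarchimedean _ _).trans (max_le (hbl _ hvs) ?_)
      rw [norm_mul, norm_pow, sq, mul_assoc]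
      exact mul_le_of_le_one_right hpp.le (mul_le_one₀ hp1.le (norm_nonneg _) (hbm hm hvs))
    · have hn : ‖((nm (∑ i, e i • v i) : ℚ) : ℚ_[p])‖ ≤ ‖(p : ℚ_[p])‖^2 := by
        rw [← nm_bcq, ez, nm_add, nm_smul, bl_smul_right]
        refine (Padic.nonarchimedean _ _).trans (max_le ((Padic.nonarchimedean _ _).trans (max_le hnm ?_)) ?_)
        · rw [norm_mul, norm_pow, norm_pow]
          refine (mul_le_of_le_one_right (by positivity) (hintg _ hm)).trans ?_
          exact pow_le_of_le_one (by positivity) (pow_le_one₀ hpp.le hp1.le) two_ne_zero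
        · rw [norm_mul, norm_pow]
          exact mul_le_of_le_one_right (by positivity) (hbm hz hm)
      obtain ⟨k, hk⟩ := hintg' _ hz'
      rw [hk] at hn
      obtain ⟨l, rfl⟩ := int_norm_dvd (p := p) (m := k) (n := 2) (by simpa using hn)
      have := F3 e
      rw [hk] at this
      refine ⟨l, ?_⟩
      have h2 : ((e ⬝ᵥ A.mulVec e : ℤ) : ℚ) = ((2 * (p:ℤ)^2 * l : ℤ) : ℚ) := by rw [this]; push_cast; ring
      exact_mod_cast h2
end
end Eich
end

section
open scoped BigOperators Matrix RealInnerProductSpace Quaternion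
namespace Eich
open Module

section
variable {a b : ℚ} {p : ℕ} [hp : Fact p.Prime]

lemma norm_of_dvd {N : ℕ} (hN : Squarefree N) (h : p ∣ N) : ‖(N : ℚ_[p])‖ = ‖(p : ℚ_[p])‖ := by
  rcases norm_N (p := p) hN with h1 | h1
  · rw [Padic.norm_natCast_eq_one_iff] at h1
    exact absurd h ((hp.out.coprime_iff_not_dvd).1 h1)
  · exact h1

lemma iso_ram {N : ℕ} (hN : Squarefree N) {R : Submodule ℤ ℍ[ℚ,a,b]} (hR : OrdN N R) {v : Fin 4 → ℍ[ℚ,a,b]} (hv : Submodule.span ℤ (Set.range v) = R)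
    {A : Matrix (Fin 4) (Fin 4) ℤ} (hA : ∀ i j, (A i j : ℚ) = bl (v i) (v j)) (hdet : (Gm v).det ≠ 0) (hpN : p ∣ N) :
    IsoAt p A ↔ ¬ Dv p (a : ℚ_[p]) b := by
  subst hv
  obtain ⟨x, y, hS, hy⟩ := hR.std hN (p := p)
  rw [norm_of_dvd hN hpN] at hy
  rw [iso_glob hA hdet (fun z hz => lc_int hR.int hz) hR.int, ← iso_loc hS hy, dv_iff hS hy, not_not]

lemma dv_ram (hp' : p.Prime) : Dv p (a : ℚ_[p]) b ↔ Rep.RamifiedAt a b p hp' := by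
  constructor
  · intro h x hx
    rw [isUnit_iff_nm]
    exact fun h0 => hx (h x h0)
  · intro h z hz
    by_contra h0
    exact (isUnit_iff_nm z).1 (h z h0) hz

lemma good_int {N : ℕ} {u : Fin 4 → ℍ[ℚ,a,b]} {B : Matrix (Fin 4) (Fin 4) ℤ} (hB : ∀ i j, (B i j : ℚ) = bl (u i) (u j)) (hG : Good N B) :
    ∀ z ∈ Submodule.span ℤ (Set.range u), ∃ m : ℤ, nm z = m := by
  intro z hz
  obtain ⟨x, rfl⟩ := mem_span_range_int hz
  obtain ⟨m, hm⟩ := even_quad B hG.symm hG.even x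
  refine ⟨m, ?_⟩
  have := bl_comb hB x x
  rw [bl_self, hm] at this
  push_cast at this
  linarith

lemma good_dual {N : ℕ} {u : Fin 4 → ℍ[ℚ,a,b]} {B : Matrix (Fin 4) (Fin 4) ℤ} (hB : ∀ i j, (B i j : ℚ) = bl (u i) (u j)) (hG : Good N B)
    (hdet : (Gm u).det ≠ 0) {ε : ℝ} (hε : 0 ≤ ε) {W : ℍ[ℚ_[p],(a:ℚ_[p]),(b:ℚ_[p])]} (hW : ∀ i, ‖bl W (bcq ℚ_[p] (u i))‖ ≤ ε) : ‖(N : ℚ_[p]) * nm W‖ ≤ ε^2 := by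
  obtain ⟨Bs, h1, h2, h3⟩ := hG.dual
  have h4 : Bs * B = (N:ℤ) • 1 := by
    have := congrArg Matrix.transpose h1
    rw [Matrix.transpose_mul, hG.symm, h2] at this
    rw [this]; simp
  obtain ⟨c, rfl⟩ := expand (det_bcq_ne (K := ℚ_[p]) hdet) W
  set W := ∑ i, c i • bcq ℚ_[p] (u i) with hWd
  set g : Fin 4 → ℚ_[p] := fun i => bl W (bcq ℚ_[p] (u i)) with hg
  have e1 : ∀ i, g i = ∑ k, (B i k : ℚ_[p]) * c k := by
    intro i
    simp only [hg, hWd, bl_sum_left, bl_smul_left, bl_bcq]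
    refine Finset.sum_congr rfl fun k _ => ?_
    rw [← hB k i, hG.symm.apply i k, mul_comm]; simp
  have e2 : ∀ i, (N : ℚ_[p]) * c i = ∑ k, (Bs i k : ℚ_[p]) * g k := by
    intro i
    simp only [e1, Finset.mul_sum]
    rw [Finset.sum_comm]
    have : ∀ j, ∑ k, (Bs i k : ℚ_[p]) * ((B k j : ℚ_[p]) * c j) = (((Bs * B) i j : ℤ) : ℚ_[p]) * c j := by
      intro j
      rw [Matrix.mul_apply]; push_cast; rw [Finset.sum_mul]
      exact Finset.sum_congr rfl fun k _ => by ring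
    simp only [this, h4]
    simp [Matrix.one_apply, Matrix.smul_apply, Finset.sum_ite_eq]
  have e3 : 2 * nm W = ∑ i, c i * g i := by
    rw [← bl_self]
    conv_lhs => rw [hWd, bl_sum_left]
    refine Finset.sum_congr rfl fun i _ => ?_
    rw [bl_smul_left, bl_comm]
  choose k hk using h3
  have hs : ∀ i j, Bs i j = Bs j i := fun i j => h2.apply j i
  have e4 : (N : ℚ_[p]) * nm W = (k 0 : ℚ_[p]) * (g 0 * g 0) + k 1 * (g 1 * g 1) + k 2 * (g 2 * g 2) + k 3 * (g 3 * g 3)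
      + Bs 0 1 * (g 0 * g 1) + Bs 0 2 * (g 0 * g 2) + Bs 0 3 * (g 0 * g 3) + Bs 1 2 * (g 1 * g 2) + Bs 1 3 * (g 1 * g 3) + Bs 2 3 * (g 2 * g 3) := by
    have t : 2 * ((N : ℚ_[p]) * nm W) = ∑ i, ((N : ℚ_[p]) * c i) * g i := by
      rw [mul_left_comm, e3, Finset.mul_sum]; simp only [mul_assoc]
    simp only [e2] at t
    simp only [Fin.sum_univ_four, hk, hs 1 0, hs 2 0, hs 3 0, hs 2 1, hs 3 1, hs 3 2] at t
    push_cast at t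
    have h20 : (2 : ℚ_[p]) ≠ 0 := two_ne_zero
    apply mul_left_cancel₀ h20
    rw [t]; ring
  have nb : ∀ (m : ℤ) i j, ‖(m : ℚ_[p]) * (g i * g j)‖ ≤ ε^2 := by
    intro m i j
    rw [norm_mul, norm_mul, sq]
    exact (mul_le_of_le_one_left (by positivity) (Padic.norm_int_le_one m)).trans (mul_le_mul (hW i) (hW j) (norm_nonneg _) hε)
  rw [e4]
  have ad : ∀ {x y : ℚ_[p]}, ‖x‖ ≤ ε^2 → ‖y‖ ≤ ε^2 → ‖x + y‖ ≤ ε^2 := fun h h' => (Padic.nonarchimedean _ _).trans (max_le h h')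
  exact ad (ad (ad (ad (ad (ad (ad (ad (ad (nb _ _ _) (nb _ _ _)) (nb _ _ _)) (nb _ _ _)) (nb _ _ _)) (nb _ _ _)) (nb _ _ _)) (nb _ _ _)) (nb _ _ _)) (nb _ _ _)

lemma right_sp {a b : ℚ_[p]} {n : ℕ} {v : Fin n → ℍ[ℚ_[p],a,b]} {g : ℍ[ℚ_[p],a,b]} (hg : nm g ≠ 0) (z) : z ∈ sp (fun i => v i * iv g) ↔ z * g ∈ sp v := by
  have key : ∀ c : Fin n → ℤ_[p], ∑ i, (c i : ℚ_[p]) • (v i * iv g) = (∑ i, (c i : ℚ_[p]) • v i) * iv g := by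
    intro c; rw [Finset.sum_mul]; simp only [smul_mul_assoc]
  rw [mem_sp, mem_sp]
  constructor
  · rintro ⟨c, rfl⟩
    exact ⟨c, by rw [key, mul_assoc, iv_mul hg, mul_one]⟩
  · rintro ⟨c, h⟩
    exact ⟨c, by rw [key, h, mul_assoc, mul_iv hg, mul_one]⟩

lemma latt_loc {N : ℕ} (hN : Squarefree N) {R : Submodule ℤ ℍ[ℚ,a,b]} (hR : OrdN N R) {u : Fin 4 → ℍ[ℚ,a,b]} {B : Matrix (Fin 4) (Fin 4) ℤ}
    (hB : ∀ i j, (B i j : ℚ) = bl (u i) (u j)) (hG : Good N B) (p : ℕ) [hp : Fact p.Prime] :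
    ∃ g, nm g ≠ 0 ∧ ∀ z, (∀ m ∈ lc p (Submodule.span ℤ (Set.range u)), z * m ∈ lc p (Submodule.span ℤ (Set.range u))) ↔ g * z * iv g ∈ lc p R := by
  obtain ⟨x, y, hS, hy⟩ := hR.std hN (p := p)
  have hN0 : (N : ℚ) ≠ 0 := by exact_mod_cast hN.ne_zero
  have hdet' : (Gm u).det = (N:ℚ)^2 := by rw [det_of_A hB, hG.det]; push_cast; ring
  have hd0 : (Gm u).det ≠ 0 := by rw [hdet']; exact pow_ne_zero _ hN0
  obtain ⟨x₀, hx₀, y₀, hy₀, hn, hd⟩ := latt_x hN hB hG p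
  have hintg := fun z (hz : z ∈ lc p (Submodule.span ℤ (Set.range u))) => lc_int (good_int hB hG) hz
  have hx₁ := bcq_mem (p := p) hx₀
  have hy₁ := bcq_mem (p := p) hy₀
  rw [lc_span] at hintg hx₁ hy₁ ⊢
  generalize bcq ℚ_[p] x₀ = X at *
  generalize bcq ℚ_[p] y₀ = Y at *
  have hY0 := nm_ne_of_unit hn
  have P := fun z => right_sp (v := fun i => bcq ℚ_[p] (u i)) hY0 z
  have hdM : ‖(Gm (fun i => bcq ℚ_[p] (u i) * iv Y)).det‖ = ‖(N : ℚ_[p])‖^2 := by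
    rw [Gm_right, Matrix.det_smul, norm_mul, norm_pow, nm_iv, norm_inv, hn, det_bcq, hdet']; simp
  have H := std_level (v := fun i => bcq ℚ_[p] (u i) * iv Y) (x := X * iv Y) (by rw [P, one_mul]; exact hy₁) ?_ ?_ hd ‖(N : ℚ_[p])‖ hdM ?_
  rotate_left
  · intro z hz
    rw [P] at hz
    have := hintg _ hz
    rwa [nm_mul, norm_mul, hn, mul_one] at this
  · rw [P, mul_assoc, iv_mul hY0, mul_one]; exact hx₁
  · rcases norm_N (p := p) hN with h1 | h1
    · exact Or.inl h1
    · right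
      refine ⟨h1, fun w hw => ?_⟩
      have hwu : ∀ i, ‖bl (w * Y) (bcq ℚ_[p] (u i))‖ ≤ ‖(N : ℚ_[p])‖ := by
        intro i
        have := hw _ (vmem_sp (fun i => bcq ℚ_[p] (u i) * iv Y) i)
        have e : bl (w * Y) (bcq ℚ_[p] (u i)) = bl w (bcq ℚ_[p] (u i) * iv Y) * nm Y := by
          rw [← bl_mul_right, mul_assoc, iv_mul hY0, mul_one]
        rw [e, norm_mul, hn, mul_one]; exact this
      have := good_dual hB hG hd0 (norm_nonneg _) hwu
      rw [norm_mul, sq, nm_mul, norm_mul, hn, mul_one] at this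
      exact le_of_mul_le_mul_left this (by rw [h1]; exact norm_pos_iff.2 p_ne)
  obtain ⟨y', hS'⟩ := H
  have hy' : ‖nm y'‖ = ‖(N : ℚ_[p])‖ := by
    have := hS'.det_eq
    rw [hdM] at this
    exact ((pow_left_inj₀ (norm_nonneg _) (norm_nonneg _) two_ne_zero).1 this).symm
  obtain ⟨g, hg, hgz⟩ := local_conj hS hS' (by rw [hy, hy']) (by rw [hy]; exact norm_N hN)
  refine ⟨g, hg, fun z => ?_⟩
  rw [← hgz]
  constructor
  · intro h
    rw [P]; exact h _ hy₁
  · intro h m hm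
    have hm' : m * iv Y ∈ sp (fun i => bcq ℚ_[p] (u i) * iv Y) := by rw [P, mul_assoc, iv_mul hY0, mul_one]; exact hm
    have := (P _).1 (hS'.mul h hm')
    rwa [mul_assoc, mul_assoc, iv_mul hY0, mul_one] at this
end
end Eich
end

section
open scoped BigOperators Matrix RealInnerProductSpace Quaternion
namespace Eich
open Module

section
variable {a b : ℚ}

lemma clear_den {v : Fin 4 → ℍ[ℚ,a,b]} (hdet : (Gm v).det ≠ 0) (w : Fin 4 → ℍ[ℚ,a,b]) :
    ∃ D : ℕ, D ≠ 0 ∧ ∀ j, (D : ℤ) • w j ∈ Submodule.span ℤ (Set.range v) := by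
  choose c hc using fun j => expand hdet (w j)
  refine ⟨∏ j, ∏ i, (c j i).den, Finset.prod_ne_zero_iff.2 fun j _ => Finset.prod_ne_zero_iff.2 fun i _ => (c j i).den_ne_zero, fun j => ?_⟩
  rw [hc j, Finset.smul_sum]
  refine Submodule.sum_mem _ fun i _ => ?_
  have hd : (c j i).den ∣ ∏ j, ∏ i, (c j i).den :=
    (Finset.dvd_prod_of_mem (fun i => (c j i).den) (Finset.mem_univ i)).trans (Finset.dvd_prod_of_mem (fun j => ∏ i, (c j i).den) (Finset.mem_univ j))
  obtain ⟨k, hk⟩ := hd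
  rw [hk]
  have : (((c j i).den * k : ℕ) : ℤ) • c j i • v i = ((k : ℤ) * (c j i).num) • v i := by
    rw [← Int.cast_smul_eq_zsmul ℚ, ← Int.cast_smul_eq_zsmul ℚ, smul_smul]
    congr 1
    push_cast
    have := Rat.den_mul_eq_num (c j i)
    rw [← this]; ring
  rw [this]
  exact Submodule.smul_mem _ _ (Submodule.subset_span ⟨i, rfl⟩)

lemma loc_clear {p : ℕ} [hp : Fact p.Prime] {v : Fin 4 → ℍ[ℚ,a,b]} (hdet : (Gm v).det ≠ 0) (z : ℍ[ℚ_[p],(a:ℚ_[p]),(b:ℚ_[p])]) :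
    ∃ n : ℕ, (p : ℚ_[p])^n • z ∈ lc p (Submodule.span ℤ (Set.range v)) := by
  have hp1 : ‖(p : ℚ_[p])‖ < 1 := Padic.norm_p_lt_one
  obtain ⟨c, rfl⟩ := expand (det_bcq_ne (K := ℚ_[p]) hdet) z
  have h1 : ∀ i, ∃ n : ℕ, ‖(p : ℚ_[p])^n * c i‖ ≤ 1 := by
    intro i
    obtain ⟨n, hn⟩ := exists_pow_lt_of_lt_one (show (0:ℝ) < (‖c i‖ + 1)⁻¹ by positivity) hp1
    refine ⟨n, ?_⟩
    rw [norm_mul, norm_pow]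
    have hc : 0 < ‖c i‖ + 1 := by positivity
    calc _ ≤ (‖c i‖ + 1)⁻¹ * (‖c i‖ + 1) := mul_le_mul hn.le (by linarith) (norm_nonneg _) (by positivity)
      _ = 1 := inv_mul_cancel₀ hc.ne'
  choose n hn using h1
  refine ⟨∑ i, n i, ?_⟩
  rw [Finset.smul_sum]
  refine Submodule.sum_mem _ fun i _ => ?_
  rw [smul_smul]
  refine smul_mem' ?_ (bcq_mem (Submodule.subset_span ⟨i, rfl⟩))
  rw [← Finset.add_sum_erase _ _ (Finset.mem_univ i), pow_add, mul_right_comm, norm_mul]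
  refine mul_le_one₀ (hn i) (norm_nonneg _) ?_
  rw [norm_pow]; exact pow_le_one₀ (norm_nonneg _) hp1.le

lemma norm_nat_le (p : ℕ) [hp : Fact p.Prime] (n : ℕ) : ‖(n : ℚ_[p])‖ ≤ 1 := by
  exact_mod_cast Padic.norm_int_le_one (p := p) n

lemma lc_eq_away {p : ℕ} [hp : Fact p.Prime] {u v : Fin 4 → ℍ[ℚ,a,b]} {D : ℕ} (hD : ¬ p ∣ D)
    (h : ∀ j, (D : ℤ) • u j ∈ Submodule.span ℤ (Set.range v)) : lc p (Submodule.span ℤ (Set.range u)) ≤ lc p (Submodule.span ℤ (Set.range v)) := by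
  have hn : ‖(D : ℚ_[p])‖ = 1 := by
    rw [Padic.norm_natCast_eq_one_iff]; exact (hp.out.coprime_iff_not_dvd).2 hD
  have hD0 : (D : ℚ_[p]) ≠ 0 := by rw [← norm_ne_zero_iff, hn]; exact one_ne_zero
  rw [lc_span]
  intro z hz
  obtain ⟨c, rfl⟩ := mem_sp.1 hz
  refine Submodule.sum_mem _ fun i _ => smul_mem' (PadicInt.norm_le_one _) ?_
  have := bcq_mem (p := p) (h i)
  rw [bcq_zsmul] at this
  have h2 := smul_mem' (c := (D : ℚ_[p])⁻¹) (by rw [norm_inv, hn, inv_one]) this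
  rw [smul_smul] at h2
  push_cast at h2
  rwa [inv_mul_cancel₀ hD0, one_smul] at h2

lemma iv_one' {K : Type*} [Field K] {a b : K} : iv (1 : ℍ[K,a,b]) = 1 := by
  have h : nm (1 : ℍ[K,a,b]) ≠ 0 := by rw [nm_one]; exact one_ne_zero
  rw [← mul_one (iv 1), iv_mul h]

lemma exists_g {N : ℕ} (hN : Squarefree N) {R : Submodule ℤ ℍ[ℚ,a,b]} (hR : OrdN N R) {u : Fin 4 → ℍ[ℚ,a,b]} {B : Matrix (Fin 4) (Fin 4) ℤ}
    (hB : ∀ i j, (B i j : ℚ) = bl (u i) (u j)) (hG : Good N B) {v : Fin 4 → ℍ[ℚ,a,b]} (hdv : (Gm v).det ≠ 0) (hdu : (Gm u).det ≠ 0) (hv : Submodule.span ℤ (Set.range v) = R) :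
    ∃ (E : ℕ) (g : ∀ (p : ℕ) [hp : Fact p.Prime], ℍ[ℚ_[p],(a:ℚ_[p]),(b:ℚ_[p])]), E ≠ 0 ∧ ∀ (p : ℕ) [hp : Fact p.Prime], nm (g p) ≠ 0 ∧
      (∀ z, (∀ m ∈ lc p (Submodule.span ℤ (Set.range u)), z * m ∈ lc p (Submodule.span ℤ (Set.range u))) ↔ g p * z * iv (g p) ∈ lc p R) ∧
      (E : ℚ_[p]) • g p ∈ lc p R ∧ (E : ℚ_[p]) • iv (g p) ∈ lc p R := by
  classical
  obtain ⟨D₁, hD₁, h1⟩ := clear_den hdv u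
  obtain ⟨D₂, hD₂, h2⟩ := clear_den hdu v
  have hone : ∀ (p : ℕ) [hp : Fact p.Prime], (1 : ℍ[ℚ_[p],(a:ℚ_[p]),(b:ℚ_[p])]) ∈ lc p R := fun p _ => by rw [← bcq_one]; exact bcq_mem hR.one
  have key : ∀ (p : ℕ) (hp : Fact p.Prime), ∃ (g : ℍ[ℚ_[p],(a:ℚ_[p]),(b:ℚ_[p])]), (nm g ≠ 0 ∧
      ∀ z, (∀ m ∈ lc p (Submodule.span ℤ (Set.range u)), z * m ∈ lc p (Submodule.span ℤ (Set.range u))) ↔ g * z * iv g ∈ lc p R) ∧ (¬ p ∣ D₁ * D₂ → g = 1) := by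
    intro p hp
    by_cases hd : p ∣ D₁ * D₂
    · obtain ⟨g, hg, hg'⟩ := latt_loc hN hR hB hG p
      exact ⟨g, ⟨hg, hg'⟩, fun h => absurd hd h⟩
    · refine ⟨1, ⟨by rw [nm_one]; exact one_ne_zero, fun z => ?_⟩, fun _ => rfl⟩
      have e : lc p (Submodule.span ℤ (Set.range u)) = lc p R := by
        rw [← hv]
        exact le_antisymm (lc_eq_away (fun h => hd (h.mul_right _)) h1) (lc_eq_away (fun h => hd (h.mul_left _)) h2)
      rw [e, iv_one', one_mul, mul_one]
      exact ⟨fun h => by simpa using h 1 (hone p), fun h m hm => lc_mul hR.mul h hm⟩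
  choose g hg hg1 using key
  have hn : ∀ (p : ℕ) (hp : Fact p.Prime), ∃ n : ℕ, (p : ℚ_[p])^n • g p hp ∈ lc p R ∧ (p : ℚ_[p])^n • iv (g p hp) ∈ lc p R := by
    intro p hp
    obtain ⟨n, hn⟩ := loc_clear hdv (g p hp)
    obtain ⟨m, hm⟩ := loc_clear hdv (iv (g p hp))
    rw [hv] at hn hm
    have hpp : ∀ k, ‖(p : ℚ_[p])^k‖ ≤ 1 := fun k => by rw [norm_pow]; exact pow_le_one₀ (norm_nonneg _) Padic.norm_p_lt_one.le
    refine ⟨n + m, ?_, ?_⟩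
    · rw [add_comm, pow_add, mul_smul]; exact smul_mem' (hpp m) hn
    · rw [pow_add, mul_smul]; exact smul_mem' (hpp n) hm
  choose n hn1 hn2 using hn
  set n' : ℕ → ℕ := fun p => if h : p.Prime then n p ⟨h⟩ else 0 with hn'
  set E : ℕ := ∏ p ∈ (D₁ * D₂).primeFactors, p ^ n' p with hE
  have hD0 : D₁ * D₂ ≠ 0 := mul_ne_zero hD₁ hD₂
  refine ⟨E, fun p hp => g p hp, ?_, ?_⟩
  · exact Finset.prod_ne_zero_iff.2 fun p hp => pow_ne_zero _ (Nat.prime_of_mem_primeFactors hp).ne_zero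
  intro p hp
  refine ⟨(hg p hp).1, (hg p hp).2, ?_⟩
  by_cases hd : p ∣ D₁ * D₂
  · have hm : p ∈ (D₁ * D₂).primeFactors := Nat.mem_primeFactors.2 ⟨hp.out, hd, hD0⟩
    obtain ⟨k, hk⟩ : p ^ n p hp ∣ E := by
      have := Finset.dvd_prod_of_mem (fun p => p ^ n' p) hm
      simp only [hn', hp.out, dif_pos] at this
      exact this
    rw [hk]
    push_cast
    rw [mul_comm, mul_smul, mul_smul]
    exact ⟨smul_mem' (norm_nat_le p k) (hn1 p hp), smul_mem' (norm_nat_le p k) (hn2 p hp)⟩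
  · simp only [hg1 p hp hd, iv_one']
    exact ⟨smul_mem' (norm_nat_le p E) (hone p), smul_mem' (norm_nat_le p E) (hone p)⟩
end
end Eich
end

section
open scoped BigOperators Matrix RealInnerProductSpace Quaternion
namespace Eich
open Module

section
variable {a b : ℚ}

def Jg (R : Submodule ℤ ℍ[ℚ,a,b]) (g : ∀ (p : ℕ) [Fact p.Prime], ℍ[ℚ_[p],(a:ℚ_[p]),(b:ℚ_[p])]) : Submodule ℤ ℍ[ℚ,a,b] where
  carrier := {z | ∀ (p : ℕ) [Fact p.Prime], bcq ℚ_[p] z * iv (g p) ∈ lc p R}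
  add_mem' := by
    intro x y hx hy p _
    rw [bcq_add, add_mul]; exact add_mem (hx p) (hy p)
  zero_mem' := by
    intro p _
    rw [bcq_zero, zero_mul]; exact zero_mem _
  smul_mem' := by
    intro c x hx p _
    rw [bcq_zsmul, smul_mul_assoc]; exact smul_mem' (Padic.norm_int_le_one c) (hx p)

lemma scaled_lc {p : ℕ} [hp : Fact p.Prime] {v : Fin 4 → ℍ[ℚ,a,b]} {E : ℕ} {w}
    (hw : w ∈ lc p (Submodule.span ℤ (Set.range fun i => (E : ℚ) • v i))) : ∃ w' ∈ lc p (Submodule.span ℤ (Set.range v)), w = (E : ℚ_[p]) • w' := by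
  rw [lc_span] at hw
  obtain ⟨c, rfl⟩ := mem_sp.1 hw
  refine ⟨∑ i, (c i : ℚ_[p]) • bcq ℚ_[p] (v i), Submodule.sum_mem _ fun i _ => smul_mem' (PadicInt.norm_le_one _) (bcq_mem (Submodule.subset_span ⟨i, rfl⟩)), ?_⟩
  rw [Finset.smul_sum]
  refine Finset.sum_congr rfl fun i _ => ?_
  rw [bcq_smul, smul_smul, smul_smul, mul_comm]; simp

lemma J_props {N : ℕ} (hN : Squarefree N) {R : Submodule ℤ ℍ[ℚ,a,b]} (hR : OrdN N R) {v : Fin 4 → ℍ[ℚ,a,b]} (hdv : (Gm v).det ≠ 0) (hv : Submodule.span ℤ (Set.range v) = R)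
    {E : ℕ} (hE : E ≠ 0) {g : ∀ (p : ℕ) [hp : Fact p.Prime], ℍ[ℚ_[p],(a:ℚ_[p]),(b:ℚ_[p])]}
    (hg : ∀ (p : ℕ) [hp : Fact p.Prime], nm (g p) ≠ 0 ∧ (E : ℚ_[p]) • g p ∈ lc p R ∧ (E : ℚ_[p]) • iv (g p) ∈ lc p R) :
    Rep.IsLattice 4 (Jg R g) ∧ (∀ x, (∀ y ∈ Jg R g, x * y ∈ Jg R g) ↔ x ∈ R) ∧
      ∀ x, (∀ y ∈ Jg R g, y * x ∈ Jg R g) ↔ ∀ (p : ℕ) [hp : Fact p.Prime], g p * bcq ℚ_[p] x * iv (g p) ∈ lc p R := by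
  have hEq : (E : ℚ) ≠ 0 := by exact_mod_cast hE
  have hER : ∀ (p : ℕ) [hp : Fact p.Prime], ∀ w ∈ lc p (Submodule.span ℤ (Set.range fun i => (E : ℚ) • v i)), w * iv (g p) ∈ lc p R := by
    intro p _ w hw
    obtain ⟨w', hw', rfl⟩ := scaled_lc hw
    rw [smul_mul_assoc, ← mul_smul_comm]
    rw [hv] at hw'
    exact lc_mul hR.mul hw' (hg p).2.2
  have hdE : (Gm fun i => (E : ℚ) • v i).det ≠ 0 := by
    have : Gm (fun i => (E : ℚ) • v i) = ((E:ℚ)^2) • Gm v := by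
      ext i j; simp [Gm, bl_smul_left, bl_smul_right]; ring
    rw [this, Matrix.det_smul]
    exact mul_ne_zero (pow_ne_zero _ (pow_ne_zero _ hEq)) hdv
  have hvJ : ∀ i, (E : ℚ) • v i ∈ Jg R g := by
    intro i p _
    exact hER p _ (bcq_mem (Submodule.subset_span ⟨i, rfl⟩))
  have hJR : ∀ z ∈ Jg R g, (E : ℚ) • z ∈ R := by
    intro z hz
    rw [← hv]
    apply mem_of_local hdv
    intro p _
    rw [hv, bcq_smul]
    have := lc_mul hR.mul (hz p) (hg p).2.1
    rw [mul_smul_comm, mul_assoc, iv_mul (hg p).1, mul_one] at this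
    simpa using this
  have hz' : ∀ (p : ℕ) [hp : Fact p.Prime], ∃ z' ∈ Jg R g, bcq ℚ_[p] z' * iv (g p) ∈ lc p R ∧ iv (bcq ℚ_[p] z' * iv (g p)) ∈ lc p R ∧ nm (bcq ℚ_[p] z' * iv (g p)) ≠ 0 := by
    intro p hp
    obtain ⟨z', ⟨m, hm, em⟩, hq⟩ := dense hdE (g p) 1
    have hm' := hER p m hm
    obtain ⟨x, y, hS, -⟩ := hR.std hN (p := p)
    have ez : bcq ℚ_[p] z' = g p + (p : ℚ_[p]) • m := by rw [← pow_one (p : ℚ_[p]), ← em]; abel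
    have eta : bcq ℚ_[p] z' * iv (g p) = 1 + (p : ℚ_[p]) • (m * iv (g p)) := by
      rw [ez, add_mul, mul_iv (hg p).1, smul_mul_assoc]
    have hp1 : ‖(p : ℚ_[p])‖ < 1 := Padic.norm_p_lt_one
    have hη : bcq ℚ_[p] z' * iv (g p) ∈ lc p R := by
      rw [eta]; exact add_mem hS.one_mem (smul_mem' hp1.le hm')
    have hn : ‖nm (bcq ℚ_[p] z' * iv (g p))‖ = 1 := by
      rw [eta, nm_add, nm_one, nm_smul, bl_smul_right, add_assoc]
      have h1 : ‖(p : ℚ_[p])^2 * nm (m * iv (g p)) + p * bl 1 (m * iv (g p))‖ < 1 := by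
        refine (Padic.nonarchimedean _ _).trans_lt (max_lt ?_ ?_)
        · rw [norm_mul, norm_pow]
          exact (mul_le_of_le_one_right (by positivity) (hS.int hm')).trans_lt (pow_lt_one₀ (norm_nonneg _) hp1 two_ne_zero)
        · rw [norm_mul]
          exact (mul_le_of_le_one_right (by positivity) (hS.blint hS.one_mem hm')).trans_lt hp1
      rw [Padic.add_eq_max_of_ne (by rw [norm_one]; exact h1.ne'), norm_one, max_eq_left h1.le]
    refine ⟨z', ?_, hη, hS.iv hη hn, nm_ne_of_unit hn⟩
    intro q _
    by_cases hqp : q = p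
    · subst hqp
      convert hη
    · exact hER q _ (hq q hqp)
  refine ⟨?_, fun x => ⟨?_, ?_⟩, fun x => ⟨?_, ?_⟩⟩
  · obtain ⟨w, hw⟩ := basis_lemma 4 (by rw [QuaternionAlgebra.finrank_eq_four]) (Jg R g) (by
      have hle : Jg R g ≤ Submodule.span ℤ (Set.range fun i => (E : ℚ)⁻¹ • v i) := by
        intro z hz
        have := hJR z hz
        rw [← hv] at this
        obtain ⟨c, hc⟩ := mem_span_range_int this
        have e : z = ∑ i, c i • ((E : ℚ)⁻¹ • v i) := by
          rw [← one_smul ℚ z, ← inv_mul_cancel₀ hEq, mul_smul, hc, Finset.smul_sum]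
          exact Finset.sum_congr rfl fun i _ => smul_comm _ _ _
        rw [e]
        exact Submodule.sum_mem _ fun i _ => Submodule.smul_mem _ _ (Submodule.subset_span ⟨i, rfl⟩)
      exact Submodule.FG.of_le (Submodule.fg_span (Set.finite_range _)) hle) (by
      rw [eq_top_iff]
      intro z _
      obtain ⟨c, rfl⟩ := expand hdE z
      exact Submodule.sum_mem _ fun i _ => Submodule.smul_mem _ _ (Submodule.subset_span (hvJ i)))
    exact ⟨w, w.linearIndependent, hw⟩
  · intro h
    rw [← hv]
    apply mem_of_local hdv
    intro p _
    rw [hv]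
    obtain ⟨z', hzJ, -, h2, h3⟩ := hz' p
    have := h z' hzJ p
    rw [bcq_mul, mul_assoc] at this
    have := lc_mul hR.mul this h2
    rwa [mul_assoc, mul_iv h3, mul_one] at this
  · intro hx y hy p _
    rw [bcq_mul, mul_assoc]
    exact lc_mul hR.mul (bcq_mem hx) (hy p)
  · intro h p _
    obtain ⟨z', hzJ, -, h2, h3⟩ := hz' p
    have := h z' hzJ p
    have h4 := lc_mul hR.mul h2 this
    have e : iv (bcq ℚ_[p] z' * iv (g p)) * (bcq ℚ_[p] (z' * x) * iv (g p)) = iv (bcq ℚ_[p] z' * iv (g p)) * ((bcq ℚ_[p] z' * iv (g p)) * (g p * bcq ℚ_[p] x * iv (g p))) := by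
      congr 1
      rw [bcq_mul, mul_assoc, mul_assoc, mul_assoc, iv_mul_mul (hg p).1]
    rw [e, iv_mul_mul h3] at h4
    exact h4
  · intro h y hy p _
    have := lc_mul hR.mul (hy p) (h p)
    rw [mul_assoc, mul_assoc, iv_mul_mul (hg p).1, ← mul_assoc, ← bcq_mul] at this
    exact this

lemma exists_J {N : ℕ} (hN : Squarefree N) {R : Submodule ℤ ℍ[ℚ,a,b]} (hR : OrdN N R) {u : Fin 4 → ℍ[ℚ,a,b]} {B : Matrix (Fin 4) (Fin 4) ℤ}
    (hB : ∀ i j, (B i j : ℚ) = bl (u i) (u j)) (hG : Good N B) {v : Fin 4 → ℍ[ℚ,a,b]} (hdv : (Gm v).det ≠ 0) (hdu : (Gm u).det ≠ 0) (hv : Submodule.span ℤ (Set.range v) = R) :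
    ∃ J : Submodule ℤ ℍ[ℚ,a,b], Rep.IsLattice 4 J ∧ (∀ x, (∀ y ∈ J, x * y ∈ J) ↔ x ∈ R) ∧
      ∀ x, (∀ y ∈ J, y * x ∈ J) ↔ (∀ y ∈ Submodule.span ℤ (Set.range u), x * y ∈ Submodule.span ℤ (Set.range u)) := by
  obtain ⟨E, g, hE, hg⟩ := exists_g hN hR hB hG hdv hdu hv
  obtain ⟨h1, h2, h3⟩ := J_props hN hR hdv hv hE (fun p _ => ⟨(hg p).1, (hg p).2.2⟩)
  refine ⟨_, h1, h2, fun x => (h3 x).trans ⟨fun h y hy => ?_, fun h p _ => ?_⟩⟩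
  · apply mem_of_local hdu
    intro p _
    rw [bcq_mul]
    exact ((hg p).2.1 _).2 (h p) _ (bcq_mem hy)
  · refine ((hg p).2.1 _).1 fun m hm => ?_
    refine lc_mul (M := Submodule.span ℤ {x}) (fun x' hx' y hy => ?_) (bcq_mem (Submodule.mem_span_singleton_self x)) hm
    obtain ⟨c, rfl⟩ := Submodule.mem_span_singleton.1 hx'
    rw [smul_mul_assoc]
    exact Submodule.smul_mem _ _ (h y hy)
end
end Eich
end

section
open scoped BigOperators Matrix RealInnerProductSpace Quaternion
namespace Eich
open Module

section
variable {N₁ N₂ : ℕ} (S : Rep.EichlerSetting N₁ N₂)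

lemma S_final {B : Matrix (Fin 4) (Fin 4) ℤ} (hG : Good (N₁ * N₂) B) {u : Fin 4 → ℍ[ℚ,S.a,S.b]} (hB : ∀ i j, (B i j : ℚ) = bl (u i) (u j)) :
    ∃ i j, Rep.IsGramOf (S.I i j : Set ℍ[ℚ,S.a,S.b]) B := by
  have hN := S.squarefree
  have hN0 : ((N₁ * N₂ : ℕ) : ℚ) ≠ 0 := by exact_mod_cast hN.ne_zero
  obtain ⟨ha, hb⟩ := neg_of_inf S.ram_inf
  have hdetu : (Gm u).det = ((N₁ * N₂ : ℕ) : ℚ)^2 := by rw [det_of_A hB, hG.det]; norm_cast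
  have hdu : (Gm u).det ≠ 0 := by rw [hdetu]; exact pow_ne_zero _ hN0
  have hR := S_ord S ⟨0, S.h_pos⟩
  obtain ⟨v, A, hv, hA, hAd⟩ := hR.gram
  have hdv : (Gm v).det ≠ 0 := by
    have : (Gm v).det = ((N₁ * N₂ : ℕ) : ℚ)^2 := by rw [det_of_A hA, hAd]; norm_cast
    rw [this]; exact pow_ne_zero _ hN0
  obtain ⟨J, hJ1, hJ2, hJ3⟩ := exists_J hN hR hB hG hdv hdu hv
  obtain ⟨j, t, rfl⟩ := S.classes_complete ⟨0, S.h_pos⟩ J hJ1 (Set.ext hJ2)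
  -- right order
  have hright : ∀ x, ((t : ℍ[ℚ,S.a,S.b]) * x * (t⁻¹ : (ℍ[ℚ,S.a,S.b])ˣ) ∈ S.Rord j) ↔ (∀ y ∈ Submodule.span ℤ (Set.range u), x * y ∈ Submodule.span ℤ (Set.range u)) := by
    intro x
    rw [← hJ3, (S_idl S ⟨0, S.h_pos⟩ j).right]
    constructor
    · rintro h _ ⟨y, hy, rfl⟩
      refine ⟨_, h y hy, ?_⟩
      simp [mul_assoc]
    · intro h y hy
      obtain ⟨y', hy', e⟩ := h _ ⟨y, hy, rfl⟩
      simp only [LinearMap.mulRight_apply] at e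
      have : y * ((t : ℍ[ℚ,S.a,S.b]) * x * (t⁻¹ : (ℍ[ℚ,S.a,S.b])ˣ)) = y' := by
        rw [← mul_assoc, ← mul_assoc, ← e, mul_assoc]; simp
      rw [this]; exact hy'
  have hmap : ∀ z, z ∈ Submodule.map (LinearMap.mulLeft ℤ (t : ℍ[ℚ,S.a,S.b])) (Submodule.span ℤ (Set.range u)) ↔ (t⁻¹ : (ℍ[ℚ,S.a,S.b])ˣ) * z ∈ Submodule.span ℤ (Set.range u) := by
    intro z
    constructor
    · rintro ⟨y, hy, rfl⟩
      simpa using hy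
    · intro h
      exact ⟨_, h, by simp⟩
  have ht0 : nm (t : ℍ[ℚ,S.a,S.b]) ≠ 0 := (isUnit_iff_nm _).1 t.isUnit
  have hdtu : (Gm fun i => (t : ℍ[ℚ,S.a,S.b]) * u i).det ≠ 0 := by
    rw [Gm_left, Matrix.det_smul]; exact mul_ne_zero (pow_ne_zero _ ht0) hdu
  have hspan : Submodule.span ℤ (Set.range fun i => (t : ℍ[ℚ,S.a,S.b]) * u i) = Submodule.map (LinearMap.mulLeft ℤ (t : ℍ[ℚ,S.a,S.b])) (Submodule.span ℤ (Set.range u)) := by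
    rw [Submodule.map_span, ← Set.range_comp]; rfl
  obtain ⟨k, w, hw⟩ := S.classes_complete j (Submodule.map (LinearMap.mulLeft ℤ (t : ℍ[ℚ,S.a,S.b])) (Submodule.span ℤ (Set.range u)))
    ⟨_, li_of_det hdtu, hspan⟩ (by
      ext x
      have h1 := hright ((t⁻¹ : (ℍ[ℚ,S.a,S.b])ˣ) * x * t)
      have e : (t : ℍ[ℚ,S.a,S.b]) * ((t⁻¹ : (ℍ[ℚ,S.a,S.b])ˣ) * x * t) * (t⁻¹ : (ℍ[ℚ,S.a,S.b])ˣ) = x := by simp [mul_assoc]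
      rw [e] at h1
      refine Iff.trans ?_ h1.symm
      constructor
      · intro h y hy
        have := (hmap _).1 (h (t * y) ⟨y, hy, rfl⟩)
        simpa [mul_assoc] using this
      · rintro h _ ⟨y, hy, rfl⟩
        refine (hmap _).2 ?_
        have := h y hy
        simpa [mul_assoc] using this)
  have hw0 : nm (w : ℍ[ℚ,S.a,S.b]) ≠ 0 := (isUnit_iff_nm _).1 w.isUnit
  set v' : Fin 4 → ℍ[ℚ,S.a,S.b] := fun i => (t * u i) * iv (w : ℍ[ℚ,S.a,S.b]) with hv'
  have hGv : Gm v' = (nm (t : ℍ[ℚ,S.a,S.b]) * (nm (w : ℍ[ℚ,S.a,S.b]))⁻¹) • Gm u := by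
    rw [hv', Gm_right (fun i => (t : ℍ[ℚ,S.a,S.b]) * u i), Gm_left, nm_iv, smul_smul, mul_comm]
  set c := nm (t : ℍ[ℚ,S.a,S.b]) * (nm (w : ℍ[ℚ,S.a,S.b]))⁻¹ with hc
  have hc0 : 0 < c := mul_pos (nm_pos ha hb t.ne_zero) (inv_pos.2 (nm_pos ha hb w.ne_zero))
  have hdv' : (Gm v').det ≠ 0 := by
    rw [hGv, Matrix.det_smul]; exact mul_ne_zero (pow_ne_zero _ hc0.ne') hdu
  have hsp : Submodule.span ℤ (Set.range v') = S.I j k := by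
    have e1 : Submodule.span ℤ (Set.range v') = Submodule.map (LinearMap.mulRight ℤ (iv (w : ℍ[ℚ,S.a,S.b]))) (Submodule.span ℤ (Set.range fun i => (t : ℍ[ℚ,S.a,S.b]) * u i)) := by
      rw [Submodule.map_span, ← Set.range_comp]; rfl
    rw [e1, hspan, hw, ← Submodule.map_comp]
    have e2 : (LinearMap.mulRight ℤ (iv (w : ℍ[ℚ,S.a,S.b]))).comp (LinearMap.mulRight ℤ (w : ℍ[ℚ,S.a,S.b])) = LinearMap.id := by
      ext1 z
      simp [mul_assoc, mul_iv hw0]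
    rw [e2, Submodule.map_id]
  have hmem : ∀ i, v' i ∈ S.I j k := fun i => by rw [← hsp]; exact Submodule.subset_span ⟨i, rfl⟩
  have hintg : ∀ i l, ∃ m : ℤ, bl (v' i) (v' l) = m := by
    intro i l
    obtain ⟨m1, h1⟩ := (S_idl S j k).int _ (add_mem (hmem i) (hmem l))
    obtain ⟨m2, h2⟩ := (S_idl S j k).int _ (hmem i)
    obtain ⟨m3, h3⟩ := (S_idl S j k).int _ (hmem l)
    exact ⟨m1 - m2 - m3, by rw [bl_rat, h1, h2, h3]; push_cast; ring⟩
  choose A' hA' using hintg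
  have hgram : Rep.IsGramOf (S.I j k : Set ℍ[ℚ,S.a,S.b]) (Matrix.of A') :=
    ⟨v', li_of_det hdv', by rw [hsp, Submodule.span_eq], fun i l => (hA' i l).symm⟩
  have hdA := (S_gram S j k hgram).2.1
  have hd1 : (Gm v').det = ((N₁ * N₂ : ℕ) : ℚ)^2 := by
    rw [det_of_A (A := Matrix.of A') (fun i l => (hA' i l).symm), hdA]; norm_cast
  rw [hGv, Matrix.det_smul, hdetu, Fintype.card_fin] at hd1
  have hc4 : c^4 = 1 := mul_right_cancel₀ (pow_ne_zero 2 hN0) (hd1.trans (one_mul _).symm)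
  have hc1 : c = 1 := (pow_eq_one_iff_of_nonneg hc0.le (by norm_num)).1 hc4
  refine ⟨j, k, v', li_of_det hdv', by rw [hsp, Submodule.span_eq], fun i l => ?_⟩
  have := congrFun (congrFun hGv i) l
  rw [hc1, one_smul] at this
  rw [hB]
  exact this.symm

lemma S_exhaust {B : Matrix (Fin 4) (Fin 4) ℤ} (hG : Good (N₁ * N₂) B) (hT : ∀ p : ℕ, p.Prime → p ∣ N₁ * N₂ → (p ∣ N₁ ↔ ¬ IsoAt p B)) :
    ∃ i j, Rep.IsGramOf (S.I i j : Set ℍ[ℚ,S.a,S.b]) B := by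
  have hN := S.squarefree
  have hR := S_ord S ⟨0, S.h_pos⟩
  obtain ⟨A, hgr, -⟩ := S.Rord_disc ⟨0, S.h_pos⟩
  have hgr' := hgr
  rw [← S.I_diag] at hgr'
  have hgA := S_gram S _ _ hgr'
  obtain ⟨v, hv, hs, hA⟩ := hgr
  rw [Submodule.span_eq] at hs
  have hdv := det_ne_of_li (S_aniso S) hv
  have hGA : Good (N₁ * N₂) A := good_of hN.ne_zero (A_symm hA) (A_even hA (by rw [hs]; exact hR.int)) hgA.1 hgA.2.1 hgA.2.2.2.1
  obtain ⟨C, hC⟩ := iso44 hN hGA hG (fun p hp hpN => by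
    haveI : Fact p.Prime := ⟨hp⟩
    rw [iso_ram hN hR hs hA hdv hpN, dv_ram hp, S.ram_iff p hp, hT p hp hpN, not_not])
  apply S_final S hG (u := fun j => ∑ i, C i j • v i)
  intro i j
  have := Gm_change (U := C) (v := v) (w := fun j => ∑ i, C i j • v i) (fun j => rfl)
  rw [Gm_of_A hA, hC] at this
  exact (congrFun (congrFun this i) j).symm
end

lemma part2 {N : ℕ} (hN : Squarefree N) {B : Matrix (Fin 4) (Fin 4) ℤ} (hs : B.IsSymm) (hev : ∀ i, 2 ∣ B i i) (hpd : Rep.PosDefMat B)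
    (hd : B.det = (N : ℤ) ^ 2) (hl : Rep.IsLevelOf B N) :
    ∃ N₁ N₂ : ℕ, N = N₁ * N₂ ∧ Odd N₁.primeFactors.card ∧
        ∀ S : Rep.EichlerSetting N₁ N₂,
          ∃ (i j : Fin S.h) (A : Matrix (Fin 4) (Fin 4) ℤ),
            Rep.IsGramOf (S.I i j : Set ℍ[ℚ, S.a, S.b]) A ∧ Rep.ZEquiv A B := by
  classical
  have hG : Good N B := good_of hN.ne_zero hs hev hpd hd hl.2.1
  have hodd := parity hN hG
  set T := N.primeFactors.filter (fun p => ¬ IsoAt p B) with hTd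
  have hTp : ∀ p ∈ T, p.Prime := fun p hp => Nat.prime_of_mem_primeFactors (Finset.mem_filter.1 hp).1
  have hpf : (∏ p ∈ T, p).primeFactors = T := Nat.primeFactors_prod hTp
  have hdvd : (∏ p ∈ T, p) ∣ N := by
    conv_rhs => rw [← Nat.prod_primeFactors_of_squarefree hN]
    exact Finset.prod_dvd_prod_of_subset _ _ _ (Finset.filter_subset _ _)
  obtain ⟨N₂, h2⟩ := hdvd
  refine ⟨_, N₂, h2, by rw [hpf]; convert hodd, ?_⟩
  intro S
  obtain ⟨i, j, h⟩ := S_exhaust S (B := B) (by rw [← h2]; exact hG) (by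
    intro p hp hpN
    rw [← h2] at hpN
    have h0 : (∏ p ∈ T, p) ≠ 0 := Finset.prod_ne_zero_iff.2 fun p hp => (hTp p hp).ne_zero
    have : p ∣ (∏ p ∈ T, p) ↔ p ∈ T := by
      conv_rhs => rw [← hpf]
      rw [Nat.mem_primeFactors]; exact ⟨fun h => ⟨hp, h, h0⟩, fun h => h.2.1⟩
    rw [this, hTd, Finset.mem_filter, Nat.mem_primeFactors]
    exact ⟨fun h => h.2, fun h => ⟨⟨hp, hpN, hN.ne_zero⟩, h⟩⟩)
  exact ⟨i, j, B, h, 1, by simp, by simp⟩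
end Eich
end

namespace Rep

/-- For a fixed decomposition `N = N₁N₂` the lattices `(I_ij, n)` form a
single genus of positive definite integral quaternary lattices of discriminant `N²` and
level `N`, and this genus consists of a single spinor genus.  Moreover, letting `N₁, N₂`
vary over the decompositions of `N` with `N₁` having an odd number of prime factors, the
`(I_ij, n)` run through all isometry classes of integral quaternary lattices of
discriminant `N²` and level `N`. -/
theorem ideals_form_single_spinor_genus_and_exhaust (N : ℕ) (hN : Squarefree N) :
    (∀ N₁ N₂ : ℕ, N = N₁ * N₂ → ∀ S : EichlerSetting N₁ N₂,
      ∀ (i j i' j' : Fin S.h) (A A' : Matrix (Fin 4) (Fin 4) ℤ),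
        IsGramOf (S.I i j : Set ℍ[ℚ, S.a, S.b]) A →
        IsGramOf (S.I i' j' : Set ℍ[ℚ, S.a, S.b]) A' →
        PosDefMat A ∧ A.det = (N : ℤ) ^ 2 ∧ IsLevelOf A N ∧
          InSameGenus A A' ∧ SameSpinorGenus A A') ∧
    ∀ B : Matrix (Fin 4) (Fin 4) ℤ, B.IsSymm → (∀ i, 2 ∣ B i i) → PosDefMat B →
      B.det = (N : ℤ) ^ 2 → IsLevelOf B N →
      ∃ N₁ N₂ : ℕ, N = N₁ * N₂ ∧ Odd N₁.primeFactors.card ∧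
        ∀ S : EichlerSetting N₁ N₂,
          ∃ (i j : Fin S.h) (A : Matrix (Fin 4) (Fin 4) ℤ),
            IsGramOf (S.I i j : Set ℍ[ℚ, S.a, S.b]) A ∧ ZEquiv A B := by
  refine ⟨?_, fun B hs hev hpd hd hl => Eich.part2 hN hs hev hpd hd hl⟩
  rintro N₁ N₂ rfl S i j i' j' A A' h h'
  have g := Eich.S_gram S i j h
  have sp := Eich.S_spinor S i j i' j' h h'
  exact ⟨g.1, g.2.1, g.2.2, sp.1, sp⟩

end Rep
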